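/- (Genus-zero case of Theorem 1.2, Runge's theorem for complete minimal surfaces of finite total curvature.) Let n ≥ 3, let E ⊂ ℂ be a finite (possibly empty) set, and let K ⊂ ℂ \ E be a compact set such that every bounded connected component of ℂ \ K contains a point of E. Let E₀ and Λ be disjoint finite subsets of K, let W ⊆ ℂ \ E be an open neighborhood of K, and let X : W \ E₀ → ℝⁿ be a conformal minimal immersion such that each component of ∂X extends meromorphically to every p ∈ E₀ and at each p ∈ E₀ at least one component of ∂X has a pole (X is complete with finite total curvature near E₀). Then for every ε > 0 and every integer r ≥ 0 there is a smooth map Y : ℂ \ (E ∪ E₀) → ℝⁿ such that: (i) Y is a conformal minimal immersion whose derivative data g = ∂Y is rational: for each j there are coprime polynomials Pⱼ, Qⱼ with Qⱼ not identically zero such that gⱼ = Pⱼ/Qⱼ away from the zeros of Qⱼ, g has no poles in ℂ \ (E ∪ E₀), at every point q ∈ E ∪ E₀ at least one component of g has a pole, and at least one component satisfies deg Pⱼ ≥ deg Qⱼ − 1 (so the vector-valued 1-form g·dz has an effective pole at infinity); consequently Y is complete and of finite total curvature; (ii) Y − X extends continuously to K, ∂Y − ∂X extends holomorphically to an open neighborhood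 of K (in particular across E₀), and sup_K ‖Y − X‖ < ε; (iii) for every p ∈ E₀ ∪ Λ one has ‖Y(z) − X(z)‖ = O(|z − p|^r) as z → p. -/

import Mathlib

open Complex Filter
open scoped Topology

noncomputable section

/-- Wirtinger-type derivative data `∂u = ∂u/∂x − i·∂u/∂y` of a real function on `ℂ`. -/
def wirt (u : ℂ → ℝ) (z : ℂ) : ℂ :=
  ((fderiv ℝ u z 1 : ℝ) : ℂ) - Complex.I * ((fderiv ℝ u z Complex.I : ℝ) : ℂ)

/-- The derivative data `∂X : O → ℂⁿ` of a map `X : ℂ → ℝⁿ`. -/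
def ddata (n : ℕ) (X : ℂ → Fin n → ℝ) (z : ℂ) : Fin n → ℂ :=
  fun j => wirt (fun w => X w j) z

/-- `X` is a conformal minimal immersion on the open set `O`: it is smooth, its
derivative data `∂X` is holomorphic on `O`, vanishes nowhere on `O`, and satisfies
`Σⱼ((∂X)ⱼ)² ≡ 0` on `O`. -/
def IsCMI (n : ℕ) (O : Set ℂ) (X : ℂ → Fin n → ℝ) : Prop :=
  ContDiffOn ℝ (⊤ : ℕ∞) X O ∧
  (∀ j, DifferentiableOn ℂ (fun z => ddata n X z j) O) ∧
  (∀ z ∈ O, ddata n X z ≠ 0) ∧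
  (∀ z ∈ O, ∑ j, (ddata n X z j) ^ 2 = 0)

/-- `f` extends meromorphically to the point `p`. -/
def MeromAt (f : ℂ → ℂ) (p : ℂ) : Prop :=
  ∃ (m : ℕ) (g : ℂ → ℂ), AnalyticAt ℂ g p ∧ ∀ᶠ z in 𝓝[≠] p, f z = g z / (z - p) ^ m

/-- `f` has an (effective) pole at `p`. -/
def IsPole (f : ℂ → ℂ) (p : ℂ) : Prop :=
  ∃ m : ℕ, 1 ≤ m ∧ ∃ g : ℂ → ℂ, AnalyticAt ℂ g p ∧ g p ≠ 0 ∧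
    ∀ᶠ z in 𝓝[≠] p, f z = g z / (z - p) ^ m

/-- the polynomial with simple roots at the points of `E` -/
def QE (E : Finset ℂ) : Polynomial ℂ := ∏ e ∈ E, (Polynomial.X - Polynomial.C e)

lemma QE_eval (E : Finset ℂ) (z : ℂ) : (QE E).eval z = ∏ e ∈ E, (z - e) := by
  simp [QE, Polynomial.eval_prod]

lemma QE_eval_ne {E : Finset ℂ} {z : ℂ} (hz : z ∉ E) : (QE E).eval z ≠ 0 := by
  rw [QE_eval, Finset.prod_ne_zero_iff]
  intro e he h
  exact hz (by rw [sub_eq_zero.1 h]; exact he)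

lemma QE_eval_zero {E : Finset ℂ} {z : ℂ} (hz : z ∈ E) : (QE E).eval z = 0 := by
  rw [QE_eval, Finset.prod_eq_zero hz (sub_self z)]

lemma QE_ne (E : Finset ℂ) : QE E ≠ 0 := by
  rw [QE, Finset.prod_ne_zero_iff]
  intro e _
  exact Polynomial.X_sub_C_ne_zero e

lemma E_open (E : Finset ℂ) : IsOpen ((E : Set ℂ)ᶜ) := E.finite_toSet.isClosed.isOpen_compl

lemma E_ev {E : Finset ℂ} {z : ℂ} (hz : z ∉ E) : ∀ᶠ w in 𝓝 z, w ∉ E :=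
  (E_open E).mem_nhds (by simpa using hz)

/-- functions which off `E` agree with a rational function with poles in `E` -/
def RE (E : Finset ℂ) : Subalgebra ℂ (ℂ → ℂ) where
  carrier := {f | ∃ (p : Polynomial ℂ) (k : ℕ), ∀ z ∉ E, f z = p.eval z / (QE E).eval z ^ k}
  mul_mem' := by
    rintro f g ⟨p, k, hp⟩ ⟨p', k', hp'⟩
    refine ⟨p * p', k + k', fun z hz => ?_⟩
    have := QE_eval_ne hz
    simp [hp z hz, hp' z hz, pow_add]
    field_simp
  add_mem' := by
    rintro f g ⟨p, k, hp⟩ ⟨p', k', hp'⟩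
    refine ⟨p * QE E ^ k' + p' * QE E ^ k, k + k', fun z hz => ?_⟩
    have := QE_eval_ne hz
    simp [hp z hz, hp' z hz, pow_add]
    field_simp
  algebraMap_mem' := by
    intro c
    exact ⟨Polynomial.C c, 0, fun z _ => by simp⟩

namespace RE
variable {E : Finset ℂ} {f g : ℂ → ℂ}

lemma congr (hf : f ∈ RE E) (h : ∀ z ∉ E, g z = f z) : g ∈ RE E := by
  obtain ⟨p, k, hp⟩ := hf
  exact ⟨p, k, fun z hz => by rw [h z hz, hp z hz]⟩

lemma const (c : ℂ) : (fun _ => c) ∈ RE E := ⟨Polynomial.C c, 0, fun z _ => by simp⟩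

lemma id_mem : (fun z => z) ∈ RE E := ⟨Polynomial.X, 0, fun z _ => by simp⟩

lemma mul (hf : f ∈ RE E) (hg : g ∈ RE E) : (fun z => f z * g z) ∈ RE E :=
  (RE E).mul_mem hf hg

lemma sub (hf : f ∈ RE E) (hg : g ∈ RE E) : (fun z => f z - g z) ∈ RE E :=
  (RE E).sub_mem hf hg

lemma inv_QE (k : ℕ) : (fun z => ((QE E).eval z ^ k)⁻¹) ∈ RE E :=
  ⟨1, k, fun z _ => by simp⟩

lemma inv_sub {e : ℂ} (he : e ∈ E) : (fun z => (z - e)⁻¹) ∈ RE E := by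
  refine ⟨∏ e' ∈ E.erase e, (Polynomial.X - Polynomial.C e'), 1, fun z hz => ?_⟩
  have h1 := QE_eval_ne hz
  rw [QE_eval, ← Finset.mul_prod_erase E _ he] at h1
  rw [pow_one, QE_eval, ← Finset.mul_prod_erase E _ he, Polynomial.eval_prod]
  simp only [Polynomial.eval_sub, Polynomial.eval_X, Polynomial.eval_C]
  have h2 := right_ne_zero_of_mul h1
  have h3 := left_ne_zero_of_mul h1
  field_simp

lemma hasDerivAt_aux {p : Polynomial ℂ} {k : ℕ} (hp : ∀ z ∉ E, f z = p.eval z / (QE E).eval z ^ k)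
    {z : ℂ} (hz : z ∉ E) :
    HasDerivAt f ((p.derivative * QE E - k * p * (QE E).derivative).eval z /
      (QE E).eval z ^ (k+1)) z := by
  have h1 : HasDerivAt (fun z => p.eval z / (QE E).eval z ^ k) ((p.derivative.eval z *
      (QE E).eval z ^ k - p.eval z * (k * (QE E).eval z ^ (k-1) * (QE E).derivative.eval z)) /
      ((QE E).eval z ^ k)^2) z :=
    (p.hasDerivAt z).div (((QE E).hasDerivAt z).pow k) (pow_ne_zero _ (QE_eval_ne hz))
  have h2 : f =ᶠ[𝓝 z] (fun z => p.eval z / (QE E).eval z ^ k) :=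
    (E_ev hz).mono hp
  have h3 := h1.congr_of_eventuallyEq h2
  have := QE_eval_ne hz
  refine h3.congr_deriv ?_
  rcases k with _ | k
  · simp; field_simp
  · simp
    field_simp
    ring

lemma differentiableAt (hf : f ∈ RE E) {z : ℂ} (hz : z ∉ E) : DifferentiableAt ℂ f z := by
  obtain ⟨p, k, hp⟩ := hf
  exact (hasDerivAt_aux hp hz).differentiableAt

lemma differentiableOn (hf : f ∈ RE E) {U : Set ℂ} (hU : ∀ e ∈ E, e ∉ U) :
    DifferentiableOn ℂ f U := fun z hz =>
  (differentiableAt hf fun h => hU z h hz).differentiableWithinAt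

lemma continuousOn (hf : f ∈ RE E) {U : Set ℂ} (hU : ∀ e ∈ E, e ∉ U) :
    ContinuousOn f U := (differentiableOn hf hU).continuousOn

lemma deriv_mem (hf : f ∈ RE E) : deriv f ∈ RE E := by
  obtain ⟨p, k, hp⟩ := hf
  exact ⟨_, _, fun z hz => (hasDerivAt_aux hp hz).deriv⟩

/-- identity principle -/
lemma eq_zero_of_frequently (hf : f ∈ RE E) {a : ℂ} (h : ∃ᶠ z in 𝓝[≠] a, f z = 0) :
    ∀ z ∉ E, f z = 0 := by
  obtain ⟨p, k, hp⟩ := hf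
  have hp0 : p = 0 := by
    refine Polynomial.eq_zero_of_infinite_isRoot p ?_
    have h2 : ∀ᶠ z in 𝓝[≠] a, z ∉ E := by
      have : ((E : Set ℂ) \ {a}).Finite := E.finite_toSet.sdiff
      have h3 := this.isClosed.isOpen_compl.mem_nhds (x := a) (by simp)
      filter_upwards [mem_nhdsWithin_of_mem_nhds h3, self_mem_nhdsWithin] with z hz hz2 hzE
      exact hz ⟨hzE, hz2⟩
    intro hfin
    have h4 : ∀ᶠ z in 𝓝[≠] a, z ∈ ({x | p.IsRoot x} \ {a})ᶜ := mem_nhdsWithin_of_mem_nhds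
      ((hfin.sdiff (t := {a})).isClosed.isOpen_compl.mem_nhds (x := a) (by simp))
    have h5 : ∀ᶠ z in 𝓝[≠] a, z ∈ ({a} : Set ℂ)ᶜ := self_mem_nhdsWithin
    obtain ⟨z, hz, hz2, hz3, hz4⟩ := (h.and_eventually (h2.and (h4.and h5))).exists
    apply hz3
    refine ⟨?_, hz4⟩
    rw [hp z hz2, div_eq_zero_iff] at hz
    exact hz.resolve_right (pow_ne_zero _ (QE_eval_ne hz2))
  intro z hz
  rw [hp z hz, hp0]; simp

lemma eq_zero_of_eventually (hf : f ∈ RE E) {a : ℂ} (h : ∀ᶠ z in 𝓝 a, f z = 0) :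
    ∀ z ∉ E, f z = 0 :=
  eq_zero_of_frequently (a := a) hf (Filter.Eventually.frequently (h.filter_mono nhdsWithin_le_nhds))

lemma mul_ne (hf : f ∈ RE E) (hg : g ∈ RE E) (h : ∀ z ∉ E, f z * g z = 0) :
    (∀ z ∉ E, f z = 0) ∨ (∀ z ∉ E, g z = 0) := by
  obtain ⟨p, k, hp⟩ := hf
  obtain ⟨p', k', hp'⟩ := hg
  have : p * p' = 0 := by
    refine Polynomial.eq_zero_of_infinite_isRoot _ (Set.Infinite.mono ?_
      (E.finite_toSet.infinite_compl))
    intro z hz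
    have hz' : z ∉ E := hz
    have := h z hz'
    rw [hp z hz', hp' z hz'] at this
    have h1 := QE_eval_ne hz'
    field_simp at this
    simpa [Polynomial.IsRoot] using this
  rcases mul_eq_zero.1 this with h | h
  · left; intro z hz; rw [hp z hz, h]; simp
  · right; intro z hz; rw [hp' z hz, h]; simp

end RE

open MeasureTheory in
lemma CP_zero {f : ℂ → ℂ} (hf : ContDiff ℝ 1 f) (hc : HasCompactSupport f) :
    ∫ ζ : ℂ, (fderiv ℝ f ζ 1 + I * fderiv ℝ f ζ I) / ζ = - (2 * Real.pi) * f 0 := by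
  have hfd : ∀ z, HasFDerivAt f (fderiv ℝ f z) z :=
    fun z => ((hf.differentiable one_ne_zero) z).hasFDerivAt
  have hcont : Continuous (fderiv ℝ f) := hf.continuous_fderiv one_ne_zero
  set e : ℝ → ℂ := fun θ => exp (θ * I) with he
  have hec : Continuous e := by fun_prop
  have hene : ∀ θ, e θ ≠ 0 := fun θ => exp_ne_zero _
  have hen : ∀ θ, ‖e θ‖ = 1 := fun θ => by simp [he, norm_exp_ofReal_mul_I]
  set A : ℝ × ℝ → ℂ := fun p => fderiv ℝ f (p.1 * e p.2) (e p.2) with hA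
  set B : ℝ × ℝ → ℂ := fun p => I * fderiv ℝ f (p.1 * e p.2) (I * e p.2) with hB
  have hAc : Continuous A := by
    refine Continuous.clm_apply ?_ (by fun_prop)
    exact hcont.comp (by fun_prop)
  have hBc : Continuous B := by
    refine continuous_const.mul (Continuous.clm_apply ?_ (by fun_prop))
    exact hcont.comp (by fun_prop)
  obtain ⟨R0, hR0⟩ := hc.isCompact.isBounded.subset_closedBall (0:ℂ)
  set R := max R0 1
  have hz : ∀ z : ℂ, R < ‖z‖ → fderiv ℝ f z = 0 := by
    intro z hz
    refine image_eq_zero_of_notMem_tsupport (fun h => ?_)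
    have := hR0 (tsupport_fderiv_subset ℝ h)
    simp at this
    have := le_max_left R0 1
    linarith [this]
  have hfz : ∀ z : ℂ, R < ‖z‖ → f z = 0 := by
    intro z hz
    refine image_eq_zero_of_notMem_tsupport (fun h => ?_)
    have := hR0 h
    simp at this
    have := le_max_left R0 1
    linarith [this]
  have key : ∀ (C : ℝ × ℝ → ℂ), Continuous C → (∀ p : ℝ × ℝ, R < p.1 → C p = 0) →
      IntegrableOn C (Set.Ioi 0 ×ˢ Set.Ioo (-Real.pi) Real.pi) := by
    intro C hC h0
    have h1 : IntegrableOn C (Set.Icc 0 R ×ˢ Set.Icc (-Real.pi) Real.pi) :=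
      hC.continuousOn.integrableOn_compact (isCompact_Icc.prod isCompact_Icc)
    refine h1.of_forall_sdiff_eq_zero (measurableSet_Ioi.prod measurableSet_Ioo) ?_
    rintro ⟨r, θ⟩ ⟨⟨h2, h3⟩, h4⟩
    apply h0
    by_contra hle
    exact h4 ⟨⟨h2.le, not_lt.1 hle⟩, h3.1.le, h3.2.le⟩
  have hnorm : ∀ p : ℝ × ℝ, R < p.1 → R < ‖(p.1 * e p.2 : ℂ)‖ := by
    intro p hp
    rw [norm_mul, hen, mul_one, norm_real]
    exact lt_of_lt_of_le hp (le_abs_self _)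
  have hAi := key A hAc (fun p hp => by simp [hA, hz _ (hnorm p hp)])
  have hBi := key B hBc (fun p hp => by simp [hB, hz _ (hnorm p hp)])
  rw [← Complex.integral_comp_polarCoord_symm]
  have e1 : ∀ p ∈ polarCoord.target, p.1 • ((fderiv ℝ f (Complex.polarCoord.symm p) 1 +
      I * fderiv ℝ f (Complex.polarCoord.symm p) I) / Complex.polarCoord.symm p) = A p + B p := by
    rintro ⟨r, θ⟩ hp
    have hr : 0 < r := by simpa using hp.1
    have h1 : Complex.polarCoord.symm (r, θ) = r * e θ := by
      rw [Complex.polarCoord_symm_apply, he]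
      simp only [exp_mul_I]
      push_cast; ring
    rw [h1]
    simp only [hA, hB]
    set D := fderiv ℝ f (r * e θ)
    have h2 : ∀ v : ℂ, D v = v.re * D 1 + v.im * D I := by
      intro v
      conv_lhs => rw [← re_add_im v]
      have : (v.re : ℂ) + v.im * I = v.re • (1:ℂ) + v.im • I := by simp
      rw [this, map_add, map_smul, map_smul]; simp
    rw [h2 (e θ), h2 (I * e θ)]
    have h3 : (r : ℂ) ≠ 0 := by exact_mod_cast hr.ne'
    have h4 := hene θ
    have h5 : e θ = Real.cos θ + Real.sin θ * I := by
      simp [he, exp_mul_I]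
    have hre : (e θ).re = Real.cos θ := by rw [h5]; simp [-ofReal_cos, -ofReal_sin]
    have him : (e θ).im = Real.sin θ := by rw [h5]; simp [-ofReal_cos, -ofReal_sin]
    have hsq : (Real.cos θ : ℂ)^2 + (Real.sin θ : ℂ)^2 = 1 := by
      exact_mod_cast Real.cos_sq_add_sin_sq θ
    rw [real_smul, mul_re, mul_im, I_re, I_im, hre, him]
    have h6 : (D 1 + I * D I) / (r * e θ) =
        (1 / r) * ((D 1 + I * D I) * (Real.cos θ - Real.sin θ * I)) := by
      rw [div_eq_iff (mul_ne_zero h3 h4), h5]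
      field_simp
      linear_combination (-(D 1 + I * D I)) * hsq + (D 1 + I * D I) * (Real.sin θ : ℂ)^2 * I_sq
    rw [h6]
    field_simp
    simp only [ofReal_sub, ofReal_add, ofReal_mul, ofReal_zero, ofReal_one]
    linear_combination (-(Real.sin θ : ℂ) * D I : ℂ) * I_sq
  rw [setIntegral_congr_fun polarCoord.open_target.measurableSet e1]
  have ht : polarCoord.target = Set.Ioi (0:ℝ) ×ˢ Set.Ioo (-Real.pi) Real.pi := rfl
  have hAi' := hAi
  rw [IntegrableOn, Measure.volume_eq_prod, ← Measure.prod_restrict] at hAi'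
  rw [ht, integral_add hAi hBi, Measure.volume_eq_prod, setIntegral_prod _ hBi,
    ← Measure.prod_restrict, integral_prod_symm _ hAi']
  have i1 : ∀ θ, ∫ r in Set.Ioi (0:ℝ), A (r, θ) = - f 0 := by
    intro θ
    have h1 : ∀ r : ℝ, HasDerivAt (fun r : ℝ => f (r * e θ)) (A (r, θ)) r := by
      intro r
      have h2 : HasDerivAt (fun r : ℝ => (r * e θ : ℂ)) (e θ) r := by
        simpa using (ofRealCLM.hasDerivAt (x := r)).mul_const (e θ)
      exact (hfd _).comp_hasDerivAt r h2
    have h3 : Tendsto (fun r : ℝ => f (r * e θ)) atTop (𝓝 0) := by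
      refine tendsto_const_nhds.congr' ?_
      filter_upwards [eventually_gt_atTop R] with r hr
      rw [hfz _ (hnorm (r, θ) hr)]
    have h4 : IntegrableOn (fun r => A (r, θ)) (Set.Ioi 0) := by
      have h1 : IntegrableOn (fun r => A (r, θ)) (Set.Icc 0 R) :=
        (hAc.comp (by fun_prop : Continuous fun r : ℝ => (r, θ))).continuousOn.integrableOn_compact
          isCompact_Icc
      refine h1.of_forall_sdiff_eq_zero measurableSet_Ioi ?_
      rintro r ⟨h2, h4⟩
      have : R < r := by
        by_contra hle
        exact h4 ⟨le_of_lt h2, not_lt.1 hle⟩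
      simp [hA, hz _ (hnorm (r, θ) this)]
    rw [integral_Ioi_of_hasDerivAt_of_tendsto' (fun r _ => h1 r) h4 h3]
    simp
  have i2 : ∀ r ∈ Set.Ioi (0:ℝ), ∫ θ in Set.Ioo (-Real.pi) Real.pi, B (r, θ) = 0 := by
    intro r hr
    have hr' : (r:ℂ) ≠ 0 := by
      have : (0:ℝ) < r := hr
      exact_mod_cast this.ne'
    have h1 : ∀ θ : ℝ, HasDerivAt (fun θ : ℝ => (I / r) * f (r * e θ)) (B (r, θ)) θ := by
      intro θ
      have h2 : HasDerivAt (fun θ : ℝ => (r * e θ : ℂ)) (r * (e θ * I)) θ := by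
        have h3 : HasDerivAt (fun θ : ℝ => (θ * I : ℂ)) I θ := by
          simpa using (ofRealCLM.hasDerivAt (x := θ)).mul_const I
        exact (h3.cexp).const_mul _
      have h4 := ((hfd _).comp_hasDerivAt θ h2).const_mul (I / (r:ℂ))
      refine h4.congr_deriv ?_
      simp only [hB]
      have : (r * (e θ * I) : ℂ) = r • (I * e θ)
        := by rw [real_smul]; ring
      rw [this, map_smul, real_smul]
      field_simp
    rw [← integral_Ioc_eq_integral_Ioo, ← intervalIntegral.integral_of_le (by linarith [Real.pi_pos]),
      intervalIntegral.integral_eq_sub_of_hasDerivAt (fun θ _ => h1 θ)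
      ((hBc.comp (by fun_prop : Continuous fun θ : ℝ => (r, θ))).intervalIntegrable _ _)]
    simp only [he]
    have : exp ((Real.pi : ℝ) * I) = exp (((-Real.pi : ℝ):ℂ) * I) := by
      push_cast
      rw [exp_pi_mul_I, neg_mul, exp_neg, exp_pi_mul_I]; norm_num
    rw [this, sub_self]
  simp_rw [i1]
  rw [setIntegral_congr_fun measurableSet_Ioi i2]
  simp
  rw [max_eq_left (by positivity)]
  left; push_cast; ring

open MeasureTheory in
/-- Cauchy-Pompeiu -/
lemma CP {f : ℂ → ℂ} (hf : ContDiff ℝ 1 f) (hc : HasCompactSupport f) (z : ℂ) :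
    ∫ ζ : ℂ, (fderiv ℝ f ζ 1 + I * fderiv ℝ f ζ I) * (z - ζ)⁻¹ = (2 * Real.pi) * f z := by
  have h1 := CP_zero (f := fun ζ => f (ζ + z)) (by fun_prop)
    (hc.comp_homeomorph (Homeomorph.addRight z))
  simp only [fderiv_comp_add_right, zero_add] at h1
  rw [← integral_add_right_eq_self _ z]
  have h2 : ∀ ζ : ℂ, (fderiv ℝ f (ζ + z) 1 + I * fderiv ℝ f (ζ + z) I) * (z - (ζ + z))⁻¹ =
      - ((fderiv ℝ f (ζ + z) 1 + I * fderiv ℝ f (ζ + z) I) / ζ) := by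
    intro ζ
    rw [show z - (ζ + z) = - ζ by ring, inv_neg, div_eq_mul_inv]; ring
  simp_rw [h2]
  rw [integral_neg, h1]; ring

open MeasureTheory in
lemma integral_dx_zero {F F' : ℂ → ℝ} (hF : ∀ z ≠ 0, HasFDerivAt (𝕜 := ℝ) F (fderiv ℝ F z) z)
    (hc : HasCompactSupport F) (v : ℂ) (hv : v = 1 ∨ v = I)
    (hF' : ∀ z ≠ 0, F' z = fderiv ℝ F z v)
    (hi : Integrable F') : ∫ z, F' z = 0 := by
  rw [← (Complex.volume_preserving_equiv_real_prod.symm).integral_comp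
    measurableEquivRealProd.symm.measurableEmbedding]
  have hi' : Integrable (fun p : ℝ × ℝ => F' (measurableEquivRealProd.symm p)) :=
    ((Complex.volume_preserving_equiv_real_prod.symm).integrable_comp_emb
      measurableEquivRealProd.symm.measurableEmbedding).2 hi
  have hm : ∀ x y : ℝ, measurableEquivRealProd.symm (x, y) = x + y * I := by
    intro x y
    apply Complex.ext <;> simp [measurableEquivRealProd]
  have hcs : ∀ (g : ℝ → ℂ), (Continuous g) → (∀ t, HasDerivAt g v t) → (∀ t, |t| ≤ ‖g t‖) →
      (∀ t, g t ≠ 0) → Integrable (fun t => F' (g t)) → ∫ t, F' (g t) = 0 := by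
    intro g hg hgd hgn hg0 hnt
    have hd : ∀ t, HasDerivAt (fun t => F (g t)) (F' (g t)) t := by
      intro t
      rw [hF' _ (hg0 t)]
      exact (hF _ (hg0 t)).comp_hasDerivAt t (hgd t)
    have hcF : HasCompactSupport (fun t => F (g t)) := by
      obtain ⟨R0, hR0⟩ := hc.isCompact.isBounded.subset_closedBall (0:ℂ)
      refine HasCompactSupport.intro (isCompact_Icc (a := -R0) (b := R0)) fun t ht => ?_
      refine image_eq_zero_of_notMem_tsupport (fun h => ht ?_)
      have h1 := hR0 h
      simp at h1
      exact abs_le.1 ((hgn t).trans h1)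
    refine integral_eq_zero_of_hasDerivAt_of_integrable hd hnt ?_
    exact Continuous.integrable_of_hasCompactSupport
      (continuous_iff_continuousAt.2 fun t => (hd t).continuousAt) hcF
  have hne : ∀ᵐ y : ℝ, y ≠ 0 := by simp [ae_iff, measure_singleton]
  rcases hv with rfl | rfl
  · rw [Measure.volume_eq_prod] at hi' ⊢
    rw [integral_prod_symm _ hi']
    have h1 := hi'.prod_left_ae
    apply integral_eq_zero_of_ae
    filter_upwards [h1, hne] with y hy hy0
    simp only [hm] at hy ⊢
    refine hcs (fun x => x + y * I) (by fun_prop) (fun t => ?_) (fun t => ?_) (fun t h => ?_) hy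
    · simpa using (ofRealCLM.hasDerivAt (x := t)).add_const (y * I)
    · simpa using abs_re_le_norm (t + y * I)
    · have := congrArg Complex.im h
      simp at this; exact hy0 this
  · rw [Measure.volume_eq_prod] at hi' ⊢
    rw [integral_prod _ hi']
    have h1 := hi'.prod_right_ae
    apply integral_eq_zero_of_ae
    filter_upwards [h1, hne] with y hy hy0
    simp only [hm] at hy ⊢
    refine hcs (fun x => y + x * I) (by fun_prop) (fun t => ?_) (fun t => ?_) (fun t h => ?_) hy
    · simpa using ((ofRealCLM.hasDerivAt (x := t)).mul_const I).const_add (y:ℂ)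
    · simpa using abs_im_le_norm (y + t * I)
    · have := congrArg Complex.re h
      simp at this; exact hy0 this

lemma hasFDerivAt_log_norm {z : ℂ} (hz : z ≠ 0) :
    HasFDerivAt (𝕜 := ℝ) (fun z : ℂ => Real.log ‖z‖) ((‖z‖^2)⁻¹ • (innerSL ℝ z)) z := by
  have h1 : HasFDerivAt (𝕜 := ℝ) (fun z : ℂ => ‖z‖^2) (2 • (innerSL ℝ z)) z :=
    (hasStrictFDerivAt_norm_sq z).hasFDerivAt
  have h2 := (h1.log (by positivity)).const_mul (1/2 : ℝ)
  have h3 : (fun z : ℂ => Real.log ‖z‖) = fun z : ℂ => 1/2 * Real.log (‖z‖^2) := by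
    ext z; rw [Real.log_pow]; push_cast; ring
  rw [h3]
  refine h2.congr_fderiv ?_
  ext <;> simp <;> ring

lemma abs_log_le {x : ℝ} (hx : 0 < x) : |Real.log x| ≤ x + x⁻¹ := by
  rw [abs_le]
  have h1 := Real.log_le_sub_one_of_pos hx
  have h2 := Real.one_sub_inv_le_log_of_pos hx
  constructor <;> nlinarith [inv_pos.2 hx]

open MeasureTheory in
lemma locInt_inv : LocallyIntegrable (fun z : ℂ => ‖z‖⁻¹) := by
  refine locallyIntegrable_of_norm_le_rpow (C := 1) (α := 1) (by simp) (by simp) ?_ ?_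
  · filter_upwards with z
    rw [Real.rpow_neg (norm_nonneg _)]; simp
  · exact (measurable_norm.inv).aestronglyMeasurable

open MeasureTheory in
lemma locInt_log : LocallyIntegrable (fun z : ℂ => Real.log ‖z‖) := by
  have h1 : LocallyIntegrable (fun z : ℂ => ‖z‖ + ‖z‖⁻¹) :=
    (continuous_norm.locallyIntegrable).add locInt_inv
  refine h1.mono (Real.measurable_log.comp measurable_norm).aestronglyMeasurable ?_
  filter_upwards with z
  have : 0 ≤ ‖z‖ + ‖z‖⁻¹ := by positivity
  rw [Real.norm_eq_abs, Real.norm_eq_abs, abs_of_nonneg this]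
  rcases eq_or_ne z 0 with rfl | hz
  · simp
  · exact abs_log_le (norm_pos_iff.2 hz)

open MeasureTheory in
lemma log_aux {g : ℂ → ℝ} (hg : ContDiff ℝ 1 g) (hc : HasCompactSupport g) (v : ℂ)
    (hv : v = 1 ∨ v = I) :
    Integrable (fun z => fderiv ℝ g z v * Real.log ‖z‖) ∧
    Integrable (fun z => g z * ((‖z‖^2)⁻¹ * innerSL ℝ z v)) ∧
    ∫ z, fderiv ℝ g z v * Real.log ‖z‖ = - ∫ z, g z * ((‖z‖^2)⁻¹ * innerSL ℝ z v) := by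
  have hgd : ∀ z, HasFDerivAt g (fderiv ℝ g z) z :=
    fun z => ((hg.differentiable one_ne_zero) z).hasFDerivAt
  have hcont : Continuous (fun z => fderiv ℝ g z v) :=
    (hg.continuous_fderiv one_ne_zero).clm_apply continuous_const
  have hcv : HasCompactSupport (fun z => fderiv ℝ g z v) := hc.fderiv_apply ℝ v
  have hvn : ‖v‖ = 1 := by rcases hv with rfl | rfl <;> simp
  have i1 : Integrable (fun z => fderiv ℝ g z v * Real.log ‖z‖) := by
    simpa using locInt_log.integrable_smul_left_of_hasCompactSupport hcont hcv
  have l2 : LocallyIntegrable (fun z : ℂ => (‖z‖^2)⁻¹ * innerSL ℝ z v) := by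
    refine locInt_inv.mono ?_ ?_
    · refine Measurable.aestronglyMeasurable ?_
      have : Continuous fun z : ℂ => innerSL ℝ z v := by
        simp only [innerSL_apply_apply]; fun_prop
      exact ((measurable_norm.pow_const 2).inv).mul this.measurable
    · filter_upwards with z
      rw [norm_mul, norm_inv, norm_inv, norm_pow, norm_norm]
      have h1 : ‖innerSL ℝ z v‖ ≤ ‖z‖ * ‖v‖ := norm_inner_le_norm z v
      rw [hvn, mul_one] at h1
      rcases eq_or_ne z 0 with rfl | hz
      · simp
      have := norm_pos_iff.2 hz
      calc (‖z‖^2)⁻¹ * ‖innerSL ℝ z v‖ ≤ (‖z‖^2)⁻¹ * ‖z‖ := by gcongr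
        _ = ‖z‖⁻¹ := by field_simp
  have i2 : Integrable (fun z => g z * ((‖z‖^2)⁻¹ * innerSL ℝ z v)) := by
    simpa using l2.integrable_smul_left_of_hasCompactSupport hg.continuous hc
  refine ⟨i1, i2, ?_⟩
  have hd : ∀ z ≠ (0:ℂ), HasFDerivAt (fun z => g z * Real.log ‖z‖)
      (g z • ((‖z‖^2)⁻¹ • (innerSL ℝ z)) + Real.log ‖z‖ • fderiv ℝ g z) z :=
    fun z hz => (hgd z).mul (hasFDerivAt_log_norm hz)
  have h := integral_dx_zero (F := fun z => g z * Real.log ‖z‖)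
    (F' := fun z => fderiv ℝ g z v * Real.log ‖z‖ + g z * ((‖z‖^2)⁻¹ * innerSL ℝ z v))
    (fun z hz => (hd z hz).differentiableAt.hasFDerivAt) hc.mul_right v hv
    (fun z hz => by rw [(hd z hz).fderiv]; simp; ring) (i1.add i2)
  rw [integral_add i1 i2] at h
  linarith

/-- Laplacian -/
def lap (w : ℂ → ℝ) (z : ℂ) : ℝ :=
  fderiv ℝ (fun ζ => fderiv ℝ w ζ 1) z 1 + fderiv ℝ (fun ζ => fderiv ℝ w ζ I) z I

open MeasureTheory in
lemma log_formula_zero {w : ℂ → ℝ} (hw : ContDiff ℝ 2 w) (hc : HasCompactSupport w) :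
    ∫ ζ, lap w ζ * Real.log ‖ζ‖ = 2 * Real.pi * w 0 := by
  have c1 : ∀ v, ContDiff ℝ 1 (fun ζ => fderiv ℝ w ζ v) := fun v =>
    (hw.fderiv_right (m := 1) (by norm_num)).clm_apply contDiff_const
  obtain ⟨a1, a2, a3⟩ := log_aux (c1 1) (hc.fderiv_apply ℝ 1) 1 (Or.inl rfl)
  obtain ⟨b1, b2, b3⟩ := log_aux (c1 I) (hc.fderiv_apply ℝ I) I (Or.inr rfl)
  simp only [lap, add_mul]
  rw [integral_add a1 b1, a3, b3, ← neg_add, ← integral_add a2 b2]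
  have hC : ContDiff ℝ 1 (fun z => (w z : ℂ)) :=
    ofRealCLM.contDiff.comp (hw.of_le (by norm_num))
  have h := CP_zero hC (hc.comp_left (g := ((↑) : ℝ → ℂ)) (by simp))
  have hd : ∀ z v, fderiv ℝ (fun z => (w z : ℂ)) z v = (fderiv ℝ w z v : ℂ) := by
    intro z v
    have h2 := (ofRealCLM.hasFDerivAt (x := w z)).comp z
      ((hw.differentiable (by norm_num)) z).hasFDerivAt
    have h3 : (fun z => (w z : ℂ)) = ofRealCLM ∘ w := rfl
    rw [h3, h2.fderiv]; simp
  simp only [hd] at h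
  have h4 : ∀ z : ℂ, ((fderiv ℝ w z 1 : ℂ) + I * (fderiv ℝ w z I : ℂ)) / z =
      ((fderiv ℝ w z 1 * ((‖z‖^2)⁻¹ * innerSL ℝ z 1) + fderiv ℝ w z I * ((‖z‖^2)⁻¹ * innerSL ℝ z I) : ℝ) : ℂ)
      + ((fderiv ℝ w z I * ((‖z‖^2)⁻¹ * innerSL ℝ z 1) - fderiv ℝ w z 1 * ((‖z‖^2)⁻¹ * innerSL ℝ z I) : ℝ) : ℂ) * I := by
    intro z
    rw [div_eq_mul_inv, Complex.inv_def, normSq_eq_norm_sq]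
    apply Complex.ext <;> simp <;> ring
  simp_rw [h4] at h
  obtain ⟨-, x2, -⟩ := log_aux (c1 1) (hc.fderiv_apply ℝ 1) I (Or.inr rfl)
  obtain ⟨-, y2, -⟩ := log_aux (c1 I) (hc.fderiv_apply ℝ I) 1 (Or.inl rfl)
  have h5 := congrArg Complex.re h
  have j1 : Integrable (fun z => ((fderiv ℝ w z 1 * ((‖z‖^2)⁻¹ * innerSL ℝ z 1) +
      fderiv ℝ w z I * ((‖z‖^2)⁻¹ * innerSL ℝ z I) : ℝ) : ℂ)) := (a2.add b2).ofReal
  have j2 : Integrable (fun z => ((fderiv ℝ w z I * ((‖z‖^2)⁻¹ * innerSL ℝ z 1) -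
      fderiv ℝ w z 1 * ((‖z‖^2)⁻¹ * innerSL ℝ z I) : ℝ) : ℂ) * I) :=
    (y2.sub x2).ofReal.mul_const I
  rw [integral_add j1 j2, integral_complex_ofReal,
    MeasureTheory.integral_mul_const, integral_complex_ofReal] at h5
  simp at h5
  rw [← neg_eq_iff_eq_neg] at h5
  simpa using h5

open MeasureTheory in
lemma log_formula {w : ℂ → ℝ} (hw : ContDiff ℝ 2 w) (hc : HasCompactSupport w) (z : ℂ) :
    ∫ ζ, lap w ζ * Real.log ‖z - ζ‖ = 2 * Real.pi * w z := by
  have h1 := log_formula_zero (w := fun ζ => w (ζ + z)) (by fun_prop)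
    (hc.comp_homeomorph (Homeomorph.addRight z))
  simp only [zero_add] at h1
  rw [← integral_add_right_eq_self _ z, ← h1]
  congr 1; ext ζ
  rw [show z - (ζ + z) = - ζ by ring, norm_neg]
  congr 1
  simp only [lap, fderiv_comp_add_right]
  rw [fderiv_comp_add_right (f := fun ζ => fderiv ℝ w ζ 1),
    fderiv_comp_add_right (f := fun ζ => fderiv ℝ w ζ I)]

/-- Runge compact sets relative to `E` -/
def RC (E : Finset ℂ) (L : Set ℂ) : Prop :=
  IsCompact L ∧ (∀ e ∈ E, e ∉ L) ∧ ∀ z ∉ L, Bornology.IsBounded (connectedComponentIn Lᶜ z) →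
      ∃ e ∈ E, e ∈ connectedComponentIn Lᶜ z

lemma PP {E : Finset ℂ} {L : Set ℂ} (hL : RC E L) (P : ℂ → Prop)
    (hloc : ∀ ζ0 ∉ L, ∀ᶠ ζ in 𝓝 ζ0, (P ζ ↔ P ζ0)) (hE : ∀ e ∈ E, P e)
    (hfar : ∃ R : ℝ, ∀ ζ : ℂ, R ≤ ‖ζ‖ → ζ ∉ L → P ζ) : ∀ ζ ∉ L, P ζ := by
  classical
  intro ζ hζ
  have hsub := connectedComponentIn_subset Lᶜ ζ
  have hcon : ∀ x ∈ connectedComponentIn Lᶜ ζ, P x → P ζ := by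
    intro x hx hPx
    have h1 : ContinuousOn (fun x => decide (P x)) (connectedComponentIn Lᶜ ζ) := by
      intro y hy
      refine ContinuousAt.continuousWithinAt ?_
      refine (continuousAt_const (y := decide (P y))).congr ?_
      filter_upwards [hloc y (hsub hy)] with w hw
      simp [hw]
    have h2 := isPreconnected_connectedComponentIn.constant h1 hx
      (mem_connectedComponentIn (F := Lᶜ) hζ)
    simpa [hPx] using h2
  by_cases hb : Bornology.IsBounded (connectedComponentIn Lᶜ ζ)
  · obtain ⟨e, he, hm⟩ := hL.2.2 ζ hζ hb
    exact hcon e hm (hE e he)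
  · obtain ⟨R, hR⟩ := hfar
    have : ∃ x ∈ connectedComponentIn Lᶜ ζ, R ≤ ‖x‖ := by
      by_contra hno
      push Not at hno
      exact hb ((Metric.isBounded_ball (x := (0:ℂ)) (r := R)).subset
        fun x hx => by simpa using hno x hx)
    obtain ⟨x, hx, hxR⟩ := this
    exact hcon x hx (hR x hxR (hsub hx))

open MeasureTheory in
lemma integral_mem_closed {V : Type*} [NormedAddCommGroup V] [NormedSpace ℝ V] [CompleteSpace V]
    (S : Submodule ℝ V) (hS : IsClosed (S : Set V)) {F : ℂ → V} (hF : Integrable F)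
    (h : ∀ ζ, F ζ ∈ S) : ∫ ζ, F ζ ∈ S := by
  have h1 := (S.mkQL).integral_comp_comm hF
  have h2 : ∀ ζ, S.mkQL (F ζ) = 0 := fun ζ => by simpa using h ζ
  simp only [h2] at h1
  simp at h1
  exact (Submodule.Quotient.mk_eq_zero S).1 h1.symm

open scoped ContDiff Manifold in
lemma cutoff {L U : Set ℂ} (hL : IsCompact L) (hU : IsOpen U) (hLU : L ⊆ U) :
    ∃ χ : ℂ → ℝ, ContDiff ℝ ∞ χ ∧ HasCompactSupport χ ∧ tsupport χ ⊆ U ∧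
      ∃ N, IsOpen N ∧ L ⊆ N ∧ ∀ z ∈ N, χ z = 1 := by
  obtain ⟨t, ht, hLt, htU⟩ := exists_compact_between hL hU hLU
  obtain ⟨f, h1, h2, -⟩ := exists_contMDiffMap_one_nhds_of_subset_interior (n := (⊤ : ℕ∞))
    𝓘(ℝ, ℂ) hL.isClosed hLt
  have hs : tsupport f ⊆ t := by
    refine closure_minimal (fun x hx => ?_) ht.isClosed
    by_contra hxt
    exact hx (h2 x hxt)
  refine ⟨f, f.contMDiff.contDiff, ht.of_isClosed_subset (isClosed_tsupport _) hs, hs.trans htU, ?_⟩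
  obtain ⟨N, hN, hN2, hN3⟩ := eventually_nhdsSet_iff_exists.1 h1
  exact ⟨N, hN, hN2, hN3⟩

open scoped ContDiff in
/-- product with a cutoff is globally smooth -/
lemma contDiff_cutoff_mul {V : Type*} [NormedAddCommGroup V] [NormedSpace ℝ V]
    {χ : ℂ → ℝ} {U : Set ℂ} {f : ℂ → V} {m : ℕ∞} (hχ : ContDiff ℝ ∞ χ) (hU : IsOpen U)
    (hs : tsupport χ ⊆ U) (hf : ContDiffOn ℝ m f U) : ContDiff ℝ m (fun z => χ z • f z) := by
  rw [contDiff_iff_contDiffAt]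
  intro z
  by_cases hz : z ∈ tsupport χ
  · exact ((hχ.of_le (by exact_mod_cast le_top)).contDiffAt).smul
      (hf.contDiffAt (hU.mem_nhds (hs hz)))
  · have : (fun z => χ z • f z) =ᶠ[𝓝 z] fun _ => 0 := by
      filter_upwards [(isClosed_tsupport χ).isOpen_compl.mem_nhds hz] with w hw
      rw [image_eq_zero_of_notMem_tsupport hw, zero_smul]
    exact contDiffAt_const.congr_of_eventuallyEq this

/-- restriction of `RE` functions -/
def resA {E : Finset ℂ} {L : Set ℂ} (hE : ∀ e ∈ E, e ∉ L) : RE E →ₐ[ℂ] C(L, ℂ) where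
  toFun f := ⟨fun z => f.1 z, (RE.continuousOn f.2 hE).restrict⟩
  map_one' := by ext; simp
  map_mul' := by intro f g; ext; rfl
  map_zero' := by ext; simp
  map_add' := by intro f g; ext; rfl
  commutes' := by intro c; ext; simp

@[simp] lemma resA_apply {E : Finset ℂ} {L : Set ℂ} (hE : ∀ e ∈ E, e ∉ L) (f : RE E) (z : L) :
    resA hE f z = f.1 z := rfl

/-- Cauchy kernel on `L` -/
def kern (L : Set ℂ) (ζ : ℂ) : C(L, ℂ) := by
  classical
  exact if h : ζ ∉ L then
    ⟨fun z => ((z : ℂ) - ζ)⁻¹, by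
      refine Continuous.inv₀ (by fun_prop) fun z hz => h ?_
      rw [← sub_eq_zero.1 hz]; exact z.2⟩ else 0

lemma kern_apply {L : Set ℂ} {ζ : ℂ} (h : ζ ∉ L) (z : L) : kern L ζ z = ((z : ℂ) - ζ)⁻¹ := by
  simp [kern, h]

lemma neumann {A : Type*} [NormedRing A] [NormedAlgebra ℂ A] [CompleteSpace A]
    (S : Subalgebra ℂ A) (hS : IsClosed (S : Set A)) {x : A} (hx : x ∈ S) (h : ‖x‖ < 1) :
    ∃ y ∈ S, y * (1 - x) = 1 := by
  refine ⟨∑' i : ℕ, x ^ i, ?_, geom_series_mul_neg x h⟩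
  have hsum := (summable_geometric_of_norm_lt_one h).hasSum
  refine hS.mem_of_tendsto hsum ?_
  filter_upwards with s
  exact S.sum_mem fun i _ => S.pow_mem hx i

lemma continuousOn_kern {L : Set ℂ} (hL : IsCompact L) : ContinuousOn (kern L) Lᶜ := by
  haveI := isCompact_iff_compactSpace.1 hL
  rw [continuousOn_iff_continuous_restrict]
  refine ContinuousMap.continuous_of_continuous_uncurry _ ?_
  have h1 : (Function.uncurry fun (x : (Lᶜ : Set ℂ)) (z : L) => ((Lᶜ).domRestrict (kern L) x) z) =
      fun p => ((p.2 : ℂ) - p.1)⁻¹ := by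
    ext ⟨x, z⟩
    simp [Function.uncurry, kern_apply x.2]
  rw [h1]
  refine Continuous.inv₀ (by fun_prop) fun p hp => p.1.2 ?_
  rw [← sub_eq_zero.1 hp]; exact p.2.2

/-- Neumann series step -/
lemma kern_step {L : Set ℂ} (hL : IsCompact L) [CompactSpace L] (S : Subalgebra ℂ C(L, ℂ))
    (hS : IsClosed (S : Set C(L, ℂ))) {ζ1 ζ2 : ℂ} (h1 : ζ1 ∉ L) (h2 : ζ2 ∉ L)
    (h12 : ∀ z ∈ L, 2 * ‖ζ2 - ζ1‖ ≤ ‖z - ζ1‖) (hk : kern L ζ1 ∈ S) : kern L ζ2 ∈ S := by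
  have hx : (ζ2 - ζ1) • kern L ζ1 ∈ S := S.smul_mem hk _
  obtain ⟨y, hy, hy2⟩ := neumann S hS hx (by
    refine lt_of_le_of_lt (b := 1/2) ?_ (by norm_num)
    rw [ContinuousMap.norm_le _ (by norm_num)]
    intro z
    have hz : 0 < ‖(z:ℂ) - ζ1‖ := norm_pos_iff.2 (sub_ne_zero.2 fun h => h1 (h ▸ z.2))
    simp only [ContinuousMap.coe_smul, Pi.smul_apply, kern_apply h1, smul_eq_mul, norm_mul, norm_inv]
    have := h12 z z.2
    rw [← div_eq_mul_inv, div_le_iff₀ hz]; linarith)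
  have : kern L ζ2 = kern L ζ1 * y := by
    ext z
    have h3 := congrArg (fun g : C(L, ℂ) => g z) hy2
    simp only [ContinuousMap.mul_apply, ContinuousMap.sub_apply, ContinuousMap.one_apply,
      ContinuousMap.smul_apply, kern_apply h1, smul_eq_mul] at h3
    rw [ContinuousMap.mul_apply, kern_apply h1, kern_apply h2]
    have a1 : (z:ℂ) - ζ1 ≠ 0 := sub_ne_zero.2 fun h => h1 (h ▸ z.2)
    have a2 : (z:ℂ) - ζ2 ≠ 0 := sub_ne_zero.2 fun h => h2 (h ▸ z.2)
    field_simp at h3 ⊢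
    linear_combination -h3
  rw [this]
  exact S.mul_mem hk hy

lemma kern_mem {E : Finset ℂ} {L : Set ℂ} (hL : RC E L) {ζ : ℂ} (hζ : ζ ∉ L) :
    haveI := isCompact_iff_compactSpace.1 hL.1
    kern L ζ ∈ (resA hL.2.1).range.topologicalClosure := by
  haveI := isCompact_iff_compactSpace.1 hL.1
  set S := (resA hL.2.1).range.topologicalClosure
  have hS : IsClosed (S : Set C(L, ℂ)) := Subalgebra.isClosed_topologicalClosure _
  have hsub : ∀ f : RE E, resA hL.2.1 f ∈ S := fun f =>
    Subalgebra.le_topologicalClosure _ ⟨f, rfl⟩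
  refine PP hL (fun ζ => kern L ζ ∈ S) ?_ ?_ ?_ ζ hζ
  · intro ζ0 h0
    obtain ⟨d, hd, hball⟩ := Metric.isOpen_iff.1 hL.1.isClosed.isOpen_compl ζ0 h0
    have hdz : ∀ z ∈ L, d ≤ ‖z - ζ0‖ := by
      intro z hz
      by_contra hlt
      exact hball (by simpa [dist_eq] using not_le.1 hlt) hz
    filter_upwards [Metric.ball_mem_nhds ζ0 (by positivity : 0 < d/3)] with ζ h
    have h3 : ‖ζ - ζ0‖ < d / 3 := by simpa [dist_eq] using h
    have h1 : ζ ∉ L := hball (by simp [dist_eq]; linarith)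
    constructor
    · refine kern_step hL.1 S hS h1 h0 fun z hz => ?_
      have := hdz z hz
      have h4 : ‖z - ζ0‖ ≤ ‖z - ζ‖ + ‖ζ - ζ0‖ := by
        simpa using norm_add_le (z - ζ) (ζ - ζ0)
      rw [norm_sub_rev ζ0 ζ]; linarith
    · refine kern_step hL.1 S hS h0 h1 fun z hz => ?_
      have := hdz z hz
      linarith
  · intro e he
    have : kern L e = resA hL.2.1 ⟨_, RE.inv_sub he⟩ := by
      ext z; rw [kern_apply (hL.2.1 e he)]; rfl
    rw [this]; exact hsub _
  · obtain ⟨R, hR⟩ := hL.1.isBounded.exists_norm_le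
    refine ⟨2 * max R 1, fun ζ hb hζ => ?_⟩
    have hR1 : 1 ≤ max R 1 := le_max_right _ _
    have hz0 : 0 < ‖ζ‖ := by linarith
    have hz1 : ζ ≠ 0 := norm_pos_iff.1 hz0
    have hx : ζ⁻¹ • resA hL.2.1 ⟨_, RE.id_mem⟩ ∈ S := S.smul_mem (hsub _) _
    obtain ⟨y, hy, hy2⟩ := neumann S hS hx (by
      refine lt_of_le_of_lt (b := 1/2) ?_ (by norm_num)
      rw [ContinuousMap.norm_le _ (by norm_num)]
      intro z
      simp only [ContinuousMap.coe_smul, Pi.smul_apply, resA_apply, smul_eq_mul, norm_mul, norm_inv]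
      have := hR z z.2
      have := le_max_left R 1
      rw [inv_mul_le_iff₀ hz0]; linarith)
    have : kern L ζ = (-ζ⁻¹) • y := by
      ext z
      have h3 := congrArg (fun g : C(L, ℂ) => g z) hy2
      simp only [ContinuousMap.mul_apply, ContinuousMap.sub_apply, ContinuousMap.one_apply,
        ContinuousMap.smul_apply, resA_apply, smul_eq_mul] at h3
      rw [ContinuousMap.smul_apply, kern_apply hζ]
      have a1 : (z:ℂ) - ζ ≠ 0 := sub_ne_zero.2 fun h => hζ (h ▸ z.2)
      rw [smul_eq_mul]
      field_simp at h3 ⊢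
      linear_combination -h3
    rw [this]
    exact S.smul_mem hy _

open MeasureTheory in
lemma kern_integrable {V 𝔸 : Type*} [NormedField 𝔸] [NormedAddCommGroup V] [NormedSpace 𝔸 V]
    {L : Set ℂ} (hL : IsCompact L) {m : ℂ → 𝔸} {k : ℂ → V} (hk : ContinuousOn k Lᶜ) (hm : Continuous m)
    (hmc : HasCompactSupport m)
    {N : Set ℂ} (hN : IsOpen N) (hLN : L ⊆ N) (h0 : ∀ z ∈ N, m z = 0) :
    Integrable (fun ζ => m ζ • k ζ) := by
  refine Continuous.integrable_of_hasCompactSupport ?_ hmc.smul_right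
  rw [continuous_iff_continuousAt]
  intro ζ
  by_cases h : ζ ∈ N
  · have : (fun ζ => m ζ • k ζ) =ᶠ[𝓝 ζ] fun _ => 0 := by
      filter_upwards [hN.mem_nhds h] with w hw
      rw [h0 w hw, zero_smul]
    exact continuousAt_const.congr this.symm
  · have h2 : ζ ∈ Lᶜ := fun hh => h (hLN hh)
    exact hm.continuousAt.smul (hk.continuousAt (hL.isClosed.isOpen_compl.mem_nhds h2))

open MeasureTheory in
open scoped ContDiff in
/-- Runge approximation -/
lemma W1 {E : Finset ℂ} {L U : Set ℂ} (hL : RC E L) (hU : IsOpen U) (hLU : L ⊆ U)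
    {f : ℂ → ℂ} (hf : DifferentiableOn ℂ f U) {ε : ℝ} (hε : 0 < ε) :
    ∃ g ∈ RE E, ∀ z ∈ L, ‖g z - f z‖ < ε := by
  have := isCompact_iff_compactSpace.1 hL.1
  obtain ⟨χ, hχ, hχc, hχU, N, hN, hLN, hN1⟩ := cutoff hL.1 hU hLU
  have hfa : ContDiffOn ℝ 1 f U :=
    ((hf.analyticOnNhd hU).restrictScalars (𝕜 := ℝ)).contDiffOn hU.uniqueDiffOn
  have hF : ContDiff ℝ 1 (fun z => χ z • f z) := by
    exact contDiff_cutoff_mul (m := 1) hχ hU hχU (by exact_mod_cast hfa)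
  have hFc : HasCompactSupport (fun z => χ z • f z) := hχc.smul_right
  set F : ℂ → ℂ := fun z => χ z • f z with hFdef
  set m : ℂ → ℂ := fun ζ => fderiv ℝ F ζ 1 + I * fderiv ℝ F ζ I with hm
  have hmc : Continuous m := by
    have := hF.continuous_fderiv (by norm_num)
    fun_prop
  have hms : HasCompactSupport m := by
    have h1 := (hFc.fderiv (𝕜 := ℝ))
    refine h1.mono ?_
    intro z hz
    by_contra h0
    rw [Function.notMem_support] at h0
    exact hz (by simp [hm, h0])
  have hm0 : ∀ z ∈ N ∩ U, m z = 0 := by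
    intro z hz
    have h1 : F =ᶠ[𝓝 z] f := by
      filter_upwards [hN.mem_nhds hz.1] with w hw
      simp [hFdef, hN1 w hw]
    have h2 := ((hf z hz.2).differentiableAt (hU.mem_nhds hz.2))
    have h3 : fderiv ℝ F z = (fderiv ℂ f z).restrictScalars ℝ := by
      rw [h1.fderiv_eq, h2.fderiv_restrictScalars (𝕜 := ℝ)]
    have h4 : fderiv ℂ f z I = I * fderiv ℂ f z 1 := by
      have := (fderiv ℂ f z).map_smul I 1
      simpa using this
    simp only [hm, h3, ContinuousLinearMap.coe_restrictScalars', h4]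
    linear_combination (fderiv ℂ f z 1) * I_sq
  set S := (resA hL.2.1).range.topologicalClosure with hSd
  have hS : IsClosed (S : Set C(L, ℂ)) := Subalgebra.isClosed_topologicalClosure _
  have hnt : Integrable (fun ζ => m ζ • kern L ζ) :=
    kern_integrable hL.1 (continuousOn_kern hL.1) hmc hms (hN.inter hU)
      (Set.subset_inter hLN hLU) hm0
  have hmem : ∫ ζ, m ζ • kern L ζ ∈ (S.toSubmodule.restrictScalars ℝ) := by
    refine integral_mem_closed _ hS hnt fun ζ => ?_
    by_cases h : ζ ∈ L
    · rw [hm0 ζ ⟨hLN h, hLU h⟩, zero_smul]; exact Submodule.zero_mem _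
    · exact S.smul_mem (kern_mem hL h) _
  have hval : ∀ z : L, (∫ ζ, m ζ • kern L ζ) z = 2 * Real.pi * f z := by
    intro z
    have h1 := (ContinuousMap.evalCLM ℂ z).integral_comp_comm hnt
    simp only [ContinuousMap.evalCLM_apply] at h1
    rw [← h1]
    have h2 := CP hF hFc z
    rw [hFdef] at h2
    simp only [hN1 z (hLN z.2), one_smul] at h2
    rw [← h2]
    congr 1; ext ζ
    by_cases h : ζ ∈ L
    · have := hm0 ζ ⟨hLN h, hLU h⟩
      simp only [ContinuousMap.smul_apply, smul_eq_mul]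
      rw [this]
      change _ = m ζ * _
      rw [this]; simp
    · simp only [ContinuousMap.smul_apply, smul_eq_mul, kern_apply h]; rfl
  have hmem2 : ((2 * Real.pi : ℂ)⁻¹) • ∫ ζ, m ζ • kern L ζ ∈ S := S.smul_mem hmem _
  have h3 := Metric.mem_closure_iff.1 hmem2 ε hε
  obtain ⟨b, ⟨g, rfl⟩, hb⟩ := h3
  refine ⟨g.1, g.2, fun z hz => ?_⟩
  have h4 := (ContinuousMap.dist_apply_le_dist (⟨z, hz⟩ : L)).trans_lt hb
  have hpi : (2 * Real.pi : ℂ) ≠ 0 := by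
    simp [Real.pi_ne_zero]
  rw [ContinuousMap.smul_apply, hval, smul_eq_mul, inv_mul_cancel_left₀ hpi, dist_comm,
    Complex.dist_eq] at h4
  exact h4

/-- peak-type function -/
lemma RC.sep {E : Finset ℂ} {L : Set ℂ} (hL : RC E L) {z0 : ℂ} (h0 : z0 ∉ L) {ε : ℝ}
    (hε : 0 < ε) : ∃ h ∈ RE E, (z0 ∉ E → h z0 = 1) ∧
      (∀ᶠ w in 𝓝 z0, w ∉ E → 1/2 < ‖h w‖) ∧ ∀ z ∈ L, ‖h z‖ < ε := by
  obtain ⟨M, hM⟩ := hL.1.isBounded.exists_norm_le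
  by_cases hz : z0 ∈ E
  · -- use a small multiple of `1/(z - e)`
    have hc : ContinuousOn (fun z : ℂ => (z - z0)⁻¹) L := by
      refine ContinuousOn.inv₀ (by fun_prop) fun z hz h => h0 ?_
      rwa [← sub_eq_zero.1 h]
    obtain ⟨C, hC⟩ := (hL.1.image_of_continuousOn hc).isBounded.exists_norm_le
    have hC' : ∀ z ∈ L, ‖(z - z0)⁻¹‖ ≤ C := fun z hz => hC _ ⟨z, hz, rfl⟩
    set c : ℝ := ε / (|C| + 1) with hcdef
    have hcp : 0 < c := by positivity
    refine ⟨fun z => (c : ℂ) * (z - z0)⁻¹, RE.mul (RE.const _) (RE.inv_sub hz),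
      fun h => absurd hz h, ?_, ?_⟩
    · filter_upwards [Metric.ball_mem_nhds z0 hcp] with w hw hwE
      have h1 : w - z0 ≠ 0 := sub_ne_zero.2 fun h => hwE (h ▸ hz)
      have h2 : ‖w - z0‖ < c := by simpa [dist_eq] using hw
      have h3 := norm_pos_iff.2 h1
      rw [norm_mul, norm_inv, Complex.norm_real, Real.norm_eq_abs, abs_of_pos hcp, ← div_eq_mul_inv,
        lt_div_iff₀ h3]
      linarith
    · intro z hz
      rw [norm_mul, Complex.norm_real, Real.norm_eq_abs, abs_of_pos hcp]
      have h4 := (hC' z hz).trans (le_abs_self C)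
      calc c * ‖(z - z0)⁻¹‖ ≤ c * |C| := by gcongr
        _ < c * (|C| + 1) := by nlinarith
        _ = ε := by rw [hcdef]; field_simp
  · set δ : ℝ := ε / (|M| + ‖z0‖ + 1) with hδ
    have hδp : 0 < δ := by positivity
    obtain ⟨g, hg, hgL⟩ := W1 hL (U := {z0}ᶜ) isOpen_compl_singleton
      (fun z hz h => h0 (by rw [Set.mem_singleton_iff] at h; rwa [← h]))
      (f := fun z => (z - z0)⁻¹) (by
        intro z hz
        exact ((differentiableAt_id.sub_const z0).inv (sub_ne_zero.2 hz)).differentiableWithinAt) hδp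
    have hmem : (fun z => 1 - (z - z0) * g z) ∈ RE E :=
      RE.sub (RE.const 1) (RE.mul (RE.sub RE.id_mem (RE.const z0)) hg)
    refine ⟨_, hmem, fun _ => by simp, ?_, ?_⟩
    · have hc := (RE.differentiableAt hmem hz).continuousAt.norm
      have : (1/2 : ℝ) < ‖1 - (z0 - z0) * g z0‖ := by simp; norm_num
      filter_upwards [hc.eventually (lt_mem_nhds this)] with w hw _ using hw
    · intro z hzL
      have h1 : z - z0 ≠ 0 := sub_ne_zero.2 fun h => h0 (h ▸ hzL)
      have : 1 - (z - z0) * g z = -((z - z0) * (g z - (z - z0)⁻¹)) := by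
        field_simp; ring
      rw [this, norm_neg, norm_mul]
      have h2 : ‖z - z0‖ ≤ |M| + ‖z0‖ :=
        (norm_sub_le _ _).trans (by gcongr; exact (hM z hzL).trans (le_abs_self M))
      calc ‖z - z0‖ * ‖g z - (z - z0)⁻¹‖ ≤ (|M| + ‖z0‖) * δ := by
            gcongr; exact (hgL z hzL).le
        _ < (|M| + ‖z0‖ + 1) * δ := by nlinarith
        _ = ε := by rw [hδ]; field_simp

lemma frontier_comp {L : Set ℂ} (hL : IsClosed L) (z : ℂ) :
    frontier (connectedComponentIn Lᶜ z) ⊆ L := by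
  intro x hx
  by_contra hxL
  have ho := hL.isOpen_compl.connectedComponentIn (x := z)
  have ho' := hL.isOpen_compl.connectedComponentIn (x := x)
  rw [frontier, ho.interior_eq] at hx
  have hxx := mem_connectedComponentIn (F := Lᶜ) hxL
  obtain ⟨y, hy1, hy2⟩ := mem_closure_iff.1 hx.1 _ ho' hxx
  have e1 := connectedComponentIn_eq hy1
  have e2 := connectedComponentIn_eq hy2
  exact hx.2 (by rw [e2, ← e1]; exact hxx)

lemma NB {E : Finset ℂ} {L U : Set ℂ} (hL : RC E L) (hU : IsOpen U) (hLU : L ⊆ U) :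
    ∃ L', RC E L' ∧ L' ⊆ U ∧ L ⊆ interior L' := by
  obtain ⟨M, hM⟩ := hL.1.isBounded.exists_norm_le
  set ρ : ℝ := M + 1 with hρ
  have hV : IsOpen (U \ (E : Set ℂ)) := hU.sdiff E.finite_toSet.isClosed
  have hLV : L ⊆ U \ (E : Set ℂ) := fun z hz => ⟨hLU hz, fun h => hL.2.1 z h hz⟩
  set V := U \ (E : Set ℂ) with hVdef
  have hT : IsCompact (Metric.closedBall (0:ℂ) ρ \ V) := (isCompact_closedBall 0 ρ).diff hV
  have hsep : ∀ z : ℂ, z ∈ Metric.closedBall (0:ℂ) ρ \ V → ∃ h ∈ RE E,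
      (∀ᶠ w in 𝓝 z, w ∉ E → 1 < ‖h w‖) ∧ ∀ z ∈ L, ‖h z‖ < 1 := by
    intro z hz
    obtain ⟨h, h1, -, h2, h3⟩ := hL.sep (z0 := z) (fun hh => hz.2 (hLV hh)) (ε := 1/2) (by norm_num)
    refine ⟨fun z => 2 * h z, RE.mul (RE.const 2) h1, ?_, ?_⟩
    · filter_upwards [h2] with w hw hwE
      have := hw hwE
      simp; linarith
    · intro z hz
      have := h3 z hz
      simp; linarith
  choose! h h1 h2 h3 using hsep
  obtain ⟨t, ht, hcov⟩ := hT.elim_nhds_subcover (fun z => interior {w | w ∉ E → 1 < ‖h z w‖})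
    (fun z hz => interior_mem_nhds.2 (h2 z hz))
  set L' : Set ℂ := {z | z ∈ Metric.closedBall (0:ℂ) ρ ∧ z ∉ E ∧ ∀ i ∈ t, ‖h i z‖ ≤ 1} with hL'
  have hL'V : L' ⊆ V := by
    intro z hz
    by_contra hzV
    obtain ⟨i, hi, hi2⟩ := Set.mem_iUnion₂.1 (hcov ⟨hz.1, hzV⟩)
    exact absurd (hz.2.2 i hi) (not_le.2 (interior_subset hi2 hz.2.1))
  have hclosed : IsClosed L' := by
    rw [← isOpen_compl_iff, isOpen_iff_mem_nhds]
    intro z hz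
    by_cases hb : z ∈ Metric.closedBall (0:ℂ) ρ
    · by_cases hzV : z ∈ V
      · have : ∃ i ∈ t, 1 < ‖h i z‖ := by
          by_contra hno
          push Not at hno
          exact hz ⟨hb, hzV.2, hno⟩
        obtain ⟨i, hi, hi1⟩ := this
        have hc := (RE.differentiableAt (h1 i (ht i hi)) hzV.2).continuousAt.norm
        filter_upwards [hc.eventually (lt_mem_nhds hi1)] with w hw hwL
        exact absurd (hwL.2.2 i hi) (not_le.2 hw)
      · -- near a point of `T`
        obtain ⟨i, hi, hi2⟩ := Set.mem_iUnion₂.1 (hcov ⟨hb, hzV⟩)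
        filter_upwards [mem_interior_iff_mem_nhds.1 hi2] with w hw hwL
        exact absurd (hwL.2.2 i hi) (not_le.2 (hw hwL.2.1))
    · filter_upwards [Metric.isClosed_closedBall.isOpen_compl.mem_nhds hb] with w hw hwL
      exact hw hwL.1
  have hcpt : IsCompact L' :=
    (isCompact_closedBall 0 ρ).of_isClosed_subset hclosed fun z hz => hz.1
  refine ⟨L', ⟨hcpt, fun e he hh => hh.2.1 he, ?_⟩, fun z hz => (hL'V hz).1, ?_⟩
  · intro z hz hb
    by_contra hno
    push Not at hno
    set Ω := connectedComponentIn L'ᶜ z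
    have ho : IsOpen Ω := hclosed.isOpen_compl.connectedComponentIn
    have hfr := frontier_comp hclosed z
    have hzΩ : z ∈ Ω := mem_connectedComponentIn hz
    have key : ∀ f : ℂ → ℂ, f ∈ RE E → ∀ C : ℝ, (∀ w ∈ L', ‖f w‖ ≤ C) → ‖f z‖ ≤ C := by
      intro f hf C hC
      refine Complex.norm_le_of_forall_mem_frontier_norm_le hb (f := f) ?_ (fun w hw => hC w (hfr hw))
        (subset_closure hzΩ)
      refine DifferentiableOn.diffContOnCl (fun w hw => ?_)
      refine (RE.differentiableAt hf ?_).differentiableWithinAt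
      intro hwE
      rw [closure_eq_self_union_frontier] at hw
      rcases hw with hw | hw
      · exact hno w hwE hw
      · exact (hfr hw).2.1 hwE
    refine hz ⟨?_, fun h => hno z h hzΩ, fun i hi => key _ (h1 i (ht i hi)) 1 fun w hw => hw.2.2 i hi⟩
    simpa using key _ RE.id_mem ρ fun w hw => by simpa using hw.1
  · intro z hz
    rw [mem_interior_iff_mem_nhds]
    have e1 : ∀ᶠ w in 𝓝 z, ∀ i ∈ t, ‖h i w‖ ≤ 1 := by
      rw [Filter.eventually_all_finset]
      intro i hi
      have hc := (RE.differentiableAt (h1 i (ht i hi)) (fun hE => hL.2.1 z hE hz)).continuousAt.norm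
      filter_upwards [hc.eventually (gt_mem_nhds (h3 i (ht i hi) z hz))] with w hw using hw.le
    have e2 : Metric.closedBall (0:ℂ) ρ ∈ 𝓝 z := by
      refine Metric.closedBall_mem_nhds_of_mem ?_
      have := hM z hz
      simp; linarith
    filter_upwards [e1, e2, hV.mem_nhds (hLV hz)] with w a b c using ⟨b, c.2, a⟩

lemma NBW {E : Finset ℂ} {L U : Set ℂ} (hL : RC E L) (hU : IsOpen U) (hLU : L ⊆ U) :
    ∃ W, IsOpen W ∧ L ⊆ W ∧ W ⊆ U ∧ (∀ e ∈ E, e ∉ W) ∧ ∀ C, IsCompact C → C ⊆ W →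
      ∃ L', RC E L' ∧ C ⊆ interior L' ∧ L' ⊆ W := by
  let T := {L : Set ℂ // RC E L ∧ L ⊆ U}
  have hstep : ∀ a : T, ∃ b : T, a.1 ⊆ interior b.1 := fun a => by
    obtain ⟨b, h1, h2, h3⟩ := NB a.2.1 hU a.2.2
    exact ⟨⟨b, h1, h2⟩, h3⟩
  choose nx hnx using hstep
  let s : ℕ → T := fun k => Nat.rec ⟨L, hL, hLU⟩ (fun _ a => nx a) k
  have hs : ∀ k, (s k).1 ⊆ interior (s (k+1)).1 := fun k => hnx (s k)
  have hmono : Monotone fun k => interior (s k).1 :=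
    monotone_nat_of_le_succ fun k => interior_subset.trans (hs k)
  refine ⟨⋃ k, interior (s k).1, isOpen_iUnion fun k => isOpen_interior,
    fun z hz => Set.mem_iUnion.2 ⟨1, hs 0 hz⟩, Set.iUnion_subset fun k => interior_subset.trans (s k).2.2,
    ?_, ?_⟩
  · intro e he h
    obtain ⟨k, hk⟩ := Set.mem_iUnion.1 h
    exact (s k).2.1.2.1 e he (interior_subset hk)
  · intro C hC hCW
    obtain ⟨k, hk⟩ := hC.elim_directed_cover _ (fun k => isOpen_interior) hCW hmono.directed_le
    exact ⟨(s k).1, (s k).2.1, hk, (hs k).trans (Set.subset_iUnion (fun k => interior (s k).1) (k+1))⟩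

/-- restriction to the complement of `E` -/
def resHom (E : Finset ℂ) : (ℂ → ℂ) →ₐ[ℂ] ({z : ℂ // z ∉ E} → ℂ) where
  toFun f := fun z => f z
  map_one' := rfl
  map_mul' _ _ := rfl
  map_zero' := rfl
  map_add' _ _ := rfl
  commutes' _ := rfl

/-- the ring of rational functions with poles in `E` as functions on the complement of `E` -/
def RS (E : Finset ℂ) : Subalgebra ℂ ({z : ℂ // z ∉ E} → ℂ) := (RE E).map (resHom E)

/-- the ring of rational functions with poles in `E` -/
def RR (E : Finset ℂ) : Type := ↥(RS E)

namespace RR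
variable {E : Finset ℂ}

instance : CommRing (RR E) := inferInstanceAs (CommRing ↥(RS E))
instance : Algebra ℂ (RR E) := inferInstanceAs (Algebra ℂ ↥(RS E))

/-- evaluation, zero on `E` -/
def ev (f : RR E) (z : ℂ) : ℂ := by
  classical
  exact if h : z ∉ E then (show ↥(RS E) from f).1 ⟨z, h⟩ else 0

instance : CoeFun (RR E) (fun _ => ℂ → ℂ) := ⟨ev⟩

lemma ev_of {f : RR E} {z : ℂ} (h : z ∉ E) : f z = (show ↥(RS E) from f).1 ⟨z, h⟩ := by
  simp [ev, h]
lemma ev_in {f : RR E} {z : ℂ} (h : z ∈ E) : f z = 0 := by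
  simp [ev, h]

lemma ext' {f g : RR E} (h : ∀ z ∉ E, f z = g z) : f = g := by
  refine Subtype.ext (funext fun z => ?_)
  have := h z.1 z.2
  rwa [ev_of z.2, ev_of z.2] at this

@[simp] lemma ev_add (f g : RR E) (z : ℂ) : (f + g) z = f z + g z := by
  by_cases h : z ∈ E
  · simp [ev_in h]
  · rw [ev_of h, ev_of h, ev_of h]; rfl
@[simp] lemma ev_mul (f g : RR E) (z : ℂ) : (f * g) z = f z * g z := by
  by_cases h : z ∈ E
  · simp [ev_in h]
  · rw [ev_of h, ev_of h, ev_of h]; rfl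
@[simp] lemma ev_smul (c : ℂ) (f : RR E) (z : ℂ) : (c • f) z = c * f z := by
  by_cases h : z ∈ E
  · simp [ev_in h]
  · rw [ev_of h, ev_of h]; rfl
@[simp] lemma ev_zero (z : ℂ) : (0 : RR E) z = 0 := by
  by_cases h : z ∈ E
  · simp [ev_in h]
  · rw [ev_of h]; rfl
lemma ev_one {z : ℂ} (h : z ∉ E) : (1 : RR E) z = 1 := by rw [ev_of h]; rfl
lemma ev_C (c : ℂ) {z : ℂ} (h : z ∉ E) : (algebraMap ℂ (RR E) c) z = c := by rw [ev_of h]; rfl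

/-- evaluation as linear map -/
def evL (z : ℂ) : RR E →ₗ[ℂ] ℂ where
  toFun f := f z
  map_add' f g := ev_add f g z
  map_smul' c f := ev_smul c f z

@[simp] lemma evL_apply (z : ℂ) (f : RR E) : evL z f = f z := rfl

@[simp] lemma ev_neg (f : RR E) (z : ℂ) : (-f) z = - f z := (evL z).map_neg f
@[simp] lemma ev_sub (f g : RR E) (z : ℂ) : (f - g) z = f z - g z := (evL z).map_sub f g
lemma ev_sum {κ : Type*} (s : Finset κ) (f : κ → RR E) (z : ℂ) :
    (∑ i ∈ s, f i) z = ∑ i ∈ s, f i z := map_sum (evL z) f s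

/-- evaluation as algebra morphism -/
def evA {z : ℂ} (h : z ∉ E) : RR E →ₐ[ℂ] ℂ where
  toFun f := f z
  map_one' := ev_one h
  map_mul' f g := ev_mul f g z
  map_zero' := ev_zero z
  map_add' f g := ev_add f g z
  commutes' c := ev_C c h

@[simp] lemma evA_apply {z : ℂ} (h : z ∉ E) (f : RR E) : evA h f = f z := rfl

lemma ev_pow (f : RR E) (k : ℕ) {z : ℂ} (h : z ∉ E) : (f ^ k) z = f z ^ k := map_pow (evA h) f k
lemma ev_prod {κ : Type*} (s : Finset κ) (f : κ → RR E) {z : ℂ} (h : z ∉ E) :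
    (∏ i ∈ s, f i) z = ∏ i ∈ s, f i z := map_prod (evA h) f s
lemma ev_natCast (m : ℕ) {z : ℂ} (h : z ∉ E) : (m : RR E) z = m := map_natCast (evA h) m

lemma ev_mem (f : RR E) : (f : ℂ → ℂ) ∈ RE E := by
  obtain ⟨g, hg, hg2⟩ := (show ↥(RS E) from f).2
  refine RE.congr hg fun z hz => ?_
  rw [ev_of hz, ← hg2]; rfl

/-- constructor -/
def mk (f : ℂ → ℂ) (hf : f ∈ RE E) : RR E := (⟨resHom E f, ⟨f, hf, rfl⟩⟩ : ↥(RS E))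

lemma mk_ev {f : ℂ → ℂ} (hf : f ∈ RE E) {z : ℂ} (h : z ∉ E) : (mk f hf) z = f z := by
  rw [ev_of h]; rfl

instance : Nontrivial (RR E) := by
  obtain ⟨z, hz⟩ := Infinite.exists_notMem_finset E
  refine ⟨0, 1, fun h => ?_⟩
  have := congrArg (fun f : RR E => f z) h
  simp [ev_one hz] at this

instance : NoZeroDivisors (RR E) := ⟨by
  intro a b h
  have := RE.mul_ne (ev_mem a) (ev_mem b) (fun z _ => by rw [← ev_mul, h, ev_zero])
  rcases this with h | h
  · exact Or.inl (ext' fun z hz => by rw [h z hz, ev_zero])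
  · exact Or.inr (ext' fun z hz => by rw [h z hz, ev_zero])⟩

instance : IsDomain (RR E) := NoZeroDivisors.to_isDomain _

lemma differentiableAt (f : RR E) {z : ℂ} (hz : z ∉ E) : DifferentiableAt ℂ f z :=
  RE.differentiableAt (ev_mem f) hz

lemma differentiableOn (f : RR E) {U : Set ℂ} (hU : ∀ e ∈ E, e ∉ U) : DifferentiableOn ℂ f U :=
  RE.differentiableOn (ev_mem f) hU

lemma continuousOn (f : RR E) {U : Set ℂ} (hU : ∀ e ∈ E, e ∉ U) : ContinuousOn f U :=
  RE.continuousOn (ev_mem f) hU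

lemma eq_zero_of_eventually {f : RR E} {a : ℂ} (h : ∀ᶠ z in 𝓝 a, f z = 0) : f = 0 :=
  ext' fun z hz => by rw [RE.eq_zero_of_eventually (ev_mem f) h z hz, ev_zero]

/-- the coordinate -/
def X : RR E := mk _ RE.id_mem
lemma ev_X {z : ℂ} (h : z ∉ E) : (X : RR E) z = z := mk_ev _ h

/-- polynomials -/
def P : Polynomial ℂ →ₐ[ℂ] RR E := Polynomial.aeval X

lemma ev_P (p : Polynomial ℂ) {z : ℂ} (h : z ∉ E) : (P p : RR E) z = p.eval z := by
  have := Polynomial.aeval_algHom_apply (evA h) (X : RR E) p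
  simp only [evA_apply, ev_X h] at this
  rw [P, ← this, Polynomial.coe_aeval_eq_eval]

lemma P_inj : Function.Injective (P : Polynomial ℂ →ₐ[ℂ] RR E) := by
  rw [injective_iff_map_eq_zero]
  intro p hp
  refine Polynomial.eq_zero_of_infinite_isRoot p ?_
  refine (Set.Finite.infinite_compl E.finite_toSet).mono fun z hz => ?_
  have hz' : z ∉ E := by simpa using hz
  have := ev_P p hz'
  rw [hp, ev_zero] at this
  exact this.symm

lemma P_ne {p : Polynomial ℂ} (hp : p ≠ 0) : (P p : RR E) ≠ 0 := fun h =>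
  hp (P_inj (by rw [h, map_zero]))

lemma exists_poly (f : RR E) : ∃ (p : Polynomial ℂ) (k : ℕ), P (QE E) ^ k * f = P p := by
  obtain ⟨p, k, h⟩ := ev_mem f
  refine ⟨p, k, ext' fun z hz => ?_⟩
  have := QE_eval_ne hz
  rw [ev_mul, ev_pow _ _ hz, ev_P _ hz, ev_P _ hz, h z hz]
  field_simp

/-- the inverse of `QE` -/
def invQ : RR E := mk _ (RE.inv_QE 1)
lemma ev_invQ {z : ℂ} (h : z ∉ E) : (invQ : RR E) z = ((QE E).eval z)⁻¹ := by
  rw [invQ, mk_ev _ h, pow_one]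
lemma invQ_mul : (invQ : RR E) * P (QE E) = 1 := ext' fun z hz => by
  rw [ev_mul, ev_one hz, ev_P _ hz, ev_invQ hz, inv_mul_cancel₀ (QE_eval_ne hz)]

/-- the inverse of `z - e` -/
def invS {e : ℂ} (he : e ∈ E) : RR E := mk _ (RE.inv_sub he)
lemma ev_invS {e : ℂ} (he : e ∈ E) {z : ℂ} (h : z ∉ E) : (invS he) z = (z - e)⁻¹ := mk_ev _ h
lemma invS_mul {e : ℂ} (he : e ∈ E) : invS he * P (Polynomial.X - Polynomial.C e) = 1 :=
  ext' fun z hz => by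
    rw [ev_mul, ev_one hz, ev_P _ hz, ev_invS he hz]
    have : z - e ≠ 0 := sub_ne_zero.2 fun h => hz (h ▸ he)
    simp [this]

/-- the derivation -/
def D : Derivation ℂ (RR E) (RR E) := Derivation.mk'
  { toFun := fun f => mk _ (RE.deriv_mem (ev_mem f))
    map_add' := fun f g => ext' fun z hz => by
      rw [ev_add, mk_ev _ hz, mk_ev _ hz, mk_ev _ hz, ← deriv_fun_add (differentiableAt f hz)
        (differentiableAt g hz), ← funext (ev_add f g)]
    map_smul' := fun c f => ext' fun z hz => by
      rw [RingHom.id_apply, ev_smul, mk_ev _ hz, mk_ev _ hz,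
        ← deriv_const_mul c (differentiableAt f hz), ← funext (ev_smul c f)] }
  (fun f g => ext' fun z hz => by
    simp only [LinearMap.coe_mk, AddHom.coe_mk, smul_eq_mul]
    rw [ev_add, ev_mul, ev_mul, mk_ev _ hz, mk_ev _ hz, mk_ev _ hz, funext (ev_mul f g),
      deriv_fun_mul (differentiableAt f hz) (differentiableAt g hz)]; ring)

lemma D_ev (f : RR E) {z : ℂ} (hz : z ∉ E) : D f z = deriv f z :=
  mk_ev (RE.deriv_mem (ev_mem f)) hz

lemma hasDerivAt (f : RR E) {z : ℂ} (hz : z ∉ E) : HasDerivAt f (D f z) z := by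
  rw [D_ev f hz]; exact (differentiableAt f hz).hasDerivAt

lemma D_mul (f g : RR E) : D (f * g) = D f * g + f * D g := by
  rw [D.leibniz, smul_eq_mul, smul_eq_mul]; ring

/-- Wronskian criterion -/
lemma wronsk {f g : RR E} (hg : g ≠ 0) (h : D f * g - f * D g = 0) : ∃ c : ℂ, f = c • g := by
  obtain ⟨a, ha, hga⟩ : ∃ a, a ∉ E ∧ g a ≠ 0 := by
    by_contra hno
    push Not at hno
    exact hg (ext' fun z hz => by rw [hno z hz, ev_zero])
  have hev : ∀ᶠ z in 𝓝 a, z ∉ E ∧ g z ≠ 0 :=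
    (E_ev ha).and ((differentiableAt g ha).continuousAt.eventually_ne hga)
  obtain ⟨ρ, hρ, hb⟩ := Metric.eventually_nhds_iff_ball.1 hev
  have hd : ∀ z ∈ Metric.ball a ρ, HasDerivAt (fun z => f z / g z) 0 z := by
    intro z hz
    have h1 := (hasDerivAt f (hb z hz).1).div (hasDerivAt g (hb z hz).1) (hb z hz).2
    have h2 := congrArg (fun f : RR E => f z) h
    simp only [ev_sub, ev_mul, ev_zero] at h2
    rw [h2, zero_div] at h1
    exact h1
  refine ⟨f a / g a, sub_eq_zero.1 (eq_zero_of_eventually (a := a) ?_)⟩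
  filter_upwards [Metric.ball_mem_nhds a hρ] with z hz
  have hc := (convex_ball a ρ).is_const_of_fderivWithin_eq_zero (𝕜 := ℂ) (f := fun z => f z / g z)
    (fun z hz => (hd z hz).differentiableAt.differentiableWithinAt) (fun z hz => by
      rw [fderivWithin_eq_fderiv (Metric.isOpen_ball.uniqueDiffWithinAt hz) (hd z hz).differentiableAt,
        (hd z hz).hasFDerivAt.fderiv]
      simp) hz (Metric.mem_ball_self hρ)
  rw [ev_sub, ev_smul, ← hc, div_mul_cancel₀ _ (hb z hz).2, sub_self]

/-- restriction to a set disjoint from `E` -/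
def res {L : Set ℂ} (hE : ∀ e ∈ E, e ∉ L) : RR E →ₐ[ℂ] C(L, ℂ) where
  toFun f := ⟨fun z => f z, (continuousOn f hE).domRestrict⟩
  map_one' := by ext z; exact ev_one fun h => hE z h z.2
  map_mul' f g := by ext z; exact ev_mul f g z
  map_zero' := by ext z; exact ev_zero _
  map_add' f g := by ext z; exact ev_add f g z
  commutes' c := by ext z; exact ev_C c fun h => hE z h z.2

lemma W1 {L U : Set ℂ} (hL : RC E L) (hU : IsOpen U) (hLU : L ⊆ U)
    {f : ℂ → ℂ} (hf : DifferentiableOn ℂ f U) {ε : ℝ} (hε : 0 < ε) :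
    ∃ g : RR E, ∀ z ∈ L, ‖g z - f z‖ < ε := by
  obtain ⟨g, hg, h⟩ := _root_.W1 hL hU hLU hf hε
  exact ⟨mk g hg, fun z hz => by rw [mk_ev _ fun h => hL.2.1 z h hz]; exact h z hz⟩

end RR

/-- real potential -/
def Pot (U : Set ℂ) (H : ℂ → ℝ) (f : ℂ → ℂ) : Prop :=
  ∀ z ∈ U, HasFDerivAt H (Complex.reCLM.comp ((ContinuousLinearMap.mul ℝ ℂ) (f z))) z

/-- domains exhausted by Runge compacts -/
structure Dom (E : Finset ℂ) (W : Set ℂ) : Prop where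
  op : IsOpen W
  dis : ∀ e ∈ E, e ∉ W
  ex : ∀ C, IsCompact C → C ⊆ W → ∃ M, RC E M ∧ C ⊆ interior M ∧ M ⊆ W

/-- path functionals -/
structure PathData (E : Finset ℂ) (W : Set ℂ) (ι : Type) where
  a : ι → ℂ
  b : ι → ℂ
  haW : ∀ α, a α ∈ W
  hbW : ∀ α, b α ∈ W
  Γ : ι → RR E →ₗ[ℂ] ℂ
  ibp : ∀ α F, Γ α (RR.D F) = F (b α) - F (a α)
  indep : ∀ q : RR E, q ≠ 0 → ∀ τ : ι → ℂ, ∃ ω, ∀ α, Γ α (q * ω) = τ α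
  ftc : ∀ α (f : RR E) H, Pot (E : Set ℂ)ᶜ H f → (Γ α f).re = H (b α) - H (a α)
  g4 : ∀ f : RR E, (∀ α, (Γ α f).re = 0) →
    ∃ H, Pot (E : Set ℂ)ᶜ H f ∧ ∀ α, H (a α) = 0 ∧ H (b α) = 0

/-- boundedness of a functional -/
def BdF {E : Finset ℂ} (W : Set ℂ) (B : RR E →ₗ[ℂ] ℂ) : Prop :=
  ∃ L, IsCompact L ∧ L ⊆ W ∧ ∃ C : ℝ, 0 ≤ C ∧ ∀ (ω : RR E) (M : ℝ), 0 ≤ M →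
    (∀ z ∈ L, ‖ω z‖ ≤ M) → ‖B ω‖ ≤ C * M

namespace BdF
variable {E : Finset ℂ} {W : Set ℂ} {B B' : RR E →ₗ[ℂ] ℂ}

lemma zero : BdF W (0 : RR E →ₗ[ℂ] ℂ) :=
  ⟨∅, isCompact_empty, Set.empty_subset _, 0, le_rfl, fun ω M hM _ => by simp⟩

lemma add (h : BdF W B) (h' : BdF W B') : BdF W (B + B') := by
  obtain ⟨L, hL, hLW, C, hC, hb⟩ := h
  obtain ⟨L', hL', hLW', C', hC', hb'⟩ := h'
  refine ⟨L ∪ L', hL.union hL', Set.union_subset hLW hLW', C + C', by positivity, fun ω M hM hω => ?_⟩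
  rw [LinearMap.add_apply, add_mul]
  exact (norm_add_le _ _).trans (add_le_add (hb ω M hM fun z hz => hω z (Or.inl hz))
    (hb' ω M hM fun z hz => hω z (Or.inr hz)))

lemma smul (c : ℂ) (h : BdF W B) : BdF W (c • B) := by
  obtain ⟨L, hL, hLW, C, hC, hb⟩ := h
  refine ⟨L, hL, hLW, ‖c‖ * C, by positivity, fun ω M hM hω => ?_⟩
  rw [LinearMap.smul_apply, smul_eq_mul, norm_mul, mul_assoc]
  exact mul_le_mul_of_nonneg_left (hb ω M hM hω) (norm_nonneg _)

lemma neg (h : BdF W B) : BdF W (-B) := by simpa using h.smul (-1)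

lemma sub (h : BdF W B) (h' : BdF W B') : BdF W (B - B') := by
  rw [sub_eq_add_neg]; exact h.add h'.neg

lemma sum {κ : Type*} (s : Finset κ) (F : κ → RR E →ₗ[ℂ] ℂ) (h : ∀ i ∈ s, BdF W (F i)) :
    BdF W (∑ i ∈ s, F i) := by
  classical
  induction s using Finset.induction_on with
  | empty => simpa using zero
  | insert a s ha ih =>
    rw [Finset.sum_insert ha]
    exact (h a (Finset.mem_insert_self _ _)).add (ih fun i hi => h i (Finset.mem_insert_of_mem hi))

lemma ev {z : ℂ} (hz : z ∈ W) : BdF W (RR.evL z : RR E →ₗ[ℂ] ℂ) :=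
  ⟨{z}, isCompact_singleton, by simpa using hz, 1, zero_le_one, fun ω M hM h => by
    simpa using h z rfl⟩

/-- the operators on `RR` we compose with -/
lemma comp (h : BdF W B) {T : RR E →ₗ[ℂ] RR E} (hT : ∀ L, IsCompact L → L ⊆ W → ∃ L', IsCompact L' ∧
      L' ⊆ W ∧ ∃ C : ℝ, 0 ≤ C ∧ ∀ (ω : RR E) (M : ℝ), 0 ≤ M → (∀ z ∈ L', ‖ω z‖ ≤ M) →
      ∀ z ∈ L, ‖T ω z‖ ≤ C * M) : BdF W (B ∘ₗ T) := by
  obtain ⟨L, hL, hLW, C, hC, hb⟩ := h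
  obtain ⟨L', hL', hLW', C', hC', hb'⟩ := hT L hL hLW
  refine ⟨L', hL', hLW', C * C', by positivity, fun ω M hM hω => ?_⟩
  rw [LinearMap.comp_apply, mul_assoc]
  exact hb _ _ (by positivity) (hb' ω M hM hω)

end BdF

lemma RR.bound {E : Finset ℂ} {W : Set ℂ} (hW : ∀ e ∈ E, e ∉ W) (g : RR E) {L : Set ℂ}
    (hL : IsCompact L) (hLW : L ⊆ W) : ∃ C : ℝ, 0 ≤ C ∧ ∀ z ∈ L, ‖g z‖ ≤ C := by
  obtain ⟨C, hC⟩ := (hL.image_of_continuousOn (g.continuousOn fun e he h => hW e he (hLW h))).isBounded.exists_norm_le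
  exact ⟨max C 0, le_max_right _ _, fun z hz => (hC _ ⟨z, hz, rfl⟩).trans (le_max_left _ _)⟩

namespace BdF
variable {E : Finset ℂ} {W : Set ℂ} {B B' : RR E →ₗ[ℂ] ℂ}

lemma mul (h : BdF W B) (hW : ∀ e ∈ E, e ∉ W) (g : RR E) : BdF W (B ∘ₗ LinearMap.mulLeft ℂ g) := by
  refine h.comp fun L hL hLW => ?_
  obtain ⟨C, hC, hg⟩ := g.bound hW hL hLW
  refine ⟨L, hL, hLW, C, hC, fun ω M hM hω z hz => ?_⟩
  simp only [LinearMap.mulLeft_apply, RR.ev_mul, norm_mul]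
  exact mul_le_mul (hg z hz) (hω z hz) (norm_nonneg _) hC

lemma deriv (h : BdF W B) (hW : Dom E W) : BdF W (B ∘ₗ (RR.D : Derivation ℂ (RR E) (RR E)).toLinearMap) := by
  refine h.comp fun L hL hLW => ?_
  obtain ⟨δ, hδ, hsub⟩ := hL.exists_cthickening_subset_open hW.op hLW
  refine ⟨Metric.cthickening δ L, hL.cthickening, hsub, δ⁻¹, by positivity, fun ω M hM hω z hz => ?_⟩
  have hb : Metric.closedBall z δ ⊆ Metric.cthickening δ L := Metric.closedBall_subset_cthickening hz δ
  have hzE : z ∉ E := fun h => hW.dis z h (hLW hz)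
  change ‖RR.D ω z‖ ≤ _
  rw [RR.D_ev _ hzE, mul_comm, ← div_eq_mul_inv]
  refine Complex.norm_deriv_le_of_forall_mem_sphere_norm_le hδ ?_ ?_
  · refine DifferentiableOn.diffContOnCl ?_
    refine ω.differentiableOn fun e he h => hW.dis e he (hsub (hb ?_))
    exact closure_minimal Metric.ball_subset_closedBall Metric.isClosed_closedBall h
  · intro w hw
    exact hω w (hb (Metric.sphere_subset_closedBall hw))

end BdF

lemma RR.div {E : Finset ℂ} {f : RR E} {w : ℂ} (hw : w ∉ E) (h : f w = 0) :
    ∃ g : RR E, f = RR.P (Polynomial.X - Polynomial.C w) * g := by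
  obtain ⟨p, k, hp⟩ := f.exists_poly
  have h1 : p.eval w = 0 := by
    rw [← RR.ev_P p hw, ← hp, RR.ev_mul, h, mul_zero]
  obtain ⟨p', rfl⟩ := Polynomial.dvd_iff_isRoot.2 h1
  refine ⟨RR.invQ ^ k * RR.P p', ?_⟩
  have h2 : (RR.invQ : RR E) ^ k * RR.P (QE E) ^ k = 1 := by rw [← mul_pow, RR.invQ_mul, one_pow]
  rw [map_mul] at hp
  linear_combination (RR.invQ : RR E) ^ k * hp - f * h2

lemma RR.ev_XC {E : Finset ℂ} (w : ℂ) {z : ℂ} (h : z ∉ E) :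
    (RR.P (Polynomial.X - Polynomial.C w) : RR E) z = z - w := by
  rw [RR.ev_P _ h]; simp

namespace PathData
variable {E : Finset ℂ} {W : Set ℂ} {ι : Type} [Fintype ι] (S : PathData E W ι)

/-- combination of the functionals -/
def β (x : ι → ℂ) : RR E →ₗ[ℂ] ℂ := ∑ α, x α • S.Γ α

lemma β_apply (x : ι → ℂ) (f : RR E) : S.β x f = ∑ α, x α * S.Γ α f := by
  simp [β]

lemma β_D (x : ι → ℂ) (F : RR E) :
    S.β x (RR.D F) = ∑ α, x α * (F (S.b α) - F (S.a α)) := by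
  simp [β_apply, S.ibp]

lemma bd_βD (x : ι → ℂ) : BdF W (S.β x ∘ₗ (RR.D : Derivation ℂ (RR E) (RR E)).toLinearMap) := by
  have : S.β x ∘ₗ (RR.D : Derivation ℂ (RR E) (RR E)).toLinearMap =
      ∑ α, x α • (RR.evL (S.b α) - RR.evL (S.a α)) := by
    ext F
    change S.β x (RR.D F) = _
    rw [β_D]
    simp
  rw [this]
  exact BdF.sum _ _ fun α _ => ((BdF.ev (S.hbW α)).sub (BdF.ev (S.haW α))).smul _

/-- removing a linear factor located in `W` -/
lemma l8_in (hW : Dom E W) {B : RR E →ₗ[ℂ] ℂ} {w : ℂ} (hw : w ∈ W)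
    (h : BdF W (B ∘ₗ LinearMap.mulLeft ℂ (RR.P (Polynomial.X - Polynomial.C w)))) : BdF W B := by
  obtain ⟨L, hL, hLW, C, hC, hb⟩ := h
  obtain ⟨δ, hδ, hδW⟩ := Metric.nhds_basis_closedBall.mem_iff.1 (hW.op.mem_nhds hw)
  have hwE : w ∉ E := fun h => hW.dis w h hw
  refine ⟨L ∪ Metric.closedBall w δ, hL.union (isCompact_closedBall w δ), Set.union_subset hLW hδW,
    C * (2 / δ) + ‖B 1‖, by positivity, fun ω M hM hω => ?_⟩
  obtain ⟨g, hg⟩ := RR.div (f := ω - algebraMap ℂ (RR E) (ω w)) hwE (by simp [RR.ev_C _ hwE])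
  have hww : ‖ω w‖ ≤ M := hω w (Or.inr (Metric.mem_closedBall_self hδ.le))
  have hgz : ∀ z, z ∉ E → ‖z - w‖ ≥ δ → ‖ω z‖ ≤ M → ‖g z‖ ≤ 2 / δ * M := by
    intro z hzE hz hzM
    have h1 := congrArg (fun f : RR E => f z) hg
    simp only [RR.ev_sub, RR.ev_mul, RR.ev_XC _ hzE, RR.ev_C _ hzE] at h1
    have h2 : ‖z - w‖ * ‖g z‖ ≤ 2 * M := by
      rw [← norm_mul, ← h1]
      exact (norm_sub_le _ _).trans (by linarith)
    have h3 : δ * ‖g z‖ ≤ 2 * M := le_trans (by gcongr) h2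
    rw [div_mul_eq_mul_div, le_div_iff₀ hδ]; linarith
  have hball : ∀ z ∈ Metric.closedBall w δ, ‖g z‖ ≤ 2 / δ * M := by
    intro z hz
    have hcl : closure (Metric.ball w δ) = Metric.closedBall w δ := closure_ball w hδ.ne'
    refine Complex.norm_le_of_forall_mem_frontier_norm_le (U := Metric.ball w δ) Metric.isBounded_ball
      (f := g) ?_ ?_ (by rw [hcl]; exact hz)
    · refine DifferentiableOn.diffContOnCl ?_
      rw [hcl]
      exact g.differentiableOn fun e he h => hW.dis e he (hδW h)
    · rw [frontier_ball w hδ.ne']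
      intro y hy
      have hyb := Metric.sphere_subset_closedBall hy
      refine hgz y (fun h => hW.dis y h (hδW hyb)) ?_ (hω y (Or.inr hyb))
      rw [mem_sphere_iff_norm] at hy; exact hy.ge
  have hgL : ∀ z ∈ L, ‖g z‖ ≤ 2 / δ * M := by
    intro z hz
    by_cases hzb : z ∈ Metric.closedBall w δ
    · exact hball z hzb
    · refine hgz z (fun h => hW.dis z h (hLW hz)) ?_ (hω z (Or.inl hz))
      rw [mem_closedBall_iff_norm, not_le] at hzb; exact hzb.le
  have h5 := hb g _ (by positivity) hgL
  have h6 : B ω = B (RR.P (Polynomial.X - Polynomial.C w) * g) + ω w * B 1 := by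
    rw [← hg, ← smul_eq_mul (ω w), ← map_smul, ← map_add, ← Algebra.algebraMap_eq_smul_one,
      sub_add_cancel]
  rw [LinearMap.comp_apply, LinearMap.mulLeft_apply] at h5
  rw [h6]
  calc _ ≤ _ := norm_add_le _ _
    _ ≤ C * (2 / δ * M) + M * ‖B 1‖ := by
        rw [norm_mul]; gcongr
    _ = _ := by ring

lemma l8_unit (hW : Dom E W) {B : RR E →ₗ[ℂ] ℂ} {u v : RR E} (huv : u * v = 1)
    (h : BdF W (B ∘ₗ LinearMap.mulLeft ℂ u)) : BdF W B := by
  have := h.mul hW.dis v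
  rw [LinearMap.comp_assoc, ← LinearMap.mulLeft_mul, huv] at this
  simpa using this

lemma l8_out (hW : Dom E W) (x : ι → ℂ) {w : ℂ} (hwW : w ∉ W) (hwE : w ∉ E) (a : ℕ) (v : RR E)
    (hv : v w ≠ 0)
    (h : BdF W (S.β x ∘ₗ LinearMap.mulLeft ℂ (RR.P (Polynomial.X - Polynomial.C w) ^ a * v *
      RR.P (Polynomial.X - Polynomial.C w)))) :
    BdF W (S.β x ∘ₗ LinearMap.mulLeft ℂ (RR.P (Polynomial.X - Polynomial.C w) ^ a * v)) := by
  classical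
  obtain ⟨L0, hL0, hL0W, C, hC, hb⟩ := h
  set s : RR E := RR.P (Polynomial.X - Polynomial.C w) with hs
  have hDs : RR.D s = 1 := by
    refine RR.ext' fun z hz => ?_
    rw [RR.D_ev _ hz, RR.ev_one hz]
    have : (s : ℂ → ℂ) =ᶠ[𝓝 z] fun z => z - w := by
      filter_upwards [E_ev hz] with y hy using RR.ev_XC w hy
    rw [this.deriv_eq]; simp
  obtain ⟨L, hL, hL0L, hLW⟩ := hW.ex (L0 ∪ (Finset.univ.image S.a ∪ Finset.univ.image S.b : Finset ℂ))
    (hL0.union (Finset.finite_toSet _).isCompact) (by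
      refine Set.union_subset hL0W ?_
      intro z hz
      simp only [Finset.coe_union, Finset.coe_image, Finset.coe_univ, Set.image_univ,
        Set.mem_union, Set.mem_range] at hz
      rcases hz with ⟨α, rfl⟩ | ⟨α, rfl⟩
      · exact S.haW α
      · exact S.hbW α)
  have hL0L' : L0 ⊆ L := fun z hz => interior_subset (hL0L (Or.inl hz))
  have haL : ∀ α, S.a α ∈ L := fun α => interior_subset (hL0L (Or.inr (by simp)))
  have hbL : ∀ α, S.b α ∈ L := fun α => interior_subset (hL0L (Or.inr (by simp)))
  have hwL : w ∉ L := fun h => hwW (hLW h)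
  have hLE : ∀ z ∈ L, z ∉ E := fun z hz h => hW.dis z h (hLW hz)
  obtain ⟨δ, hδ, hδL⟩ : ∃ δ > 0, ∀ z ∈ L, δ ≤ ‖z - w‖ := by
    obtain ⟨d, hd, hball⟩ := Metric.isOpen_iff.1 hL.1.isClosed.isOpen_compl w hwL
    refine ⟨d, hd, fun z hz => ?_⟩
    by_contra hlt
    exact hball (by simpa [dist_eq] using not_le.1 hlt) hz
  obtain ⟨η0, hη0, hη1, -, hηL⟩ := hL.sep hwL (ε := 1/2) (by norm_num)
  set η : RR E := RR.mk η0 hη0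
  have hηw : η w = 1 := by rw [RR.mk_ev _ hwE, hη1 hwE]
  have hηL' : ∀ z ∈ L, ‖η z‖ ≤ 1/2 := fun z hz => by
    rw [RR.mk_ev _ (hLE z hz)]; exact (hηL z hz).le
  -- the functions `θ m`
  set θ : ℕ → RR E := fun m => (a + 1) • (v * η ^ (m+1)) + 2 • (s * RR.D v * η ^ (m+1)) +
    (m + 1) • (s * v * η ^ m * RR.D η) with hθ
  have hθD : ∀ m, RR.D (s ^ (a+1) * v ^ 2 * η ^ (m+1)) = s ^ a * v * θ m := by
    intro m
    simp only [hθ, RR.D_mul, Derivation.leibniz_pow, hDs, smul_eq_mul, Nat.add_sub_cancel, nsmul_eq_mul]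
    push_cast
    ring
  have hθw : ∀ m, θ m w = (a + 1) * v w := by
    intro m
    have : s w = 0 := by rw [hs, RR.ev_XC _ hwE, sub_self]
    simp [hθ, nsmul_eq_mul, this, RR.ev_natCast, hwE, RR.ev_pow, hηw, RR.ev_one]
  -- smallness
  obtain ⟨c1, hc1, hc1'⟩ := RR.bound hW.dis v hL.1 hLW
  obtain ⟨c2, hc2, hc2'⟩ := RR.bound hW.dis (s * RR.D v) hL.1 hLW
  obtain ⟨c3, hc3, hc3'⟩ := RR.bound hW.dis (s * v * RR.D η) hL.1 hLW
  obtain ⟨c4, hc4, hc4'⟩ := RR.bound hW.dis (s ^ (a+1) * v ^ 2) hL.1 hLW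
  have hηp : ∀ m, ∀ z ∈ L, ‖η z ^ m‖ ≤ (1/2)^m := fun m z hz => by
    rw [norm_pow]; gcongr; exact hηL' z hz
  set t : ℕ → ℝ := fun m => (a + 1) * (c1 * (1/2)^(m+1)) + 2 * (c2 * (1/2)^(m+1)) +
    (m + 1) * (c3 * (1/2)^m) with ht
  have hθt : ∀ m, ∀ z ∈ L, ‖θ m z‖ ≤ t m := by
    intro m z hz
    have e1 : θ m z = (a + 1) * (v z * η z ^ (m+1)) + 2 * ((s * RR.D v) z * η z ^ (m+1)) +
        (m + 1) * ((s * v * RR.D η) z * η z ^ m) := by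
      simp only [hθ, nsmul_eq_mul, RR.ev_add, RR.ev_mul, RR.ev_natCast _ (hLE z hz),
        RR.ev_pow _ _ (hLE z hz)]
      push_cast; ring
    rw [e1]
    refine (norm_add₃_le).trans ?_
    simp only [norm_mul]
    have n1 : ‖(a + 1 : ℂ)‖ = a + 1 := by
      have := Complex.norm_natCast (a + 1); push_cast at this; exact this
    have n2 : ‖(m + 1 : ℂ)‖ = m + 1 := by
      have := Complex.norm_natCast (m + 1); push_cast at this; exact this
    rw [n1, n2, Complex.norm_ofNat]
    have := hc2' z hz
    have := hc3' z hz
    have := hc1' z hz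
    have := hηp m z hz
    have := hηp (m+1) z hz
    simp only [ht]
    gcongr
  have hg0 : Tendsto (fun m : ℕ => ((1/2 : ℝ))^m) atTop (𝓝 0) :=
    tendsto_pow_atTop_nhds_zero_of_lt_one (by norm_num) (by norm_num)
  have hg1 : Tendsto (fun m : ℕ => ((1/2 : ℝ))^(m+1)) atTop (𝓝 0) :=
    (tendsto_add_atTop_iff_nat 1).2 hg0
  have hg2 : Tendsto (fun m : ℕ => (m : ℝ) * ((1/2 : ℝ))^m) atTop (𝓝 0) :=
    tendsto_self_mul_const_pow_of_lt_one (by norm_num) (by norm_num)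
  have ht0 : Tendsto t atTop (𝓝 0) := by
    have := (((hg1.const_mul c1).const_mul (a+1 : ℝ)).add ((hg1.const_mul c2).const_mul 2)).add
      ((hg2.add hg0).const_mul c3)
    simp only [mul_zero, add_zero] at this
    refine this.congr fun m => ?_
    simp only [ht]; ring
  have hβ0 : Tendsto (fun m => ‖S.β x (s ^ a * v * θ m)‖) atTop (𝓝 0) := by
    have hup : Tendsto (fun m : ℕ => ∑ α, ‖x α‖ * (2 * (c4 * (1/2 : ℝ)^(m+1)))) atTop (𝓝 0) := by
      have := tendsto_finset_sum Finset.univ fun α (_ : α ∈ Finset.univ) =>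
        ((hg1.const_mul c4).const_mul 2).const_mul ‖x α‖
      simpa using this
    refine squeeze_zero (fun m => norm_nonneg _) (fun m => ?_) hup
    rw [← hθD, β_D]
    refine (norm_sum_le _ _).trans (Finset.sum_le_sum fun α _ => ?_)
    rw [norm_mul]
    refine mul_le_mul_of_nonneg_left ?_ (norm_nonneg _)
    have hz : ∀ z ∈ L, ‖(s ^ (a+1) * v ^ 2 * η ^ (m+1)) z‖ ≤ c4 * (1/2)^(m+1) := by
      intro z hz
      rw [RR.ev_mul, RR.ev_pow η _ (hLE z hz), norm_mul]
      have := hc4' z hz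
      have := hηp (m+1) z hz
      gcongr
    refine (norm_sub_le _ _).trans ?_
    have := hz _ (hbL α)
    have := hz _ (haL α)
    linarith
  refine ⟨L, hL.1, hLW, C / δ, by positivity, fun ω M hM hω => ?_⟩
  have hne : ((a : ℂ) + 1) * v w ≠ 0 := mul_ne_zero (by exact_mod_cast Nat.succ_ne_zero a) hv
  set κ : ℂ := ω w / ((a + 1) * v w) with hκ
  have hbound : ∀ m, ‖S.β x (s ^ a * v * ω)‖ ≤
      ‖κ‖ * ‖S.β x (s ^ a * v * θ m)‖ + C * ((M + ‖κ‖ * t m) / δ) := by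
    intro m
    have ht_nn : 0 ≤ t m := by simp only [ht]; positivity
    obtain ⟨g, hg⟩ := RR.div (f := ω - κ • θ m) hwE (by
      rw [RR.ev_sub, RR.ev_smul, hθw, hκ, div_mul_cancel₀ _ hne, sub_self])
    rw [← hs] at hg
    have hgL : ∀ z ∈ L0, ‖g z‖ ≤ (M + ‖κ‖ * t m) / δ := by
      intro z hz0
      have hz := hL0L' hz0
      have h1 := congrArg (fun f : RR E => f z) hg
      simp only [RR.ev_sub, RR.ev_mul, RR.ev_smul] at h1
      rw [hs, RR.ev_XC _ (hLE z hz)] at h1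
      rw [le_div_iff₀ hδ]
      calc ‖g z‖ * δ ≤ ‖g z‖ * ‖z - w‖ := by gcongr; exact hδL z hz
        _ = ‖ω z - κ * θ m z‖ := by rw [h1, norm_mul, mul_comm]
        _ ≤ ‖ω z‖ + ‖κ‖ * ‖θ m z‖ := by rw [← norm_mul]; exact norm_sub_le _ _
        _ ≤ _ := by have := hω z hz; have := hθt m z hz; gcongr
    have h5 := hb g _ (by positivity) hgL
    rw [LinearMap.comp_apply, LinearMap.mulLeft_apply] at h5
    have h6 : s ^ a * v * ω = κ • (s ^ a * v * θ m) + s ^ a * v * s * g := by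
      have : ω = κ • θ m + s * g := by rw [← hg]; ring
      conv_lhs => rw [this]
      rw [mul_add, mul_smul_comm]; ring
    rw [h6, map_add, map_smul, smul_eq_mul]
    refine (norm_add_le _ _).trans ?_
    rw [norm_mul]
    linarith
  have hlim : Tendsto (fun m => ‖κ‖ * ‖S.β x (s ^ a * v * θ m)‖ + C * ((M + ‖κ‖ * t m) / δ)) atTop
      (𝓝 (‖κ‖ * 0 + C * ((M + ‖κ‖ * 0) / δ))) :=
    (hβ0.const_mul _).add ((((ht0.const_mul _).const_add M).div_const δ).const_mul C)
  have := ge_of_tendsto' hlim hbound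
  rw [LinearMap.comp_apply, LinearMap.mulLeft_apply]
  refine this.trans (le_of_eq ?_)
  simp; ring

lemma l8_poly (hW : Dom E W) (x : ι → ℂ) : ∀ (n : ℕ) (p : Polynomial ℂ), p ≠ 0 → p.natDegree = n →
    BdF W (S.β x ∘ₗ LinearMap.mulLeft ℂ (RR.P p)) → BdF W (S.β x) := by
  intro n
  induction n with
  | zero =>
    intro p hp hd h
    rw [Polynomial.eq_C_of_natDegree_eq_zero hd] at h hp
    set c := p.coeff 0
    have hc : c ≠ 0 := fun h0 => hp (by rw [h0, map_zero])
    refine l8_unit hW (u := RR.P (Polynomial.C c)) (v := RR.P (Polynomial.C c⁻¹)) ?_ h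
    rw [← map_mul, ← map_mul, mul_inv_cancel₀ hc, map_one, map_one]
  | succ n ih =>
    intro p hp hd h
    obtain ⟨w, hw⟩ := IsAlgClosed.exists_root p (by
      rw [Polynomial.degree_eq_natDegree hp, hd]; exact_mod_cast Nat.succ_ne_zero n)
    obtain ⟨p1, rfl⟩ := Polynomial.dvd_iff_isRoot.2 hw
    have hp1 : p1 ≠ 0 := right_ne_zero_of_mul hp
    have hd1 : p1.natDegree = n := by
      rw [Polynomial.natDegree_mul (Polynomial.X_sub_C_ne_zero w) hp1, Polynomial.natDegree_X_sub_C] at hd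
      omega
    refine ih p1 hp1 hd1 ?_
    by_cases hwE : w ∈ E
    · refine l8_unit hW (u := RR.P (Polynomial.X - Polynomial.C w)) (v := RR.invS hwE)
        (by rw [mul_comm, RR.invS_mul]) ?_
      rwa [LinearMap.comp_assoc, ← LinearMap.mulLeft_mul, ← map_mul, mul_comm p1]
    · by_cases hwW : w ∈ W
      · refine l8_in hW hwW ?_
        rwa [LinearMap.comp_assoc, ← LinearMap.mulLeft_mul, ← map_mul, mul_comm p1]
      · obtain ⟨v, hv, hv2⟩ := Polynomial.exists_eq_pow_rootMultiplicity_mul_and_not_dvd p1 hp1 w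
        rw [hv, map_mul, map_pow]
        refine S.l8_out hW x hwW hwE _ _ ?_ ?_
        · rw [RR.ev_P _ hwE]
          exact fun h0 => hv2 (Polynomial.dvd_iff_isRoot.2 h0)
        · rw [← map_pow, ← map_mul, ← hv, ← map_mul, mul_comm p1]
          exact h

lemma l8 (hW : Dom E W) (x : ι → ℂ) {q : RR E} (hq : q ≠ 0)
    (h : BdF W (S.β x ∘ₗ LinearMap.mulLeft ℂ q)) : BdF W (S.β x) := by
  obtain ⟨p, k, hp⟩ := q.exists_poly
  refine S.l8_poly hW x _ p ?_ rfl ?_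
  · rintro rfl
    rw [map_zero] at hp
    exact mul_ne_zero (pow_ne_zero k (RR.P_ne (QE_ne E))) hq hp
  · rw [← hp, mul_comm, LinearMap.mulLeft_mul, ← LinearMap.comp_assoc]
    exact h.mul hW.dis _

/-- elimination -/
lemma elim (hW : Dom E W) : ∀ (k : ℕ) (Φ : Fin k → RR E) (x : Fin k → ι → ℂ) (Φ0 : RR E) (x0 : ι → ℂ)
    (q : RR E), q ≠ 0 → Φ0 ∉ Submodule.span ℂ (Set.range Φ) →
    BdF W (S.β x0 ∘ₗ LinearMap.mulLeft ℂ (q * Φ0) +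
      ∑ i, S.β (x i) ∘ₗ LinearMap.mulLeft ℂ (q * Φ i)) → BdF W (S.β x0) := by
  intro k
  induction k with
  | zero =>
    intro Φ x Φ0 x0 q hq hΦ h
    have h0 : Φ0 ≠ 0 := fun h0 => hΦ (by rw [h0]; exact Submodule.zero_mem _)
    refine S.l8 hW x0 (mul_ne_zero hq h0) ?_
    simpa using h
  | succ k ih =>
    intro Φ x Φ0 x0 q hq hΦ h
    set g := Φ 0 with hg
    have hsp : ∀ i, Φ i ∈ Submodule.span ℂ (Set.range Φ) := fun i => Submodule.subset_span ⟨i, rfl⟩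
    by_cases hg0 : g = 0
    · refine ih (fun i => Φ i.succ) (fun i => x i.succ) Φ0 x0 q hq (fun hm => hΦ ?_) ?_
      · refine Submodule.span_mono ?_ hm
        rintro _ ⟨i, rfl⟩; exact ⟨i.succ, rfl⟩
      · rw [Fin.sum_univ_succ, ← hg, hg0, mul_zero] at h
        simpa using h
    · -- general step
      let V : RR E → RR E := fun f => RR.D f * g - f * RR.D g
      refine ih (fun i => V (Φ i.succ)) (fun i => x i.succ) (V Φ0) x0 (q ^ 2) (pow_ne_zero 2 hq) ?_ ?_
      · intro hm
        rw [Submodule.mem_span_range_iff_exists_fun] at hm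
        obtain ⟨c, hc⟩ := hm
        obtain ⟨d, hd⟩ := RR.wronsk (f := Φ0 - ∑ i, c i • Φ i.succ) hg0 (by
          have : RR.D (Φ0 - ∑ i, c i • Φ i.succ) * g - (Φ0 - ∑ i, c i • Φ i.succ) * RR.D g =
              V Φ0 - ∑ i, c i • V (Φ i.succ) := by
            simp only [V, map_sub, map_sum, Derivation.map_smul, sub_mul, Finset.sum_mul, smul_sub,
              Finset.sum_sub_distrib, smul_mul_assoc]
            ring
          rw [this, hc, sub_self])
        refine hΦ ?_
        rw [sub_eq_iff_eq_add] at hd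
        rw [hd]
        exact Submodule.add_mem _ (Submodule.smul_mem _ _ (hsp 0))
          (Submodule.sum_mem _ fun i _ => Submodule.smul_mem _ _ (hsp _))
      · -- plug in
        let T : RR E →ₗ[ℂ] RR E := LinearMap.mulLeft ℂ (2 * RR.D q * g + 2 * q * RR.D g) +
          LinearMap.mulLeft ℂ (q * g) ∘ₗ (RR.D : Derivation ℂ (RR E) (RR E)).toLinearMap
        have hT : ∀ {B : RR E →ₗ[ℂ] ℂ}, BdF W B → BdF W (B ∘ₗ T) := by
          intro B hB
          rw [LinearMap.comp_add, ← LinearMap.comp_assoc]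
          exact (hB.mul hW.dis _).add ((hB.mul hW.dis _).deriv hW)
        have hTeq : ∀ ω, q * T ω * g = RR.D (q ^ 2 * g ^ 2 * ω) := by
          intro ω
          have : T ω = (2 * RR.D q * g + 2 * q * RR.D g) * ω + q * g * RR.D ω := rfl
          rw [this]
          simp only [RR.D_mul, Derivation.leibniz_pow, smul_eq_mul, nsmul_eq_mul]
          push_cast
          ring
        have hstep : ∀ f : RR E, ∀ ω, q * T ω * f = RR.D (q ^ 2 * g * f * ω) - q ^ 2 * V f * ω := by
          intro f ω
          refine mul_right_cancel₀ hg0 ?_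
          have h1 := hTeq ω
          simp only [V, RR.D_mul, Derivation.leibniz_pow, smul_eq_mul, nsmul_eq_mul] at h1 ⊢
          push_cast at h1 ⊢
          linear_combination f * h1
        have hb : ∀ (y : ι → ℂ) (f : RR E), BdF W (S.β y ∘ₗ LinearMap.mulLeft ℂ (q * f) ∘ₗ T +
            S.β y ∘ₗ LinearMap.mulLeft ℂ (q ^ 2 * V f)) := by
          intro y f
          have := (S.bd_βD y).mul hW.dis (q ^ 2 * g * f)
          convert this using 1
          ext ω
          simp only [LinearMap.add_apply, LinearMap.comp_apply, LinearMap.mulLeft_apply]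
          change _ = S.β y (RR.D _)
          rw [← map_add]
          congr 1
          linear_combination hstep f ω
        have hb0 : BdF W (S.β (x 0) ∘ₗ LinearMap.mulLeft ℂ (q * g) ∘ₗ T) := by
          have := (S.bd_βD (x 0)).mul hW.dis (q ^ 2 * g ^ 2)
          convert this using 1
          ext ω
          simp only [LinearMap.comp_apply, LinearMap.mulLeft_apply]
          change _ = S.β (x 0) (RR.D _)
          congr 1
          linear_combination hTeq ω
        have hall := ((hb x0 Φ0).add (BdF.sum Finset.univ _ fun (i : Fin k) _ =>
          hb (x i.succ) (Φ i.succ))).sub ((hT h).sub hb0)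
        convert hall using 1
        rw [Fin.sum_univ_succ, Finset.sum_add_distrib]
        ext ω
        simp only [LinearMap.add_apply, LinearMap.sub_apply, LinearMap.comp_apply, LinearMap.sum_apply]
        rw [← hg]
        ring

end PathData

lemma dual_pi {κ : Type*} [Fintype κ] (φ : (κ → ℂ) →ₗ[ℂ] ℂ) :
    ∃ ξ : κ → ℂ, ∀ v, φ v = ∑ k, ξ k * v k := by
  classical
  refine ⟨fun k => φ (Pi.single k 1), fun v => ?_⟩
  rw [LinearMap.pi_apply_eq_sum_univ φ v]
  refine Finset.sum_congr rfl fun k _ => ?_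
  rw [smul_eq_mul, mul_comm]
  congr 2
  ext j
  simp [Pi.single_apply, eq_comm]

lemma soft {V F κ : Type*} [AddCommGroup V] [Module ℂ V] [NormedAddCommGroup F] [NormedSpace ℂ F]
    [Fintype κ] (J : V →ₗ[ℂ] F) (T : V →ₗ[ℂ] (κ → ℂ)) (τ : κ → ℂ)
    (h : ∀ ξ : κ → ℂ, (∃ C : ℝ, ∀ v, ‖∑ k, ξ k * T v k‖ ≤ C * ‖J v‖) → ∑ k, ξ k * τ k = 0)
    {ε : ℝ} (hε : 0 < ε) : ∃ v, ‖J v‖ < ε ∧ T v = τ := by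
  obtain ⟨v0, hv0⟩ : τ ∈ LinearMap.range T := by
    by_contra hno
    obtain ⟨φ, hφ, hφ2⟩ := Submodule.exists_le_ker_of_notMem hno
    obtain ⟨ξ, hξ⟩ := dual_pi φ
    refine hφ ?_
    rw [hξ]
    refine h ξ ⟨0, fun v => ?_⟩
    rw [← hξ, show φ (T v) = 0 from hφ2 ⟨v, rfl⟩]; simp
  set Sb := ((LinearMap.ker T).map J).topologicalClosure with hSb
  have hmem : J v0 ∈ Sb := by
    by_contra hno
    have hne : Sb.mkQL (J v0) ≠ 0 := fun h0 => hno ((Submodule.Quotient.mk_eq_zero _).1 h0)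
    haveI : IsClosed (Sb : Set F) := Submodule.isClosed_topologicalClosure _
    obtain ⟨f, hf⟩ := SeparatingDual.exists_ne_zero (R := ℂ) hne
    set ℓ : F →L[ℂ] ℂ := f.comp Sb.mkQL
    have hℓ : ∀ v, T v = 0 → ℓ (J v) = 0 := by
      intro v hv
      have : J v ∈ Sb := Submodule.le_topologicalClosure _ ⟨v, hv, rfl⟩
      have h0 : Sb.mkQL (J v) = 0 := (Submodule.Quotient.mk_eq_zero _).2 this
      change f (Sb.mkQL (J v)) = 0
      rw [h0, map_zero]
    have hr : (ℓ.toLinearMap ∘ₗ J) ∈ LinearMap.range T.dualMap := by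
      rw [LinearMap.range_dualMap_eq_dualAnnihilator_ker, Submodule.mem_dualAnnihilator]
      exact fun v hv => hℓ v hv
    obtain ⟨φ, hφ⟩ := hr
    obtain ⟨ξ, hξ⟩ := dual_pi φ
    have hφ' : ∀ v, φ (T v) = ℓ (J v) := fun v => congrArg (fun g => g v) hφ
    have := h ξ ⟨‖ℓ‖, fun v => by rw [← hξ, hφ']; exact ℓ.le_opNorm _⟩
    rw [← hξ, ← hv0, hφ'] at this
    exact hf this
  obtain ⟨_, ⟨k, hk, rfl⟩, hd⟩ := Metric.mem_closure_iff.1 hmem ε hε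
  refine ⟨v0 - k, ?_, ?_⟩
  · rw [map_sub, ← dist_eq_norm]; exact hd
  · rw [map_sub, show T k = 0 from hk, sub_zero, hv0]

namespace PathData
variable {E : Finset ℂ} {W : Set ℂ} {ι : Type} [Fintype ι] (S : PathData E W ι)

lemma slin (hW : Dom E W) {k : ℕ} (Φ : Fin k → RR E) (Φ0 : RR E) (q : RR E) (hq : q ≠ 0)
    (hΦ : Φ0 ∉ Submodule.span ℂ (Set.range Φ)) (τ : ι → ℂ)
    (hτ : ∀ x, BdF W (S.β x) → ∑ α, x α * τ α = 0) {L : Set ℂ} (hL : IsCompact L) (hLW : L ⊆ W)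
    {ε : ℝ} (hε : 0 < ε) : ∃ ω : RR E, (∀ z ∈ L, ‖ω z‖ < ε) ∧ (∀ α, S.Γ α (q * Φ0 * ω) = τ α) ∧
      ∀ i α, S.Γ α (q * Φ i * ω) = 0 := by
  have := isCompact_iff_compactSpace.1 hL
  have hLE : ∀ e ∈ E, e ∉ L := fun e he h => hW.dis e he (hLW h)
  let T : RR E →ₗ[ℂ] ((ι ⊕ Fin k × ι) → ℂ) := LinearMap.pi (fun s => match s with
    | Sum.inl α => S.Γ α ∘ₗ LinearMap.mulLeft ℂ (q * Φ0)
    | Sum.inr (i, α) => S.Γ α ∘ₗ LinearMap.mulLeft ℂ (q * Φ i))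
  obtain ⟨ω, h1, h2⟩ := soft (RR.res hLE).toLinearMap T
    (fun s => match s with | Sum.inl α => τ α | Sum.inr _ => 0) (by
      rintro ξ ⟨C, hC⟩
      rw [Fintype.sum_sum_type]
      simp only [mul_zero, Finset.sum_const_zero, add_zero]
      refine hτ _ (S.elim hW k Φ (fun i α => ξ (Sum.inr (i, α))) Φ0 (fun α => ξ (Sum.inl α)) q hq hΦ ?_)
      refine ⟨L, hL, hLW, |C|, abs_nonneg _, fun ω M hM hω => ?_⟩
      have h3 := hC ω
      have h4 : ‖RR.res hLE ω‖ ≤ M := by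
        rw [ContinuousMap.norm_le _ hM]; exact fun z => hω z z.2
      have h5 : (S.β (fun α => ξ (Sum.inl α)) ∘ₗ LinearMap.mulLeft ℂ (q * Φ0) +
          ∑ i, S.β (fun α => ξ (Sum.inr (i, α))) ∘ₗ LinearMap.mulLeft ℂ (q * Φ i)) ω =
          ∑ k, ξ k * T ω k := by
        rw [Fintype.sum_sum_type, Fintype.sum_prod_type]
        simp [T, β_apply]
      rw [h5]
      calc _ ≤ _ := h3
        _ ≤ |C| * ‖RR.res hLE ω‖ := by gcongr; exact le_abs_self C; exact le_rfl
        _ ≤ _ := by gcongr) hε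
  refine ⟨ω, fun z hz => ?_, fun α => ?_, fun i α => ?_⟩
  · exact (ContinuousMap.norm_coe_le_norm (RR.res hLE ω) ⟨z, hz⟩).trans_lt h1
  · exact congrFun h2 (Sum.inl α)
  · exact congrFun h2 (Sum.inr (i, α))

end PathData

/-- a nonzero common isotropic vector in an infinite dimensional space -/
lemma lemI {V κ κ' : Type} [AddCommGroup V] [Module ℂ V] [Fintype κ] [Fintype κ']
    (hV : ¬ FiniteDimensional ℂ V) (ℓ : κ' → V →ₗ[ℂ] ℂ) (B : κ → V →ₗ[ℂ] V →ₗ[ℂ] ℂ)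
    (hB : ∀ α u v, B α u v = B α v u) : ∃ v : V, v ≠ 0 ∧ (∀ i, ℓ i v = 0) ∧ ∀ α, B α v v = 0 := by
  classical
  -- greedy choice
  have hgr : ∀ M : ℕ, ∃ v : Fin M → V, LinearIndependent ℂ v ∧ (∀ k i, ℓ i (v k) = 0) ∧
      ∀ k l, k ≠ l → ∀ α, B α (v k) (v l) = 0 := by
    intro M
    induction M with
    | zero => exact ⟨Fin.elim0, linearIndependent_empty_type, fun k => k.elim0, fun k => k.elim0⟩
    | succ M ih =>
      obtain ⟨v, hv, hv1, hv2⟩ := ih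
      let T : V →ₗ[ℂ] (κ' ⊕ Fin M × κ → ℂ) := LinearMap.pi (fun s => match s with
        | Sum.inl i => ℓ i
        | Sum.inr (k, α) => B α (v k))
      obtain ⟨u, hu, hu2⟩ : ∃ u ∈ LinearMap.ker T, u ∉ Submodule.span ℂ (Set.range v) := by
        by_contra hno
        push Not at hno
        have hle : LinearMap.ker T ≤ Submodule.span ℂ (Set.range v) := hno
        have : FiniteDimensional ℂ (Submodule.span ℂ (Set.range v)) :=
          FiniteDimensional.span_of_finite ℂ (Set.finite_range v)
        have h1 : FiniteDimensional ℂ (LinearMap.ker T) := Submodule.finiteDimensional_of_le hle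
        have h2 : FiniteDimensional ℂ (LinearMap.range T) := inferInstance
        have h3 : FiniteDimensional ℂ (V ⧸ LinearMap.ker T) :=
          Module.Finite.equiv (T.quotKerEquivRange).symm
        exact hV (Module.Finite.of_submodule_quotient (LinearMap.ker T))
      have hT : ∀ s, T u s = 0 := fun s => congrFun hu s
      refine ⟨Fin.snoc v u, ?_, ?_, ?_⟩
      · exact hv.finSnoc hu2
      · intro k i
        induction k using Fin.lastCases with
        | last => rw [Fin.snoc_last]; exact hT (Sum.inl i)
        | cast k => rw [Fin.snoc_castSucc]; exact hv1 k i
      · intro k l hkl α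
        induction k using Fin.lastCases with
        | last =>
          induction l using Fin.lastCases with
          | last => exact absurd rfl hkl
          | cast l =>
            rw [Fin.snoc_last, Fin.snoc_castSucc, hB]; exact hT (Sum.inr (l, α))
        | cast k =>
          induction l using Fin.lastCases with
          | last => rw [Fin.snoc_last, Fin.snoc_castSucc]; exact hT (Sum.inr (k, α))
          | cast l =>
            rw [Fin.snoc_castSucc, Fin.snoc_castSucc]
            exact hv2 k l (fun h => hkl (by rw [h])) α
  obtain ⟨v, hv, hv1, hv2⟩ := hgr (Fintype.card κ + 1)
  have hdep : ¬ LinearIndependent ℂ (fun k : Fin (Fintype.card κ + 1) => fun α => B α (v k) (v k)) := by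
    intro hli
    have := hli.fintype_card_le_finrank
    simp at this
  rw [Fintype.not_linearIndependent_iff] at hdep
  obtain ⟨c, hc, k0, hk0⟩ := hdep
  choose s hs using fun k => IsAlgClosed.exists_pow_nat_eq (c k) (n := 2) (by norm_num)
  refine ⟨∑ k, s k • v k, ?_, ?_, ?_⟩
  · intro h0
    have := (Fintype.linearIndependent_iff.1 hv) s h0 k0
    exact hk0 (by rw [← hs, this]; norm_num)
  · intro i; simp [hv1]
  · intro α
    have h1 := congrFun hc α
    simp only [Finset.sum_apply, Pi.smul_apply, smul_eq_mul, Pi.zero_apply] at h1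
    rw [← h1]
    simp only [map_sum, map_smul, LinearMap.sum_apply, LinearMap.smul_apply, smul_eq_mul]
    refine Finset.sum_congr rfl fun k _ => ?_
    rw [Finset.mul_sum, Finset.sum_eq_single k]
    · rw [← hs k]; ring
    · intro l _ hl; rw [hv2 l k hl]; ring
    · simp

/-- normalised coefficients -/
lemma lemX {κ : Type*} [Fintype κ] {M : ℕ} (hM : Fintype.card κ < M) (d : Fin M → κ → ℂ) :
    ∃ x : Fin M → ℂ, ∑ k, x k = 1 ∧ (∀ k, ‖x k‖ ≤ 1) ∧ ∀ α, ∑ k, x k ^ 2 * d k α = 0 := by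
  classical
  have hdep : ¬ LinearIndependent ℂ d := by
    intro hli
    have := hli.fintype_card_le_finrank
    simp at this
    omega
  rw [Fintype.not_linearIndependent_iff] at hdep
  obtain ⟨c, hc, k1, hk1⟩ := hdep
  choose s hs using fun k => IsAlgClosed.exists_pow_nat_eq (c k) (n := 2) (by norm_num)
  haveI : Nonempty (Fin M) := ⟨k1⟩
  obtain ⟨k0, hk0⟩ := Finite.exists_max (fun k => ‖s k‖)
  have hpos : 0 < ‖s k0‖ := lt_of_lt_of_le (norm_pos_iff.2 fun h => hk1 (by rw [← hs, h]; norm_num)) (hk0 k1)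
  set T := ∑ k ∈ Finset.univ.erase k0, s k with hT
  obtain ⟨σ, hσ, hσ2⟩ : ∃ σ : ℂ, σ ^ 2 = 1 ∧ ‖s k0‖ ≤ ‖s k0 + σ * T‖ := by
    by_contra hno
    push Not at hno
    have h1 := hno 1 (by norm_num)
    have h2 := hno (-1) (by norm_num)
    have h3 := norm_add_le (s k0 + 1 * T) (s k0 + (-1) * T)
    have h4 : s k0 + 1 * T + (s k0 + (-1) * T) = 2 * s k0 := by ring
    rw [h4, norm_mul, Complex.norm_ofNat] at h3
    linarith
  have hnσ : ‖σ‖ = 1 := by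
    have : ‖σ‖ ^ 2 = 1 := by rw [← norm_pow, hσ, norm_one]
    exact (pow_eq_one_iff_of_nonneg (norm_nonneg _) (by norm_num)).1 this
  set N := s k0 + σ * T with hN
  have hN0 : N ≠ 0 := norm_pos_iff.1 (hpos.trans_le hσ2)
  set y : Fin M → ℂ := fun k => if k = k0 then s k0 else σ * s k with hy
  have hysum : ∑ k, y k = N := by
    rw [← Finset.add_sum_erase _ _ (Finset.mem_univ k0), hN, hT, Finset.mul_sum]
    congr 1
    · simp [hy]
    · refine Finset.sum_congr rfl fun k hk => ?_
      simp [hy, Finset.ne_of_mem_erase hk]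
  have hy2 : ∀ k, y k ^ 2 = c k := by
    intro k
    by_cases h : k = k0
    · simp [hy, h, hs]
    · simp only [hy, h, if_false, mul_pow, hσ, hs, one_mul]
  have hyn : ∀ k, ‖y k‖ ≤ ‖N‖ := by
    intro k
    refine le_trans ?_ hσ2
    by_cases h : k = k0
    · simp [hy, h]
    · simp only [hy, h, if_false, norm_mul, hnσ, one_mul]; exact hk0 k
  refine ⟨fun k => y k / N, ?_, fun k => ?_, fun α => ?_⟩
  · rw [← Finset.sum_div, hysum, div_self hN0]
  · rw [norm_div, div_le_one (norm_pos_iff.2 hN0)]; exact hyn k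
  · have h1 := congrFun hc α
    simp only [Finset.sum_apply, Pi.smul_apply, smul_eq_mul, Pi.zero_apply] at h1
    have : ∀ k, (y k / N) ^ 2 * d k α = (N ^ 2)⁻¹ * (c k * d k α) := by
      intro k; rw [div_pow, hy2]; ring
    simp only [this, ← Finset.mul_sum, h1, mul_zero]

/-- vanishing order of a finite dimensional space is bounded -/
lemma ordB {E : Finset ℂ} {k : ℕ} (Φ : Fin k → RR E) {x : ℂ} (hx : x ∉ E) :
    ∃ K : ℕ, ∀ f ∈ Submodule.span ℂ (Set.range Φ), ∀ g : RR E,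
      f = RR.P (Polynomial.X - Polynomial.C x) ^ K * g → f = 0 := by
  choose p m hp using fun i => (Φ i).exists_poly
  set N := ∑ i, m i with hN
  have hmN : ∀ i, m i ≤ N := fun i => Finset.single_le_sum (f := m) (fun _ _ => Nat.zero_le _) (Finset.mem_univ i)
  set p' : Fin k → Polynomial ℂ := fun i => QE E ^ (N - m i) * p i with hp'
  have hpp : ∀ i, RR.P (QE E) ^ N * Φ i = RR.P (p' i) := by
    intro i
    rw [hp', map_mul, map_pow, ← hp, ← mul_assoc, ← pow_add, Nat.sub_add_cancel (hmN i)]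
  set d := ∑ i, (p' i).natDegree with hd
  refine ⟨d + 1, fun f hf g hfg => ?_⟩
  obtain ⟨c, rfl⟩ := (Submodule.mem_span_range_iff_exists_fun ℂ).1 hf
  set F : Polynomial ℂ := ∑ i, c i • p' i with hF
  have h1 : RR.P (QE E) ^ N * (∑ i, c i • Φ i) = RR.P F := by
    rw [hF, map_sum, Finset.mul_sum]
    refine Finset.sum_congr rfl fun i _ => ?_
    rw [mul_smul_comm, hpp, map_smul]
  have hdeg : F.natDegree ≤ d := by
    refine Polynomial.natDegree_sum_le_of_forall_le _ _ fun i _ => ?_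
    exact (Polynomial.natDegree_smul_le _ _).trans
      (Finset.single_le_sum (f := fun i => (p' i).natDegree) (fun _ _ => Nat.zero_le _) (Finset.mem_univ i))
  obtain ⟨g', l, hg⟩ := g.exists_poly
  have h2 : QE E ^ l * F = (Polynomial.X - Polynomial.C x) ^ (d + 1) * (QE E ^ N * g') := by
    apply RR.P_inj
    rw [map_mul, map_pow, ← h1, hfg, map_mul, map_pow, map_mul, map_pow, ← hg]
    ring
  have hcop : IsCoprime ((Polynomial.X - Polynomial.C x) ^ (d + 1)) (QE E ^ l) := by
    apply IsCoprime.pow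
    rw [(Polynomial.irreducible_X_sub_C x).coprime_iff_not_dvd, Polynomial.dvd_iff_isRoot]
    exact QE_eval_ne hx
  have h3 : (Polynomial.X - Polynomial.C x) ^ (d + 1) ∣ F :=
    hcop.dvd_of_dvd_mul_left (Dvd.intro _ h2.symm)
  have hF0 : F = 0 := by
    by_contra hne
    have := Polynomial.natDegree_le_of_dvd h3 hne
    rw [Polynomial.natDegree_pow, Polynomial.natDegree_X_sub_C] at this
    omega
  rw [hF0, map_zero] at h1
  refine (mul_eq_zero.1 h1).resolve_left (pow_ne_zero _ (RR.P_ne (QE_ne E)))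

lemma poly_not_fd : ¬ FiniteDimensional ℂ (Polynomial ℂ) := Polynomial.not_finite

namespace PathData
variable {E : Finset ℂ} {W : Set ℂ} {ι : Type} [Fintype ι] (S : PathData E W ι)

/-- a functional kills all bounded combinations -/
def Kills (lam : ι → ℂ) : Prop := ∀ x, BdF W (S.β x) → ∑ α, x α * lam α = 0

lemma Kills.smul {lam : ι → ℂ} (h : S.Kills lam) (c : ℂ) : S.Kills (fun α => c * lam α) := by
  intro x hx
  have := h x hx
  calc _ = c * ∑ α, x α * lam α := by
        rw [Finset.mul_sum]; exact Finset.sum_congr rfl fun α _ => by ring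
    _ = 0 := by rw [this, mul_zero]

lemma iso_poly (a b : RR E) (A B C : RR E) : ∃ u : Polynomial ℂ, u ≠ 0 ∧
    ∀ α, S.Γ α (A * RR.P u) = 0 ∧ S.Γ α (B * RR.P u) = 0 ∧ S.Γ α (C * RR.P u ^ 2) = 0 := by
  let T : ι → RR E → Polynomial ℂ →ₗ[ℂ] ℂ := fun α A => S.Γ α ∘ₗ LinearMap.mulLeft ℂ A ∘ₗ RR.P.toLinearMap
  obtain ⟨u, hu, h1, h2⟩ := lemI (κ := ι) (κ' := ι ⊕ ι) poly_not_fd (fun s => match s with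
    | Sum.inl α => T α A
    | Sum.inr α => T α B) (fun α => (LinearMap.mul ℂ (Polynomial ℂ)).compr₂ (T α C)) (by
      intro α u v
      simp [mul_comm u v])
  refine ⟨u, hu, fun α => ⟨h1 (Sum.inl α), h1 (Sum.inr α), ?_⟩⟩
  have := h2 α
  simpa [T, sq] using this

lemma seq_choice (hW : Dom E W) (φ ψ q Z0 p : RR E) (hq : q ≠ 0) {x : ℂ} (hx : x ∉ E)
    (hp : Z0 * p * φ ∉ Submodule.span ℂ (Set.range ![φ, ψ]))
    (lam : ι → ℂ) (hlam : S.Kills lam) {L : Set ℂ} (hL : IsCompact L) (hLW : L ⊆ W)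
    {ε : ℝ} (hε : 0 < ε) (K : ℕ) (hK : ∀ f ∈ Submodule.span ℂ (Set.range ![φ, ψ, Z0 * p * φ]), ∀ g : RR E,
      f = RR.P (Polynomial.X - Polynomial.C x) ^ K * g → f = 0) (M : ℕ) :
    ∃ ω : Fin M → RR E, (∀ k, ∀ z ∈ L, ‖ω k z‖ < ε) ∧ (∀ k α,
      S.Γ α (q * RR.P (Polynomial.X - Polynomial.C x) ^ K * ω k * φ) = 0 ∧
      S.Γ α (q * RR.P (Polynomial.X - Polynomial.C x) ^ K * ω k * ψ) = 0 ∧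
      S.Γ α (Z0 * p * (q * RR.P (Polynomial.X - Polynomial.C x) ^ K * ω k) * φ) = lam α) ∧
      ∀ k l, k ≠ l → ∀ α, S.Γ α (Z0 * (q * RR.P (Polynomial.X - Polynomial.C x) ^ K * ω k) *
        (q * RR.P (Polynomial.X - Polynomial.C x) ^ K * ω l) * φ) = 0 := by
  set y : RR E := RR.P (Polynomial.X - Polynomial.C x) with hy
  have hy0 : y ≠ 0 := RR.P_ne (Polynomial.X_sub_C_ne_zero x)
  induction M with
  | zero => exact ⟨Fin.elim0, fun k => k.elim0, fun k => k.elim0, fun k => k.elim0⟩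
  | succ M ih =>
    obtain ⟨ω, h1, h2, h3⟩ := ih
    set Φ : Fin (M + 2) → RR E := Fin.cons φ (Fin.cons ψ fun l => Z0 * (q * y ^ K * ω l) * φ) with hΦ
    have hnot : Z0 * p * φ ∉ Submodule.span ℂ (Set.range Φ) := by
      intro hmem
      obtain ⟨c, hc⟩ := (Submodule.mem_span_range_iff_exists_fun ℂ).1 hmem
      rw [Fin.sum_univ_succ, Fin.sum_univ_succ] at hc
      simp only [hΦ, Fin.cons_zero, Fin.cons_succ] at hc
      set s := ∑ i : Fin M, c i.succ.succ • (Z0 * (q * y ^ K * ω i) * φ) with hs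
      have hs1 : s = y ^ K * (∑ i : Fin M, c i.succ.succ • (Z0 * (q * ω i) * φ)) := by
        rw [hs, Finset.mul_sum]
        refine Finset.sum_congr rfl fun i _ => ?_
        rw [mul_smul_comm]; congr 1; ring
      have m0 : φ ∈ Submodule.span ℂ (Set.range ![φ, ψ]) := Submodule.subset_span ⟨0, rfl⟩
      have m1 : ψ ∈ Submodule.span ℂ (Set.range ![φ, ψ]) := Submodule.subset_span ⟨1, rfl⟩
      have n0 : φ ∈ Submodule.span ℂ (Set.range ![φ, ψ, Z0 * p * φ]) := Submodule.subset_span ⟨0, rfl⟩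
      have n1 : ψ ∈ Submodule.span ℂ (Set.range ![φ, ψ, Z0 * p * φ]) := Submodule.subset_span ⟨1, rfl⟩
      have n2 : Z0 * p * φ ∈ Submodule.span ℂ (Set.range ![φ, ψ, Z0 * p * φ]) := Submodule.subset_span ⟨2, rfl⟩
      have hs2 : s = Z0 * p * φ - c 0 • φ - c (Fin.succ 0) • ψ := by rw [← hc]; abel
      have hs0 : s = 0 := by
        refine hK s ?_ _ hs1
        rw [hs2]
        exact Submodule.sub_mem _ (Submodule.sub_mem _ n2 (Submodule.smul_mem _ _ n0)) (Submodule.smul_mem _ _ n1)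
      apply hp
      rw [← hc, hs0, add_zero]
      exact Submodule.add_mem _ (Submodule.smul_mem _ _ m0) (Submodule.smul_mem _ _ m1)
    obtain ⟨w, w1, w2, w3⟩ := S.slin hW Φ (Z0 * p * φ) (q * y ^ K) (mul_ne_zero hq (pow_ne_zero _ hy0)) hnot lam
      hlam hL hLW hε
    have w30 : ∀ α, S.Γ α (q * y ^ K * φ * w) = 0 := fun α => by simpa [hΦ] using w3 0 α
    have w31 : ∀ α, S.Γ α (q * y ^ K * ψ * w) = 0 := fun α => by simpa [hΦ] using w3 (Fin.succ 0) α
    have w32 : ∀ l α, S.Γ α (q * y ^ K * (Z0 * (q * y ^ K * ω l) * φ) * w) = 0 := fun l α => by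
      simpa [hΦ] using w3 l.succ.succ α
    refine ⟨Fin.snoc ω w, fun k => ?_, fun k => ?_, fun k l hkl α => ?_⟩
    · induction k using Fin.lastCases with
      | last => rw [Fin.snoc_last]; exact w1
      | cast k => rw [Fin.snoc_castSucc]; exact h1 k
    · induction k using Fin.lastCases with
      | last =>
        rw [Fin.snoc_last]
        intro α
        refine ⟨?_, ?_, ?_⟩
        · rw [← w30 α]; congr 1; ring
        · rw [← w31 α]; congr 1; ring
        · rw [← w2 α]; congr 1; ring
      | cast k => rw [Fin.snoc_castSucc]; exact h2 k
    · induction k using Fin.lastCases with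
      | last =>
        induction l using Fin.lastCases with
        | last => exact absurd rfl hkl
        | cast l =>
          rw [Fin.snoc_last, Fin.snoc_castSucc, ← w32 l α]; congr 1; ring
      | cast k =>
        induction l using Fin.lastCases with
        | last => rw [Fin.snoc_last, Fin.snoc_castSucc, ← w32 k α]; congr 1; ring
        | cast l =>
          rw [Fin.snoc_castSucc, Fin.snoc_castSucc]
          exact h3 k l (fun h => hkl (by rw [h])) α

/-- the shear lemma -/
lemma SL (hW : Dom E W) (φ ψ q Z0 : RR E) (hφ : φ ≠ 0) (hq : q ≠ 0) (hZ : Z0 ≠ 0)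
    (lam : ι → ℂ) (hlam : S.Kills lam) {L : Set ℂ} (hL : IsCompact L) (hLW : L ⊆ W)
    {ε : ℝ} (hε : 0 < ε) : ∃ ω : RR E, (∀ z ∈ L, ‖ω z‖ < ε) ∧ ∀ α, S.Γ α (q * ω * φ) = 0 ∧
      S.Γ α (q * ω * ψ) = 0 ∧ S.Γ α (Z0 * (q * ω) ^ 2 * φ) = lam α := by
  obtain ⟨x, hx⟩ := Infinite.exists_notMem_finset E
  set y : RR E := RR.P (Polynomial.X - Polynomial.C x) with hy
  have hy0 : y ≠ 0 := RR.P_ne (Polynomial.X_sub_C_ne_zero x)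
  obtain ⟨K, hK⟩ := ordB ![φ, ψ] hx
  obtain ⟨u, hu, hu2⟩ := S.iso_poly φ ψ (q * y ^ K * φ) (q * y ^ K * ψ) (Z0 * (q * y ^ K) ^ 2 * φ)
  have hPu : (RR.P u : RR E) ≠ 0 := RR.P_ne hu
  set p := q * y ^ K * RR.P u with hp
  have hpφ : Z0 * p * φ ∉ Submodule.span ℂ (Set.range ![φ, ψ]) := by
    intro hmem
    have := hK _ hmem (Z0 * q * RR.P u * φ) (by rw [hp]; ring)
    have hne : Z0 * p * φ ≠ 0 :=
      mul_ne_zero (mul_ne_zero hZ (mul_ne_zero (mul_ne_zero hq (pow_ne_zero _ hy0)) hPu)) hφ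
    exact hne this
  have p1 : ∀ α, S.Γ α (p * φ) = 0 := fun α => by rw [← (hu2 α).1]; congr 1; rw [hp]; ring
  have p2 : ∀ α, S.Γ α (p * ψ) = 0 := fun α => by rw [← (hu2 α).2.1]; congr 1; rw [hp]; ring
  have p3 : ∀ α, S.Γ α (Z0 * p ^ 2 * φ) = 0 := fun α => by rw [← (hu2 α).2.2]; congr 1; rw [hp]; ring
  obtain ⟨K', hK'⟩ := ordB ![φ, ψ, Z0 * p * φ] hx
  obtain ⟨C1, hC1, hb1⟩ := (y ^ K * RR.P u).bound hW.dis hL hLW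
  obtain ⟨C2, hC2, hb2⟩ := (y ^ K').bound hW.dis hL hLW
  set M := Fintype.card ι + 1 with hM
  set δ : ℝ := ε / (2 * (C1 + 1)) with hδ
  have hδ0 : 0 < δ := by positivity
  have hδc : (δ : ℂ) ≠ 0 := by exact_mod_cast hδ0.ne'
  set ε' : ℝ := ε / (2 * M * (C2 + 1)) with hε'
  have hMpos : (0 : ℝ) < M := by rw [hM]; positivity
  have hε0 : 0 < ε' := by positivity
  obtain ⟨ω, w1, w2, w3⟩ := S.seq_choice hW φ ψ q Z0 p hq hx hpφ (fun α => (1 / (2 * δ : ℂ)) * lam α)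
    (Kills.smul S hlam _) hL hLW hε0 K' hK' M
  rw [← hy] at w2 w3
  set σ : Fin M → RR E := fun k => q * y ^ K' * ω k with hσ
  obtain ⟨xx, x1, x2, x3⟩ := lemX (Nat.lt_succ_self (Fintype.card ι))
    (fun (k : Fin M) α => S.Γ α (Z0 * σ k * σ k * φ))
  have hqω : q * ((δ : ℂ) • (y ^ K * RR.P u) + ∑ k, xx k • (y ^ K' * ω k)) =
      (δ : ℂ) • p + ∑ k, xx k • σ k := by
    rw [mul_add, Finset.mul_sum, mul_smul_comm, hp, hσ]
    congr 1
    · congr 1; ring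
    · refine Finset.sum_congr rfl fun k _ => ?_
      rw [mul_smul_comm]; congr 1; ring
  refine ⟨(δ : ℂ) • (y ^ K * RR.P u) + ∑ k, xx k • (y ^ K' * ω k), fun z hz => ?_, fun α => ?_⟩
  · rw [RR.ev_add, RR.ev_smul, RR.ev_sum]
    have e1 : ‖(δ : ℂ) * (y ^ K * RR.P u : RR E) z‖ < ε / 2 := by
      rw [norm_mul, Complex.norm_real, Real.norm_of_nonneg hδ0.le]
      calc δ * _ ≤ δ * C1 := by gcongr; exact hb1 z hz
        _ < δ * (C1 + 1) := by gcongr; linarith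
        _ = ε / 2 := by rw [hδ]; field_simp
    have e2 : ‖∑ k, (xx k • (y ^ K' * ω k)) z‖ ≤ ε / 2 := by
      calc _ ≤ ∑ k : Fin M, ‖(xx k • (y ^ K' * ω k)) z‖ := norm_sum_le _ _
        _ ≤ ∑ k : Fin M, (C2 + 1) * ε' := by
          refine Finset.sum_le_sum fun k _ => ?_
          rw [RR.ev_smul, RR.ev_mul, norm_mul, norm_mul]
          calc _ ≤ 1 * ((C2 + 1) * ε') := by
                gcongr
                · exact x2 k
                · exact (hb2 z hz).trans (by linarith)
                · exact (w1 k z hz).le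
            _ = _ := one_mul _
        _ = ε / 2 := by
          rw [Finset.sum_const, Finset.card_univ, Fintype.card_fin, nsmul_eq_mul, hε']; field_simp
    calc _ ≤ _ := norm_add_le _ _
      _ < ε / 2 + ε / 2 := add_lt_add_of_lt_of_le e1 e2
      _ = ε := by ring
  · rw [hqω]
    have key : ∀ c : RR E, S.Γ α (((δ : ℂ) • p + ∑ k, xx k • σ k) * c) =
        δ * S.Γ α (p * c) + ∑ k, xx k * S.Γ α (σ k * c) := by
      intro c
      rw [add_mul, Finset.sum_mul, map_add, map_sum, smul_mul_assoc, map_smul, smul_eq_mul]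
      congr 1
      refine Finset.sum_congr rfl fun k _ => ?_
      rw [smul_mul_assoc, map_smul, smul_eq_mul]
    refine ⟨?_, ?_, ?_⟩
    · rw [key, p1, mul_zero, zero_add]
      exact Finset.sum_eq_zero fun k _ => by rw [(w2 k α).1, mul_zero]
    · rw [key, p2, mul_zero, zero_add]
      exact Finset.sum_eq_zero fun k _ => by rw [(w2 k α).2.1, mul_zero]
    · have r1 : Z0 * ((δ : ℂ) • p + ∑ k, xx k • σ k) ^ 2 * φ = ((δ : ℂ) • p + ∑ k, xx k • σ k) *
          (((δ : ℂ) • p + ∑ k, xx k • σ k) * (Z0 * φ)) := by ring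
      rw [r1, key]
      have r2 : ∀ c, c * (((δ : ℂ) • p + ∑ k, xx k • σ k) * (Z0 * φ)) =
          ((δ : ℂ) • p + ∑ k, xx k • σ k) * (c * (Z0 * φ)) := fun c => by ring
      have r3 : S.Γ α (p * (((δ : ℂ) • p + ∑ k, xx k • σ k) * (Z0 * φ))) = 1 / (2 * δ) * lam α := by
        rw [r2, key]
        have : p * (p * (Z0 * φ)) = Z0 * p ^ 2 * φ := by ring
        rw [this, p3, mul_zero, zero_add]
        have : ∀ k, S.Γ α (σ k * (p * (Z0 * φ))) = 1 / (2 * δ) * lam α := fun k => by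
          rw [← (w2 k α).2.2]; congr 1; rw [hσ]; ring
        simp only [this]
        rw [← Finset.sum_mul, x1, one_mul]
      have r4 : ∀ k, S.Γ α (σ k * (((δ : ℂ) • p + ∑ k, xx k • σ k) * (Z0 * φ))) =
          1 / 2 * lam α + xx k * S.Γ α (Z0 * σ k * σ k * φ) := by
        intro k
        rw [r2, key, Finset.sum_eq_single k]
        · have : S.Γ α (p * (σ k * (Z0 * φ))) = 1 / (2 * δ) * lam α := by
            rw [← (w2 k α).2.2]; congr 1; rw [hσ]; ring
          rw [this]
          congr 1
          · field_simp
          · congr 2; ring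
        · intro l _ hl
          have := w3 l k hl α
          rw [show σ l * (σ k * (Z0 * φ)) = Z0 * σ l * σ k * φ by ring]
          rw [hσ]; simp only; rw [this, mul_zero]
        · simp
      rw [r3]
      simp only [r4, mul_add, Finset.sum_add_distrib]
      have r5 : ∑ k, xx k * (xx k * S.Γ α (Z0 * σ k * σ k * φ)) = 0 := by
        rw [← x3 α]; exact Finset.sum_congr rfl fun k _ => by ring
      rw [r5, ← Finset.sum_mul, x1]
      field_simp
      ring

end PathData

lemma hol_div {U : Set ℂ} (hU : IsOpen U) {u : ℂ → ℂ} (hu : DifferentiableOn ℂ u U) {a : ℂ} (ha : a ∈ U) :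
    DifferentiableOn ℂ (dslope u a) U ∧ ∀ z, u z = u a + (z - a) * dslope u a z := by
  refine ⟨(differentiableOn_dslope (hU.mem_nhds ha)).2 hu, fun z => ?_⟩
  have := sub_smul_dslope u a z
  rw [smul_eq_mul] at this
  rw [this]; ring

/-- polynomial remainder -/
lemma HI {U : Set ℂ} (hU : IsOpen U) {f : ℂ → ℂ} (hf : DifferentiableOn ℂ f U) (q : Polynomial ℂ)
    (hq : q ≠ 0) : ∃ (J : Polynomial ℂ) (h : ℂ → ℂ), DifferentiableOn ℂ h U ∧
      ∀ z ∈ U, f z = J.eval z + q.eval z * h z := by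
  suffices H : ∀ (s : Multiset ℂ) (c : ℂ), c ≠ 0 → ∃ (J : Polynomial ℂ) (h : ℂ → ℂ), DifferentiableOn ℂ h U ∧
      ∀ z ∈ U, f z = J.eval z + (Polynomial.C c * (s.map fun a => Polynomial.X - Polynomial.C a).prod).eval z * h z by
    have h1 := (IsAlgClosed.splits q).eq_prod_roots
    rw [h1]
    exact H _ _ (Polynomial.leadingCoeff_ne_zero.2 hq)
  intro s c hc
  induction s using Multiset.induction_on with
  | empty => exact ⟨0, fun z => c⁻¹ * f z, hf.const_mul _, fun z _ => by simp [hc]⟩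
  | cons a s ih =>
    obtain ⟨J, h, hh, hJ⟩ := ih
    set q1 := Polynomial.C c * (s.map fun a => Polynomial.X - Polynomial.C a).prod with hq1
    have hq2 : Polynomial.C c * ((a ::ₘ s).map fun a => Polynomial.X - Polynomial.C a).prod =
        (Polynomial.X - Polynomial.C a) * q1 := by
      rw [Multiset.map_cons, Multiset.prod_cons, hq1]; ring
    rw [hq2]
    by_cases ha : a ∈ U
    · obtain ⟨h1, h2⟩ := hol_div hU hh ha
      refine ⟨J + q1 * Polynomial.C (h a), _, h1, fun z hz => ?_⟩
      rw [hJ z hz, h2 z]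
      simp only [Polynomial.eval_add, Polynomial.eval_mul, Polynomial.eval_sub, Polynomial.eval_X, Polynomial.eval_C]
      ring
    · have hne : ∀ z ∈ U, z - a ≠ 0 := fun z hz h0 => ha (by rwa [← sub_eq_zero.1 h0])
      refine ⟨J, fun z => h z / (z - a), hh.div (by fun_prop) hne, fun z hz => ?_⟩
      have := hne z hz
      rw [hJ z hz]
      simp only [Polynomial.eval_mul, Polynomial.eval_sub, Polynomial.eval_X, Polynomial.eval_C]
      field_simp

/-- division in `RR` -/
lemma RRdiv {E : Finset ℂ} {U : Set ℂ} (hU : IsOpen U) (q : Polynomial ℂ) (hq : q ≠ 0)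
    (hroots : ∀ a, q.eval a = 0 → a ∉ E → a ∈ U) (r : RR E) (h : ℂ → ℂ) (hh : ContinuousOn h U)
    (hr : ∀ z ∈ U, z ∉ E → r z = q.eval z * h z) : ∃ ω : RR E, r = RR.P q * ω := by
  suffices H : ∀ (s : Multiset ℂ) (c : ℂ), c ≠ 0 → (∀ a ∈ s, a ∉ E → a ∈ U) → ∀ r : RR E,
      (∀ z ∈ U, z ∉ E → r z =
        (Polynomial.C c * (s.map fun a => Polynomial.X - Polynomial.C a).prod).eval z * h z) →
      ∃ ω : RR E, r = RR.P (Polynomial.C c * (s.map fun a => Polynomial.X - Polynomial.C a).prod) * ω by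
    have h1 := (IsAlgClosed.splits q).eq_prod_roots
    rw [h1]
    refine H _ _ (Polynomial.leadingCoeff_ne_zero.2 hq) (fun a ha => hroots a (Polynomial.isRoot_of_mem_roots ha)) r ?_
    rw [← h1]; exact hr
  clear hr r hroots hq q
  intro s c hc
  induction s using Multiset.induction_on with
  | empty =>
    intro _ r _
    refine ⟨c⁻¹ • r, ?_⟩
    simp only [Multiset.map_zero, Multiset.prod_zero, mul_one]
    refine RR.ext' fun z hz => ?_
    rw [RR.ev_mul, RR.ev_P _ hz, RR.ev_smul, Polynomial.eval_C, ← mul_assoc, mul_inv_cancel₀ hc, one_mul]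
  | cons a s ih =>
    intro hs r hr
    set q1 := Polynomial.C c * (s.map fun a => Polynomial.X - Polynomial.C a).prod with hq1
    have hq2 : Polynomial.C c * ((a ::ₘ s).map fun a => Polynomial.X - Polynomial.C a).prod =
        (Polynomial.X - Polynomial.C a) * q1 := by
      rw [Multiset.map_cons, Multiset.prod_cons, hq1]; ring
    rw [hq2] at hr ⊢
    obtain ⟨r1, hr1⟩ : ∃ r1 : RR E, r = RR.P (Polynomial.X - Polynomial.C a) * r1 := by
      by_cases ha : a ∈ E
      · refine ⟨RR.invS ha * r, ?_⟩
        rw [← mul_assoc, mul_comm (RR.P _), RR.invS_mul, one_mul]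
      · refine RR.div ha ?_
        rw [hr a (hs a (Multiset.mem_cons_self _ _) ha) ha]
        simp
    obtain ⟨ω, hω⟩ := ih (fun b hb => hs b (Multiset.mem_cons_of_mem hb)) r1 (by
      have hne : ∀ z ∈ U, z ∉ E → z ≠ a → r1 z = q1.eval z * h z := by
        intro z hz hzE hza
        have h1 := hr z hz hzE
        rw [hr1, RR.ev_mul, RR.ev_P _ hzE, Polynomial.eval_mul, mul_assoc] at h1
        refine mul_left_cancel₀ ?_ h1
        simpa [sub_eq_zero] using hza
      intro z hz hzE
      by_cases hza : z = a
      · subst hza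
        have c1 : ContinuousAt r1 z := (r1.differentiableAt hzE).continuousAt
        have c2 : ContinuousAt (fun z => q1.eval z * h z) z :=
          (q1.continuous.continuousAt).mul (hh.continuousAt (hU.mem_nhds hz))
        have e1 : (r1 : ℂ → ℂ) =ᶠ[𝓝[≠] z] fun z => q1.eval z * h z := by
          filter_upwards [self_mem_nhdsWithin, nhdsWithin_le_nhds (hU.mem_nhds hz),
            nhdsWithin_le_nhds (E_ev hzE)] with w h1 h2 h3
          exact hne w h2 h3 h1
        exact tendsto_nhds_unique ((c1.tendsto.mono_left nhdsWithin_le_nhds).congr' e1)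
          (c2.tendsto.mono_left nhdsWithin_le_nhds)
      · exact hne z hz hzE hza)
    exact ⟨ω, by rw [hr1, hω, ← mul_assoc, ← map_mul]⟩

lemma ZF1 {U : Set ℂ} (hU : IsOpen U) {a : ℂ} (ha : a ∈ U) (m : ℕ) : ∀ u : ℂ → ℂ,
    DifferentiableOn ℂ u U → analyticOrderAt u a = m →
    ∃ v : ℂ → ℂ, DifferentiableOn ℂ v U ∧ v a ≠ 0 ∧ ∀ z, u z = (z - a) ^ m * v z := by
  induction m with
  | zero =>
    intro u hu h
    refine ⟨u, hu, ?_, fun z => by simp⟩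
    exact ((hu.analyticAt (hU.mem_nhds ha)).analyticOrderAt_eq_zero).1 (by simpa using h)
  | succ m ih =>
    intro u hu h
    have hua := hu.analyticAt (hU.mem_nhds ha)
    have h0 : u a = 0 := by
      by_contra hne
      rw [hua.analyticOrderAt_eq_zero.2 hne] at h
      exact absurd h.symm (by exact_mod_cast Nat.succ_ne_zero m)
    obtain ⟨h1, h2⟩ := hol_div hU hu ha
    have hda := h1.analyticAt (hU.mem_nhds ha)
    have hs : analyticOrderAt (fun z : ℂ => z - a) a = 1 := by
      have hsa : AnalyticAt ℂ (fun z : ℂ => z - a) a := by fun_prop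
      rw [show (1 : ℕ∞) = ((1 : ℕ) : ℕ∞) from rfl, hsa.analyticOrderAt_eq_natCast]
      exact ⟨fun _ => 1, analyticAt_const, one_ne_zero, by simp⟩
    have hm : analyticOrderAt u a = 1 + analyticOrderAt (dslope u a) a := by
      have : u = (fun z : ℂ => z - a) * dslope u a := by
        funext z; rw [Pi.mul_apply]
        have := h2 z
        rw [h0, zero_add] at this
        exact this
      conv_lhs => rw [this]
      rw [analyticOrderAt_mul (by fun_prop) hda, hs]
    obtain ⟨v, hv, hva, hvz⟩ := ih _ h1 (by
      rw [h] at hm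
      cases hx : analyticOrderAt (dslope u a) a with
      | top => rw [hx] at hm; simp at hm;
      | coe k =>
        rw [hx] at hm
        have : m + 1 = 1 + k := by exact_mod_cast hm
        have : k = m := by omega
        rw [this])
    refine ⟨v, hv, hva, fun z => ?_⟩
    rw [h2 z, h0, hvz z]; ring

lemma zeros_finite {U L : Set ℂ} (hU : IsOpen U) (hL : IsCompact L) (hLU : L ⊆ U) {u : ℂ → ℂ}
    (hu : DifferentiableOn ℂ u U) (hnz : ∀ z ∈ L, ¬ ∀ᶠ w in 𝓝 z, u w = 0) :
    ∃ t : Finset ℂ, (∀ z ∈ t, z ∈ L) ∧ ∀ z ∈ L, u z = 0 → z ∈ t := by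
  classical
  have h1 : ∀ z ∈ L, {w | w ≠ z → u w ≠ 0} ∈ 𝓝 z := by
    intro z hz
    rcases (hu.analyticAt (hU.mem_nhds (hLU hz))).eventually_eq_zero_or_eventually_ne_zero with h | h
    · exact absurd h (hnz z hz)
    · exact eventually_nhdsWithin_iff.1 h
  obtain ⟨t, ht, hc⟩ := hL.elim_nhds_subcover _ h1
  refine ⟨t, ht, fun z hz h0 => ?_⟩
  obtain ⟨y, hy, hz2⟩ := Set.mem_iUnion₂.1 (hc hz)
  by_contra hzt
  exact hz2 (fun h => hzt (h ▸ hy)) h0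

/-- extraction of zeros -/
lemma ZF {U L : Set ℂ} (hU : IsOpen U) (hL : IsCompact L) (hLU : L ⊆ U) {u : ℂ → ℂ}
    (hu : DifferentiableOn ℂ u U) (hnz : ∀ z ∈ L, ¬ ∀ᶠ w in 𝓝 z, u w = 0) :
    ∃ (U0 : Polynomial ℂ) (v : ℂ → ℂ), U0 ≠ 0 ∧ (∀ a, U0.eval a = 0 → a ∈ L) ∧ DifferentiableOn ℂ v U ∧
      (∀ z ∈ L, v z ≠ 0) ∧ ∀ z, u z = U0.eval z * v z := by
  classical
  obtain ⟨t, ht, htz⟩ := zeros_finite hU hL hLU hu hnz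
  have H : ∀ s : Finset ℂ, s ⊆ t → ∃ (U0 : Polynomial ℂ) (v : ℂ → ℂ), U0 ≠ 0 ∧ (∀ a, U0.eval a = 0 → a ∈ L) ∧
      DifferentiableOn ℂ v U ∧ (∀ z ∈ s, v z ≠ 0) ∧ ∀ z, u z = U0.eval z * v z := by
    intro s
    induction s using Finset.induction_on with
    | empty => exact fun _ => ⟨1, u, one_ne_zero, by simp, hu, by simp, by simp⟩
    | insert a s ha ih =>
      intro hst
      obtain ⟨U0, v, h1, h2, h3, h4, h5⟩ := ih fun x hx => hst (Finset.mem_insert_of_mem hx)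
      have haL : a ∈ L := ht a (hst (Finset.mem_insert_self _ _))
      have hne : analyticOrderAt v a ≠ ⊤ := by
        intro htop
        rw [analyticOrderAt_eq_top] at htop
        refine hnz a haL ?_
        filter_upwards [htop] with w hw
        rw [h5, hw, mul_zero]
      obtain ⟨m, hm⟩ := ENat.ne_top_iff_exists.1 hne
      obtain ⟨v', k1, k2, k3⟩ := ZF1 hU (hLU haL) m v h3 hm.symm
      refine ⟨U0 * (Polynomial.X - Polynomial.C a) ^ m, v', mul_ne_zero h1 (pow_ne_zero _ (Polynomial.X_sub_C_ne_zero a)),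
        fun b hb => ?_, k1, fun z hz => ?_, fun z => ?_⟩
      · rw [Polynomial.eval_mul, mul_eq_zero] at hb
        rcases hb with hb | hb
        · exact h2 b hb
        · rw [Polynomial.eval_pow] at hb
          have := eq_zero_of_pow_eq_zero hb
          simp [sub_eq_zero] at this
          rwa [this]
      · rcases Finset.mem_insert.1 hz with rfl | hz
        · exact k2
        · intro h0
          exact h4 z hz (by rw [k3, h0, mul_zero])
      · rw [h5, k3]; simp; ring
  obtain ⟨U0, v, h1, h2, h3, h4, h5⟩ := H t subset_rfl
  refine ⟨U0, v, h1, h2, h3, fun z hz h0 => ?_, h5⟩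
  exact h4 z (htz z hz (by rw [h5, h0, mul_zero])) h0

/-- `g` is a polynomial with roots in `E` times a square, near `L` -/
def SqG (E : Finset ℂ) (L : Set ℂ) (g : ℂ → ℂ) : Prop :=
  ∃ (U : Set ℂ) (R : Polynomial ℂ) (κ : ℂ → ℂ), IsOpen U ∧ L ⊆ U ∧ (∀ a, R.eval a = 0 → a ∈ E) ∧
    DifferentiableOn ℂ κ U ∧ (∀ z ∈ U, κ z ≠ 0) ∧ ∀ z ∈ U, g z = R.eval z * κ z ^ 2

namespace SqG
variable {E : Finset ℂ} {L : Set ℂ} {f g : ℂ → ℂ}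

lemma mul (hf : SqG E L f) (hg : SqG E L g) : SqG E L (fun z => f z * g z) := by
  obtain ⟨U, R, κ, h1, h2, h3, h4, h5, h6⟩ := hf
  obtain ⟨U', R', κ', h1', h2', h3', h4', h5', h6'⟩ := hg
  refine ⟨U ∩ U', R * R', fun z => κ z * κ' z, h1.inter h1', Set.subset_inter h2 h2', fun a ha => ?_,
    (h4.mono Set.inter_subset_left).mul (h4'.mono Set.inter_subset_right),
    fun z hz => mul_ne_zero (h5 z hz.1) (h5' z hz.2), fun z hz => ?_⟩
  · rw [Polynomial.eval_mul, mul_eq_zero] at ha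
    exact ha.elim (h3 a) (h3' a)
  · simp only [h6 z hz.1, h6' z hz.2, Polynomial.eval_mul]; ring

lemma const {c : ℂ} (hc : c ≠ 0) : SqG E L (fun _ => c) :=
  ⟨Set.univ, Polynomial.C c, fun _ => 1, isOpen_univ, Set.subset_univ _, fun a ha => absurd (by simpa using ha) hc,
    differentiableOn_const _, fun _ _ => one_ne_zero, fun z _ => by simp⟩

lemma inv (hL : ∀ e ∈ E, e ∉ L) (hf : SqG E L f) : SqG E L (fun z => (f z)⁻¹) := by
  obtain ⟨U, R, κ, h1, h2, h3, h4, h5, h6⟩ := hf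
  have hR : ∀ z ∈ U \ (E : Set ℂ), R.eval z ≠ 0 := fun z hz h0 => hz.2 (h3 z h0)
  have hd : DifferentiableOn ℂ (fun z => R.eval z * κ z) (U \ (E : Set ℂ)) :=
    (R.differentiable.differentiableOn).mul (h4.mono Set.diff_subset)
  have hne : ∀ z ∈ U \ (E : Set ℂ), R.eval z * κ z ≠ 0 := fun z hz => mul_ne_zero (hR z hz) (h5 z hz.1)
  refine ⟨U \ (E : Set ℂ), R, fun z => (R.eval z * κ z)⁻¹, h1.sdiff E.finite_toSet.isClosed,
    fun z hz => ⟨h2 hz, fun h => hL z h hz⟩, h3, hd.inv hne, fun z hz => inv_ne_zero (hne z hz), fun z hz => ?_⟩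
  have e1 := hR z hz
  have e2 := h5 z hz.1
  simp only [h6 z hz.1]
  field_simp

lemma congr (hf : SqG E L f) {U : Set ℂ} (hU : IsOpen U) (hLU : L ⊆ U) (h : ∀ z ∈ U, g z = f z) : SqG E L g := by
  obtain ⟨U', R, κ, h1, h2, h3, h4, h5, h6⟩ := hf
  exact ⟨U ∩ U', R, κ, hU.inter h1, Set.subset_inter hLU h2, h3, h4.mono Set.inter_subset_right,
    fun z hz => h5 z hz.2, fun z hz => by rw [h z hz.1, h6 z hz.2]⟩

/-- functions near one are squares -/
lemma near_one {U : Set ℂ} (hU : IsOpen U) (hLU : L ⊆ U) (hf : DifferentiableOn ℂ f U)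
    (h1 : ∀ z ∈ L, ‖f z - 1‖ < 1) : SqG E L f := by
  set V := U ∩ {z | ‖f z - 1‖ < 1} with hV
  have hVo : IsOpen V := by
    have : ContinuousOn (fun z => ‖f z - 1‖) U := (hf.continuousOn.sub continuousOn_const).norm
    exact this.isOpen_inter_preimage hU isOpen_Iio
  have hsl : ∀ z ∈ V, f z ∈ Complex.slitPlane := fun z hz => by
    have h2 : ‖f z - 1‖ < 1 := hz.2
    have h3 := Complex.abs_re_le_norm (f z - 1)
    rw [Complex.sub_re, Complex.one_re] at h3
    have := (abs_lt.1 (h3.trans_lt h2)).1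
    exact Or.inl (by linarith)
  refine ⟨V, 1, fun z => Complex.exp (Complex.log (f z) / 2), hVo, fun z hz => ⟨hLU hz, h1 z hz⟩,
    fun a ha => absurd ha (by simp), ?_, fun z _ => Complex.exp_ne_zero _, fun z hz => ?_⟩
  · refine DifferentiableOn.cexp ?_
    exact ((hf.mono Set.inter_subset_left).clog hsl).div_const _
  · rw [← Complex.exp_nat_mul]
    have h0 : f z ≠ 0 := Complex.slitPlane_ne_zero (hsl z hz)
    rw [show ((2 : ℕ) : ℂ) * (Complex.log (f z) / 2) = Complex.log (f z) by push_cast; ring, Complex.exp_log h0]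
    simp

lemma near {U : Set ℂ} (hU : IsOpen U) (hLU : L ⊆ U) (hf : DifferentiableOn ℂ f U) (hg : DifferentiableOn ℂ g U)
    (hg0 : ∀ z ∈ U, g z ≠ 0) (h1 : ∀ z ∈ L, ‖f z - g z‖ < ‖g z‖) (h : SqG E L g) : SqG E L f := by
  have := near_one (E := E) hU hLU (hf.div hg hg0) (fun z hz => by
    have h0 := hg0 z (hLU hz)
    have h2 := h1 z hz
    rw [Pi.div_apply, show f z / g z - 1 = (f z - g z) / g z by field_simp, norm_div, div_lt_one (norm_pos_iff.2 h0)]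
    exact h2)
  refine (this.mul h).congr hU hLU fun z hz => ?_
  have := hg0 z hz
  simp only [Pi.div_apply]; field_simp

lemma lin (hL : RC E L) : ∀ a ∉ L, SqG E L (fun z => z - a) := by
  obtain ⟨M, hM⟩ := hL.1.isBounded.exists_norm_le
  refine PP hL _ ?_ ?_ ?_
  · intro ζ0 h0
    have hop : IsOpen Lᶜ := hL.1.isClosed.isOpen_compl
    obtain ⟨ρ, hρ, hb⟩ := Metric.isOpen_iff.1 hop ζ0 h0
    have hd : ∀ z ∈ L, ρ ≤ ‖z - ζ0‖ := fun z hz => by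
      by_contra hlt
      push Not at hlt
      exact hb (by rwa [Metric.mem_ball, dist_eq_norm]) hz
    filter_upwards [Metric.ball_mem_nhds ζ0 (half_pos hρ)] with ζ hζ
    rw [Metric.mem_ball, dist_eq_norm] at hζ
    have hU : IsOpen ({ζ, ζ0}ᶜ : Set ℂ) := (Set.toFinite _).isClosed.isOpen_compl
    have hζL : ζ ∉ L := hb (by rw [Metric.mem_ball, dist_eq_norm]; linarith)
    have hLU : L ⊆ ({ζ, ζ0}ᶜ : Set ℂ) := fun z hz h => by
      rcases h with rfl | h
      · exact hζL hz
      · rw [Set.mem_singleton_iff] at h; exact h0 (h ▸ hz)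
    have d1 : ∀ a : ℂ, DifferentiableOn ℂ (fun z : ℂ => z - a) ({ζ, ζ0}ᶜ : Set ℂ) := fun a => by fun_prop
    constructor
    · refine near hU hLU (d1 _) (d1 _) (fun z hz h => hz (Or.inl (sub_eq_zero.1 h))) (fun z hz => ?_)
      have := hd z hz
      rw [show z - ζ0 - (z - ζ) = ζ - ζ0 by ring]
      have h2 := norm_sub_norm_le (z - ζ0) (ζ - ζ0)
      rw [show z - ζ0 - (ζ - ζ0) = z - ζ by ring] at h2
      linarith
    · refine near hU hLU (d1 _) (d1 _) (fun z hz h => hz (Or.inr (sub_eq_zero.1 h))) (fun z hz => ?_)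
      have := hd z hz
      rw [show z - ζ - (z - ζ0) = ζ0 - ζ by ring, norm_sub_rev]
      linarith
  · intro e he
    exact ⟨Set.univ, Polynomial.X - Polynomial.C e, fun _ => 1, isOpen_univ, Set.subset_univ _,
      fun a ha => by simp [sub_eq_zero] at ha; rwa [ha], differentiableOn_const _, fun _ _ => one_ne_zero,
      fun z _ => by simp⟩
  · refine ⟨max M 0 + 1, fun ζ hζ _ => ?_⟩
    have h0 : (-ζ) ≠ 0 := neg_ne_zero.2 (norm_pos_iff.1 (by have := le_max_right M 0; linarith))
    refine near isOpen_univ (Set.subset_univ _) (by fun_prop) (g := fun _ => -ζ) (by fun_prop) (fun _ _ => h0)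
      (fun z hz => ?_) (const h0)
    rw [show z - ζ - -ζ = z by ring, norm_neg]
    have := hM z hz
    have := le_max_left M 0
    linarith

lemma poly (hL : RC E L) {p : Polynomial ℂ} (hp0 : p ≠ 0) (hp : ∀ a, p.eval a = 0 → a ∉ L) :
    SqG E L (fun z => p.eval z) := by
  have H : ∀ (s : Multiset ℂ) (c : ℂ), c ≠ 0 → (∀ a ∈ s, a ∉ L) → SqG E L (fun z =>
      (Polynomial.C c * (s.map fun a => Polynomial.X - Polynomial.C a).prod).eval z) := by
    intro s c hc
    induction s using Multiset.induction_on with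
    | empty => intro _; simpa using const hc
    | cons a s ih =>
      intro h
      have h1 := (lin hL a (h a (Multiset.mem_cons_self _ _))).mul (ih fun b hb => h b (Multiset.mem_cons_of_mem hb))
      refine h1.congr isOpen_univ (Set.subset_univ _) fun z _ => ?_
      simp only [Multiset.map_cons, Multiset.prod_cons, Polynomial.eval_mul, Polynomial.eval_sub, Polynomial.eval_X, Polynomial.eval_C]
      ring
  have h1 := (IsAlgClosed.splits p).eq_prod_roots
  rw [h1]
  exact H _ _ (Polynomial.leadingCoeff_ne_zero.2 hp0) fun a ha => hp a (Polynomial.isRoot_of_mem_roots ha)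

end SqG

/-- square roots near Runge compacts -/
lemma sqrtL {E : Finset ℂ} {L U : Set ℂ} (hL : RC E L) (hU : IsOpen U) (hLU : L ⊆ U) {f : ℂ → ℂ}
    (hf : DifferentiableOn ℂ f U) (hf0 : ∀ z ∈ L, f z ≠ 0) : SqG E L f := by
  rcases L.eq_empty_or_nonempty with rfl | hne
  · exact ⟨∅, 1, fun _ => 1, isOpen_empty, subset_rfl, fun a ha => absurd ha (by simp), differentiableOn_const _,
      by simp, by simp⟩
  obtain ⟨z0, hz0, hmin⟩ := hL.1.exists_isMinOn hne (hf.continuousOn.mono hLU).norm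
  have hpos : 0 < ‖f z0‖ := norm_pos_iff.2 (hf0 z0 hz0)
  obtain ⟨F, hF⟩ := RR.W1 hL hU hLU hf (half_pos hpos)
  have hFE : ∀ z ∈ L, z ∉ E := fun z hz h => hL.2.1 z h hz
  obtain ⟨p, k, hp⟩ := F.exists_poly
  have hpe : ∀ z ∉ E, (QE E).eval z ^ k * F z = p.eval z := fun z hz => by
    rw [← RR.ev_P p hz, ← hp, RR.ev_mul, RR.ev_pow _ _ hz, RR.ev_P _ hz]
  have hFb : ∀ z ∈ L, ‖f z - F z‖ < ‖F z‖ := fun z hz => by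
    have h1 := hF z hz
    have h2 : ‖f z0‖ ≤ ‖f z‖ := hmin hz
    have h3 := norm_sub_norm_le (f z) (f z - F z)
    rw [sub_sub_cancel] at h3
    rw [norm_sub_rev] at h1
    linarith
  have hF0 : ∀ z ∈ L, F z ≠ 0 := fun z hz h => by
    have := hFb z hz
    rw [h, norm_zero] at this
    exact absurd this (not_lt.2 (norm_nonneg _))
  have hsF : SqG E L F := by
    have hpL : ∀ a, p.eval a = 0 → a ∉ L := fun a ha haL => by
      have := hpe a (hFE a haL)
      rw [ha] at this
      exact mul_ne_zero (pow_ne_zero _ (QE_eval_ne (hFE a haL))) (hF0 a haL) this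
    have hp0 : p ≠ 0 := fun h => hpL z0 (by rw [h]; simp) hz0
    have hq := (SqG.poly hL (pow_ne_zero k (QE_ne E)) (fun a ha haL => by
      rw [Polynomial.eval_pow] at ha
      exact QE_eval_ne (hFE a haL) (eq_zero_of_pow_eq_zero ha))).inv hL.2.1
    refine ((SqG.poly hL hp0 hpL).mul hq).congr (U := (E : Set ℂ)ᶜ) E.finite_toSet.isClosed.isOpen_compl
      (fun z hz => hFE z hz) fun z hz => ?_
    have h1 := hpe z hz
    have h2 : (QE E).eval z ≠ 0 := QE_eval_ne hz
    rw [← h1, Polynomial.eval_pow]; field_simp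
  set V := (U \ (E : Set ℂ)) ∩ {z | F z ≠ 0} with hV
  have hVo : IsOpen V := by
    refine ContinuousOn.isOpen_inter_preimage (F.continuousOn ?_) (hU.sdiff E.finite_toSet.isClosed) isOpen_ne
    exact fun e he h => h.2 he
  refine SqG.near hVo (fun z hz => ⟨⟨hLU hz, hFE z hz⟩, hF0 z hz⟩) (hf.mono fun z hz => hz.1.1)
    (F.differentiableOn fun e he h => h.1.2 he) (fun z hz => hz.2) hFb hsF

/-- Runge approximation with interpolation off the compact -/
lemma W1i {E : Finset ℂ} {L U : Set ℂ} (hL : RC E L) (hU : IsOpen U) (hLU : L ⊆ U) {f : ℂ → ℂ}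
    (hf : DifferentiableOn ℂ f U) (Z : Finset ℂ) (hZ : ∀ z ∈ Z, z ∉ L ∧ z ∉ E) (c : ℂ → ℂ) {ε : ℝ} (hε : 0 < ε) :
    ∃ g : RR E, (∀ z ∈ L, ‖g z - f z‖ < ε) ∧ ∀ z ∈ Z, g z = c z := by
  classical
  have key : ∀ a ∈ Z, ∀ ε > 0, ∃ η : RR E, (∀ z ∈ L, ‖η z‖ < ε) ∧ η a = 1 ∧ ∀ b ∈ Z, b ≠ a → η b = 0 := by
    intro a ha ε hε
    have haE := (hZ a ha).2
    set p : Polynomial ℂ := Polynomial.C (∏ b ∈ Z.erase a, (a - b))⁻¹ * ∏ b ∈ Z.erase a, (Polynomial.X - Polynomial.C b) with hp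
    have hpa : p.eval a = 1 := by
      rw [hp, Polynomial.eval_mul, Polynomial.eval_C, Polynomial.eval_prod]
      simp only [Polynomial.eval_sub, Polynomial.eval_X, Polynomial.eval_C]
      refine inv_mul_cancel₀ (Finset.prod_ne_zero_iff.2 fun b hb h => ?_)
      exact Finset.ne_of_mem_erase hb (sub_eq_zero.1 h).symm
    have hpb : ∀ b ∈ Z, b ≠ a → p.eval b = 0 := fun b hb hba => by
      have h0 : (Polynomial.X - Polynomial.C b).eval b = 0 := by simp
      rw [hp, Polynomial.eval_mul, Polynomial.eval_prod]
      rw [Finset.prod_eq_zero (f := fun j : ℂ => (Polynomial.X - Polynomial.C j : Polynomial ℂ).eval b)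
        (Finset.mem_erase.2 ⟨hba, hb⟩) h0, mul_zero]
    obtain ⟨C, hC⟩ := (hL.1.image p.continuous).isBounded.exists_norm_le
    have hC' : ∀ z ∈ L, ‖p.eval z‖ ≤ max C 0 + 1 := fun z hz =>
      (hC _ ⟨z, hz, rfl⟩).trans ((le_max_left _ _).trans (by linarith))
    have hpos : 0 < max C 0 + 1 := by have := le_max_right C 0; linarith
    obtain ⟨h, h1, h2, -, h3⟩ := hL.sep (hZ a ha).1 (div_pos hε hpos)
    refine ⟨RR.P p * RR.mk h h1, fun z hz => ?_, ?_, fun b hb hba => ?_⟩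
    · have hzE : z ∉ E := fun h => hL.2.1 z h hz
      rw [RR.ev_mul, RR.ev_P _ hzE, RR.mk_ev _ hzE, norm_mul]
      calc _ ≤ (max C 0 + 1) * ‖h z‖ := by gcongr; exact hC' z hz
        _ < (max C 0 + 1) * (ε / (max C 0 + 1)) := by gcongr; exact h3 z hz
        _ = ε := by field_simp
    · rw [RR.ev_mul, RR.ev_P _ haE, RR.mk_ev _ haE, hpa, h2 haE, one_mul]
    · rw [RR.ev_mul, RR.ev_P _ (hZ b hb).2, hpb b hb hba, zero_mul]
  obtain ⟨g0, hg0⟩ := RR.W1 hL hU hLU hf (half_pos hε)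
  set N : ℝ := Z.card + 1 with hN
  have hNp : 0 < N := by positivity
  have key2 : ∀ a : ℂ, ∃ η : RR E, a ∈ Z → (∀ z ∈ L, ‖(c a - g0 a) * η z‖ ≤ ε / (2 * N)) ∧ η a = 1 ∧ ∀ b ∈ Z, b ≠ a → η b = 0 := by
    intro a
    by_cases ha : a ∈ Z
    · obtain ⟨η, h1, h2, h3⟩ := key a ha (ε / (2 * N * (‖c a - g0 a‖ + 1))) (by positivity)
      refine ⟨η, fun _ => ⟨fun z hz => ?_, h2, h3⟩⟩
      rw [norm_mul]
      calc _ ≤ (‖c a - g0 a‖ + 1) * (ε / (2 * N * (‖c a - g0 a‖ + 1))) := by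
            gcongr
            · linarith
            · exact (h1 z hz).le
        _ = _ := by field_simp
    · exact ⟨0, fun h => absurd h ha⟩
  choose η hη using key2
  refine ⟨g0 + ∑ a ∈ Z, (c a - g0 a) • η a, fun z hz => ?_, fun z hz => ?_⟩
  · rw [RR.ev_add, RR.ev_sum]
    simp only [RR.ev_smul]
    have h1 : ‖∑ a ∈ Z, (c a - g0 a) * η a z‖ ≤ ε / 2 := by
      calc _ ≤ ∑ a ∈ Z, ‖(c a - g0 a) * η a z‖ := norm_sum_le _ _
        _ ≤ ∑ a ∈ Z, ε / (2 * N) := Finset.sum_le_sum fun a ha => (hη a ha).1 z hz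
        _ = Z.card * (ε / (2 * N)) := by rw [Finset.sum_const, nsmul_eq_mul]
        _ ≤ N * (ε / (2 * N)) := by gcongr; rw [hN]; linarith
        _ = ε / 2 := by field_simp
    rw [add_sub_right_comm]
    calc _ ≤ _ := norm_add_le _ _
      _ < ε / 2 + ε / 2 := add_lt_add_of_lt_of_le (hg0 z hz) h1
      _ = ε := by ring
  · rw [RR.ev_add, RR.ev_sum, Finset.sum_eq_single_of_mem z hz, RR.ev_smul, (hη z hz).2.1]
    · ring
    · intro b hb hbz
      rw [RR.ev_smul, (hη b hb).2.2 z hz hbz.symm, mul_zero]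

/-- `f'` agrees with `f` to the order `q`, the quotient being at most `η` on `L` -/
def App {E : Finset ℂ} (L : Set ℂ) (q : Polynomial ℂ) (η : ℝ) (f : ℂ → ℂ) (f' : RR E) : Prop :=
  ∃ (U : Set ℂ) (h : ℂ → ℂ), IsOpen U ∧ L ⊆ U ∧ DifferentiableOn ℂ h U ∧
    (∀ z ∈ U, f' z = f z + q.eval z * h z) ∧ ∀ z ∈ L, ‖h z‖ ≤ η

namespace App
variable {E : Finset ℂ} {L : Set ℂ} {q : Polynomial ℂ} {η η' : ℝ} {f g : ℂ → ℂ} {f' g' : RR E}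

lemma add (h1 : App L q η f f') (h2 : App L q η' g g') : App L q (η + η') (fun z => f z + g z) (f' + g') := by
  obtain ⟨U, h, a1, a2, a3, a4, a5⟩ := h1
  obtain ⟨V, k, b1, b2, b3, b4, b5⟩ := h2
  refine ⟨U ∩ V, fun z => h z + k z, a1.inter b1, Set.subset_inter a2 b2,
    (a3.mono Set.inter_subset_left).add (b3.mono Set.inter_subset_right), fun z hz => ?_, fun z hz => ?_⟩
  · rw [RR.ev_add, a4 z hz.1, b4 z hz.2]; ring
  · exact (norm_add_le _ _).trans (add_le_add (a5 z hz) (b5 z hz))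

lemma smul (c : ℂ) (h1 : App L q η f f') : App L q (‖c‖ * η) (fun z => c * f z) (c • f') := by
  obtain ⟨U, h, a1, a2, a3, a4, a5⟩ := h1
  refine ⟨U, fun z => c * h z, a1, a2, a3.const_mul c, fun z hz => ?_, fun z hz => ?_⟩
  · rw [RR.ev_smul, a4 z hz]; ring
  · rw [norm_mul]; gcongr; exact a5 z hz

lemma mono (h1 : App L q η f f') (h : η ≤ η') : App L q η' f f' := by
  obtain ⟨U, k, a1, a2, a3, a4, a5⟩ := h1
  exact ⟨U, k, a1, a2, a3, a4, fun z hz => (a5 z hz).trans h⟩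

lemma congr (h1 : App L q η f f') {V : Set ℂ} (hV : IsOpen V) (hLV : L ⊆ V) (h : ∀ z ∈ V, g z = f z) :
    App L q η g f' := by
  obtain ⟨U, k, a1, a2, a3, a4, a5⟩ := h1
  exact ⟨U ∩ V, k, a1.inter hV, Set.subset_inter a2 hLV, a3.mono Set.inter_subset_left,
    fun z hz => by rw [h z hz.2, a4 z hz.1], a5⟩

lemma sum {κ : Type*} (s : Finset κ) {F : κ → ℂ → ℂ} {F' : κ → RR E} {η : κ → ℝ} (h : ∀ i ∈ s, App L q (η i) (F i) (F' i)) :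
    App L q (∑ i ∈ s, η i) (fun z => ∑ i ∈ s, F i z) (∑ i ∈ s, F' i) := by
  classical
  induction s using Finset.induction_on with
  | empty =>
    exact ⟨Set.univ, fun _ => 0, isOpen_univ, Set.subset_univ _, differentiableOn_const _, by simp, by simp⟩
  | insert a s ha ih =>
    simp only [Finset.sum_insert ha]
    exact (h a (Finset.mem_insert_self _ _)).add (ih fun i hi => h i (Finset.mem_insert_of_mem hi))

end App

lemma cpt_bound {L : Set ℂ} (hL : IsCompact L) {f : ℂ → ℂ} (hf : ContinuousOn f L) :
    ∃ B : ℝ, 0 ≤ B ∧ ∀ z ∈ L, ‖f z‖ ≤ B := by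
  obtain ⟨C, hC⟩ := (hL.image_of_continuousOn hf).isBounded.exists_norm_le
  exact ⟨max C 0, le_max_right _ _, fun z hz => (hC _ ⟨z, hz, rfl⟩).trans (le_max_left _ _)⟩

lemma RR.zeros {E : Finset ℂ} {f : RR E} (hf : f ≠ 0) : ∃ Z : Finset ℂ, ∀ z, z ∈ Z ↔ z ∉ E ∧ f z = 0 := by
  classical
  obtain ⟨p, k, hp⟩ := f.exists_poly
  have hp0 : p ≠ 0 := by
    rintro rfl
    rw [map_zero] at hp
    exact hf ((mul_eq_zero.1 hp).resolve_left (pow_ne_zero _ (RR.P_ne (QE_ne E))))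
  refine ⟨p.roots.toFinset.filter (· ∉ E), fun z => ?_⟩
  rw [Finset.mem_filter, Multiset.mem_toFinset, Polynomial.mem_roots hp0, Polynomial.IsRoot]
  constructor
  · rintro ⟨h1, h2⟩
    refine ⟨h2, ?_⟩
    rw [← RR.ev_P p h2, ← hp, RR.ev_mul, RR.ev_pow _ _ h2, RR.ev_P _ h2, mul_eq_zero] at h1
    exact h1.resolve_left (pow_ne_zero _ (QE_eval_ne h2))
  · rintro ⟨h2, h1⟩
    refine ⟨?_, h2⟩
    rw [← RR.ev_P p h2, ← hp, RR.ev_mul, h1, mul_zero]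

set_option maxHeartbeats 1000000 in
lemma LemA1 {E : Finset ℂ} {L U : Set ℂ} (hL : RC E L) (hne : L.Nonempty) (hU : IsOpen U) (hLU : L ⊆ U) {m : ℕ}
    (j0 : Fin m) {u v : ℂ → ℂ} {w : Fin m → ℂ → ℂ} (hu : DifferentiableOn ℂ u U) (hv : DifferentiableOn ℂ v U)
    (hw : ∀ j, DifferentiableOn ℂ (w j) U) (hnull : ∀ z ∈ U, u z * v z + ∑ j, w j z ^ 2 = 0)
    (hnv : ∀ z ∈ L, ¬ (u z = 0 ∧ v z = 0 ∧ ∀ j, w j z = 0)) (q : Polynomial ℂ) (hq : q ≠ 0)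
    (hqL : ∀ a, q.eval a = 0 → a ∈ L) (hnz : ∀ z ∈ L, ¬ ∀ᶠ w in 𝓝 z, u w = 0) {η : ℝ} (hη : 0 < η) :
    ∃ (u' v' : RR E) (w' : Fin m → RR E), u' * v' + ∑ j, w' j ^ 2 = 0 ∧
      (∀ z ∉ E, ¬ (u' z = 0 ∧ v' z = 0 ∧ ∀ j, w' j z = 0)) ∧ App L q η u u' ∧ App L q η v v' ∧
      ∀ j, App L q η (w j) (w' j) := by
  classical
  have hLE : ∀ z ∈ L, z ∉ E := fun z hz h => hL.2.1 z h hz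
  -- square root of u
  obtain ⟨U0, ut, a1, a2, a3, a4, a5⟩ := ZF hU hL.1 hLU hu hnz
  obtain ⟨V0, R1, κ, b1, b2, b3, b4, b5, b6⟩ := sqrtL hL hU hLU a3 a4
  set V := (V0 ∩ U) \ (E : Set ℂ) with hV
  have hVo : IsOpen V := (b1.inter hU).sdiff E.finite_toSet.isClosed
  have hLV : L ⊆ V := fun z hz => ⟨⟨b2 hz, hLU hz⟩, hLE z hz⟩
  have hVE : ∀ z ∈ V, z ∉ E := fun z hz => hz.2
  have hVE' : ∀ e ∈ E, e ∉ V := fun z hz h => h.2 hz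
  have hVU : V ⊆ U := fun z hz => hz.1.2
  set R0 := U0 * R1 with hR0
  obtain ⟨zz, hzz⟩ := hne
  have hR1 : R1 ≠ 0 := fun h => hLE zz hzz (b3 zz (by rw [h]; simp))
  have hR0ne : R0 ≠ 0 := mul_ne_zero a1 hR1
  have hR0L : ∀ a, R0.eval a = 0 → a ∉ E → a ∈ L := fun a ha haE => by
    rw [hR0, Polynomial.eval_mul, mul_eq_zero] at ha
    exact ha.elim (a2 a) fun h => absurd (b3 a h) haE
  have hκd : DifferentiableOn ℂ κ V := b4.mono fun z hz => hz.1.1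
  have hκ0 : ∀ z ∈ V, κ z ≠ 0 := fun z hz => b5 z hz.1.1
  have huκ : ∀ z ∈ V, u z = R0.eval z * κ z ^ 2 := fun z hz => by
    rw [a5, b6 z hz.1.1, hR0, Polynomial.eval_mul]; ring
  set ω : Fin m → ℂ → ℂ := fun j z => w j z / κ z with hω
  have hωd : ∀ j, DifferentiableOn ℂ (ω j) V := fun j => ((hw j).mono hVU).div hκd hκ0
  have hwω : ∀ j, ∀ z ∈ V, w j z = κ z * ω j z := fun j z hz => by
    have := hκ0 z hz
    simp only [hω]; field_simp
  have hω2 : ∀ z ∈ V, ∑ j, ω j z ^ 2 = - (R0.eval z * v z) := fun z hz => by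
    have h1 := hnull z (hVU hz)
    have h2 := hκ0 z hz
    have h3 : κ z ^ 2 * (R0.eval z * v z + ∑ j, ω j z ^ 2) = 0 := by
      rw [← h1, huκ z hz, mul_add, Finset.mul_sum]
      congr 1
      · ring
      · exact Finset.sum_congr rfl fun j _ => by rw [hwω j z hz]; ring
    have := (mul_eq_zero.1 h3).resolve_left (pow_ne_zero _ h2)
    linear_combination this
  -- polynomial parts
  obtain ⟨Jκ, α0, c1, c2⟩ := HI hVo hκd q hq
  choose J γ0 d1 d2 using fun j => HI hVo (hωd j) (q * R0) (mul_ne_zero hq hR0ne)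
  -- bounds
  obtain ⟨B1, hB1, hb1⟩ := cpt_bound hL.1 (hκd.continuousOn.mono hLV)
  obtain ⟨B2, hB2, hb2⟩ := cpt_bound hL.1 R0.continuous.continuousOn
  obtain ⟨B3, hB3, hb3⟩ := cpt_bound hL.1 q.continuous.continuousOn
  choose B4 hB4 hb4 using fun j => cpt_bound hL.1 ((hωd j).continuousOn.mono hLV)
  set B := 1 + B1 + B2 + B3 + ∑ j, B4 j with hB
  have hS : 0 ≤ ∑ j, B4 j := Finset.sum_nonneg fun j _ => hB4 j
  have hB0 : 1 ≤ B := by linarith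
  have k1 : ∀ z ∈ L, ‖κ z‖ ≤ B := fun z hz => (hb1 z hz).trans (by linarith)
  have k2 : ∀ z ∈ L, ‖R0.eval z‖ ≤ B := fun z hz => (hb2 z hz).trans (by linarith)
  have k3 : ∀ z ∈ L, ‖q.eval z‖ ≤ B := fun z hz => (hb3 z hz).trans (by linarith)
  have k4 : ∀ j, ∀ z ∈ L, ‖ω j z‖ ≤ B := fun j z hz => (hb4 j z hz).trans (by
    have := Finset.single_le_sum (f := B4) (fun j _ => hB4 j) (Finset.mem_univ j)
    linarith)
  obtain ⟨zκ, hzκ, hκmin⟩ := hL.1.exists_isMinOn ⟨zz, hzz⟩ (hκd.continuousOn.mono hLV).norm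
  have hμκ : 0 < ‖κ zκ‖ := norm_pos_iff.2 (hκ0 _ (hLV hzκ))
  have hcN : ContinuousOn (fun z => ‖u z‖ + ‖v z‖ + ∑ j, ‖w j z‖) L :=
    (((hu.continuousOn.mono hLU).norm).add ((hv.continuousOn.mono hLU).norm)).add
      (continuousOn_finsetSum _ fun j _ => ((hw j).continuousOn.mono hLU).norm)
  obtain ⟨zN, hzN, hNmin⟩ := hL.1.exists_isMinOn ⟨zz, hzz⟩ hcN
  set μ := ‖u zN‖ + ‖v zN‖ + ∑ j, ‖w j zN‖ with hμ
  have hμ0 : 0 < μ := by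
    have hnn : 0 ≤ ∑ j, ‖w j zN‖ := Finset.sum_nonneg fun j _ => norm_nonneg _
    refine lt_of_le_of_ne (by positivity) fun h0 => hnv zN hzN ?_
    have e1 := norm_nonneg (u zN)
    have e2 := norm_nonneg (v zN)
    have e3 : ∑ j, ‖w j zN‖ = 0 := by linarith
    refine ⟨norm_eq_zero.1 (by linarith), norm_eq_zero.1 (by linarith), fun j => ?_⟩
    exact norm_eq_zero.1 ((Finset.sum_eq_zero_iff_of_nonneg fun j _ => norm_nonneg _).1 e3 j (Finset.mem_univ j))
  set η1 := min η (μ / (2 * (m + 2) * B)) with hη1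
  have hη10 : 0 < η1 := lt_min hη (by positivity)
  set δ := min 1 (min (‖κ zκ‖ / (2 * B)) (η1 / (3 * (m + 1) * B ^ 2))) with hδ
  have hδ0 : 0 < δ := lt_min one_pos (lt_min (by positivity) (by positivity))
  have hδ1 : δ ≤ 1 := min_le_left _ _
  have hδ2 : B * δ < ‖κ zκ‖ := by
    have : δ ≤ ‖κ zκ‖ / (2 * B) := (min_le_right _ _).trans (min_le_left _ _)
    calc B * δ ≤ B * (‖κ zκ‖ / (2 * B)) := by gcongr
      _ = ‖κ zκ‖ / 2 := by field_simp
      _ < _ := by linarith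
  have hδ3 : 3 * (m + 1) * B ^ 2 * δ ≤ η1 := by
    have : δ ≤ η1 / (3 * (m + 1) * B ^ 2) := (min_le_right _ _).trans (min_le_right _ _)
    calc _ ≤ 3 * (m + 1) * B ^ 2 * (η1 / (3 * (m + 1) * B ^ 2)) := by gcongr
      _ = η1 := by field_simp
  have hδ4 : 3 * B ^ 2 * δ ≤ η1 := by
    refine le_trans ?_ hδ3
    have h1 : 0 ≤ 3 * B ^ 2 * δ := by positivity
    have h2 : (0 : ℝ) ≤ m := Nat.cast_nonneg m
    nlinarith
  -- approximations
  obtain ⟨aR, haR⟩ := RR.W1 hL hVo hLV c1 hδ0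
  set κ' : RR E := RR.P Jκ + RR.P q * aR with hκ'
  set α : ℂ → ℂ := fun z => aR z - α0 z with hα
  have hαd : DifferentiableOn ℂ α V := (aR.differentiableOn hVE').sub c1
  have hκ'e : ∀ z ∈ V, κ' z = κ z + q.eval z * α z := fun z hz => by
    rw [hκ', RR.ev_add, RR.ev_mul, RR.ev_P _ (hVE z hz), RR.ev_P _ (hVE z hz), c2 z hz, hα]; ring
  have hκ'L : ∀ z ∈ L, κ' z ≠ 0 := fun z hz h0 => by
    rw [hκ'e z (hLV hz)] at h0
    have h1 : κ z = -(q.eval z * α z) := by linear_combination h0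
    have h2 : ‖κ z‖ ≤ B * δ := by
      rw [h1, norm_neg, norm_mul]; gcongr
      · exact k3 z hz
      · exact (haR z hz).le
    have h3 : ‖κ zκ‖ ≤ ‖κ z‖ := hκmin hz
    linarith
  have hκ'ne : κ' ≠ 0 := fun h => hκ'L zz hzz (by rw [h, RR.ev_zero])
  obtain ⟨Z, hZ⟩ := RR.zeros hκ'ne
  have hZL : ∀ z ∈ Z, z ∉ L ∧ z ∉ E := fun z hz => ⟨fun h => hκ'L z h ((hZ z).1 hz).2, ((hZ z).1 hz).1⟩
  choose gR hg1 hg2 using fun j => W1i hL hVo hLV (d1 j) Z hZL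
    (fun z => ((if j = j0 then 1 else 0) - (J j).eval z) / (q * R0).eval z) hδ0
  set ω' : Fin m → RR E := fun j => RR.P (J j) + RR.P (q * R0) * gR j with hω'
  set γ : Fin m → ℂ → ℂ := fun j z => gR j z - γ0 j z with hγ
  have hγd : ∀ j, DifferentiableOn ℂ (γ j) V := fun j => ((gR j).differentiableOn hVE').sub (d1 j)
  have hω'e : ∀ j, ∀ z ∈ V, ω' j z = ω j z + q.eval z * R0.eval z * γ j z := fun j z hz => by
    simp only [hω', hγ]
    rw [RR.ev_add, RR.ev_mul, RR.ev_P _ (hVE z hz), RR.ev_P _ (hVE z hz), d2 j z hz, Polynomial.eval_mul]; ring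
  have hω'Z : ∀ z ∈ Z, ∀ j, ω' j z = if j = j0 then 1 else 0 := fun z hz j => by
    have h1 : (q * R0).eval z ≠ 0 := by
      rw [Polynomial.eval_mul]
      exact mul_ne_zero (fun h => (hZL z hz).1 (hqL z h)) fun h => (hZL z hz).1 (hR0L z h (hZL z hz).2)
    simp only [hω']
    rw [RR.ev_add, RR.ev_mul, RR.ev_P _ (hZL z hz).2, RR.ev_P _ (hZL z hz).2, hg2 j z hz, mul_div_cancel₀ _ h1]
    ring
  set hvf : ℂ → ℂ := fun z => - ∑ j, (2 * ω j z * γ j z + q.eval z * R0.eval z * γ j z ^ 2) with hhv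
  have hvd : DifferentiableOn ℂ hvf V := by
    refine (DifferentiableOn.fun_sum fun j _ => ?_).neg
    exact (((hωd j).const_mul 2).mul (hγd j)).add
      (((q.differentiable.differentiableOn).mul R0.differentiable.differentiableOn).mul ((hγd j).pow 2))
  obtain ⟨v', hv'⟩ := RRdiv hVo R0 hR0ne (fun a h1 h2 => hLV (hR0L a h1 h2)) (- ∑ j, ω' j ^ 2)
    (fun z => v z + q.eval z * hvf z)
    ((hv.continuousOn.mono hVU).add (q.continuous.continuousOn.mul hvd.continuousOn)) (by
      intro z hz hzE
      rw [RR.ev_neg, RR.ev_sum]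
      have : ∀ j, (ω' j ^ 2) z = ω j z ^ 2 + R0.eval z * (q.eval z * (2 * ω j z * γ j z + q.eval z * R0.eval z * γ j z ^ 2)) := by
        intro j
        rw [RR.ev_pow _ _ hzE, hω'e j z hz]; ring
      simp only [this]
      rw [Finset.sum_add_distrib, hω2 z hz, ← Finset.mul_sum, ← Finset.mul_sum, hhv]
      ring)
  have hv'e : ∀ z ∈ V, R0.eval z * v' z = R0.eval z * (v z + q.eval z * hvf z) := fun z hz => by
    have hzE := hVE z hz
    have h1 : (- ∑ j, ω' j ^ 2 : RR E) z = R0.eval z * v' z := by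
      rw [hv', RR.ev_mul, RR.ev_P _ hzE]
    rw [← h1, RR.ev_neg, RR.ev_sum]
    have : ∀ j, (ω' j ^ 2) z = ω j z ^ 2 + R0.eval z * (q.eval z * (2 * ω j z * γ j z + q.eval z * R0.eval z * γ j z ^ 2)) := by
      intro j
      rw [RR.ev_pow _ _ hzE, hω'e j z hz]; ring
    simp only [this]
    rw [Finset.sum_add_distrib, hω2 z hz, ← Finset.mul_sum, ← Finset.mul_sum, hhv]
    ring
  have hv'e2 : ∀ z ∈ V, v' z = v z + q.eval z * hvf z := by
    intro z hz
    have hzE := hVE z hz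
    have c1 : ContinuousAt v' z := (v'.differentiableAt hzE).continuousAt
    have c2 : ContinuousAt (fun z => v z + q.eval z * hvf z) z :=
      ((hv.continuousOn.mono hVU).continuousAt (hVo.mem_nhds hz)).add
        ((q.continuous.continuousAt).mul (hvd.continuousOn.continuousAt (hVo.mem_nhds hz)))
    have e0 : ∀ᶠ w in 𝓝[≠] z, R0.eval w ≠ 0 := by
      have : (↑R0.roots.toFinset : Set ℂ) \ {z} ∈ (𝓝[≠] z).sets ∨ True := Or.inr trivial
      have hfin : ((↑R0.roots.toFinset : Set ℂ) \ {z}).Finite := (R0.roots.toFinset.finite_toSet).subset Set.diff_subset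
      have : ((↑R0.roots.toFinset : Set ℂ) \ {z})ᶜ ∈ 𝓝 z := hfin.isClosed.isOpen_compl.mem_nhds (by simp)
      filter_upwards [nhdsWithin_le_nhds this, self_mem_nhdsWithin] with y hy hyz h0
      exact hy ⟨by simpa [hR0ne] using h0, hyz⟩
    have e1 : (v' : ℂ → ℂ) =ᶠ[𝓝[≠] z] fun z => v z + q.eval z * hvf z := by
      filter_upwards [e0, nhdsWithin_le_nhds (hVo.mem_nhds hz)] with y h1 h2
      exact mul_left_cancel₀ h1 (hv'e y h2)
    exact tendsto_nhds_unique ((c1.tendsto.mono_left nhdsWithin_le_nhds).congr' e1)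
      (c2.tendsto.mono_left nhdsWithin_le_nhds)
  have hαb : ∀ z ∈ L, ‖α z‖ ≤ δ := fun z hz => (haR z hz).le
  have hγb : ∀ j, ∀ z ∈ L, ‖γ j z‖ ≤ δ := fun j z hz => (hg1 j z hz).le
  have App_u : App L q η1 u (RR.P R0 * κ' ^ 2) := by
    refine ⟨V, fun z => R0.eval z * (2 * κ z * α z + q.eval z * α z ^ 2), hVo, hLV,
      (R0.differentiable.differentiableOn).mul (((hκd.const_mul 2).mul hαd).add
        ((q.differentiable.differentiableOn).mul (hαd.pow 2))), fun z hz => ?_, fun z hz => ?_⟩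
    · rw [RR.ev_mul, RR.ev_pow _ _ (hVE z hz), RR.ev_P _ (hVE z hz), hκ'e z hz, huκ z hz]; ring
    · refine le_trans ?_ hδ4
      calc _ ≤ ‖R0.eval z‖ * (2 * ‖κ z‖ * ‖α z‖ + ‖q.eval z‖ * ‖α z‖ ^ 2) := by
            rw [norm_mul]; gcongr
            refine (norm_add_le _ _).trans ?_
            simp [norm_mul]
        _ ≤ B * (2 * B * δ + B * (δ * 1)) := by
            rw [sq ‖α z‖]
            have := k1 z hz; have := k2 z hz; have := k3 z hz; have := hαb z hz
            have : ‖α z‖ ≤ 1 := this.trans hδ1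
            gcongr
        _ = 3 * B ^ 2 * δ := by ring
  have App_w : ∀ j, App L q η1 (w j) (κ' * ω' j) := by
    intro j
    refine ⟨V, fun z => α z * ω j z + κ z * R0.eval z * γ j z + q.eval z * α z * R0.eval z * γ j z, hVo, hLV,
      ((hαd.mul (hωd j)).add ((hκd.mul (R0.differentiable.differentiableOn)).mul (hγd j))).add
        (((q.differentiable.differentiableOn.mul hαd).mul R0.differentiable.differentiableOn).mul (hγd j)),
      fun z hz => ?_, fun z hz => ?_⟩
    · rw [RR.ev_mul, hκ'e z hz, hω'e j z hz, hwω j z hz]; ring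
    · refine le_trans ?_ hδ4
      have := k1 z hz; have := k2 z hz; have := k3 z hz; have h5 := hαb z hz; have := k4 j z hz; have := hγb j z hz
      have h6 : ‖α z‖ ≤ 1 := h5.trans hδ1
      calc _ ≤ ‖α z‖ * ‖ω j z‖ + ‖κ z‖ * ‖R0.eval z‖ * ‖γ j z‖ + ‖q.eval z‖ * ‖α z‖ * ‖R0.eval z‖ * ‖γ j z‖ := by
            simp only [← norm_mul]
            exact norm_add₃_le
        _ ≤ δ * B + B * B * δ + B * 1 * B * δ := by gcongr
        _ ≤ 3 * B ^ 2 * δ := by nlinarith [mul_nonneg hδ0.le (by linarith : 0 ≤ B), mul_nonneg (mul_nonneg hδ0.le (by linarith : 0 ≤ B)) (by linarith : 0 ≤ B - 1)]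
  have App_v : App L q η1 v v' := by
    refine ⟨V, hvf, hVo, hLV, hvd, hv'e2, fun z hz => ?_⟩
    refine le_trans ?_ hδ3
    rw [hhv, norm_neg]
    calc _ ≤ ∑ j : Fin m, ‖2 * ω j z * γ j z + q.eval z * R0.eval z * γ j z ^ 2‖ := norm_sum_le _ _
      _ ≤ ∑ j : Fin m, 3 * B ^ 2 * δ := by
        refine Finset.sum_le_sum fun j _ => ?_
        have := k2 z hz; have := k3 z hz; have := k4 j z hz; have h5 := hγb j z hz
        have h6 : ‖γ j z‖ ≤ 1 := h5.trans hδ1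
        calc _ ≤ 2 * ‖ω j z‖ * ‖γ j z‖ + ‖q.eval z‖ * ‖R0.eval z‖ * ‖γ j z‖ ^ 2 := by
              refine (norm_add_le _ _).trans ?_
              simp [norm_mul]
          _ ≤ 2 * B * δ + B * B * (δ * 1) := by rw [sq ‖γ j z‖]; gcongr
          _ ≤ 3 * B ^ 2 * δ := by nlinarith [mul_nonneg hδ0.le (by linarith : 0 ≤ B), mul_nonneg (mul_nonneg hδ0.le (by linarith : 0 ≤ B)) (by linarith : 0 ≤ B - 1)]
      _ = m * (3 * B ^ 2 * δ) := by rw [Finset.sum_const, Finset.card_univ, Fintype.card_fin, nsmul_eq_mul]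
      _ ≤ 3 * (m + 1) * B ^ 2 * δ := by
        have h1 : 0 ≤ 3 * B ^ 2 * δ := by positivity
        nlinarith
  have small : ∀ (f : ℂ → ℂ) (f' : RR E), App L q η1 f f' → ∀ z ∈ L, f' z = 0 → ‖f z‖ ≤ B * η1 := by
    rintro f f' ⟨U1, h, x1, x2, x3, x4, x5⟩ z hz h0
    have h1 := x4 z (x2 hz)
    rw [h0] at h1
    have h2 : f z = -(q.eval z * h z) := by linear_combination -h1
    rw [h2, norm_neg, norm_mul]
    have := k3 z hz; have := x5 z hz
    gcongr
  refine ⟨RR.P R0 * κ' ^ 2, v', fun j => κ' * ω' j, ?_, ?_, App_u.mono (min_le_left _ _), App_v.mono (min_le_left _ _),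
    fun j => (App_w j).mono (min_le_left _ _)⟩
  · have : RR.P R0 * κ' ^ 2 * v' = κ' ^ 2 * (RR.P R0 * v') := by ring
    rw [this, ← hv', mul_neg, Finset.mul_sum]
    simp only [mul_pow]
    exact neg_add_cancel _
  · rintro z hzE ⟨h1, h2, h3⟩
    by_cases hk : κ' z = 0
    · have hzZ : z ∈ Z := (hZ z).2 ⟨hzE, hk⟩
      have e1 : (- ∑ j, ω' j ^ 2 : RR E) z = R0.eval z * v' z := by rw [hv', RR.ev_mul, RR.ev_P _ hzE]
      rw [h2, mul_zero, RR.ev_neg, RR.ev_sum, neg_eq_zero] at e1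
      simp only [RR.ev_pow _ _ hzE, hω'Z z hzZ] at e1
      simp at e1
    · have hzL : z ∈ L := by
        rw [RR.ev_mul, RR.ev_P _ hzE, RR.ev_pow _ _ hzE, mul_eq_zero] at h1
        exact hR0L z (h1.resolve_right (pow_ne_zero _ hk)) hzE
      have g1 := small _ _ App_u z hzL h1
      have g2 := small _ _ App_v z hzL h2
      have g3 := fun j => small _ _ (App_w j) z hzL (h3 j)
      have g4 : ∑ j, ‖w j z‖ ≤ m * (B * η1) := by
        calc _ ≤ ∑ j : Fin m, B * η1 := Finset.sum_le_sum fun j _ => g3 j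
          _ = _ := by rw [Finset.sum_const, Finset.card_univ, Fintype.card_fin, nsmul_eq_mul]
      have g5 : μ ≤ ‖u z‖ + ‖v z‖ + ∑ j, ‖w j z‖ := hNmin hzL
      have g6 : η1 ≤ μ / (2 * (m + 2) * B) := min_le_right _ _
      have g7 : (m + 2) * (B * η1) ≤ μ / 2 := by
        calc _ ≤ (m + 2) * (B * (μ / (2 * (m + 2) * B))) := by gcongr
          _ = μ / 2 := by field_simp
      linarith

lemma gen_t {m : ℕ} (hm : 0 < m) (u v : ℂ) (w : Fin m → ℂ) (h : ¬ (u = 0 ∧ v = 0 ∧ ∀ j, w j = 0)) :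
    ∃ F : Finset ℂ, ∀ t ∉ F, u - 2 * ∑ j, t ^ (j.1 + 1) * w j - (∑ j : Fin m, (t ^ (j.1 + 1)) ^ 2) * v ≠ 0 := by
  classical
  set p : Polynomial ℂ := Polynomial.C u - 2 * ∑ j : Fin m, Polynomial.X ^ (j.1 + 1) * Polynomial.C (w j)
    - (∑ j : Fin m, (Polynomial.X ^ (j.1 + 1)) ^ 2) * Polynomial.C v with hp
  have hev : ∀ t, p.eval t = u - 2 * ∑ j, t ^ (j.1 + 1) * w j - (∑ j : Fin m, (t ^ (j.1 + 1)) ^ 2) * v := by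
    intro t
    simp only [hp, Polynomial.eval_finset_sum, Polynomial.eval_sub, Polynomial.eval_mul, Polynomial.eval_C, Polynomial.eval_pow,
      Polynomial.eval_X, Polynomial.eval_ofNat]
  have hco : ∀ k, p.coeff k = (if k = 0 then u else 0) - 2 * (∑ j : Fin m, if k = j.1 + 1 then w j else 0)
      - (∑ j : Fin m, if k = (j.1 + 1) * 2 then v else 0) := by
    intro k
    have h2 : (2 : Polynomial ℂ) = Polynomial.C 2 := rfl
    simp only [hp, Polynomial.coeff_sub, Polynomial.coeff_C, h2, Polynomial.coeff_C_mul,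
      Polynomial.finsetSum_coeff, Polynomial.coeff_mul_C, Polynomial.coeff_X_pow, ← pow_mul, Finset.sum_mul]
    simp
  have hp0 : p ≠ 0 := by
    intro h0
    have hc : ∀ k, p.coeff k = 0 := fun k => by rw [h0]; simp
    have hv : v = 0 := by
      have := hc (m * 2)
      rw [hco, if_neg (by omega), Finset.sum_eq_zero, Finset.sum_eq_single ⟨m - 1, by omega⟩, if_pos] at this
      · simpa using this
      · simp; omega
      · intro b _ hb
        rw [if_neg]
        intro h; apply hb; ext; simp; omega
      · simp
      · intro j _
        rw [if_neg]; have := j.2; omega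
    subst hv
    refine h ⟨?_, rfl, fun j => ?_⟩
    · have := hc 0
      rw [hco] at this
      simpa using this
    · have := hc (j.1 + 1)
      rw [hco, Finset.sum_eq_single j] at this
      · simpa using this
      · intro b _ hb
        rw [if_neg]
        intro h; apply hb; ext; omega
      · simp
  refine ⟨p.roots.toFinset, fun t ht => ?_⟩
  rw [← hev]
  intro h
  exact ht (by rw [Multiset.mem_toFinset, Polynomial.mem_roots hp0]; exact h)

lemma gen_t' {L U : Set ℂ} (hL : IsCompact L) (hU : IsOpen U) (hLU : L ⊆ U) {m : ℕ} (hm : 0 < m)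
    {u v : ℂ → ℂ} {w : Fin m → ℂ → ℂ} (hu : DifferentiableOn ℂ u U) (hv : DifferentiableOn ℂ v U)
    (hw : ∀ j, DifferentiableOn ℂ (w j) U)
    (hnv : ∀ z ∈ L, ¬ (u z = 0 ∧ v z = 0 ∧ ∀ j, w j z = 0)) : ∃ F : Finset ℂ, ∀ t ∉ F, ∀ z ∈ L,
      ¬ ∀ᶠ y in 𝓝 z, u y - 2 * ∑ j, t ^ (j.1 + 1) * w j y - (∑ j : Fin m, (t ^ (j.1 + 1)) ^ 2) * v y = 0 := by
  classical
  set T : ℂ → ℂ → ℂ := fun t y => u y - 2 * ∑ j, t ^ (j.1 + 1) * w j y - (∑ j : Fin m, (t ^ (j.1 + 1)) ^ 2) * v y with hT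
  have hTd : ∀ t, DifferentiableOn ℂ (T t) U := fun t =>
    (hu.sub ((DifferentiableOn.fun_sum fun j _ => (hw j).const_mul _).const_mul 2)).sub (hv.const_mul _)
  refine hL.induction_on (p := fun S => ∃ F : Finset ℂ, ∀ t ∉ F, ∀ z ∈ S, ¬ ∀ᶠ y in 𝓝 z, T t y = 0) ?_ ?_ ?_ ?_
  · exact ⟨∅, by simp⟩
  · rintro s t hst ⟨F, hF⟩
    exact ⟨F, fun a ha z hz => hF a ha z (hst hz)⟩
  · rintro s t ⟨F, hF⟩ ⟨F', hF'⟩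
    refine ⟨F ∪ F', fun a ha z hz => ?_⟩
    rw [Finset.mem_union, not_or] at ha
    exact hz.elim (hF a ha.1 z) (hF' a ha.2 z)
  · intro x hx
    obtain ⟨r, hr, hrU⟩ := Metric.isOpen_iff.1 hU x (hLU hx)
    obtain ⟨F, hF⟩ := gen_t hm (u x) (v x) (fun j => w j x) (hnv x hx)
    refine ⟨Metric.ball x r, mem_nhdsWithin_of_mem_nhds (Metric.ball_mem_nhds x hr), F, fun t ht z hz h => ?_⟩
    have h1 := ((hTd t).mono hrU).analyticOnNhd Metric.isOpen_ball
    have h2 := h1.eqOn_zero_of_preconnected_of_eventuallyEq_zero (convex_ball x r).isPreconnected hz h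
    exact hF t ht (h2 (Metric.mem_ball_self hr))

/-- null curves near a Runge compact are approximated (with interpolation) by rational null curves -/
lemma LemA {E : Finset ℂ} {L U : Set ℂ} (hL : RC E L) (hne : L.Nonempty) (hU : IsOpen U) (hLU : L ⊆ U) {n : ℕ}
    (hn : 3 ≤ n) {G : Fin n → ℂ → ℂ} (hG : ∀ j, DifferentiableOn ℂ (G j) U)
    (hnull : ∀ z ∈ U, ∑ j, G j z ^ 2 = 0)
    (hnv : ∀ z ∈ L, ∃ j, G j z ≠ 0) (q : Polynomial ℂ) (hq : q ≠ 0)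
    (hqL : ∀ a, q.eval a = 0 → a ∈ L) {η : ℝ} (hη : 0 < η) :
    ∃ G' : Fin n → RR E, ∑ j, G' j ^ 2 = 0 ∧ (∀ z ∉ E, ∃ j, G' j z ≠ 0) ∧ ∀ j, App L q η (G j) (G' j) := by
  classical
  obtain ⟨m, rfl⟩ : ∃ m, n = m + 2 := ⟨n - 2, by omega⟩
  have hm : 0 < m := by omega
  set u : ℂ → ℂ := fun z => G 0 z - I * G 1 z with hu
  set v : ℂ → ℂ := fun z => G 0 z + I * G 1 z with hv
  set w : Fin m → ℂ → ℂ := fun j z => G j.succ.succ z with hw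
  have hud : DifferentiableOn ℂ u U := (hG 0).sub ((hG 1).const_mul I)
  have hvd : DifferentiableOn ℂ v U := (hG 0).add ((hG 1).const_mul I)
  have hwd : ∀ j, DifferentiableOn ℂ (w j) U := fun j => hG _
  have hnv' : ∀ z ∈ L, ¬ (u z = 0 ∧ v z = 0 ∧ ∀ j, w j z = 0) := by
    rintro z hz ⟨h1, h2, h3⟩
    obtain ⟨j, hj⟩ := hnv z hz
    apply hj
    have e0 : G 0 z = 0 := by simp only [hu, hv] at h1 h2; linear_combination (h1 + h2) / 2
    have e1 : G 1 z = 0 := by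
      simp only [hu, hv] at h1 h2; linear_combination I * (h1 - h2) / 2 + (G 1 z) * I_sq
    refine Fin.cases e0 (fun j => Fin.cases e1 (fun j => h3 j) j) j
  obtain ⟨F, hF⟩ := gen_t' hL.1 hU hLU hm hud hvd hwd hnv'
  obtain ⟨t, ht⟩ := Infinite.exists_notMem_finset F
  set Q : Fin m → ℂ := fun j => t ^ (j.1 + 1) with hQ
  set q2 : ℂ := ∑ j, Q j ^ 2 with hq2
  set C : ℝ := 1 + 2 * ∑ j, ‖Q j‖ + ‖q2‖ with hC
  have hsum0 : 0 ≤ ∑ j, ‖Q j‖ := Finset.sum_nonneg fun j _ => norm_nonneg _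
  have hC0 : 1 ≤ C := by have := norm_nonneg q2; rw [hC]; linarith
  have hnull2 : ∀ z ∈ U, (u z - 2 * ∑ j, Q j * w j z - q2 * v z) * v z + ∑ j, (w j z + Q j * v z) ^ 2 = 0 := by
    intro z hz
    have h1 := hnull z hz
    rw [Fin.sum_univ_succ, Fin.sum_univ_succ] at h1
    have h2 : ∑ j, (w j z + Q j * v z) ^ 2 = ∑ j, w j z ^ 2 + 2 * v z * ∑ j, Q j * w j z + q2 * v z ^ 2 := by
      rw [hq2, Finset.mul_sum, Finset.sum_mul, ← Finset.sum_add_distrib, ← Finset.sum_add_distrib]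
      exact Finset.sum_congr rfl fun j _ => by ring
    have h3 : u z * v z = G 0 z ^ 2 + G 1 z ^ 2 := by
      simp only [hu, hv]; linear_combination -(G 1 z ^ 2) * I_sq
    have h4 : ∑ j, w j z ^ 2 = ∑ i : Fin m, G i.succ.succ z ^ 2 := rfl
    have h5 : G (Fin.succ 0) z = G 1 z := rfl
    rw [h5] at h1
    rw [h2, h4]
    linear_combination h3 + h1
  obtain ⟨u', v', w', c1, c2, c3, c4, c5⟩ := LemA1 hL hne hU hLU (j0 := ⟨0, hm⟩)
    (u := fun z => u z - 2 * ∑ j, Q j * w j z - q2 * v z) (v := v) (w := fun j z => w j z + Q j * v z)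
    ((hud.sub ((DifferentiableOn.fun_sum fun j _ => (hwd j).const_mul _).const_mul 2)).sub (hvd.const_mul _))
    hvd (fun j => (hwd j).add (hvd.const_mul _)) hnull2
    (by
      rintro z hz ⟨h1, h2, h3⟩
      have h4 : ∀ j, w j z = 0 := fun j => by simpa [h2] using h3 j
      refine hnv' z hz ⟨?_, h2, h4⟩
      simpa [h2, h4] using h1) q hq hqL (hF t ht) (η := η / C) (by positivity)
  set w2 : Fin m → RR E := fun j => w' j + (-Q j) • v' with hw2
  set u2 : RR E := u' + (∑ j, (2 * Q j) • w' j) + (-q2) • v' with hu2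
  have a1 : ∀ j, App L q η (w j) (w2 j) := by
    intro j
    refine (((c5 j).add (c4.smul (-Q j))).congr isOpen_univ (Set.subset_univ _) (g := w j) (fun z _ => by ring)).mono ?_
    have hle : ‖Q j‖ ≤ ∑ j, ‖Q j‖ := Finset.single_le_sum (f := fun j => ‖Q j‖) (fun j _ => norm_nonneg _) (Finset.mem_univ j)
    rw [norm_neg, ← one_add_mul, mul_div_assoc', div_le_iff₀ (by positivity), mul_comm]
    have := norm_nonneg q2
    gcongr
    rw [hC]; linarith
  have a2 : App L q η u u2 := by
    refine (((c3.add (App.sum Finset.univ fun j _ => (c5 j).smul (2 * Q j))).add (c4.smul (-q2))).congr isOpen_univ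
      (Set.subset_univ _) (g := u) (fun z _ => ?_)).mono ?_
    · simp only [mul_add, Finset.sum_add_distrib]
      have : ∑ j, 2 * Q j * (Q j * v z) = 2 * q2 * v z := by
        rw [hq2, Finset.mul_sum, Finset.sum_mul]; exact Finset.sum_congr rfl fun j _ => by ring
      rw [this]
      have : ∑ j, 2 * Q j * w j z = 2 * ∑ j, Q j * w j z := by
        rw [Finset.mul_sum]; exact Finset.sum_congr rfl fun j _ => by ring
      rw [this]; ring
    · rw [← Finset.sum_mul, norm_neg, ← one_add_mul, ← add_mul]
      have : ∑ j, ‖2 * Q j‖ = 2 * ∑ j, ‖Q j‖ := by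
        rw [Finset.mul_sum]; exact Finset.sum_congr rfl fun j _ => by simp
      rw [this, ← hC]
      exact le_of_eq (by field_simp)
  have a3 : App L q η v v' := c4.mono (div_le_self hη.le hC0)
  refine ⟨Fin.cons ((1/2 : ℂ) • u2 + (1/2 : ℂ) • v') (Fin.cons ((I/2) • u2 + (-I/2) • v') w2), ?_, ?_, ?_⟩
  · rw [Fin.sum_univ_succ, Fin.sum_univ_succ]
    simp only [Fin.cons_zero, Fin.cons_succ]
    apply RR.ext'
    intro z hz
    have d1 := congrArg (fun f : RR E => f z) c1
    simp only [RR.ev_add, RR.ev_mul, RR.ev_sum, RR.ev_zero, RR.ev_pow _ _ hz] at d1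
    simp only [RR.ev_add, RR.ev_sum, RR.ev_zero, RR.ev_pow _ _ hz, RR.ev_smul, hu2, hw2]
    have h2 : ∑ j, (w' j z + -Q j * v' z) ^ 2 = ∑ j, w' j z ^ 2 - 2 * v' z * ∑ j, Q j * w' j z + q2 * v' z ^ 2 := by
      rw [hq2, Finset.mul_sum, Finset.sum_mul, ← Finset.sum_sub_distrib, ← Finset.sum_add_distrib]
      exact Finset.sum_congr rfl fun j _ => by ring
    have h3 : ∑ j, 2 * Q j * w' j z = 2 * ∑ j, Q j * w' j z := by
      rw [Finset.mul_sum]; exact Finset.sum_congr rfl fun j _ => by ring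
    rw [h2, h3]
    linear_combination d1 + (1/4) * (u' z + 2 * ∑ j, Q j * w' j z + -q2 * v' z - v' z) ^ 2 * I_sq
  · intro z hz
    by_contra hcon
    push Not at hcon
    have e0 := hcon 0
    have e1 := hcon (Fin.succ 0)
    have e2 : ∀ j : Fin m, w2 j z = 0 := fun j => by simpa using hcon j.succ.succ
    simp only [Fin.cons_zero, Fin.cons_succ, RR.ev_add, RR.ev_smul] at e0 e1
    have ev' : v' z = 0 := by linear_combination e0 + I * e1 - (u2 z - v' z) / 2 * I_sq
    have eu' : u2 z = 0 := by linear_combination 2 * e0 - ev'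
    have ew' : ∀ j, w' j z = 0 := fun j => by simpa [hw2, ev'] using e2 j
    refine c2 z hz ⟨?_, ev', ew'⟩
    simpa [hu2, ev', ew', RR.ev_sum] using eu'
  · intro j
    refine Fin.cases ?_ (fun j => Fin.cases ?_ (fun j => a1 j) j) j
    · refine (((a2.smul (1/2)).add (a3.smul (1/2))).congr isOpen_univ (Set.subset_univ _) (g := G 0) fun z _ => ?_).mono ?_
      · simp only [hu, hv]; ring
      · norm_num; linarith
    · refine (((a2.smul (I/2)).add (a3.smul (-I/2))).congr isOpen_univ (Set.subset_univ _) (g := G 1) fun z _ => ?_).mono ?_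
      · simp only [hu, hv]; linear_combination  (G 1 z) * I_sq
      · norm_num; linarith

/-- restriction to a compact -/
def rst (L : Set ℂ) (f : ℂ → ℂ) : C(L, ℂ) := by
  classical
  exact if h : ContinuousOn f L then ⟨fun z => f z, h.domRestrict⟩ else 0

lemma rst_apply {L : Set ℂ} {f : ℂ → ℂ} (h : ContinuousOn f L) (z : L) : rst L f z = f z := by
  rw [rst, dif_pos h]; rfl

lemma rst_congr {L : Set ℂ} {f g : ℂ → ℂ} (h : ∀ z ∈ L, f z = g z) : rst L f = rst L g := by
  have : ContinuousOn f L ↔ ContinuousOn g L := continuousOn_congr h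
  by_cases hf : ContinuousOn f L
  · ext z; rw [rst_apply hf, rst_apply (this.1 hf), h z z.2]
  · rw [rst, rst, dif_neg hf, dif_neg fun h => hf (this.2 h)]

lemma rst_add {L : Set ℂ} {f g : ℂ → ℂ} (hf : ContinuousOn f L) (hg : ContinuousOn g L) :
    rst L (fun z => f z + g z) = rst L f + rst L g := by
  ext z; rw [rst_apply (f := fun z => f z + g z) (hf.add hg), ContinuousMap.add_apply, rst_apply hf, rst_apply hg]

lemma rst_sub {L : Set ℂ} {f g : ℂ → ℂ} (hf : ContinuousOn f L) (hg : ContinuousOn g L) :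
    rst L (fun z => f z - g z) = rst L f - rst L g := by
  ext z; rw [rst_apply (f := fun z => f z - g z) (hf.sub hg), ContinuousMap.sub_apply, rst_apply hf, rst_apply hg]

lemma rst_smul {L : Set ℂ} {f : ℂ → ℂ} (c : ℂ) (hf : ContinuousOn f L) :
    rst L (fun z => c * f z) = c • rst L f := by
  ext z; rw [rst_apply (f := fun z => c * f z) (continuousOn_const.mul hf), ContinuousMap.smul_apply, rst_apply hf, smul_eq_mul]

lemma rst_sum {L : Set ℂ} {κ : Type*} (s : Finset κ) {f : κ → ℂ → ℂ} (hf : ∀ i ∈ s, ContinuousOn (f i) L) :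
    rst L (fun z => ∑ i ∈ s, f i z) = ∑ i ∈ s, rst L (f i) := by
  ext z; rw [rst_apply (continuousOn_finset_sum _ hf), ContinuousMap.sum_apply]
  exact Finset.sum_congr rfl fun i hi => (rst_apply (hf i hi) z).symm

lemma rst_RR {E : Finset ℂ} {L : Set ℂ} (hE : ∀ e ∈ E, e ∉ L) (f : RR E) : rst L f = RR.res hE f := by
  ext z; rw [rst_apply (f.continuousOn hE)]; rfl

lemma rst_norm {L : Set ℂ} [CompactSpace L] {f : ℂ → ℂ} {ε : ℝ} (hε : 0 ≤ ε) (h : ∀ z ∈ L, ‖f z‖ ≤ ε) :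
    ‖rst L f‖ ≤ ε := by
  rw [ContinuousMap.norm_le _ hε]
  intro z
  by_cases hf : ContinuousOn f L
  · rw [rst_apply hf]; exact h z z.2
  · simp [rst, hf, hε]

/-- Runge approximation with derivatives -/
lemma RR.W1D {E : Finset ℂ} {L U : Set ℂ} (hL : RC E L) (hU : IsOpen U) (hLU : L ⊆ U)
    {f : ℂ → ℂ} (hf : DifferentiableOn ℂ f U) {ε : ℝ} (hε : 0 < ε) :
    ∃ g : RR E, ∀ z ∈ L, ‖g z - f z‖ < ε ∧ ‖RR.D g z - deriv f z‖ < ε := by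
  obtain ⟨L', hL', hLU', hLi⟩ := NB hL hU hLU
  obtain ⟨δ, hδ, hsub⟩ := hL.1.exists_cthickening_subset_open isOpen_interior hLi
  obtain ⟨g, hg⟩ := RR.W1 hL' hU hLU' hf (ε := min ε (ε * δ / 2)) (by positivity)
  refine ⟨g, fun z hz => ⟨(hg z (interior_subset (hLi hz))).trans_le (min_le_left _ _), ?_⟩⟩
  have hb : Metric.closedBall z δ ⊆ interior L' := (Metric.closedBall_subset_cthickening hz δ).trans hsub
  have hzE : z ∉ E := fun h => hL.2.1 z h hz
  have hcl : closure (Metric.ball z δ) ⊆ interior L' :=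
    (closure_minimal Metric.ball_subset_closedBall Metric.isClosed_closedBall).trans hb
  have hgd : DifferentiableAt ℂ g z := g.differentiableAt hzE
  have hfd : DifferentiableAt ℂ f z := (hf z (hLU hz)).differentiableAt (hU.mem_nhds (hLU hz))
  rw [RR.D_ev _ hzE, ← deriv_sub hgd hfd]
  refine lt_of_le_of_lt (Complex.norm_deriv_le_of_forall_mem_sphere_norm_le (C := ε * δ / 2) hδ ?_ ?_) ?_
  · refine DifferentiableOn.diffContOnCl ?_
    refine (g.differentiableOn fun e he h => ?_).sub (hf.mono fun w hw => hLU' (interior_subset (hcl hw)))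
    exact hL'.2.1 e he (interior_subset (hcl h))
  · intro w hw
    exact ((hg w (interior_subset (hb (Metric.sphere_subset_closedBall hw)))).trans_le (min_le_right _ _)).le
  · rw [div_lt_iff₀ hδ]; nlinarith [mul_pos hε hδ]

namespace PathData
variable {E : Finset ℂ} {W : Set ℂ} {ι : Type} [Fintype ι] (S : PathData E W ι)

/-- bounded extension -/
lemma exists_ext (x : ι → ℂ) (h : BdF W (S.β x)) : ∃ L0, IsCompact L0 ∧ L0 ⊆ W ∧ ∀ L, L0 ⊆ L →
    ∀ (_ : CompactSpace L) (_ : ∀ e ∈ E, e ∉ L), ∃ ℓ : C(L, ℂ) →L[ℂ] ℂ, ∀ f : RR E, ℓ (rst L f) = S.β x f := by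
  obtain ⟨L0, h1, h2, C, hC, hb⟩ := h
  refine ⟨L0, h1, h2, fun L hL _ hE => ?_⟩
  set J : RR E →ₗ[ℂ] C(L, ℂ) := (RR.res hE).toLinearMap with hJ
  have hJb : ∀ f, ‖S.β x f‖ ≤ C * ‖J f‖ := fun f => hb f _ (norm_nonneg _) fun z hz =>
    ContinuousMap.norm_coe_le_norm (J f) ⟨z, hL hz⟩
  have hmem : S.β x ∈ LinearMap.range J.dualMap := by
    rw [LinearMap.range_dualMap_eq_dualAnnihilator_ker, Submodule.mem_dualAnnihilator]
    intro f hf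
    have := hJb f
    rw [LinearMap.mem_ker.1 hf] at this
    simpa using this
  obtain ⟨g, hg⟩ := hmem
  have hg' : ∀ f, g (J f) = S.β x f := fun f => by rw [← hg]; rfl
  set p := LinearMap.range J
  obtain ⟨ℓ, hℓ, -⟩ := exists_extension_norm_eq p ((g.domRestrict p).mkContinuous C (by
    rintro ⟨_, f, rfl⟩
    change ‖g (J f)‖ ≤ _
    rw [hg']; exact hJb f))
  refine ⟨ℓ, fun f => ?_⟩
  rw [rst_RR hE]
  have := hℓ ⟨J f, f, rfl⟩
  rw [← hg' f]
  exact this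

/-- integration by parts for the extended functional -/
lemma ext_ibp {x : ι → ℂ} {L U : Set ℂ} [CompactSpace L] (hL : RC E L) (hab : ∀ α, S.a α ∈ L ∧ S.b α ∈ L)
    {ℓ : C(L, ℂ) →L[ℂ] ℂ} (hℓ : ∀ f : RR E, ℓ (rst L f) = S.β x f) (hU : IsOpen U) (hLU : L ⊆ U)
    {F : ℂ → ℂ} (hF : DifferentiableOn ℂ F U) :
    ℓ (rst L (deriv F)) = ∑ α, x α * (F (S.b α) - F (S.a α)) := by
  have hF' : ContinuousOn (deriv F) L := (hF.deriv hU).continuousOn.mono hLU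
  have key : ∀ ε > 0, ‖ℓ (rst L (deriv F)) - ∑ α, x α * (F (S.b α) - F (S.a α))‖ ≤ (‖ℓ‖ + ∑ α, ‖x α‖ * 2) * ε := by
    intro ε hε
    obtain ⟨g, hg⟩ := RR.W1D hL hU hLU hF hε
    have h1 : ℓ (rst L (RR.D g)) = ∑ α, x α * (g (S.b α) - g (S.a α)) := by
      rw [hℓ, S.β_D]
    have h2 : ℓ (rst L (deriv F)) - ∑ α, x α * (F (S.b α) - F (S.a α)) =
        - ℓ (rst L (fun z => RR.D g z - deriv F z)) +
        ∑ α, x α * ((g (S.b α) - F (S.b α)) - (g (S.a α) - F (S.a α))) := by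
      rw [rst_sub (RR.continuousOn _ hL.2.1) hF', map_sub, h1]
      simp only [mul_sub, Finset.sum_sub_distrib]; ring
    rw [h2, add_mul]
    refine (norm_add_le _ _).trans (add_le_add ?_ ?_)
    · rw [norm_neg]
      refine (ℓ.le_opNorm _).trans ?_
      gcongr
      exact rst_norm hε.le fun z hz => (hg z hz).2.le
    · rw [Finset.sum_mul]
      refine (norm_sum_le _ _).trans (Finset.sum_le_sum fun α _ => ?_)
      rw [norm_mul, mul_assoc]
      gcongr
      rw [two_mul]
      exact (norm_sub_le _ _).trans (add_le_add (hg _ (hab α).2).1.le (hg _ (hab α).1).1.le)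
  refine eq_of_forall_dist_le fun ε hε => ?_
  have hB : 0 ≤ ‖ℓ‖ + ∑ α, ‖x α‖ * 2 := by positivity
  have := key (ε / (‖ℓ‖ + ∑ α, ‖x α‖ * 2 + 1)) (by positivity)
  rw [dist_eq_norm]
  refine this.trans ?_
  rw [mul_div_assoc', div_le_iff₀ (by positivity)]
  nlinarith

end PathData

lemma kern_eq {L : Set ℂ} {ζ : ℂ} (h : ζ ∉ L) : kern L ζ = rst L (fun z => (z - ζ)⁻¹) := by
  ext z
  rw [kern_apply h, rst_apply]
  exact (continuousOn_id.sub continuousOn_const).inv₀ fun z hz h0 => h (by have := sub_eq_zero.1 h0; simp at this; rwa [← this])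

lemma one_sub_slit {w : ℂ} (h : ‖w‖ < 1) : 1 - w ∈ slitPlane := by
  rw [mem_slitPlane_iff]; left
  have := (abs_re_le_norm w).trans_lt h
  rw [abs_lt] at this
  simp; linarith

lemma fd_re {F : ℂ → ℂ} {f z : ℂ} (h : HasDerivAt F f z) :
    HasFDerivAt (fun z => (F z).re) (Complex.reCLM.comp ((ContinuousLinearMap.mul ℝ ℂ) f)) z := by
  have h1 := (h.hasFDerivAt.restrictScalars ℝ)
  have h2 := (Complex.reCLM.hasFDerivAt (x := F z)).comp z h1
  refine h2.congr_fderiv ?_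
  ext v <;> simp [mul_comm]

lemma fd_log {e z : ℂ} (h : z - e ≠ 0) : HasFDerivAt (fun z => Real.log ‖z - e‖)
    (Complex.reCLM.comp ((ContinuousLinearMap.mul ℝ ℂ) (z - e)⁻¹)) z := by
  have h1 : HasDerivAt (fun y => Complex.log ((y - e) / (z - e))) ((z - e)⁻¹) z := by
    have := (((hasDerivAt_id z).sub_const e).div_const (z - e)).clog (by simp [div_self h])
    refine this.congr_deriv ?_
    simp [div_self h]
  have h2 := (fd_re h1).add_const (Real.log ‖z - e‖)
  refine h2.congr_of_eventuallyEq ?_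
  have h3 : ∀ᶠ y in 𝓝 z, y - e ≠ 0 := (continuousAt_id.sub continuousAt_const).eventually_ne h
  filter_upwards [h3] with y hy
  rw [Complex.log_re, norm_div, Real.log_div (norm_ne_zero_iff.2 hy) (norm_ne_zero_iff.2 h)]; ring

lemma Pot.contDiffOn {U : Set ℂ} (hU : IsOpen U) {H : ℂ → ℝ} {f : ℂ → ℂ} (h : Pot U H f)
    (hf : DifferentiableOn ℂ f U) : ContDiffOn ℝ (⊤ : ℕ∞) H U := by
  rw [contDiffOn_infty_iff_fderiv_of_isOpen hU]
  refine ⟨fun z hz => (h z hz).differentiableAt.differentiableWithinAt, ?_⟩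
  have hfa : ContDiffOn ℝ (⊤ : ℕ∞) f U :=
    ((hf.analyticOnNhd hU).restrictScalars (𝕜 := ℝ)).contDiffOn hU.uniqueDiffOn
  have h1 : ContDiffOn ℝ (⊤ : ℕ∞) (fun z => Complex.reCLM.comp ((ContinuousLinearMap.mul ℝ ℂ) (f z))) U :=
    ContDiffOn.clm_comp contDiffOn_const ((ContinuousLinearMap.mul ℝ ℂ).contDiff.comp_contDiffOn hfa)
  exact h1.congr fun z hz => (h z hz).fderiv

namespace PathData
variable {E : Finset ℂ} {W : Set ℂ} {ι : Type} [Fintype ι] (S : PathData E W ι)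

lemma ext_kern {y : ι → ℝ} {L : Set ℂ} [CompactSpace L] (hL : RC E L) (hab : ∀ α, S.a α ∈ L ∧ S.b α ∈ L)
    {ℓ : C(L, ℂ) →L[ℂ] ℂ} (hℓ : ∀ f : RR E, ℓ (rst L f) = S.β (fun α => (y α : ℂ)) f) : ∀ ζ ∉ L,
    (ℓ (kern L ζ)).re = ∑ α, y α * (Real.log ‖S.b α - ζ‖ - Real.log ‖S.a α - ζ‖) := by
  have hre : ∀ F : ℂ → ℂ, (∑ α, (y α : ℂ) * (F (S.b α) - F (S.a α))).re = ∑ α, y α * ((F (S.b α)).re - (F (S.a α)).re) := by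
    intro F
    rw [Complex.re_sum]
    exact Finset.sum_congr rfl fun α _ => by rw [re_ofReal_mul, sub_re]
  refine PP hL _ ?_ ?_ ?_
  · intro ζ0 h0
    obtain ⟨d, hd, hball⟩ := Metric.isOpen_iff.1 hL.1.isClosed.isOpen_compl ζ0 h0
    filter_upwards [Metric.ball_mem_nhds ζ0 hd] with ζ hζ
    have hζL : ζ ∉ L := hball hζ
    rw [mem_ball_iff_norm] at hζ
    set U : Set ℂ := {z | ‖ζ - ζ0‖ < ‖z - ζ0‖} with hU
    have hUo : IsOpen U := isOpen_lt continuous_const (by fun_prop)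
    have hLU : L ⊆ U := fun z hz => by
      by_contra h
      rw [hU, Set.mem_setOf_eq, not_lt] at h
      exact hball (mem_ball_iff_norm.2 (h.trans_lt hζ)) hz
    have n0 : ∀ z ∈ U, z - ζ0 ≠ 0 := fun z hz => norm_pos_iff.1 ((norm_nonneg _).trans_lt hz)
    have n1 : ∀ z ∈ U, z - ζ ≠ 0 := fun z hz h => by
      rw [sub_eq_zero.1 h] at hz; exact lt_irrefl _ (show ‖ζ - ζ0‖ < ‖ζ - ζ0‖ from hz)
    set F : ℂ → ℂ := fun z => Complex.log (1 - (ζ - ζ0) / (z - ζ0)) with hF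
    have e1 : ∀ z ∈ U, 1 - (ζ - ζ0) / (z - ζ0) = (z - ζ) / (z - ζ0) := fun z hz => by
      have := n0 z hz; field_simp; ring
    have hder : ∀ z ∈ U, HasDerivAt F ((z - ζ)⁻¹ - (z - ζ0)⁻¹) z := fun z hz => by
      have h1 : HasDerivAt (fun z => 1 - (ζ - ζ0) / (z - ζ0)) ((ζ - ζ0) / (z - ζ0) ^ 2) z := by
        have := (((hasDerivAt_id z).sub_const ζ0).fun_inv (n0 z hz)).const_mul (ζ - ζ0) |>.const_sub 1
        refine (this.congr_deriv ?_)
        simp; ring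
      have h2 := h1.clog (one_sub_slit (by
        rw [norm_div, div_lt_one (norm_pos_iff.2 (n0 z hz))]; exact hz))
      refine h2.congr_deriv ?_
      rw [e1 z hz]
      have := n0 z hz; have := n1 z hz
      field_simp; ring
    have hFd : DifferentiableOn ℂ F U := fun z hz => (hder z hz).differentiableAt.differentiableWithinAt
    have h1 := S.ext_ibp hL hab hℓ hUo hLU hFd
    rw [rst_congr (g := fun z => (z - ζ)⁻¹ - (z - ζ0)⁻¹) fun z hz => (hder z (hLU hz)).deriv,
      rst_sub, map_sub, ← kern_eq hζL, ← kern_eq h0] at h1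
    · have h2 := congrArg Complex.re h1
      rw [hre, sub_re] at h2
      have e2 : ∀ z ∈ L, (F z).re = Real.log ‖z - ζ‖ - Real.log ‖z - ζ0‖ := fun z hz => by
        simp only [hF]
        rw [Complex.log_re, e1 z (hLU hz), norm_div, Real.log_div]
        · exact norm_ne_zero_iff.2 (n1 z (hLU hz))
        · exact norm_ne_zero_iff.2 (n0 z (hLU hz))
      have h3 : ∑ α, y α * ((F (S.b α)).re - (F (S.a α)).re) =
          ∑ α, y α * (Real.log ‖S.b α - ζ‖ - Real.log ‖S.a α - ζ‖) -
          ∑ α, y α * (Real.log ‖S.b α - ζ0‖ - Real.log ‖S.a α - ζ0‖) := by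
        rw [← Finset.sum_sub_distrib]
        refine Finset.sum_congr rfl fun α _ => ?_
        rw [e2 _ (hab α).1, e2 _ (hab α).2]; ring
      rw [h3] at h2
      constructor <;> intro h <;> linarith
    · exact (continuousOn_id.sub continuousOn_const).inv₀ fun z hz => n1 z (hLU hz)
    · exact (continuousOn_id.sub continuousOn_const).inv₀ fun z hz => n0 z (hLU hz)
  · intro e he
    have h1 : kern L e = rst L (RR.invS he) := by
      rw [kern_eq (hL.2.1 e he)]
      exact rst_congr fun z hz => (RR.ev_invS he fun h => hL.2.1 z h hz).symm
    rw [h1, hℓ, S.β_apply, Complex.re_sum]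
    refine Finset.sum_congr rfl fun α _ => ?_
    rw [re_ofReal_mul, S.ftc α _ (fun z => Real.log ‖z - e‖)]
    intro z hz
    have hze : z - e ≠ 0 := sub_ne_zero.2 fun h => hz (by rw [h]; exact he)
    rw [RR.ev_invS he hz]
    exact fd_log hze
  · obtain ⟨R, hR⟩ := hL.1.isBounded.exists_norm_le
    refine ⟨max R 0 + 1, fun ζ hζ hζL => ?_⟩
    have hζ0 : ζ ≠ 0 := norm_pos_iff.1 (by have := le_max_right R 0; linarith)
    set U : Set ℂ := Metric.ball 0 ‖ζ‖ with hU
    have hLU : L ⊆ U := fun z hz => by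
      rw [hU, mem_ball_zero_iff]; have := hR z hz; have := le_max_left R 0; linarith
    have n1 : ∀ z ∈ U, ζ - z ≠ 0 := fun z hz h => by
      rw [← sub_eq_zero.1 h] at hz; rw [hU, mem_ball_zero_iff] at hz; exact lt_irrefl _ hz
    set F : ℂ → ℂ := fun z => Complex.log (1 - z / ζ) with hF
    have hder : ∀ z ∈ U, HasDerivAt F ((z - ζ)⁻¹) z := fun z hz => by
      have h1 : HasDerivAt (fun z => 1 - z / ζ) (-(1 / ζ)) z := ((hasDerivAt_id z).div_const ζ).const_sub 1
      have h2 := h1.clog (one_sub_slit (by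
        rw [norm_div, div_lt_one (norm_pos_iff.2 hζ0)]; exact mem_ball_zero_iff.1 hz))
      refine h2.congr_deriv ?_
      have := n1 z hz
      have : z - ζ ≠ 0 := fun h => this (by linear_combination -h)
      have : 1 - z / ζ ≠ 0 := by
        rw [one_sub_div hζ0]; exact div_ne_zero (n1 z hz) hζ0
      field_simp; ring
    have hFd : DifferentiableOn ℂ F U := fun z hz => (hder z hz).differentiableAt.differentiableWithinAt
    have h1 := S.ext_ibp hL hab hℓ Metric.isOpen_ball hLU hFd
    rw [rst_congr (g := fun z => (z - ζ)⁻¹) fun z hz => (hder z (hLU hz)).deriv, ← kern_eq hζL] at h1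
    rw [h1, hre]
    have e2 : ∀ z ∈ L, (F z).re = Real.log ‖z - ζ‖ - Real.log ‖ζ‖ := fun z hz => by
      simp only [hF]
      rw [Complex.log_re, one_sub_div hζ0, norm_div, Real.log_div, norm_sub_rev]
      · exact norm_ne_zero_iff.2 (n1 z (hLU hz))
      · exact norm_ne_zero_iff.2 hζ0
    refine Finset.sum_congr rfl fun α _ => ?_
    rw [e2 _ (hab α).1, e2 _ (hab α).2]; ring

open MeasureTheory in
open scoped ContDiff in
/-- Fact 1 -/
lemma fact1 {y : ι → ℝ} {L U : Set ℂ} [CompactSpace L] (hL : RC E L) (hab : ∀ α, S.a α ∈ L ∧ S.b α ∈ L)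
    {ℓ : C(L, ℂ) →L[ℂ] ℂ} (hℓ : ∀ f : RR E, ℓ (rst L f) = S.β (fun α => (y α : ℂ)) f)
    (hU : IsOpen U) (hLU : L ⊆ U) {H : ℂ → ℝ} {h : ℂ → ℂ} (hh : DifferentiableOn ℂ h U) (hH : Pot U H h) :
    (ℓ (rst L h)).re = ∑ α, y α * (H (S.b α) - H (S.a α)) := by
  obtain ⟨χ, hχ, hχc, hχU, N, hN, hLN, hN1⟩ := cutoff hL.1 hU hLU
  have hw : ContDiff ℝ 2 (fun z => χ z • H z) := by
    refine contDiff_cutoff_mul (m := 2) hχ hU hχU ?_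
    exact (hH.contDiffOn hU hh).of_le (by exact_mod_cast le_top)
  have hwc : HasCompactSupport (fun z => χ z • H z) := hχc.smul_right
  set w : ℂ → ℝ := fun z => χ z • H z with hwdef
  have c1 : ∀ v, ContDiff ℝ 1 (fun ζ => fderiv ℝ w ζ v) := fun v =>
    (hw.fderiv_right (m := 1) (by norm_num)).clm_apply contDiff_const
  set f : ℂ → ℂ := fun z => (fderiv ℝ w z 1 : ℂ) - I * (fderiv ℝ w z I : ℂ) with hf
  have hfC : ContDiff ℝ 1 f := by
    have h1 := ofRealCLM.contDiff.comp (c1 1)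
    have h2 := ofRealCLM.contDiff.comp (c1 I)
    exact h1.sub (contDiff_const.mul h2)
  have hfc : HasCompactSupport f := by
    refine (hwc.fderiv (𝕜 := ℝ)).mono ?_
    intro z hz
    by_contra h0
    rw [Function.notMem_support] at h0
    exact hz (by simp [hf, h0])
  have hlap : ∀ z, fderiv ℝ f z 1 + I * fderiv ℝ f z I = (lap w z : ℂ) := by
    intro z
    have d : ∀ v, HasFDerivAt (fun ζ => fderiv ℝ w ζ v) (fderiv ℝ (fun ζ => fderiv ℝ w ζ v) z) z := fun v =>
      ((c1 v).differentiable one_ne_zero z).hasFDerivAt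
    have d1 := (ofRealCLM.hasFDerivAt (x := fderiv ℝ w z 1)).comp z (d 1)
    have d2 := ((ofRealCLM.hasFDerivAt (x := fderiv ℝ w z I)).comp z (d I)).const_mul I
    have d3 : HasFDerivAt f _ z := d1.sub d2
    have hsym : fderiv ℝ (fun ζ => fderiv ℝ w ζ 1) z I = fderiv ℝ (fun ζ => fderiv ℝ w ζ I) z 1 := by
      have hs := (hw.contDiffAt (x := z)).isSymmSndFDerivAt (by simp)
      have hd : DifferentiableAt ℝ (fderiv ℝ w) z :=
        (hw.fderiv_right (m := 1) (by norm_num)).differentiable one_ne_zero z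
      have e : ∀ u v, fderiv ℝ (fun ζ => fderiv ℝ w ζ v) z u = fderiv ℝ (fderiv ℝ w) z u v := by
        intro u v
        rw [fderiv_clm_apply hd (differentiableAt_const v)]
        simp
      rw [e, e]
      exact hs I 1
    rw [d3.fderiv, lap]
    simp only [ContinuousLinearMap.sub_apply, ContinuousLinearMap.comp_apply, ofRealCLM_apply,
      ContinuousLinearMap.smul_apply, smul_eq_mul, hsym]
    push_cast
    linear_combination -((fderiv ℝ (fun ζ => fderiv ℝ w ζ I) z I : ℝ) : ℂ) * I_sq
  have hfh : ∀ z ∈ N ∩ U, f z = h z := by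
    intro z hz
    have h1 : w =ᶠ[𝓝 z] H := by
      filter_upwards [hN.mem_nhds hz.1] with y hy
      simp [hwdef, hN1 y hy]
    simp only [hf]
    rw [h1.fderiv_eq, (hH z hz.2).fderiv]
    simp
    apply Complex.ext <;> simp
  have hm0 : ∀ z ∈ N ∩ U, lap w z = 0 := by
    intro z hz
    have h1 : f =ᶠ[𝓝 z] h := by
      filter_upwards [(hN.inter hU).mem_nhds hz] with y hy using hfh y hy
    have h2 := ((hh z hz.2).differentiableAt (hU.mem_nhds hz.2))
    have h3 : fderiv ℝ f z = (fderiv ℂ h z).restrictScalars ℝ := by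
      rw [h1.fderiv_eq, h2.fderiv_restrictScalars (𝕜 := ℝ)]
    have h4 : fderiv ℂ h z I = I * fderiv ℂ h z 1 := by
      have := (fderiv ℂ h z).map_smul I 1
      simpa using this
    have h5 := hlap z
    rw [h3] at h5
    simp only [ContinuousLinearMap.coe_restrictScalars', h4] at h5
    have h6 : ((lap w z : ℝ) : ℂ) = 0 := by rw [← h5]; linear_combination (fderiv ℂ h z 1) * I_sq
    exact_mod_cast h6
  have hmc : Continuous (lap w) := by
    have h1 := (c1 1).continuous_fderiv one_ne_zero
    have h2 := (c1 I).continuous_fderiv one_ne_zero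
    unfold lap
    fun_prop
  have hms : HasCompactSupport (lap w) := by
    have h1 := (hfc.fderiv (𝕜 := ℝ))
    refine h1.mono ?_
    intro z hz
    by_contra h0
    rw [Function.notMem_support] at h0
    have := hlap z
    rw [h0] at this
    simp at this
    exact hz (by exact_mod_cast this.symm)
  have hnt : Integrable (fun ζ => lap w ζ • kern L ζ) :=
    kern_integrable hL.1 (continuousOn_kern hL.1) hmc hms (hN.inter hU)
      (Set.subset_inter hLN hLU) hm0
  have hhc : ContinuousOn h L := hh.continuousOn.mono hLU
  have hval : ∫ ζ, lap w ζ • kern L ζ = (2 * Real.pi : ℂ) • rst L h := by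
    ext z
    have h1 := (ContinuousMap.evalCLM ℝ z).integral_comp_comm hnt
    simp only [ContinuousMap.evalCLM_apply] at h1
    rw [← h1]
    have h2 := CP hfC hfc z
    rw [hfh z ⟨hLN z.2, hLU z.2⟩] at h2
    rw [ContinuousMap.smul_apply, rst_apply hhc, smul_eq_mul, ← h2]
    congr 1; ext ζ
    rw [hlap]
    by_cases h : ζ ∈ L
    · simp [hm0 ζ ⟨hLN h, hLU h⟩]
    · simp [kern_apply h]
  have h1 := (ℓ.restrictScalars ℝ).integral_comp_comm hnt
  rw [hval] at h1
  have hint2 : Integrable (fun ζ => (ℓ.restrictScalars ℝ) (lap w ζ • kern L ζ)) :=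
    (ℓ.restrictScalars ℝ).integrable_comp hnt
  have h2 := reCLM.integral_comp_comm hint2
  rw [h1] at h2
  have h3 : ∀ ζ, reCLM ((ℓ.restrictScalars ℝ) (lap w ζ • kern L ζ)) =
      ∑ α, y α * (lap w ζ * Real.log ‖S.b α - ζ‖ - lap w ζ * Real.log ‖S.a α - ζ‖) := by
    intro ζ
    by_cases h : ζ ∈ L
    · simp [hm0 ζ ⟨hLN h, hLU h⟩]
    · have := S.ext_kern hL hab hℓ ζ h
      rw [map_smul, map_smul, smul_eq_mul]
      change lap w ζ * (ℓ (kern L ζ)).re = _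
      rw [this, Finset.mul_sum]
      exact Finset.sum_congr rfl fun α _ => by ring
  simp only [h3] at h2
  have hi : ∀ z ∈ L, Integrable (fun ζ => lap w ζ * Real.log ‖z - ζ‖) := by
    intro z hz
    refine kern_integrable (k := fun ζ => Real.log ‖z - ζ‖) hL.1 ?_ hmc hms (hN.inter hU) (Set.subset_inter hLN hLU) hm0
    refine ContinuousOn.log (by fun_prop) fun ζ hζ h0 => hζ ?_
    rw [norm_eq_zero, sub_eq_zero] at h0
    rwa [← h0]
  rw [integral_finset_sum _ fun α _ => by
    simpa using ((hi _ (hab α).2).sub (hi _ (hab α).1)).const_mul (y α)] at h2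
  have hwH : ∀ z ∈ L, w z = H z := fun z hz => by simp [hwdef, hN1 z (hLN hz)]
  have h4 : ∀ α, ∫ ζ, y α * (lap w ζ * Real.log ‖S.b α - ζ‖ - lap w ζ * Real.log ‖S.a α - ζ‖) =
      (2 * Real.pi) * (y α * (H (S.b α) - H (S.a α))) := by
    intro α
    rw [integral_const_mul, integral_sub (hi _ (hab α).2) (hi _ (hab α).1), log_formula hw hwc, log_formula hw hwc,
      hwH _ (hab α).1, hwH _ (hab α).2]
    ring
  simp only [h4] at h2
  rw [← Finset.mul_sum] at h2
  have h5 : (2 * Real.pi) * (ℓ (rst L h)).re = (2 * Real.pi) * ∑ α, y α * (H (S.b α) - H (S.a α)) := by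
    rw [h2]
    change _ = (ℓ ((2 * Real.pi : ℂ) • rst L h)).re
    rw [map_smul, smul_eq_mul]
    have : (2 * Real.pi : ℂ) = ((2 * Real.pi : ℝ) : ℂ) := by push_cast; rfl
    rw [this, re_ofReal_mul]
  exact mul_left_cancel₀ (by positivity) h5

end PathData

/-- the situation of Fact 2 -/
structure F2 {E : Finset ℂ} {W : Set ℂ} {ι : Type} [Fintype ι] (S : PathData E W ι) (L : Set ℂ) [CompactSpace L] {n : ℕ}
    (y : Fin n → ι → ℝ) (ℓ : Fin n → C(L, ℂ) →L[ℂ] ℂ) (q : Polynomial ℂ) (U : Set ℂ) (G : Fin n → ℂ → ℂ) : Prop where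
  hL : RC E L
  hab : ∀ α, S.a α ∈ L ∧ S.b α ∈ L
  hℓ : ∀ j (f : RR E), ℓ j (rst L f) = S.β (fun α => (y j α : ℂ)) f
  hq : q ≠ 0
  hqa : ∀ α, q.eval (S.a α) = 0 ∧ q.eval (S.b α) = 0
  hU : IsOpen U
  hLU : L ⊆ U
  hUE : ∀ e ∈ E, e ∉ U
  hG : ∀ j, DifferentiableOn ℂ (G j) U
  hnull : ∀ z ∈ U, ∑ j, G j z ^ 2 = 0
  hnv : ∀ z ∈ L, ∃ j, G j z ≠ 0
  star : ∀ j l, ∀ r : RR E, ℓ j (rst L (fun z => q.eval z * r z * G l z)) = ℓ l (rst L (fun z => q.eval z * r z * G j z))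

namespace F2
variable {E : Finset ℂ} {W : Set ℂ} {ι : Type} [Fintype ι] {S : PathData E W ι} {L : Set ℂ} [CompactSpace L] {n : ℕ}
    {y : Fin n → ι → ℝ} {ℓ : Fin n → C(L, ℂ) →L[ℂ] ℂ} {q : Polynomial ℂ} {U : Set ℂ} {G : Fin n → ℂ → ℂ}

lemma star' (h : F2 S L y ℓ q U G) (j l : Fin n) {V : Set ℂ} (hV : IsOpen V) (hLV : L ⊆ V) {r : ℂ → ℂ}
    (hr : DifferentiableOn ℂ r V) :
    ℓ j (rst L (fun z => q.eval z * r z * G l z)) = ℓ l (rst L (fun z => q.eval z * r z * G j z)) := by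
  have hGc : ∀ j, ContinuousOn (G j) L := fun j => (h.hG j).continuousOn.mono h.hLU
  have hrc : ContinuousOn r L := hr.continuousOn.mono hLV
  have hqc : ContinuousOn (fun z => q.eval z) L := q.continuous.continuousOn
  obtain ⟨Bq, hBq0, hBq⟩ := cpt_bound h.hL.1 hqc
  have hBG : ∀ l, ∃ B : ℝ, 0 ≤ B ∧ ∀ z ∈ L, ‖G l z‖ ≤ B := fun l => cpt_bound h.hL.1 (hGc l)
  have key : ∀ j l : Fin n, ∃ B : ℝ, 0 ≤ B ∧ ∀ ε : ℝ, 0 < ε → ∀ g : RR E, (∀ z ∈ L, ‖g z - r z‖ < ε) →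
      ‖ℓ j (rst L (fun z => q.eval z * g z * G l z)) - ℓ j (rst L (fun z => q.eval z * r z * G l z))‖ ≤ B * ε := by
    intro j l
    obtain ⟨BG, hBG0, hBG⟩ := hBG l
    refine ⟨‖ℓ j‖ * (Bq * BG), by positivity, fun ε hε g hg => ?_⟩
    rw [← map_sub, ← rst_sub (f := fun z => q.eval z * g z * G l z) (g := fun z => q.eval z * r z * G l z)]
    · refine ((ℓ j).le_opNorm _).trans ?_
      rw [mul_assoc]
      gcongr
      refine rst_norm (by positivity) fun z hz => ?_
      have : q.eval z * g z * G l z - q.eval z * r z * G l z = q.eval z * (g z - r z) * G l z := by ring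
      rw [this, norm_mul, norm_mul]
      have h1 := hBq z hz; have h2 := hBG z hz; have h3 := (hg z hz).le
      calc ‖q.eval z‖ * ‖g z - r z‖ * ‖G l z‖ ≤ Bq * ε * BG := by gcongr
        _ = _ := by ring
    · exact (hqc.mul (g.continuousOn h.hL.2.1)).mul (hGc l)
    · exact (hqc.mul hrc).mul (hGc l)
  obtain ⟨B1, hB1, k1⟩ := key j l
  obtain ⟨B2, hB2, k2⟩ := key l j
  refine eq_of_forall_dist_le fun ε hε => ?_
  obtain ⟨g, hg⟩ := RR.W1 h.hL hV hLV hr (ε := ε / (B1 + B2 + 1)) (by positivity)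
  have e1 := k1 _ (by positivity) g hg
  have e2 := k2 _ (by positivity) g hg
  rw [h.star j l g] at e1
  rw [← dist_eq_norm, dist_comm] at e1
  rw [← dist_eq_norm] at e2
  refine (dist_triangle _ _ _).trans ((add_le_add e1 e2).trans ?_)
  rw [← add_mul, mul_div_assoc', div_le_iff₀ (by positivity)]
  nlinarith

lemma dd (h : F2 S L y ℓ q U G) (j l : Fin n) {V : Set ℂ} (hV : IsOpen V) (hLV : L ⊆ V) {r : ℂ → ℂ}
    (hr : DifferentiableOn ℂ r V) :
    ℓ j (rst L (fun z => q.eval z ^ 2 * r z * deriv (G l) z)) = ℓ l (rst L (fun z => q.eval z ^ 2 * r z * deriv (G j) z)) := by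
  set V' := V ∩ U with hV'
  have hVo : IsOpen V' := hV.inter h.hU
  have hLV' : L ⊆ V' := Set.subset_inter hLV h.hLU
  have hGc : ∀ j, ContinuousOn (G j) L := fun j => (h.hG j).continuousOn.mono h.hLU
  have hGc' : ∀ j, ContinuousOn (deriv (G j)) L := fun j => ((h.hG j).deriv h.hU).continuousOn.mono h.hLU
  have hrc : ContinuousOn r L := hr.continuousOn.mono hLV
  have hrd : DifferentiableOn ℂ (deriv r) V := hr.deriv hV
  have hqc : ContinuousOn (fun z => q.eval z) L := q.continuous.continuousOn
  set s : ℂ → ℂ := fun z => 2 * q.derivative.eval z * r z + q.eval z * deriv r z with hs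
  have hsd : DifferentiableOn ℂ s V :=
    ((q.derivative.differentiable.differentiableOn.const_mul 2).mul hr).add (q.differentiable.differentiableOn.mul hrd)
  have hsc : ContinuousOn s L := hsd.continuousOn.mono hLV
  have key : ∀ j l : Fin n, ℓ j (rst L (fun z => q.eval z * s z * G l z)) +
      ℓ j (rst L (fun z => q.eval z ^ 2 * r z * deriv (G l) z)) = 0 := by
    intro j l
    have hd : ∀ z ∈ V', HasDerivAt (fun z => q.eval z ^ 2 * r z * G l z)
        (q.eval z * s z * G l z + q.eval z ^ 2 * r z * deriv (G l) z) z := fun z hz => by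
      have h1 := (q.hasDerivAt z).pow 2
      have h2 := ((hr z hz.1).differentiableAt (hV.mem_nhds hz.1)).hasDerivAt
      have h3 := ((h.hG l z hz.2).differentiableAt (h.hU.mem_nhds hz.2)).hasDerivAt
      refine ((h1.mul h2).mul h3).congr_deriv ?_
      simp only [hs, Pi.mul_apply, Pi.pow_apply]
      push_cast; ring
    have h1 := S.ext_ibp h.hL h.hab (h.hℓ j) hVo hLV' (fun z hz => (hd z hz).differentiableAt.differentiableWithinAt)
    rw [rst_congr fun z hz => (hd z (hLV' hz)).deriv, rst_add, map_add] at h1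
    · rw [h1]
      refine Finset.sum_eq_zero fun α _ => ?_
      simp [(h.hqa α).1, (h.hqa α).2]
    · exact (hqc.mul hsc).mul (hGc l)
    · exact ((hqc.pow 2).mul hrc).mul (hGc' l)
  have e1 := key j l
  have e2 := key l j
  rw [h.star' j l hV hLV hsd] at e1
  exact add_left_cancel (e1.trans e2.symm)

lemma ww (h : F2 S L y ℓ q U G) (j l m : Fin n) {V : Set ℂ} (hV : IsOpen V) (hLV : L ⊆ V) {r : ℂ → ℂ}
    (hr : DifferentiableOn ℂ r V) :
    ℓ j (rst L (fun z => q.eval z ^ 2 * r z * (G l z * deriv (G m) z - G m z * deriv (G l) z))) = 0 := by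
  set V' := V ∩ U with hV'
  have hVo : IsOpen V' := hV.inter h.hU
  have hLV' : L ⊆ V' := Set.subset_inter hLV h.hLU
  have hGV : ∀ j, DifferentiableOn ℂ (G j) V' := fun j => (h.hG j).mono Set.inter_subset_right
  have hGV' : ∀ j, DifferentiableOn ℂ (deriv (G j)) V' := fun j => ((h.hG j).deriv h.hU).mono Set.inter_subset_right
  have hrV := hr.mono (Set.inter_subset_left : V' ⊆ V)
  have hqV : DifferentiableOn ℂ (fun z => q.eval z) V' := q.differentiable.differentiableOn
  have e1 := h.star' j l hVo hLV' ((hqV.mul hrV).mul (hGV' m))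
  have e2 := h.dd l m hVo hLV' (hrV.mul (hGV j))
  have e3 := h.star' m j hVo hLV' ((hqV.mul hrV).mul (hGV' l))
  have f1 : rst L (fun z => q.eval z ^ 2 * r z * (G l z * deriv (G m) z - G m z * deriv (G l) z)) =
      rst L (fun z => q.eval z * (q.eval z * r z * deriv (G m) z) * G l z) -
      rst L (fun z => q.eval z * (q.eval z * r z * deriv (G l) z) * G m z) := by
    rw [← rst_sub]
    · exact rst_congr fun z _ => by ring
    · exact ((hqV.mul ((hqV.mul hrV).mul (hGV' m))).mul (hGV l)).continuousOn.mono hLV'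
    · exact ((hqV.mul ((hqV.mul hrV).mul (hGV' l))).mul (hGV m)).continuousOn.mono hLV'
  rw [f1, map_sub, sub_eq_zero]
  refine e1.trans (Eq.trans ?_ (e2.trans (Eq.trans ?_ e3)))
  · exact congrArg _ (rst_congr fun z _ => by simp only [Pi.mul_apply]; ring)
  · exact congrArg _ (rst_congr fun z _ => by simp only [Pi.mul_apply]; ring)

end F2

open Classical in
lemma pw_diff {C U2 : Set ℂ} (hC : IsOpen C) (hU2 : IsOpen U2) (hd : Disjoint C U2) {f1 f2 : ℂ → ℂ}
    (h1 : DifferentiableOn ℂ f1 C) (h2 : DifferentiableOn ℂ f2 U2) :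
    DifferentiableOn ℂ (fun z => if z ∈ C then f1 z else f2 z) (C ∪ U2) := by
  rintro z (hz | hz)
  · have := (h1 z hz).differentiableAt (hC.mem_nhds hz)
    refine (this.congr_of_eventuallyEq ?_).differentiableWithinAt
    filter_upwards [hC.mem_nhds hz] with w hw
    simp [hw]
  · have := (h2 z hz).differentiableAt (hU2.mem_nhds hz)
    refine (this.congr_of_eventuallyEq ?_).differentiableWithinAt
    filter_upwards [hU2.mem_nhds hz] with w hw
    have : w ∉ C := fun h => hd.le_bot ⟨h, hw⟩
    simp [this]

namespace F2
variable {E : Finset ℂ} {W : Set ℂ} {ι : Type} [Fintype ι] {S : PathData E W ι} {L : Set ℂ} [CompactSpace L] {n : ℕ}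
    {y : Fin n → ι → ℝ} {ℓ : Fin n → C(L, ℂ) →L[ℂ] ℂ} {q : Polynomial ℂ} {U : Set ℂ} {G : Fin n → ℂ → ℂ}

open Classical in
lemma comp (h : F2 S L y ℓ q U G) {C U2 : Set ℂ} (hC : IsOpen C) (hU2 : IsOpen U2) (hd : Disjoint C U2)
    (hU : U = C ∪ U2) (hpre : IsPreconnected C) (hne : (C ∩ L).Nonempty) :
    ∃ Q : Polynomial ℂ, Q ≠ 0 ∧ ∀ f : RR E, (∀ α, (S.Γ α f).re = 0) → (∃ g, f = RR.P Q * g) →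
      ∀ j, ℓ j (rst L (fun z => if z ∈ C then f z else 0)) = 0 := by
  have hCU : C ⊆ U := by rw [hU]; exact Set.subset_union_left
  have hUE : ∀ z ∈ U, z ∉ E := fun z hz he => h.hUE z he hz
  have hGC : ∀ j, DifferentiableOn ℂ (G j) C := fun j => (h.hG j).mono hCU
  by_cases hflat : ∃ l m, ∃ z ∈ C, G l z * deriv (G m) z - G m z * deriv (G l) z ≠ 0
  · obtain ⟨l, m, z1, hz1, hw⟩ := hflat
    set w : ℂ → ℂ := fun z => G l z * deriv (G m) z - G m z * deriv (G l) z with hwd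
    have hwC : DifferentiableOn ℂ w C := ((hGC l).mul ((hGC m).deriv hC)).sub ((hGC m).mul ((hGC l).deriv hC))
    set u : ℂ → ℂ := fun z => if z ∈ C then w z else 1 with hu
    have hud : DifferentiableOn ℂ u U := by
      rw [hU]; exact pw_diff hC hU2 hd hwC (differentiableOn_const 1)
    obtain ⟨U0, v, a1, a2, a3, a4, a5⟩ := ZF h.hU h.hL.1 h.hLU hud (by
      intro z hz hev
      by_cases hzC : z ∈ C
      · have hev' : ∀ᶠ x in 𝓝 z, w x = 0 := by
          filter_upwards [hev, hC.mem_nhds hzC] with x hx hxC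
          simpa [hu, hxC] using hx
        exact hw ((hwC.analyticOnNhd hC).eqOn_zero_of_preconnected_of_eventuallyEq_zero hpre hzC hev' hz1)
      · have := hev.self_of_nhds
        simp [hu, hzC] at this)
    refine ⟨q ^ 2 * U0, mul_ne_zero (pow_ne_zero _ h.hq) a1, ?_⟩
    rintro f - ⟨g, rfl⟩ j
    set C' : Set ℂ := {z ∈ C | v z ≠ 0} with hC'
    have hC'o : IsOpen C' := (a3.mono hCU).continuousOn.isOpen_inter_preimage hC isOpen_ne
    have hLV : L ⊆ C' ∪ U2 := fun z hz => by
      have := h.hLU hz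
      rw [hU] at this
      rcases this with h1 | h1
      · exact Or.inl ⟨h1, a4 z hz⟩
      · exact Or.inr h1
    have hr := pw_diff hC'o hU2 (hd.mono_left fun z hz => hz.1) (f1 := fun z => g z / v z) (f2 := fun _ => 0)
      ((g.differentiableOn fun e he h' => h.hUE e he (hCU h'.1)).div (a3.mono fun z hz => hCU hz.1) fun z hz => hz.2)
      (differentiableOn_const 0)
    refine Eq.trans (congrArg _ (rst_congr fun z hz => ?_)) (h.ww j l m (hC'o.union hU2) hLV hr)
    by_cases hzC : z ∈ C
    · have h1 := a5 z
      have h2 := a4 z hz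
      have h3 : z ∈ C' := ⟨hzC, h2⟩
      simp only [hu, hzC, if_true, hwd] at h1
      simp only [hzC, h3, if_true]
      rw [h1, RR.ev_mul, RR.ev_P _ (hUE z (hCU hzC))]
      simp only [Polynomial.eval_mul, Polynomial.eval_pow]
      field_simp
    · have h3 : z ∉ C' := fun h => hzC h.1
      simp [hzC, h3]
  · push Not at hflat
    obtain ⟨z0, hz0C, hz0L⟩ := hne
    obtain ⟨m, hm⟩ := h.hnv z0 hz0L
    set κ : Fin n → ℂ := fun l => G l z0 / G m z0 with hκ
    have hκG : ∀ l, ∀ z ∈ C, G l z = κ l * G m z := by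
      intro l
      have hev : ∀ᶠ z in 𝓝 z0, G l z - κ l * G m z = 0 := by
        have hcm : ContinuousAt (G m) z0 := (hGC m).continuousOn.continuousAt (hC.mem_nhds hz0C)
        obtain ⟨ρ, hρ, hρC⟩ := Metric.mem_nhds_iff.1 (inter_mem (hC.mem_nhds hz0C) (hcm.eventually_ne hm))
        have hd0 : ∀ z ∈ Metric.ball z0 ρ, HasDerivAt (fun z => G l z / G m z) 0 z := fun z hz => by
          have hzC := (hρC hz).1
          have hzm : G m z ≠ 0 := (hρC hz).2
          have d1 := ((hGC l z hzC).differentiableAt (hC.mem_nhds hzC)).hasDerivAt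
          have d2 := ((hGC m z hzC).differentiableAt (hC.mem_nhds hzC)).hasDerivAt
          refine (d1.div d2 hzm).congr_deriv ?_
          rw [div_eq_zero_iff]; left
          linear_combination hflat m l z hzC
        filter_upwards [Metric.ball_mem_nhds z0 hρ] with z hz
        have := (convex_ball z0 ρ).is_const_of_fderivWithin_eq_zero (𝕜 := ℂ) (f := fun z => G l z / G m z)
          (fun x hx => (hd0 x hx).differentiableAt.differentiableWithinAt) (fun x hx => by
            rw [fderivWithin_of_isOpen Metric.isOpen_ball hx, (hd0 x hx).hasFDerivAt.fderiv]
            ext; simp) hz (Metric.mem_ball_self hρ)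
        have hzm : G m z ≠ 0 := (hρC hz).2
        simp only [hκ]
        rw [← this]; field_simp; ring
      intro z hz
      have := (((hGC l).sub ((hGC m).const_mul (κ l))).analyticOnNhd hC).eqOn_zero_of_preconnected_of_eventuallyEq_zero
        hpre hz0C hev hz
      exact sub_eq_zero.1 this
    have hκm : κ m = 1 := div_self hm
    have hnr : ∃ j, (κ j).im ≠ 0 := by
      by_contra hcon
      push Not at hcon
      have h1 : ∑ j, κ j ^ 2 = 0 := by
        have := h.hnull z0 (hCU hz0C)
        simp only [hκ, div_pow]
        rw [← Finset.sum_div, this, zero_div]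
      have h2 : ∑ j, (κ j).re ^ 2 = 0 := by
        have := congrArg Complex.re h1
        rw [Complex.re_sum] at this
        rw [← Complex.zero_re, ← this]
        refine Finset.sum_congr rfl fun j _ => ?_
        rw [pow_two, pow_two, mul_re, hcon j]; ring
      have h3 := (Finset.sum_eq_zero_iff_of_nonneg fun j _ => sq_nonneg _).1 h2 m (Finset.mem_univ _)
      rw [hκm] at h3
      norm_num at h3
    obtain ⟨j1, hj1⟩ := hnr
    have hGm : ∀ z ∈ C ∩ L, G m z ≠ 0 := fun z hz h0 => by
      obtain ⟨j, hj⟩ := h.hnv z hz.2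
      exact hj (by rw [hκG j z hz.1, h0, mul_zero])
    refine ⟨q, h.hq, ?_⟩
    intro f hf hfg j
    set fC : ℂ → ℂ := fun z => if z ∈ C then f z else 0 with hfC
    have hfCd : DifferentiableOn ℂ fC U := by
      rw [hU]
      exact pw_diff hC hU2 hd (f.differentiableOn fun e he h' => h.hUE e he (hCU h')) (differentiableOn_const 0)
    have hre : ∀ j, (ℓ j (rst L fC)).re = 0 := by
      intro j
      obtain ⟨H, hH, hH0⟩ := S.g4 f hf
      rw [S.fact1 h.hL h.hab (h.hℓ j) h.hU h.hLU hfCd (H := fun z => if z ∈ C then H z else 0)]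
      · refine Finset.sum_eq_zero fun α _ => ?_
        simp [(hH0 α).1, (hH0 α).2]
      · intro z hz
        rw [hU] at hz
        rcases hz with hz | hz
        · refine (HasFDerivAt.congr_of_eventuallyEq (f := H) ?_ ?_)
          · have := hH z (hUE z (hCU hz))
            simpa [hfC, hz] using this
          · filter_upwards [hC.mem_nhds hz] with w hw
            simp [hw]
        · have hzC : z ∉ C := fun h => hd.le_bot ⟨h, hz⟩
          refine (HasFDerivAt.congr_of_eventuallyEq (f := fun _ => (0 : ℝ)) ?_ ?_)
          · have := hasFDerivAt_const (𝕜 := ℝ) (0 : ℝ) z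
            simpa [hfC, hzC] using this
          · filter_upwards [hU2.mem_nhds hz] with w hw
            have : w ∉ C := fun h => hd.le_bot ⟨h, hw⟩
            simp [this]
    obtain ⟨g, rfl⟩ := hfg
    set C' : Set ℂ := {z ∈ C | G m z ≠ 0} with hC'
    have hC'o : IsOpen C' := (hGC m).continuousOn.isOpen_inter_preimage hC isOpen_ne
    have hLV : L ⊆ C' ∪ U2 := fun z hz => by
      have := h.hLU hz
      rw [hU] at this
      rcases this with h1 | h1
      · exact Or.inl ⟨h1, hGm z ⟨h1, hz⟩⟩
      · exact Or.inr h1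
    have hr := pw_diff hC'o hU2 (hd.mono_left fun z hz => hz.1) (f1 := fun z => g z / G m z) (f2 := fun _ => 0)
      ((g.differentiableOn fun e he h' => h.hUE e he (hCU h'.1)).div ((hGC m).mono fun z hz => hz.1) fun z hz => hz.2)
      (differentiableOn_const 0)
    have hst : ∀ j, ℓ j (rst L fC) = κ j * ℓ m (rst L fC) := by
      intro j
      have e1 := h.star' j m (hC'o.union hU2) hLV hr
      have hfcc : ContinuousOn fC L := hfCd.continuousOn.mono h.hLU
      rw [← smul_eq_mul, ← map_smul, ← rst_smul _ hfcc]
      refine (Eq.trans ?_ e1).trans ?_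
      · refine congrArg _ (rst_congr fun z hz => ?_)
        by_cases hzC : z ∈ C
        · have h2 := hGm z ⟨hzC, hz⟩
          have h3 : z ∈ C' := ⟨hzC, h2⟩
          simp only [hfC, hzC, h3, if_true, RR.ev_mul, RR.ev_P _ (hUE z (hCU hzC))]
          field_simp
        · have h3 : z ∉ C' := fun h => hzC h.1
          simp [hfC, hzC, h3]
      · refine congrArg _ (rst_congr fun z hz => ?_)
        by_cases hzC : z ∈ C
        · have h2 := hGm z ⟨hzC, hz⟩
          have h3 : z ∈ C' := ⟨hzC, h2⟩
          simp only [hfC, hzC, h3, if_true, RR.ev_mul, RR.ev_P _ (hUE z (hCU hzC)), hκG j z hzC]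
          field_simp
        · have h3 : z ∉ C' := fun h => hzC h.1
          simp [hfC, hzC, h3]
    have hm0 : ℓ m (rst L fC) = 0 := by
      have e1 := hre m
      have e2 := hre j1
      rw [hst j1, mul_re, e1, mul_zero, zero_sub, neg_eq_zero, mul_eq_zero] at e2
      exact Complex.ext e1 (e2.resolve_left hj1)
    rw [hst j, hm0, mul_zero]

end F2

namespace F2
variable {E : Finset ℂ} {W : Set ℂ} {ι : Type} [Fintype ι] {S : PathData E W ι} {L : Set ℂ} [CompactSpace L] {n : ℕ}
    {y : Fin n → ι → ℝ} {ℓ : Fin n → C(L, ℂ) →L[ℂ] ℂ} {q : Polynomial ℂ} {U : Set ℂ} {G : Fin n → ℂ → ℂ}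

open Classical in
theorem zero (h : F2 S L y ℓ q U G) : y = 0 := by
  set c : ℂ → Set ℂ := fun z => connectedComponentIn U z with hc
  have hco : ∀ z, IsOpen (c z) := fun z => h.hU.connectedComponentIn
  have hcU : ∀ z, c z ⊆ U := fun z => connectedComponentIn_subset U z
  have hcm : ∀ z ∈ U, z ∈ c z := fun z hz => mem_connectedComponentIn hz
  have hceq : ∀ z w, w ∈ c z → c z = c w := fun z w hw => connectedComponentIn_eq hw
  obtain ⟨T, hTL, hT⟩ := h.hL.1.elim_nhds_subcover c (fun z hz => (hco z).mem_nhds (hcm z (h.hLU hz)))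
  have hcomp : ∀ t ∈ T, ∃ Q : Polynomial ℂ, Q ≠ 0 ∧ ∀ f : RR E, (∀ α, (S.Γ α f).re = 0) → (∃ g, f = RR.P Q * g) →
      ∀ j, ℓ j (rst L (fun z => if z ∈ c t then f z else 0)) = 0 := by
    intro t ht
    refine h.comp (hco t) (U2 := U \ c t) ?_ Set.disjoint_sdiff_right (Set.union_sdiff_cancel (hcU t)).symm
      isPreconnected_connectedComponentIn ⟨t, hcm t (h.hLU (hTL t ht)), hTL t ht⟩
    refine isOpen_iff_mem_nhds.2 fun z hz => ?_
    filter_upwards [(hco z).mem_nhds (hcm z hz.1)] with w hw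
    refine ⟨hcU z hw, fun hw' => hz.2 ?_⟩
    rw [hceq t w hw', ← hceq z w hw]
    exact hcm z hz.1
  choose! Q hQ0 hQ using hcomp
  set QQ : Polynomial ℂ := ∏ t ∈ T, Q t with hQQ
  have hQQ0 : QQ ≠ 0 := Finset.prod_ne_zero_iff.2 hQ0
  set CC : Finset (Set ℂ) := T.image c with hCC
  have main : ∀ f : RR E, (∀ α, (S.Γ α f).re = 0) → (∃ g, f = RR.P QQ * g) → ∀ j, ℓ j (rst L f) = 0 := by
    rintro f hf ⟨g, hg⟩ j
    have hcont : ∀ C ∈ CC, ContinuousOn (fun z => if z ∈ C then f z else 0) L := by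
      intro C hC
      obtain ⟨t, ht, rfl⟩ := Finset.mem_image.1 hC
      have hO : IsOpen (U \ c t) := by
        refine isOpen_iff_mem_nhds.2 fun z hz => ?_
        filter_upwards [(hco z).mem_nhds (hcm z hz.1)] with w hw
        refine ⟨hcU z hw, fun hw' => hz.2 ?_⟩
        rw [hceq t w hw', ← hceq z w hw]
        exact hcm z hz.1
      have := pw_diff (hco t) hO Set.disjoint_sdiff_right (f1 := f) (f2 := fun _ => 0)
        (f.differentiableOn fun e he h' => h.hUE e he (hcU t h')) (differentiableOn_const 0)
      rw [Set.union_sdiff_cancel (hcU t)] at this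
      exact this.continuousOn.mono h.hLU
    have e1 : rst L f = ∑ C ∈ CC, rst L (fun z => if z ∈ C then f z else 0) := by
      rw [← rst_sum _ hcont]
      refine rst_congr fun z hz => ?_
      obtain ⟨t, ht, hzt⟩ := Set.mem_iUnion₂.1 (hT hz)
      rw [Finset.sum_eq_single (c t)]
      · simp [hzt]
      · intro C hC hne
        obtain ⟨s, hs, rfl⟩ := Finset.mem_image.1 hC
        rw [if_neg]
        exact fun hzs => hne ((hceq s z hzs).trans (hceq t z hzt).symm)
      · exact fun hn => absurd (Finset.mem_image_of_mem c ht) hn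
    rw [e1, map_sum]
    refine Finset.sum_eq_zero fun C hC => ?_
    obtain ⟨t, ht, rfl⟩ := Finset.mem_image.1 hC
    refine hQ t ht f hf ?_ j
    refine ⟨RR.P (∏ s ∈ T.erase t, Q s) * g, ?_⟩
    rw [hg, hQQ, ← Finset.mul_prod_erase T Q ht, map_mul]
    ring
  funext j α0
  obtain ⟨ω, hω⟩ := S.indep (RR.P QQ) (RR.P_ne hQQ0) (Pi.single α0 I)
  have := main (RR.P QQ * ω) (fun α => by
    rw [hω α]
    by_cases hα : α = α0
    · subst hα; simp
    · simp [hα]) ⟨ω, rfl⟩ j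
  rw [h.hℓ j, S.β_apply] at this
  simp only [hω] at this
  rw [Finset.sum_eq_single α0 (by intro b _ hb; simp [hb]) (by simp)] at this
  simpa using this

end F2

/-- fold of elementary moves -/
def fld {V κ : Type*} [AddCommGroup V] [Module ℝ V] (v w : κ → V → V) (t : κ → ℝ) (l : List κ) (h : V) : V :=
  l.foldr (fun k x => x + t k • v k x + (t k) ^ 2 • w k x) h

lemma fld_deriv {V κ : Type*} [NormedAddCommGroup V] [NormedSpace ℝ V] [Fintype κ]
    (v w : κ → V → V) (hv : ∀ k, ContDiff ℝ 1 (v k)) (hw : ∀ k, ContDiff ℝ 1 (w k)) (l : List κ) :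
    fld v w 0 l 0 = 0 ∧ HasStrictFDerivAt (fun p : (κ → ℝ) × V => fld v w p.1 l p.2)
      (ContinuousLinearMap.snd ℝ (κ → ℝ) V + (l.map fun k =>
        ((ContinuousLinearMap.proj (R := ℝ) (φ := fun _ : κ => ℝ) k).comp
          (ContinuousLinearMap.fst ℝ (κ → ℝ) V)).smulRight (v k 0)).sum) 0 := by
  induction l with
  | nil =>
    refine ⟨rfl, ?_⟩
    simpa [fld] using (hasStrictFDerivAt_snd (𝕜 := ℝ) (E := κ → ℝ) (F := V) (p := 0))
  | cons k l ih =>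
    obtain ⟨ih1, ih2⟩ := ih
    refine ⟨by simp only [fld, List.foldr_cons] at ih1 ⊢; simp [ih1], ?_⟩
    have ht : HasStrictFDerivAt (fun p : (κ → ℝ) × V => p.1 k)
        ((ContinuousLinearMap.proj (R := ℝ) (φ := fun _ : κ => ℝ) k).comp
          (ContinuousLinearMap.fst ℝ (κ → ℝ) V)) 0 :=
      ((ContinuousLinearMap.proj (R := ℝ) (φ := fun _ : κ => ℝ) k).comp
          (ContinuousLinearMap.fst ℝ (κ → ℝ) V)).hasStrictFDerivAt
    have hx0 : fld v w (0 : (κ → ℝ) × V).1 l (0 : (κ → ℝ) × V).2 = 0 := ih1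
    have hvk : HasStrictFDerivAt (v k) (fderiv ℝ (v k) 0) (fld v w (0 : (κ → ℝ) × V).1 l (0 : (κ → ℝ) × V).2) := by
      rw [hx0]; exact ((hv k).contDiffAt).hasStrictFDerivAt one_ne_zero
    have hwk : HasStrictFDerivAt (w k) (fderiv ℝ (w k) 0) (fld v w (0 : (κ → ℝ) × V).1 l (0 : (κ → ℝ) × V).2) := by
      rw [hx0]; exact ((hw k).contDiffAt).hasStrictFDerivAt one_ne_zero
    have h1 := ht.smul (hvk.comp (0 : (κ → ℝ) × V) ih2)
    have h2 := (ht.pow 2).smul (hwk.comp (0 : (κ → ℝ) × V) ih2)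
    refine ((ih2.add h1).add h2).congr_fderiv ?_
    ext p <;> simp [hx0, add_comm, add_left_comm, ih1]

lemma ift {V T κ : Type*} [NormedAddCommGroup V] [NormedSpace ℝ V] [CompleteSpace V] [NormedAddCommGroup T]
    [NormedSpace ℝ T] [FiniteDimensional ℝ T] [Fintype κ] [DecidableEq κ]
    (v w : κ → V → V) (hv : ∀ k, ContDiff ℝ 1 (v k)) (hw : ∀ k, ContDiff ℝ 1 (w k)) (Λ : V →L[ℝ] T)
    (hs : Submodule.span ℝ (Set.range fun k => Λ (v k 0)) = ⊤) {η : ℝ} (hη : 0 < η) :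
    ∃ δ : ℝ, 0 < δ ∧ ∀ h : V, ‖h‖ < δ → ∃ t : κ → ℝ, ‖fld v w t Finset.univ.toList h‖ < η ∧
      Λ (fld v w t Finset.univ.toList h) = 0 := by
  have : CompleteSpace T := FiniteDimensional.complete ℝ T
  obtain ⟨h0, h1⟩ := fld_deriv v w hv hw Finset.univ.toList
  have h2 := ((Λ.hasStrictFDerivAt (x := fld v w 0 Finset.univ.toList 0)).comp (0 : (κ → ℝ) × V) h1).prodMk
    (hasStrictFDerivAt_snd (𝕜 := ℝ) (E := κ → ℝ) (F := V) (p := 0))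
  have h3 := h2.map_nhds_eq_of_surj (by
    rw [LinearMap.range_eq_top]
    rintro ⟨a, δ⟩
    have ha : a - Λ δ ∈ Submodule.span ℝ (Set.range fun k => Λ (v k 0)) := by rw [hs]; trivial
    obtain ⟨c, hc⟩ := (Submodule.mem_span_range_iff_exists_fun ℝ).1 ha
    refine ⟨(c, δ), ?_⟩
    refine Prod.ext ?_ (by simp)
    have : (List.map (fun k => ((ContinuousLinearMap.proj (R := ℝ) (φ := fun _ : κ => ℝ) k).comp
          (ContinuousLinearMap.fst ℝ (κ → ℝ) V)).smulRight (v k 0)) Finset.univ.toList).sum =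
        ∑ k, ((ContinuousLinearMap.proj (R := ℝ) (φ := fun _ : κ => ℝ) k).comp
          (ContinuousLinearMap.fst ℝ (κ → ℝ) V)).smulRight (v k 0) := Finset.sum_map_toList _ _
    simp only [this]
    simp [hc])
  have hc : ∀ᶠ p in 𝓝 (0 : (κ → ℝ) × V), ‖fld v w p.1 Finset.univ.toList p.2‖ < η := by
    have := h1.continuousAt.norm
    refine this.eventually_lt continuousAt_const ?_
    change ‖fld v w 0 Finset.univ.toList 0‖ < η
    rw [h0]; simpa using hη
  have h4 := Filter.image_mem_map (m := fun p : (κ → ℝ) × V => (Λ (fld v w p.1 Finset.univ.toList p.2), p.2)) hc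
  have hz : (Λ (fld v w (0 : (κ → ℝ) × V).1 Finset.univ.toList (0 : (κ → ℝ) × V).2), (0 : (κ → ℝ) × V).2) = (0 : T × V) := by
    change (Λ (fld v w 0 Finset.univ.toList 0), (0 : V)) = 0
    rw [h0]; simp
  have h5 := h3.ge h4
  rw [hz] at h5
  obtain ⟨δ, hδ, hb⟩ := Metric.mem_nhds_iff.1 h5
  refine ⟨δ, hδ, fun h hh => ?_⟩
  have hm : ((0 : T), h) ∈ Metric.ball (0 : T × V) δ := by
    rw [mem_ball_zero_iff, Prod.norm_def]
    simpa [hδ] using hh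
  obtain ⟨p, hp, he⟩ := hb hm
  obtain ⟨e1, e2⟩ := Prod.mk.inj he
  subst e2
  exact ⟨p.1, hp, e1⟩

/-- type of a shear -/
structure Sh (n : ℕ) where
  j : Fin n
  k : Fin n
  l : Fin n
  ε : ℂ
  hjk : j ≠ k
  hjl : j ≠ l
  hkl : k ≠ l
  hε : ε * ε = -1

namespace Sh
variable {n : ℕ} (d : Sh n) {A B : Type*} [CommRing A] [Algebra ℂ A] [CommRing B] [Algebra ℂ B]

/-- the increment of a shear -/
def H (y : A) (G : Fin n → A) (r : A) (m : Fin n) : A :=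
  if m = d.l then -(r * (G d.j + d.ε • G d.k)) else
  if m = d.j then r * G d.l - (1 / 2 : ℂ) • (y * r ^ 2 * (G d.j + d.ε • G d.k)) else
  if m = d.k then d.ε • (r * G d.l - (1 / 2 : ℂ) • (y * r ^ 2 * (G d.j + d.ε • G d.k))) else 0

lemma H_l (y : A) (G : Fin n → A) (r : A) : d.H y G r d.l = -(r * (G d.j + d.ε • G d.k)) := by simp [H]
lemma H_j (y : A) (G : Fin n → A) (r : A) : d.H y G r d.j =
    r * G d.l - (1 / 2 : ℂ) • (y * r ^ 2 * (G d.j + d.ε • G d.k)) := by simp [H, d.hjl]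
lemma H_k (y : A) (G : Fin n → A) (r : A) : d.H y G r d.k =
    d.ε • (r * G d.l - (1 / 2 : ℂ) • (y * r ^ 2 * (G d.j + d.ε • G d.k))) := by simp [H, d.hkl, d.hjk.symm]
lemma H_o (y : A) (G : Fin n → A) (r : A) {m : Fin n} (h1 : m ≠ d.l) (h2 : m ≠ d.j) (h3 : m ≠ d.k) :
    d.H y G r m = 0 := by simp [H, h1, h2, h3]

lemma H0_j (G : Fin n → A) (r : A) : d.H 0 G r d.j = r * G d.l := by simp [H_j]
lemma H0_k (G : Fin n → A) (r : A) : d.H 0 G r d.k = d.ε • (r * G d.l) := by simp [H_k]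

lemma H_map (F : A →ₐ[ℂ] B) (y : A) (G : Fin n → A) (r : A) (m : Fin n) :
    F (d.H y G r m) = d.H (F y) (fun i => F (G i)) (F r) m := by
  unfold H
  split_ifs <;> simp

lemma sum3 {M : Type*} [AddCommMonoid M] (s : Fin n → M) (hs : ∀ m, m ≠ d.l → m ≠ d.j → m ≠ d.k → s m = 0) :
    ∑ m, s m = s d.l + (s d.j + s d.k) := by
  classical
  rw [← Finset.sum_subset (Finset.subset_univ {d.l, d.j, d.k})]
  · rw [Finset.sum_insert (by simp [d.hjl.symm, d.hkl.symm]), Finset.sum_insert (by simp [d.hjk]), Finset.sum_singleton]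
  · intro m _ hm
    simp only [Finset.mem_insert, Finset.mem_singleton, not_or] at hm
    exact hs m hm.1 hm.2.1 hm.2.2

lemma null (y : A) (G : Fin n → A) (r : A) :
    ∑ m, (G m + y * d.H y G r m) ^ 2 = ∑ m, G m ^ 2 := by
  rw [← sub_eq_zero, ← Finset.sum_sub_distrib, d.sum3]
  · rw [H_l, H_j, H_k]
    have h1 : (algebraMap ℂ A d.ε) * (algebraMap ℂ A d.ε) = -1 := by rw [← map_mul, d.hε]; simp
    have h2 : 2 * (algebraMap ℂ A (1 / 2)) = 1 := by
      have : (2 : A) = algebraMap ℂ A 2 := (map_ofNat _ 2).symm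
      rw [this, ← map_mul]; norm_num
    simp only [Algebra.smul_def]
    generalize algebraMap ℂ A d.ε = e at *
    generalize algebraMap ℂ A (1 / 2) = c at *
    linear_combination (y * (r * G d.l - c * (y * r ^ 2 * (G d.j + e * G d.k)))) ^ 2 * h1
      - (y * r) ^ 2 * (G d.j + e * G d.k) ^ 2 * h2
  · intro m h1 h2 h3
    rw [d.H_o _ _ _ h1 h2 h3]; ring

lemma nv (y : ℂ) (G : Fin n → ℂ) (r : ℂ) (h : ∀ m, G m + y * d.H y G r m = 0) : ∀ m, G m = 0 := by
  have hl := h d.l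
  have hj := h d.j
  have hk := h d.k
  rw [H_l] at hl
  rw [H_j] at hj
  rw [H_k] at hk
  simp only [smul_eq_mul] at hl hj hk
  have hφ : G d.j + d.ε * G d.k = 0 := by
    linear_combination hj + d.ε * hk - y * (r * G d.l - 1 / 2 * (y * r ^ 2 * (G d.j + d.ε * G d.k))) * d.hε
  rw [hφ] at hl hj hk
  have h1 : G d.l = 0 := by simpa using hl
  rw [h1] at hj hk
  intro m
  by_cases m1 : m = d.l
  · rw [m1, h1]
  by_cases m2 : m = d.j
  · rw [m2]; simpa using hj
  by_cases m3 : m = d.k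
  · rw [m3]; simpa using hk
  have := h m
  rw [d.H_o _ _ _ m1 m2 m3] at this
  simpa using this

lemma H_smul [Module ℝ A] [IsScalarTower ℝ ℂ A] (y : A) (G : Fin n → A) (r : A) (t : ℝ) :
    d.H y G (t • r) = t • d.H 0 G r + t ^ 2 • (d.H y G r - d.H 0 G r) := by
  have ht : ∀ (s : ℝ) (x : A), s • x = algebraMap ℂ A s * x := fun s x => by
    rw [← Algebra.smul_def, ← one_smul ℂ x, ← smul_assoc]; simp
  funext m
  simp only [Pi.add_apply, Pi.smul_apply, Pi.sub_apply]
  unfold H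
  split_ifs <;> simp only [ht, Algebra.smul_def] <;> push_cast <;> (try simp only [map_pow]) <;> ring

end Sh

/-- invariant of the construction -/
structure Stt {E : Finset ℂ} {n : ℕ} (L : Set ℂ) (q Z0 : Polynomial ℂ) (P0 : Fin n → Polynomial ℂ) (f : Fin n → ℂ → ℂ)
    (F : Fin n → RR E) (γ : Fin n → C(L, ℂ)) : Prop where
  null : ∑ m, (RR.P Z0 * F m + RR.P (P0 m)) ^ 2 = 0
  nv : ∀ z ∉ E, ∃ m, (RR.P Z0 * F m + RR.P (P0 m) : RR E) z ≠ 0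
  app : ∀ m, ∃ (U : Set ℂ) (h : ℂ → ℂ), IsOpen U ∧ L ⊆ U ∧ DifferentiableOn ℂ h U ∧
    (∀ z ∈ U, F m z = f m z + q.eval z * h z) ∧ ∀ z : L, γ m z = h z

/-- the data on compact sets -/
def GA {n : ℕ} (L : Set ℂ) (q Z0 : Polynomial ℂ) (P0 : Fin n → Polynomial ℂ) (f : Fin n → ℂ → ℂ)
    (γ : Fin n → C(L, ℂ)) (m : Fin n) : C(L, ℂ) :=
  rst L (fun z => Z0.eval z) * (rst L (f m) + rst L (fun z => q.eval z) * γ m) + rst L (fun z => (P0 m).eval z)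

lemma Stt.step {E : Finset ℂ} {n : ℕ} {L : Set ℂ} {q Z0 : Polynomial ℂ} {P0 : Fin n → Polynomial ℂ} {f : Fin n → ℂ → ℂ}
    {F : Fin n → RR E} {γ : Fin n → C(L, ℂ)} (h : Stt L q Z0 P0 f F γ) (hE : ∀ e ∈ E, e ∉ L)
    (hf : ∀ m, ContinuousOn (f m) L) (d : Sh n) (r : RR E) :
    Stt L q Z0 P0 f (fun m => F m + RR.P q * d.H (RR.P Z0 * RR.P q) (fun m => RR.P Z0 * F m + RR.P (P0 m)) r m)
      (fun m => γ m + d.H (rst L (fun z => Z0.eval z) * rst L (fun z => q.eval z)) (GA L q Z0 P0 f γ) (rst L r) m) := by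
  have hG : ∀ m, RR.P Z0 * (F m + RR.P q * d.H (RR.P Z0 * RR.P q) (fun m => RR.P Z0 * F m + RR.P (P0 m)) r m) + RR.P (P0 m)
      = (RR.P Z0 * F m + RR.P (P0 m)) + (RR.P Z0 * RR.P q) *
        d.H (RR.P Z0 * RR.P q) (fun m => RR.P Z0 * F m + RR.P (P0 m)) r m := fun m => by ring
  refine ⟨?_, ?_, ?_⟩
  · simp only [hG]
    rw [d.null]; exact h.null
  · intro z hz
    by_contra hcon
    push Not at hcon
    obtain ⟨m, hm⟩ := h.nv z hz
    refine hm ?_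
    have := d.nv (RR.evA hz (RR.P Z0 * RR.P q)) (fun m => RR.evA hz (RR.P Z0 * F m + RR.P (P0 m))) (RR.evA hz r) (fun m => by
      have := hcon m
      rw [hG] at this
      rw [← d.H_map]
      rw [← map_mul, ← map_add]; exact this) m
    exact this
  · intro m
    obtain ⟨U, g, hU, hLU, hg, hFg, hγ⟩ := h.app m
    refine ⟨U ∩ (E : Set ℂ)ᶜ, fun z => g z + d.H (RR.P Z0 * RR.P q) (fun m => RR.P Z0 * F m + RR.P (P0 m)) r m z,
      hU.inter E.finite_toSet.isClosed.isOpen_compl, fun z hz => ⟨hLU hz, fun he => hE z he hz⟩, ?_, ?_, ?_⟩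
    · exact (hg.mono Set.inter_subset_left).add (RR.differentiableOn _ fun e he h => h.2 he)
    · intro z hz
      have hzE : z ∉ E := hz.2
      rw [RR.ev_add, RR.ev_mul, RR.ev_P _ hzE, hFg z hz.1]
      ring
    · intro z
      have hzE : (z : ℂ) ∉ E := fun he => hE z he z.2
      rw [ContinuousMap.add_apply, hγ]
      congr 1
      have e1 := d.H_map (ContinuousMap.evalAlgHom ℂ ℂ z) (rst L (fun z => Z0.eval z) * rst L (fun z => q.eval z))
        (GA L q Z0 P0 f γ) (rst L r) m
      have e2 := d.H_map (RR.evA hzE) (RR.P Z0 * RR.P q) (fun m => RR.P Z0 * F m + RR.P (P0 m)) r m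
      refine e1.trans (Eq.trans ?_ e2.symm)
      have c1 : (ContinuousMap.evalAlgHom ℂ ℂ z) (rst L (fun z => Z0.eval z) * rst L (fun z => q.eval z)) =
          RR.evA hzE (RR.P Z0 * RR.P q) := by
        change (rst L (fun z => Z0.eval z) * rst L (fun z => q.eval z)) z = (RR.P Z0 * RR.P q : RR E) z
        rw [ContinuousMap.mul_apply, rst_apply Z0.continuous.continuousOn, rst_apply q.continuous.continuousOn,
          RR.ev_mul, RR.ev_P _ hzE, RR.ev_P _ hzE]
      have c2 : (ContinuousMap.evalAlgHom ℂ ℂ z) (rst L r) = RR.evA hzE r := by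
        change (rst L r) z = r z
        rw [rst_apply (r.continuousOn hE)]
      have c3 : ∀ i, (ContinuousMap.evalAlgHom ℂ ℂ z) (GA L q Z0 P0 f γ i) = RR.evA hzE (RR.P Z0 * F i + RR.P (P0 i)) := by
        intro i
        obtain ⟨U', g', hU', hLU', hg', hFg', hγ'⟩ := h.app i
        change (GA L q Z0 P0 f γ i) z = (RR.P Z0 * F i + RR.P (P0 i) : RR E) z
        rw [RR.ev_add, RR.ev_mul, RR.ev_P _ hzE, RR.ev_P _ hzE, hFg' z (hLU' z.2), ← hγ', GA]
        rw [ContinuousMap.add_apply, ContinuousMap.mul_apply, ContinuousMap.add_apply, ContinuousMap.mul_apply,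
          rst_apply Z0.continuous.continuousOn, rst_apply q.continuous.continuousOn,
          rst_apply (P0 i).continuous.continuousOn, rst_apply (hf i)]
      rw [c1, c2]
      simp only [c3]

/-- the problem data -/
structure Prb {E : Finset ℂ} {W : Set ℂ} {ι : Type} [Fintype ι] (S : PathData E W ι) {n : ℕ} (q Z0 : Polynomial ℂ)
    (P0 : Fin n → Polynomial ℂ) (f : Fin n → ℂ → ℂ) (Xt : Fin n → ℂ → ℝ) : Prop where
  hn : 3 ≤ n
  hW : Dom E W
  hq : q ≠ 0
  hqa : ∀ α, q.eval (S.a α) = 0 ∧ q.eval (S.b α) = 0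
  hqW : ∀ a, q.eval a = 0 → a ∈ W
  hZ : Z0 ≠ 0
  hZW : ∀ a, Z0.eval a = 0 → a ∈ W
  hf : ∀ m, DifferentiableOn ℂ (f m) W
  hnull : ∀ z ∈ W, ∑ m, (Z0.eval z * f m z + (P0 m).eval z) ^ 2 = 0
  hnv : ∀ z ∈ W, ∃ m, Z0.eval z * f m z + (P0 m).eval z ≠ 0
  hX : ∀ m, Pot W (Xt m) (f m)

lemma exists_third {n : ℕ} (hn : 3 ≤ n) (j l : Fin n) : ∃ k, k ≠ j ∧ k ≠ l := by
  classical
  have : ∃ k ∈ (Finset.univ : Finset (Fin n)), k ∉ ({j, l} : Finset (Fin n)) := by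
    refine Finset.exists_mem_notMem_of_card_lt_card ?_
    have := Finset.card_le_two (a := j) (b := l)
    rw [Finset.card_univ, Fintype.card_fin]
    omega
  obtain ⟨k, -, hk⟩ := this
  simp only [Finset.mem_insert, Finset.mem_singleton, not_or] at hk
  exact ⟨k, hk.1, hk.2⟩

lemma clm_pi_fin {n d : ℕ} (D : (Fin n → Fin d → ℝ) →ₗ[ℝ] ℝ) :
    ∃ y : Fin n → Fin d → ℝ, ∀ x, D x = ∑ m, ∑ i, y m i * x m i := by
  classical
  refine ⟨fun m i => D (Pi.single m (Pi.single i 1)), fun x => ?_⟩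
  conv_lhs => rw [show x = ∑ m, ∑ i, x m i • (Pi.single m (Pi.single i 1) : Fin n → Fin d → ℝ) from by
    funext m i
    simp only [Finset.sum_apply, Pi.smul_apply, smul_eq_mul]
    rw [Finset.sum_eq_single m, Finset.sum_eq_single i]
    · simp
    · intro b _ hb; simp [hb.symm]
    · simp
    · intro b _ hb; simp [hb.symm]
    · simp]
  simp only [map_sum, map_smul, smul_eq_mul]
  exact Finset.sum_congr rfl fun m _ => Finset.sum_congr rfl fun i _ => mul_comm _ _

namespace Prb
variable {E : Finset ℂ} {W : Set ℂ} {ι : Type} [Fintype ι] {S : PathData E W ι} {n : ℕ} {q Z0 : Polynomial ℂ}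
    {P0 : Fin n → Polynomial ℂ} {f : Fin n → ℂ → ℂ} {Xt : Fin n → ℂ → ℝ}

/-- the surjectivity of the linearisation -/
lemma surj (p : Prb S q Z0 P0 f Xt) {L : Set ℂ} [CompactSpace L] (hL : RC E L) (hLW : L ⊆ W)
    (hab : ∀ α, S.a α ∈ L ∧ S.b α ∈ L) {d : ℕ} (b : Fin d → ι → ℝ) (hb : LinearIndependent ℝ b)
    (ℓ : Fin d → C(L, ℂ) →L[ℂ] ℂ) (hℓ : ∀ i (f : RR E), ℓ i (rst L f) = S.β (fun α => (b i α : ℂ)) f)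
    (Λ : (Fin n → C(L, ℂ)) →ₗ[ℝ] (Fin n → Fin d → ℝ))
    (hΛ : ∀ γ m i, Λ γ m i = (ℓ i (rst L (fun z => q.eval z) * γ m)).re) :
    Submodule.span ℝ (Set.range fun x : Sh n × RR E => Λ (x.1.H 0 (GA L q Z0 P0 f 0) (rst L x.2))) = ⊤ := by
  by_contra hne
  obtain ⟨D, hD0, hD⟩ := Submodule.exists_le_ker_of_lt_top _ (lt_top_iff_ne_top.2 hne)
  obtain ⟨y, hy⟩ := clm_pi_fin D
  have hker : ∀ x : Sh n × RR E, D (Λ (x.1.H 0 (GA L q Z0 P0 f 0) (rst L x.2))) = 0 := fun x =>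
    hD (Submodule.subset_span ⟨x, rfl⟩)
  set G : Fin n → ℂ → ℂ := fun m z => Z0.eval z * f m z + (P0 m).eval z with hG
  have hGd : ∀ m, DifferentiableOn ℂ (G m) W := fun m =>
    (Z0.differentiable.differentiableOn.mul (p.hf m)).add (P0 m).differentiable.differentiableOn
  have hGA : ∀ m, GA L q Z0 P0 f 0 m = rst L (G m) := by
    intro m
    have hfc := (p.hf m).continuousOn.mono hLW
    ext z
    rw [GA, ContinuousMap.add_apply, ContinuousMap.mul_apply, ContinuousMap.add_apply, ContinuousMap.mul_apply,
      rst_apply Z0.continuous.continuousOn, rst_apply (P0 m).continuous.continuousOn, rst_apply hfc,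
      rst_apply ((hGd m).continuousOn.mono hLW)]
    simp [hG]
  set ℓ' : Fin n → C(L, ℂ) →L[ℂ] ℂ := fun m => ∑ i, (y m i : ℂ) • ℓ i with hℓ'
  have hD' : ∀ γ, D (Λ γ) = (∑ m, ℓ' m (rst L (fun z => q.eval z) * γ m)).re := by
    intro γ
    rw [hy, Complex.re_sum]
    refine Finset.sum_congr rfl fun m _ => ?_
    simp only [hℓ', ContinuousLinearMap.sum_apply, ContinuousLinearMap.smul_apply, smul_eq_mul, Complex.re_sum,
      Complex.re_ofReal_mul, hΛ]
  have h2 : F2 S L (fun m α => ∑ i, y m i * b i α) ℓ' q W G := by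
    refine ⟨hL, hab, ?_, p.hq, p.hqa, p.hW.op, hLW, p.hW.dis, hGd, p.hnull, fun z hz => p.hnv z (hLW hz), ?_⟩
    · intro j g
      simp only [hℓ', ContinuousLinearMap.sum_apply, ContinuousLinearMap.smul_apply, smul_eq_mul, hℓ, S.β_apply]
      push_cast
      simp only [Finset.mul_sum, Finset.sum_mul]
      rw [Finset.sum_comm]
      exact Finset.sum_congr rfl fun _ _ => Finset.sum_congr rfl fun _ _ => by ring
    · -- star
      have hrw : ∀ (r : RR E) (m : Fin n), rst L (fun z => q.eval z * r z * G m z) =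
          rst L (fun z => q.eval z) * (rst L r * GA L q Z0 P0 f 0 m) := by
        intro r m
        have c1 := r.continuousOn hL.2.1
        have c2 := (hGd m).continuousOn.mono hLW
        have c3 : ContinuousOn (fun z => q.eval z) L := q.continuous.continuousOn
        ext z
        rw [hGA, ContinuousMap.mul_apply, ContinuousMap.mul_apply, rst_apply c1, rst_apply c2, rst_apply c3,
          rst_apply (f := fun z => q.eval z * r z * G m z) ((c3.mul c1).mul c2), mul_assoc]
      set Q := rst L (fun z => q.eval z) with hQ
      set GG := GA L q Z0 P0 f 0 with hGG
      have key : ∀ (s : Sh n) (r : RR E), ℓ' s.j (Q * (rst L r * GG s.l)) - ℓ' s.l (Q * (rst L r * GG s.j)) +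
          s.ε * (ℓ' s.k (Q * (rst L r * GG s.l)) - ℓ' s.l (Q * (rst L r * GG s.k))) = 0 := by
        intro s
        set B : RR E → ℂ := fun r => ℓ' s.j (Q * (rst L r * GG s.l)) - ℓ' s.l (Q * (rst L r * GG s.j)) +
          s.ε * (ℓ' s.k (Q * (rst L r * GG s.l)) - ℓ' s.l (Q * (rst L r * GG s.k))) with hB
        have hre : ∀ r, (B r).re = 0 := by
          intro r
          rw [← hker (s, r), hD', s.sum3]
          · rw [s.H_l, s.H0_j, s.H0_k]
            congr 1
            simp only [hB,  mul_neg, map_neg, mul_add, map_add, mul_smul_comm, map_smul,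
              smul_eq_mul]
            ring
          · intro m h1 h2 h3
            rw [s.H_o _ _ _ h1 h2 h3]; simp
        have hI : ∀ r, B (I • r) = I * B r := by
          intro r
          have : rst L (⇑(I • r)) = I • rst L r := by
            rw [← rst_smul I (r.continuousOn hL.2.1)]
            exact rst_congr fun z _ => by simp
          simp only [hB, this, smul_mul_assoc, mul_smul_comm, map_smul, smul_eq_mul]
          ring
        intro r
        refine Complex.ext (hre r) ?_
        have := hre (I • r)
        rw [hI] at this
        have h5 : (B r).im = 0 := by simpa only [mul_re, I_re, I_im, zero_mul, one_mul, zero_sub, neg_eq_zero] using this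
        exact h5
      intro j l r
      rw [hrw, hrw]
      by_cases hjl : j = l
      · rw [hjl]
      obtain ⟨k, hkj, hkl⟩ := exists_third p.hn j l
      have e1 := key ⟨j, k, l, I, hkj.symm, hjl, hkl, by simp⟩ r
      have e2 := key ⟨j, k, l, -I, hkj.symm, hjl, hkl, by simp⟩ r
      simp only at e1 e2
      linear_combination (e1 + e2) / 2
  have h3 := h2.zero
  have h4 : y = 0 := by
    funext m
    have := Fintype.linearIndependent_iff.1 hb (y m) (by
      funext α
      have := congrFun (congrFun h3 m) α
      simpa [Finset.sum_apply] using this)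
    funext i; exact this i
  exact hD0 (LinearMap.ext fun x => by rw [hy, h4]; simp)
end Prb

lemma H_contDiff {n : ℕ} (d : Sh n) {L : Set ℂ} [CompactSpace L] (q Z0 : Polynomial ℂ) (P0 : Fin n → Polynomial ℂ)
    (f : Fin n → ℂ → ℂ) (y r : C(L, ℂ)) : ContDiff ℝ 1 (fun γ : Fin n → C(L, ℂ) => d.H y (GA L q Z0 P0 f γ) r) := by
  have hG : ∀ m, ContDiff ℝ 1 (fun γ : Fin n → C(L, ℂ) => GA L q Z0 P0 f γ m) := by
    intro m
    unfold GA
    exact (contDiff_const.mul (contDiff_const.add (contDiff_const.mul (contDiff_apply ℝ _ m)))).add contDiff_const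
  have hs : ∀ (c : ℂ) (g : (Fin n → C(L, ℂ)) → C(L, ℂ)), ContDiff ℝ 1 g → ContDiff ℝ 1 fun γ => c • g γ :=
    fun c g hg => hg.const_smul c
  rw [contDiff_pi]
  intro m
  unfold Sh.H
  have hφ := (hG d.j).add (hs d.ε _ (hG d.k))
  have h2 : ContDiff ℝ 1 fun γ : Fin n → C(L, ℂ) => r * GA L q Z0 P0 f γ d.l -
      (1 / 2 : ℂ) • (y * r ^ 2 * (GA L q Z0 P0 f γ d.j + d.ε • GA L q Z0 P0 f γ d.k)) :=
    (contDiff_const.mul (hG d.l)).sub (hs _ _ (contDiff_const.mul hφ))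
  split_ifs
  · exact (contDiff_const.mul hφ).neg
  · exact h2
  · exact hs _ _ h2
  · exact contDiff_const

/-- the real bounded functionals -/
def bdSub {E : Finset ℂ} {W : Set ℂ} {ι : Type} [Fintype ι] (S : PathData E W ι) : Submodule ℝ (ι → ℝ) where
  carrier := {y | BdF W (S.β (fun α => (y α : ℂ)))}
  zero_mem' := by
    have : S.β (fun α => ((0 : ι → ℝ) α : ℂ)) = 0 := by ext f; simp [S.β_apply]
    show BdF W _
    rw [this]; exact BdF.zero
  add_mem' := by
    intro a b ha hb
    have : S.β (fun α => ((a + b) α : ℂ)) = S.β (fun α => (a α : ℂ)) + S.β (fun α => (b α : ℂ)) := by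
      ext f; simp [S.β_apply, add_mul, Finset.sum_add_distrib]
    show BdF W _
    rw [this]; exact BdF.add ha hb
  smul_mem' := by
    intro c a ha
    have : S.β (fun α => ((c • a) α : ℂ)) = (c : ℂ) • S.β (fun α => (a α : ℂ)) := by
      ext f; simp [S.β_apply, Finset.mul_sum, mul_assoc]
    show BdF W _
    rw [this]; exact BdF.smul _ ha

namespace Prb
variable {E : Finset ℂ} {W : Set ℂ} {ι : Type} [Fintype ι] {S : PathData E W ι} {n : ℕ} {q Z0 : Polynomial ℂ}
    {P0 : Fin n → Polynomial ℂ} {f : Fin n → ℂ → ℂ} {Xt : Fin n → ℂ → ℝ}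

/-- the initial rational approximation -/
lemma strt (p : Prb S q Z0 P0 f Xt) {L : Set ℂ} [CompactSpace L] (hL : RC E L) (hne : L.Nonempty) (hLW : L ⊆ W)
    (hqL : ∀ a, (q * Z0).eval a = 0 → a ∈ L) {δ : ℝ} (hδ : 0 < δ) :
    ∃ (F : Fin n → RR E) (γ : Fin n → C(L, ℂ)), Stt L q Z0 P0 f F γ ∧ ‖γ‖ < δ := by
  set G : Fin n → ℂ → ℂ := fun m z => Z0.eval z * f m z + (P0 m).eval z with hG
  have hGd : ∀ m, DifferentiableOn ℂ (G m) W := fun m =>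
    (Z0.differentiable.differentiableOn.mul (p.hf m)).add (P0 m).differentiable.differentiableOn
  obtain ⟨G', h1, h2, h3⟩ := LemA hL hne p.hW.op hLW p.hn hGd p.hnull (fun z hz => p.hnv z (hLW hz)) (q * Z0)
    (mul_ne_zero p.hq p.hZ) hqL (half_pos hδ)
  have hdiv : ∀ m, ∃ (ω : RR E) (g : C(L, ℂ)), G' m - RR.P (P0 m) = RR.P Z0 * ω ∧ ‖g‖ ≤ δ / 2 ∧
      ∃ (U : Set ℂ) (h : ℂ → ℂ), IsOpen U ∧ L ⊆ U ∧ DifferentiableOn ℂ h U ∧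
    (∀ z ∈ U, ω z = f m z + q.eval z * h z) ∧ ∀ z : L, g z = h z := by
    intro m
    obtain ⟨U, h, hU, hLU, hh, hUh, hhL⟩ := h3 m
    set V := U ∩ W with hV
    have hVo : IsOpen V := hU.inter p.hW.op
    have hVE : ∀ z ∈ V, z ∉ E := fun z hz he => p.hW.dis z he hz.2
    have hLV : L ⊆ V := fun z hz => ⟨hLU hz, hLW hz⟩
    have hcd : DifferentiableOn ℂ (fun z => f m z + q.eval z * h z) V :=
      ((p.hf m).mono Set.inter_subset_right).add (q.differentiable.differentiableOn.mul (hh.mono Set.inter_subset_left))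
    have heq : ∀ z ∈ V, (G' m - RR.P (P0 m) : RR E) z = Z0.eval z * (f m z + q.eval z * h z) := by
      intro z hz
      rw [RR.ev_sub, RR.ev_P _ (hVE z hz), hUh z hz.1]
      simp only [hG, Polynomial.eval_mul]; ring
    obtain ⟨ω, hω⟩ := RRdiv hVo Z0 p.hZ (fun a ha _ => hLV (hqL a (by simp [ha]))) (G' m - RR.P (P0 m)) _ hcd.continuousOn
      (fun z hz _ => heq z hz)
    have hhc : ContinuousOn h L := hh.continuousOn.mono hLU
    refine ⟨ω, rst L h, hω, rst_norm (by positivity) hhL, V, h, hVo, hLV, hh.mono Set.inter_subset_left, ?_, ?_⟩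
    · intro z hz
      have hc1 : ContinuousAt ω z := (ω.differentiableAt (hVE z hz)).continuousAt
      have hc2 : ContinuousAt (fun z => f m z + q.eval z * h z) z := hcd.continuousOn.continuousAt (hVo.mem_nhds hz)
      refine tendsto_nhds_unique_of_eventuallyEq (hc1.tendsto.mono_left nhdsWithin_le_nhds)
        (hc2.tendsto.mono_left (nhdsWithin_le_nhds (s := {z}ᶜ))) ?_
      have hfin : ∀ᶠ x in 𝓝[≠] z, Z0.eval x ≠ 0 := by
        have : (Z0.rootSet ℂ).Finite := Z0.rootSet_finite ℂ
        have h5 : (Z0.rootSet ℂ \ {z})ᶜ ∈ 𝓝 z := (this.sdiff.isClosed.isOpen_compl).mem_nhds (by simp)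
        filter_upwards [nhdsWithin_le_nhds h5, self_mem_nhdsWithin] with x hx hxz h0
        refine hx ⟨?_, hxz⟩
        rw [Polynomial.mem_rootSet]
        exact ⟨p.hZ, by simpa using h0⟩
      filter_upwards [hfin, nhdsWithin_le_nhds (hVo.mem_nhds hz)] with x hx hxV
      have h6 := heq x hxV
      rw [hω, RR.ev_mul, RR.ev_P _ (hVE x hxV)] at h6
      exact mul_left_cancel₀ hx h6
    · intro z; exact rst_apply hhc z
  choose F γ hF hγ happ using hdiv
  have hGF : ∀ m, RR.P Z0 * F m + RR.P (P0 m) = G' m := fun m => by rw [← hF]; ring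
  refine ⟨F, γ, ⟨?_, ?_, happ⟩, ?_⟩
  · simp only [hGF]; exact h1
  · intro z hz
    obtain ⟨m, hm⟩ := h2 z hz
    exact ⟨m, by rw [hGF]; exact hm⟩
  · exact lt_of_le_of_lt ((pi_norm_le_iff_of_nonneg (by positivity)).2 hγ) (half_lt_self hδ)

end Prb

lemma Stt.fold {E : Finset ℂ} {n : ℕ} {L : Set ℂ} [CompactSpace L] {q Z0 : Polynomial ℂ} {P0 : Fin n → Polynomial ℂ}
    {f : Fin n → ℂ → ℂ}
    {F : Fin n → RR E} {γ : Fin n → C(L, ℂ)} (h : Stt L q Z0 P0 f F γ) (hE : ∀ e ∈ E, e ∉ L)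
    (hf : ∀ m, ContinuousOn (f m) L) {κ : Type} (D : κ → Sh n × RR E) (t : κ → ℝ) (l : List κ) :
    ∃ F' : Fin n → RR E, Stt L q Z0 P0 f F' (fld (fun k x => (D k).1.H 0 (GA L q Z0 P0 f x) (rst L (D k).2))
      (fun k x => (D k).1.H (rst L (fun z => Z0.eval z) * rst L (fun z => q.eval z)) (GA L q Z0 P0 f x) (rst L (D k).2) -
        (D k).1.H 0 (GA L q Z0 P0 f x) (rst L (D k).2)) t l γ) := by
  induction l with
  | nil => exact ⟨F, h⟩
  | cons k l ih =>
    obtain ⟨F', hF'⟩ := ih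
    have hs := hF'.step hE hf (D k).1 ((t k : ℂ) • (D k).2)
    refine ⟨fun m => F' m + RR.P q * (D k).1.H (RR.P Z0 * RR.P q) (fun m => RR.P Z0 * F' m + RR.P (P0 m))
      ((t k : ℂ) • (D k).2) m, ?_⟩
    · convert hs using 1
      have e1 : rst L (⇑((t k : ℂ) • (D k).2)) = t k • rst L (D k).2 := by
        have c1 := (D k).2.continuousOn hE
        have : rst L (⇑((t k : ℂ) • (D k).2)) = (t k : ℂ) • rst L (D k).2 := by
          rw [← rst_smul _ c1]
          exact rst_congr fun z _ => by rw [RR.ev_smul]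
        rw [this]
        ext z; simp
      rw [e1, (D k).1.H_smul]
      simp only [fld, List.foldr_cons]
      rw [add_assoc]
      rfl

namespace Prb
variable {E : Finset ℂ} {W : Set ℂ} {ι : Type} [Fintype ι] {S : PathData E W ι} {n : ℕ} {q Z0 : Polynomial ℂ}
    {P0 : Fin n → Polynomial ℂ} {f : Fin n → ℂ → ℂ} {Xt : Fin n → ℂ → ℝ}

theorem step2 (p : Prb S q Z0 P0 f Xt) {L1 : Set ℂ} (hL1 : IsCompact L1) (hL1W : L1 ⊆ W) (hne : L1.Nonempty)
    {η : ℝ} (hη : 0 < η) : ∃ (L : Set ℂ) (_ : CompactSpace L) (F : Fin n → RR E) (γ : Fin n → C(L, ℂ)),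
      RC E L ∧ L1 ⊆ L ∧ L ⊆ W ∧ Stt L q Z0 P0 f F γ ∧ ‖γ‖ < η ∧
      ∀ y : ι → ℝ, BdF W (S.β (fun α => (y α : ℂ))) → ∀ m,
        ∑ α, y α * ((S.Γ α (F m)).re - (Xt m (S.b α) - Xt m (S.a α))) = 0 := by
  classical
  set b := Module.finBasis ℝ (bdSub S) with hb
  set d := Module.finrank ℝ (bdSub S) with hd
  have hbd : ∀ i, BdF W (S.β (fun α => ((b i : ι → ℝ) α : ℂ))) := fun i => (b i).2
  choose L0 hL0 hL0W hext using fun i => S.exists_ext _ (hbd i)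
  obtain ⟨L, hL, hCL, hLW⟩ := p.hW.ex (L1 ∪ (⋃ i, L0 i) ∪ (Set.range S.a ∪ Set.range S.b) ∪ (q * Z0).rootSet ℂ)
    (((hL1.union (isCompact_iUnion hL0)).union ((Set.finite_range _).isCompact.union (Set.finite_range _).isCompact)).union
      ((q * Z0).rootSet_finite ℂ).isCompact) (by
      refine Set.union_subset (Set.union_subset (Set.union_subset hL1W (Set.iUnion_subset hL0W))
        (Set.union_subset ?_ ?_)) ?_
      · rintro _ ⟨α, rfl⟩; exact S.haW α
      · rintro _ ⟨α, rfl⟩; exact S.hbW α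
      · intro a ha
        have := (Polynomial.mem_rootSet.1 ha).2
        rw [Polynomial.coe_aeval_eq_eval, Polynomial.eval_mul, mul_eq_zero] at this
        exact this.elim (p.hqW a) (p.hZW a))
  have hCL := hCL.trans interior_subset
  have hc : CompactSpace L := isCompact_iff_compactSpace.1 hL.1
  have hL1L : L1 ⊆ L := fun z hz => hCL (Or.inl (Or.inl (Or.inl hz)))
  have hab : ∀ α, S.a α ∈ L ∧ S.b α ∈ L := fun α =>
    ⟨hCL (Or.inl (Or.inr (Or.inl ⟨α, rfl⟩))), hCL (Or.inl (Or.inr (Or.inr ⟨α, rfl⟩)))⟩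
  have hqL : ∀ a, (q * Z0).eval a = 0 → a ∈ L := fun a ha => hCL (Or.inr (by
    rw [Polynomial.mem_rootSet]; exact ⟨mul_ne_zero p.hq p.hZ, by simpa using ha⟩))
  have hfc : ∀ m, ContinuousOn (f m) L := fun m => (p.hf m).continuousOn.mono hLW
  choose ℓ hℓ using fun i => hext i L (fun z hz => hCL (Or.inl (Or.inl (Or.inr (Set.mem_iUnion.2 ⟨i, hz⟩))))) hc hL.2.1
  set Q : C(L, ℂ) := rst L (fun z => q.eval z) with hQ
  set Λ : (Fin n → C(L, ℂ)) →L[ℝ] (Fin n → Fin d → ℝ) :=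
    ContinuousLinearMap.pi fun m => ContinuousLinearMap.pi fun i =>
      (Complex.reCLM.comp ((ℓ i).restrictScalars ℝ)).comp ((ContinuousLinearMap.mul ℝ C(L, ℂ) Q).comp
        (ContinuousLinearMap.proj (R := ℝ) (φ := fun _ : Fin n => C(L, ℂ)) m)) with hΛ
  have hΛ' : ∀ γ m i, Λ γ m i = (ℓ i (Q * γ m)).re := fun γ m i => rfl
  have hli : LinearIndependent ℝ (fun i => (b i : ι → ℝ)) :=
    b.linearIndependent.map' (bdSub S).subtype (Submodule.ker_subtype _)
  have hsurj := p.surj hL hLW hab (fun i => (b i : ι → ℝ)) hli ℓ hℓ Λ.toLinearMap hΛ'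
  obtain ⟨κ, hκ1, D, hD⟩ : ∃ (κ : Type) (_ : Fintype κ) (D : κ → Sh n × RR E), Submodule.span ℝ
      (Set.range fun k => Λ ((D k).1.H 0 (GA L q Z0 P0 f 0) (rst L (D k).2))) = ⊤ := by
    have hfg := IsNoetherian.noetherian (R := ℝ) (Submodule.span ℝ (Set.range fun x : Sh n × RR E =>
      Λ.toLinearMap (x.1.H 0 (GA L q Z0 P0 f 0) (rst L x.2))))
    obtain ⟨s, hs1, hs2⟩ := (Submodule.fg_span_iff_fg_span_finset_subset _).1 hfg
    choose g hg using fun x : s => hs1 x.2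
    refine ⟨s, inferInstance, g, ?_⟩
    rw [← hsurj, hs2]
    congr 1
    ext x
    constructor
    · rintro ⟨k, rfl⟩
      have h7 : Λ ((g k).1.H 0 (GA L q Z0 P0 f 0) (rst L (g k).2)) = k := hg k
      show Λ ((g k).1.H 0 (GA L q Z0 P0 f 0) (rst L (g k).2)) ∈ (s : Set _)
      rw [h7]
      exact k.2
    · intro hx
      exact ⟨⟨x, hx⟩, hg ⟨x, hx⟩⟩
  obtain ⟨δ, hδ, hift⟩ := ift (κ := κ) (fun k x => (D k).1.H 0 (GA L q Z0 P0 f x) (rst L (D k).2))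
      (fun k x => (D k).1.H (rst L (fun z => Z0.eval z) * rst L (fun z => q.eval z)) (GA L q Z0 P0 f x) (rst L (D k).2) -
        (D k).1.H 0 (GA L q Z0 P0 f x) (rst L (D k).2)) (fun k => H_contDiff _ _ _ _ _ _ _)
        (fun k => (H_contDiff _ _ _ _ _ _ _).sub (H_contDiff _ _ _ _ _ _ _)) Λ hD hη
  obtain ⟨F0, γ0, hst, hγ0⟩ := p.strt hL (hne.mono hL1L) hLW hqL hδ
  obtain ⟨t, ht1, ht2⟩ := hift γ0 hγ0
  obtain ⟨F, hF⟩ := hst.fold hL.2.1 hfc D t Finset.univ.toList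
  refine ⟨L, hc, F, _, hL, hL1L, hLW, hF, ht1, ?_⟩
  generalize fld _ _ t Finset.univ.toList γ0 = γ at ht1 ht2 hF
  intro y hy m
  -- linear functional
  set Dm : (ι → ℝ) →ₗ[ℝ] ℝ := ∑ α, ((S.Γ α (F m)).re - (Xt m (S.b α) - Xt m (S.a α))) • LinearMap.proj α with hDm
  have hDa : ∀ y, Dm y = ∑ α, y α * ((S.Γ α (F m)).re - (Xt m (S.b α) - Xt m (S.a α))) := by
    intro y; simp [hDm, mul_comm]
  have h0 : Dm ∘ₗ (bdSub S).subtype = 0 := by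
    refine b.ext fun i => ?_
    rw [LinearMap.comp_apply, Submodule.subtype_apply, hDa, LinearMap.zero_apply]
    have e1 := hℓ i (F m)
    have e2 := S.fact1 hL hab (hℓ i) p.hW.op hLW (p.hf m) (p.hX m)
    have e3 : rst L (F m) = rst L (f m) + Q * γ m := by
      obtain ⟨U, h, hU, hLU, hh, hUh, hhL⟩ := hF.app m
      ext z
      rw [ContinuousMap.add_apply, ContinuousMap.mul_apply, rst_apply ((F m).continuousOn hL.2.1), rst_apply (hfc m),
        rst_apply q.continuous.continuousOn, hhL, hUh z (hLU z.2)]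
    have e4 : (ℓ i (Q * γ m)).re = 0 := by rw [← hΛ', ht2]; rfl
    rw [e3, map_add] at e1
    have e5 := congrArg Complex.re e1
    rw [add_re, e2, e4, S.β_apply, Complex.re_sum] at e5
    simp only [Complex.re_ofReal_mul] at e5
    simp only [mul_sub (_ : ℝ) (Complex.re _), Finset.sum_sub_distrib]
    linarith
  have := LinearMap.congr_fun h0 ⟨y, hy⟩
  rw [← hDa]; exact this

end Prb

lemma PathData.compl_lam {E : Finset ℂ} {W : Set ℂ} {ι : Type} [Fintype ι] (S : PathData E W ι) (err : ι → ℝ)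
    (h : ∀ y : ι → ℝ, BdF W (S.β (fun α => (y α : ℂ))) → ∑ α, y α * err α = 0) :
    ∃ lam : ι → ℂ, S.Kills lam ∧ ∀ α, (lam α).re = err α := by
  classical
  set M : Submodule ℂ (ι → ℂ) :=
    { carrier := {x | BdF W (S.β x)}
      zero_mem' := by
        have : S.β (0 : ι → ℂ) = 0 := by ext f; simp [S.β_apply]
        show BdF W _
        rw [this]; exact BdF.zero
      add_mem' := by
        intro a b ha hb
        have : S.β (a + b) = S.β a + S.β b := by
          ext f; simp [S.β_apply, add_mul, Finset.sum_add_distrib]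
        show BdF W _
        rw [this]; exact BdF.add ha hb
      smul_mem' := by
        intro c a ha
        have : S.β (c • a) = c • S.β a := by
          ext f; simp [S.β_apply, Finset.mul_sum, mul_assoc]
        show BdF W _
        rw [this]; exact BdF.smul _ ha } with hM
  have hMm : ∀ x, x ∈ M ↔ BdF W (S.β x) := fun x => Iff.rfl
  set inc : (ι → ℝ) →ₗ[ℝ] (ι → ℂ) := LinearMap.pi fun α => Complex.ofRealCLM.toLinearMap ∘ₗ LinearMap.proj α with hinc
  have hinc' : ∀ y α, inc y α = (y α : ℂ) := fun y α => rfl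
  set g : (ι → ℝ) →ₗ[ℝ] ((ι → ℂ) ⧸ M) := (M.mkQ.restrictScalars ℝ) ∘ₗ inc with hg
  set e : Module.Dual ℝ (ι → ℝ) := ∑ α, err α • LinearMap.proj α with he
  have he' : ∀ y, e y = ∑ α, y α * err α := by intro y; simp [he, mul_comm]
  have hmem : e ∈ LinearMap.range g.dualMap := by
    rw [LinearMap.range_dualMap_eq_dualAnnihilator_ker, Submodule.mem_dualAnnihilator]
    intro y hy
    rw [he']
    refine h y ?_
    rw [LinearMap.mem_ker] at hy
    have : M.mkQ (inc y) = 0 := hy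
    rw [Submodule.mkQ_apply, Submodule.Quotient.mk_eq_zero, hMm] at this
    exact this
  obtain ⟨T, hT⟩ := hmem
  set T' : (ι → ℂ) →ₗ[ℝ] ℝ := T ∘ₗ (M.mkQ.restrictScalars ℝ) with hT'
  set U : (ι → ℂ) →ₗ[ℂ] ℂ := Module.Dual.extendRCLike T' with hU
  have hUx : ∀ x, U x = (T' x : ℂ) - I * T' (I • x) := fun x => by
    rw [hU, Module.Dual.extendRCLike_apply]; rfl
  have hTM : ∀ x ∈ M, T' x = 0 := fun x hx => by
    show T (M.mkQ x) = 0
    rw [Submodule.mkQ_apply, (Submodule.Quotient.mk_eq_zero M).2 hx, map_zero]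
  refine ⟨fun α => U (Pi.single α 1), ?_, ?_⟩
  · intro x hx
    have h1 : U x = 0 := by
      rw [hUx, hTM x hx, hTM _ (M.smul_mem I hx)]; simp
    have h2 : x = ∑ α, x α • (Pi.single α 1 : ι → ℂ) := by
      ext β
      simp [Finset.sum_apply, Pi.single_apply]
    rw [h2, map_sum] at h1
    simpa using h1
  · intro α
    have : (U (Pi.single α 1)).re = T' (Pi.single α 1) := by
      rw [hUx]; simp
    rw [this]
    have h3 : (Pi.single α 1 : ι → ℂ) = inc (Pi.single α 1) := by
      ext β; rw [hinc']; by_cases hb : β = α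
      · subst hb; simp
      · simp [hb]
    rw [h3]
    have : T' (inc (Pi.single α 1)) = e (Pi.single α 1) := by rw [← hT]; rfl
    rw [this, he']
    simp [Pi.single_apply]

lemma null_pair {n : ℕ} (hn : 3 ≤ n) (v : Fin n → ℂ) (h0 : ∑ m, v m ^ 2 = 0) (hv : ∃ m, v m ≠ 0) (j : Fin n) :
    ∃ k, k ≠ j ∧ v j ^ 2 + v k ^ 2 ≠ 0 := by
  classical
  by_contra hcon
  push Not at hcon
  have h1 : ∑ m ∈ Finset.univ.erase j, v m ^ 2 = ∑ m ∈ Finset.univ.erase j, -(v j ^ 2) :=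
    Finset.sum_congr rfl fun m hm => by linear_combination hcon m (Finset.ne_of_mem_erase hm)
  rw [← Finset.add_sum_erase _ _ (Finset.mem_univ j), h1, Finset.sum_const, Finset.card_erase_of_mem (Finset.mem_univ j),
    Finset.card_univ, Fintype.card_fin, nsmul_eq_mul] at h0
  obtain ⟨n, rfl⟩ := Nat.exists_eq_add_of_le hn
  have h2 : ((n : ℂ) + 1) * v j ^ 2 = 0 := by
    rw [show 3 + n - 1 = n + 2 by omega] at h0
    push_cast at h0
    linear_combination -h0
  have h3 : v j = 0 := by
    have : (n : ℂ) + 1 ≠ 0 := by exact_mod_cast n.succ_ne_zero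
    simpa [this] using h2
  obtain ⟨m, hm⟩ := hv
  by_cases hmj : m = j
  · exact hm (hmj ▸ h3)
  · have := hcon m hmj
    rw [h3] at this
    simp at this; exact hm this

lemma H_small {n : ℕ} (d : Sh n) {L : Set ℂ} [CompactSpace L] (y : C(L, ℂ)) (G : Fin n → C(L, ℂ)) {η : ℝ} (hη : 0 < η) :
    ∃ δ > 0, ∀ r : C(L, ℂ), ‖r‖ < δ → ‖d.H y G r‖ < η := by
  have hc : Continuous fun r : C(L, ℂ) => d.H y G r := by
    refine continuous_pi fun m => ?_
    unfold Sh.H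
    split_ifs <;> fun_prop
  have h0 : d.H y G 0 = 0 := by
    funext m
    unfold Sh.H
    split_ifs <;> simp
  have := Metric.continuous_iff.1 hc 0 η hη
  obtain ⟨δ, hδ, h⟩ := this
  refine ⟨δ, hδ, fun r hr => ?_⟩
  have := h r (by simpa using hr)
  rwa [h0, dist_zero_right] at this

namespace Prb
variable {E : Finset ℂ} {W : Set ℂ} {ι : Type} [Fintype ι] {S : PathData E W ι} {n : ℕ} {q Z0 : Polynomial ℂ}
    {P0 : Fin n → Polynomial ℂ} {f : Fin n → ℂ → ℂ} {Xt : Fin n → ℂ → ℝ}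

lemma shear (p : Prb S q Z0 P0 f Xt) {L : Set ℂ} [CompactSpace L] (hL : RC E L) (hLW : L ⊆ W)
    {F : Fin n → RR E} {γ : Fin n → C(L, ℂ)} (h : Stt L q Z0 P0 f F γ) {η : ℝ} (hγ : ‖γ‖ < η) (d : Sh n)
    (hφ : (RR.P Z0 * F d.j + RR.P (P0 d.j)) + d.ε • (RR.P Z0 * F d.k + RR.P (P0 d.k)) ≠ 0)
    (lam : ι → ℂ) (hlam : S.Kills lam) :
    ∃ (F' : Fin n → RR E) (γ' : Fin n → C(L, ℂ)), Stt L q Z0 P0 f F' γ' ∧ ‖γ'‖ < η ∧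
      (∀ z ∉ E, q.eval z = 0 → ∀ m, F' m z = F m z) ∧
      (∀ α, S.Γ α (F' d.j) = S.Γ α (F d.j) - (1 / 2) * lam α) ∧
      (∀ α, S.Γ α (F' d.k) = S.Γ α (F d.k) - (1 / 2) * d.ε * lam α) ∧
      ∀ α m, m ≠ d.j → m ≠ d.k → S.Γ α (F' m) = S.Γ α (F m) := by
  set G : Fin n → RR E := fun m => RR.P Z0 * F m + RR.P (P0 m) with hG
  set φ := G d.j + d.ε • G d.k with hφd
  obtain ⟨δ, hδ, hs⟩ := H_small d (rst L (fun z => Z0.eval z) * rst L (fun z => q.eval z)) (GA L q Z0 P0 f γ) (sub_pos.2 hγ)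
  obtain ⟨ω, hω, hΓ⟩ := S.SL p.hW φ (G d.l) (RR.P q) (RR.P Z0) hφ (RR.P_ne p.hq) (RR.P_ne p.hZ) lam hlam hL.1 hLW (half_pos hδ)
  have hst := h.step hL.2.1 (fun m => (p.hf m).continuousOn.mono hLW) d ω
  refine ⟨_, _, hst, ?_, ?_, ?_, ?_, ?_⟩
  · have := hs (rst L ω) (lt_of_le_of_lt (rst_norm (half_pos hδ).le fun z hz => (hω z hz).le) (half_lt_self hδ))
    calc _ ≤ ‖γ‖ + ‖d.H (rst L (fun z => Z0.eval z) * rst L (fun z => q.eval z)) (GA L q Z0 P0 f γ) (rst L ω)‖ :=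
          norm_add_le γ _
      _ < η := by linarith
  · intro z hz hqz m
    rw [RR.ev_add, RR.ev_mul, RR.ev_P _ hz, hqz]; ring
  · intro α
    rw [d.H_j, map_add]
    have : RR.P q * (ω * G d.l - (1 / 2 : ℂ) • (RR.P Z0 * RR.P q * ω ^ 2 * φ)) =
      RR.P q * ω * G d.l - (1 / 2 : ℂ) • (RR.P Z0 * (RR.P q * ω) ^ 2 * φ) := by
      rw [mul_sub, mul_smul_comm, show RR.P q * (RR.P Z0 * RR.P q * ω ^ 2 * φ) = RR.P Z0 * (RR.P q * ω) ^ 2 * φ by ring, mul_assoc (RR.P q) ω (G d.l)]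
    rw [this, map_sub, map_smul, (hΓ α).2.1, (hΓ α).2.2, smul_eq_mul]; ring
  · intro α
    rw [d.H_k, map_add]
    have : RR.P q * (d.ε • (ω * G d.l - (1 / 2 : ℂ) • (RR.P Z0 * RR.P q * ω ^ 2 * φ))) =
      d.ε • (RR.P q * ω * G d.l - (1 / 2 : ℂ) • (RR.P Z0 * (RR.P q * ω) ^ 2 * φ)) := by
      rw [mul_smul_comm, mul_sub, mul_smul_comm, show RR.P q * (RR.P Z0 * RR.P q * ω ^ 2 * φ) = RR.P Z0 * (RR.P q * ω) ^ 2 * φ by ring, mul_assoc (RR.P q) ω (G d.l)]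
    rw [this, map_smul, map_sub, map_smul, (hΓ α).2.1, (hΓ α).2.2, smul_eq_mul, smul_eq_mul]; ring
  · intro α m h1 h2
    by_cases h3 : m = d.l
    · subst h3
      rw [d.H_l, map_add]
      have : RR.P q * -(ω * φ) = -(RR.P q * ω * φ) := by ring
      rw [this, map_neg, (hΓ α).1]; ring
    · rw [d.H_o _ _ _ h3 h1 h2]; simp

lemma fixcol (p : Prb S q Z0 P0 f Xt) {L : Set ℂ} [CompactSpace L] (hL : RC E L) (hLW : L ⊆ W)
    {F : Fin n → RR E} {γ : Fin n → C(L, ℂ)} (h : Stt L q Z0 P0 f F γ) {η : ℝ} (hγ : ‖γ‖ < η) (j : Fin n)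
    (err : ι → ℝ) (herr : ∀ y : ι → ℝ, BdF W (S.β (fun α => (y α : ℂ))) → ∑ α, y α * err α = 0) :
    ∃ (F' : Fin n → RR E) (γ' : Fin n → C(L, ℂ)), Stt L q Z0 P0 f F' γ' ∧ ‖γ'‖ < η ∧
      (∀ α, (S.Γ α (F' j)).re = (S.Γ α (F j)).re + err α) ∧
      ∀ α m, m ≠ j → S.Γ α (F' m) = S.Γ α (F m) := by
  rcases isEmpty_or_nonempty ι with hι | ⟨⟨α0⟩⟩
  · exact ⟨F, γ, h, hγ, fun α => (hι.false α).elim, fun α => (hι.false α).elim⟩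
  set c := S.a α0 with hc
  have hcE : c ∉ E := fun he => p.hW.dis c he (S.haW α0)
  have hqc : q.eval c = 0 := (p.hqa α0).1
  obtain ⟨lam, hlam, hre⟩ := S.compl_lam err herr
  have hlam' : S.Kills (fun α => (-1) * lam α) := PathData.Kills.smul S hlam _
  obtain ⟨k, hkj, hk⟩ := null_pair p.hn (fun m => (RR.P Z0 * F m + RR.P (P0 m) : RR E) c) (by
    have := congrArg (RR.evA hcE) h.null
    rw [map_sum, map_zero] at this
    simp only [map_pow] at this
    exact this) (h.nv c hcE) j
  obtain ⟨l, hlj, hlk⟩ := exists_third p.hn j k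
  set vj := (RR.P Z0 * F j + RR.P (P0 j) : RR E) c with hvj
  set vk := (RR.P Z0 * F k + RR.P (P0 k) : RR E) c with hvk
  have hne : ∀ ε : ℂ, ε * ε = -1 → vj + ε * vk ≠ 0 := by
    intro ε hε h0
    apply hk
    linear_combination (vj - ε * vk) * h0 + vk ^ 2 * hε
  let d1 : Sh n := ⟨j, k, l, I, hkj.symm, hlj.symm, hlk.symm, by simp⟩
  let d2 : Sh n := ⟨j, k, l, -I, hkj.symm, hlj.symm, hlk.symm, by simp⟩
  obtain ⟨F1, γ1, s1, n1, z1, j1, k1, o1⟩ := p.shear hL hLW h hγ d1 (by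
    intro h0
    refine hne I (by simp) ?_
    have := congrArg (fun f : RR E => f c) h0
    simp only [RR.ev_add, RR.ev_smul, RR.ev_zero, RR.ev_mul] at this
    rw [hvj, hvk]
    simp only [RR.ev_add, RR.ev_mul]
    exact this) _ hlam'
  obtain ⟨F2, γ2, s2, n2, z2, j2, k2, o2⟩ := p.shear hL hLW s1 n1 d2 (by
    intro h0
    refine hne (-I) (by simp) ?_
    have := congrArg (fun f : RR E => f c) h0
    simp only [RR.ev_add, RR.ev_smul, RR.ev_zero, RR.ev_mul, z1 c hcE hqc] at this
    rw [hvj, hvk]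
    simp only [RR.ev_add, RR.ev_mul]
    exact this) _ hlam'
  refine ⟨F2, γ2, s2, n2, ?_, ?_⟩
  · intro α
    have e1 : S.Γ α (F2 j) = S.Γ α (F j) + lam α := by
      have a1 := j1 α
      have a2 := j2 α
      simp only [d1, d2] at a1 a2
      rw [a2, a1]; ring
    rw [e1, add_re, hre]
  · intro α m hm
    by_cases hmk : m = k
    · have a1 := k1 α
      have a2 := k2 α
      simp only [d1, d2] at a1 a2
      rw [hmk, a2, a1]; ring
    · rw [o2 α m hm hmk, o1 α m hm hmk]

lemma step4 (p : Prb S q Z0 P0 f Xt) {L : Set ℂ} [CompactSpace L] (hL : RC E L) (hLW : L ⊆ W)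
    {F : Fin n → RR E} {γ : Fin n → C(L, ℂ)} (h : Stt L q Z0 P0 f F γ) {η : ℝ} (hγ : ‖γ‖ < η)
    (hbd : ∀ y : ι → ℝ, BdF W (S.β (fun α => (y α : ℂ))) → ∀ m,
        ∑ α, y α * ((S.Γ α (F m)).re - (Xt m (S.b α) - Xt m (S.a α))) = 0) :
    ∃ (F' : Fin n → RR E) (γ' : Fin n → C(L, ℂ)), Stt L q Z0 P0 f F' γ' ∧ ‖γ'‖ < η ∧
      ∀ m α, (S.Γ α (F' m)).re = Xt m (S.b α) - Xt m (S.a α) := by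
  classical
  have key : ∀ s : Finset (Fin n), ∃ (F' : Fin n → RR E) (γ' : Fin n → C(L, ℂ)), Stt L q Z0 P0 f F' γ' ∧ ‖γ'‖ < η ∧
      (∀ m ∈ s, ∀ α, (S.Γ α (F' m)).re = Xt m (S.b α) - Xt m (S.a α)) ∧
      ∀ m ∉ s, ∀ α, S.Γ α (F' m) = S.Γ α (F m) := by
    intro s
    induction s using Finset.induction_on with
    | empty => exact ⟨F, γ, h, hγ, by simp, by simp⟩
    | insert j s hj ih =>
      obtain ⟨F1, γ1, s1, n1, i1, o1⟩ := ih
      obtain ⟨F2, γ2, s2, n2, i2, o2⟩ := p.fixcol hL hLW s1 n1 j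
        (fun α => (Xt j (S.b α) - Xt j (S.a α)) - (S.Γ α (F1 j)).re) (by
          intro y hy
          have := hbd y hy j
          simp only [o1 j hj]
          rw [← neg_eq_zero, ← Finset.sum_neg_distrib, ← this]
          exact Finset.sum_congr rfl fun α _ => by ring)
      refine ⟨F2, γ2, s2, n2, ?_, ?_⟩
      · intro m hm α
        rcases Finset.mem_insert.1 hm with rfl | hm
        · rw [i2]; ring
        · rw [o2 α m (fun h => hj (h ▸ hm)), i1 m hm]
      · intro m hm α
        rw [Finset.mem_insert, not_or] at hm
        rw [o2 α m hm.1, o1 m hm.2]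
  obtain ⟨F', γ', h1, h2, h3, -⟩ := key Finset.univ
  exact ⟨F', γ', h1, h2, fun m => h3 m (Finset.mem_univ m)⟩

end Prb

section
open Asymptotics

/-- the basic function with simple poles at all ends -/
def thE (E : Finset ℂ) : RR E := RR.X + RR.invQ

lemma thE_ev {E : Finset ℂ} {z : ℂ} (hz : z ∉ E) : thE E z = z + ((QE E).eval z)⁻¹ := by
  rw [thE, RR.ev_add, RR.ev_X hz, RR.ev_invQ hz]

/-- the filters of the ends -/
structure EndF (E : Finset ℂ) (l : Filter ℂ) : Prop where
  ev : ∀ r : ℂ, ∀ᶠ z in l, z ≠ r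
  th : Tendsto (fun z => ‖thE E z‖) l atTop
  zb : (fun z : ℂ => z) =O[l] thE E
  inv : ∀ r : ℂ, (fun z : ℂ => (z - r)⁻¹) =O[l] thE E

namespace EndF
variable {E : Finset ℂ} {l : Filter ℂ}

lemma evE (hl : EndF E l) : ∀ᶠ z in l, z ∉ E := by
  have := (Filter.eventually_all_finset E).2 fun e _ => hl.ev e
  filter_upwards [this] with z hz he
  exact hz z he rfl

lemma mono (hl : EndF E l) {a b : ℕ} (h : a ≤ b) : (fun z => thE E z ^ a) =O[l] fun z => thE E z ^ b := by
  refine IsBigO.of_bound 1 ?_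
  filter_upwards [hl.th.eventually_ge_atTop 1] with z hz
  rw [one_mul, norm_pow, norm_pow]
  exact pow_le_pow_right₀ hz h

lemma one (hl : EndF E l) (b : ℕ) : (fun _ => (1 : ℂ)) =O[l] fun z => thE E z ^ b := by
  simpa using hl.mono (Nat.zero_le b)

lemma poly (hl : EndF E l) (p : Polynomial ℂ) : ∃ a : ℕ, (fun z => p.eval z) =O[l] fun z => thE E z ^ a := by
  induction p using Polynomial.induction_on' with
  | add p r hp hr =>
    obtain ⟨a, ha⟩ := hp
    obtain ⟨b, hb⟩ := hr
    refine ⟨a + b, ?_⟩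
    simp only [Polynomial.eval_add]
    exact (ha.trans (hl.mono (by omega))).add (hb.trans (hl.mono (by omega)))
  | monomial k c =>
    refine ⟨k, ?_⟩
    simp only [Polynomial.eval_monomial]
    exact (hl.zb.pow k).const_mul_left c

lemma polyinv (hl : EndF E l) (p : Polynomial ℂ) (hp : p ≠ 0) : (∀ᶠ z in l, p.eval z ≠ 0) ∧
    ∃ a : ℕ, (fun z => (p.eval z)⁻¹) =O[l] fun z => thE E z ^ a := by
  constructor
  · have := (Filter.eventually_all_finset p.roots.toFinset).2 fun e _ => hl.ev e
    filter_upwards [this] with z hz h0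
    exact hz z (by rw [Multiset.mem_toFinset, Polynomial.mem_roots hp]; exact h0) rfl
  have key : ∀ M : Multiset ℂ, ∃ a : ℕ, (fun z => ((M.map fun r => Polynomial.X - Polynomial.C r).prod.eval z)⁻¹)
      =O[l] fun z => thE E z ^ a := by
    intro M
    induction M using Multiset.induction_on with
    | empty => exact ⟨0, by simpa using hl.one 0⟩
    | cons r M ih =>
      obtain ⟨a, ha⟩ := ih
      refine ⟨1 + a, ?_⟩
      simp only [Multiset.map_cons, Multiset.prod_cons, Polynomial.eval_mul, mul_inv, pow_add, pow_one]
      exact IsBigO.mul (by simpa using hl.inv r) ha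
  obtain ⟨a, ha⟩ := key p.roots
  refine ⟨a, ?_⟩
  have h1 := (IsAlgClosed.splits p).eq_prod_roots
  rw [h1]
  simp only [Polynomial.eval_mul, mul_inv, Polynomial.eval_C]
  exact ha.const_mul_left _

lemma bigO (hl : EndF E l) (f : RR E) : ∃ a : ℕ, f =O[l] fun z => thE E z ^ a := by
  obtain ⟨p, k, hpk⟩ := RR.exists_poly f
  obtain ⟨a, ha⟩ := hl.poly p
  obtain ⟨-, b, hb⟩ := hl.polyinv (QE E) (QE_ne E)
  refine ⟨b * k + a, ?_⟩
  have h1 : (fun z => (((QE E).eval z)⁻¹) ^ k * p.eval z) =O[l] fun z => thE E z ^ (b * k + a) := by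
    simp only [pow_add, pow_mul]
    exact (hb.pow k).mul ha
  refine h1.congr' ?_ EventuallyEq.rfl
  filter_upwards [hl.evE] with z hz
  have := congrArg (fun f : RR E => f z) hpk
  simp only [RR.ev_mul, RR.ev_pow _ _ hz, RR.ev_P _ hz] at this
  rw [← this, inv_pow, inv_mul_cancel_left₀ (pow_ne_zero _ (QE_eval_ne hz))]

lemma invO (hl : EndF E l) (f : RR E) (hf : f ≠ 0) : (∀ᶠ z in l, f z ≠ 0) ∧
    ∃ a : ℕ, (fun z => (f z)⁻¹) =O[l] fun z => thE E z ^ a := by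
  obtain ⟨p, k, hpk⟩ := RR.exists_poly f
  have hp : p ≠ 0 := by
    rintro rfl
    rw [map_zero, mul_eq_zero] at hpk
    exact hpk.elim (pow_ne_zero _ (RR.P_ne (QE_ne E))) hf
  obtain ⟨h0, a, ha⟩ := hl.polyinv p hp
  obtain ⟨b, hb⟩ := hl.poly (QE E)
  have hz' : ∀ z ∉ E, (QE E).eval z ^ k * f z = p.eval z := by
    intro z hz
    have := congrArg (fun f : RR E => f z) hpk
    simpa only [RR.ev_mul, RR.ev_pow _ _ hz, RR.ev_P _ hz] using this
  constructor
  · filter_upwards [hl.evE, h0] with z hz h1 h2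
    rw [← hz' z hz, h2, mul_zero] at h1
    exact h1 rfl
  refine ⟨b * k + a, ?_⟩
  have h1 : (fun z => ((QE E).eval z) ^ k * (p.eval z)⁻¹) =O[l] fun z => thE E z ^ (b * k + a) := by
    simp only [pow_add, pow_mul]
    exact (hb.pow k).mul ha
  refine h1.congr' ?_ EventuallyEq.rfl
  filter_upwards [hl.evE] with z hz
  rw [← hz' z hz, mul_inv, mul_inv_cancel_left₀ (pow_ne_zero _ (QE_eval_ne hz))]

/-- growth at the ends -/
lemma growth (hl : EndF E l) (F s : RR E) (hs : s ≠ 0) (N : ℕ) : ∃ J0 : ℕ, ∀ J ≥ J0, ∀ u : Polynomial ℂ, u ≠ 0 → ∀ τ : ℂ, τ ≠ 0 →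
    Tendsto (fun z => ‖F z - τ * (s z * thE E z ^ J * u.eval (thE E z))‖ / ‖thE E z‖ ^ N) l atTop := by
  obtain ⟨a, ha⟩ := hl.bigO F
  obtain ⟨h0, b, hb⟩ := hl.invO s hs
  refine ⟨a + b + N + 1, fun J hJ u hu τ hτ => ?_⟩
  obtain ⟨C, hC, hF⟩ := ha.exists_pos
  obtain ⟨D, hD, hS⟩ := hb.exists_pos
  rw [isBigOWith_iff] at hF hS
  obtain ⟨c, hc, hu⟩ : ∃ c > 0, ∀ᶠ z in l, c ≤ ‖u.eval (thE E z)‖ := by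
    by_cases hd : 0 < u.degree
    · exact ⟨1, one_pos, (u.tendsto_norm_atTop hd hl.th).eventually_ge_atTop 1⟩
    · have := Polynomial.eq_C_of_degree_le_zero (not_lt.1 hd)
      refine ⟨‖u.coeff 0‖, norm_pos_iff.2 fun h => hu (by rw [this, h, map_zero]), Eventually.of_forall fun z => ?_⟩
      conv_rhs => rw [this]
      simp
  set c' : ℝ := ‖τ‖ * (D⁻¹ * c) with hc'
  have hc0 : 0 < c' := by have := norm_pos_iff.2 hτ; positivity
  have hlim : Tendsto (fun z => c' * ‖thE E z‖ - C) l atTop :=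
    tendsto_atTop_add_const_right _ _ (hl.th.const_mul_atTop hc0)
  refine tendsto_atTop_mono' l ?_ hlim
  filter_upwards [hF, hS, hu, h0, hl.th.eventually_ge_atTop 1, hlim.eventually_ge_atTop 0] with z h1 h2 h3 h4 h5 h6
  set t := ‖thE E z‖ with ht
  have ht0 : 0 < t := by linarith
  rw [norm_pow, ← ht] at h1 h2
  rw [le_div_iff₀ (by positivity)]
  have hs' : D⁻¹ ≤ ‖s z‖ * t ^ b := by
    rw [norm_inv] at h2
    have h7 := norm_pos_iff.2 h4
    rw [inv_le_iff_one_le_mul₀ hD]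
    rw [inv_le_iff_one_le_mul₀ h7] at h2
    linarith
  have hJ' : t ^ b * t ^ (a + N + 1) ≤ t ^ J := by
    rw [← pow_add]; exact pow_le_pow_right₀ h5 (by omega)
  have hbig : c' * t ^ (a + N + 1) ≤ ‖τ * (s z * thE E z ^ J * u.eval (thE E z))‖ := by
    rw [norm_mul, norm_mul, norm_mul, norm_pow, ← ht, hc', mul_assoc]
    refine mul_le_mul_of_nonneg_left ?_ (norm_nonneg _)
    calc D⁻¹ * c * t ^ (a + N + 1) ≤ ‖s z‖ * t ^ b * c * t ^ (a + N + 1) := by gcongr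
      _ = ‖s z‖ * (t ^ b * t ^ (a + N + 1)) * c := by ring
      _ ≤ ‖s z‖ * t ^ J * ‖u.eval (thE E z)‖ := by gcongr
  have htri := norm_sub_norm_le (τ * (s z * thE E z ^ J * u.eval (thE E z))) (F z)
  rw [norm_sub_rev] at htri
  have e1 : 1 ≤ t ^ a := one_le_pow₀ h5
  have e2 : 1 ≤ t ^ N := one_le_pow₀ h5
  calc (c' * t - C) * t ^ N ≤ t ^ a * ((c' * t - C) * t ^ N) := le_mul_of_one_le_left (by positivity) e1
    _ = c' * t ^ (a + N + 1) - C * t ^ a * t ^ N := by ring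
    _ ≤ c' * t ^ (a + N + 1) - C * t ^ a := by nlinarith [mul_pos hC (pow_pos ht0 a)]
    _ ≤ _ := by linarith

end EndF

lemma QE_inv_O (E : Finset ℂ) (l : Filter ℂ) (h : ∀ e ∈ E, (fun z : ℂ => (z - e)⁻¹) =O[l] fun _ => (1 : ℂ)) :
    (fun z => ((QE E).eval z)⁻¹) =O[l] fun _ => (1 : ℂ) := by
  classical
  simp only [QE_eval]
  induction E using Finset.induction_on with
  | empty => simpa using isBigO_refl (fun _ : ℂ => (1 : ℂ)) l
  | insert e s he ih =>
    simp only [Finset.prod_insert he, mul_inv]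
    simpa using (h e (Finset.mem_insert_self _ _)).mul (ih fun a ha => h a (Finset.mem_insert_of_mem ha))

lemma endF_infty (E : Finset ℂ) : EndF E (Bornology.cobounded ℂ) := by
  have hev : ∀ r : ℂ, ∀ᶠ z in Bornology.cobounded ℂ, z ≠ r := fun r => Bornology.eventually_ne_cobounded r
  have hE : ∀ᶠ z in Bornology.cobounded ℂ, z ∉ E := by
    have := (Filter.eventually_all_finset E).2 fun e _ => hev e
    filter_upwards [this] with z hz he
    exact hz z he rfl
  have hinv : ∀ r : ℂ, (fun z : ℂ => (z - r)⁻¹) =O[Bornology.cobounded ℂ] fun _ => (1 : ℂ) := by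
    intro r
    have : Tendsto (fun z : ℂ => (z - r)⁻¹) (Bornology.cobounded ℂ) (𝓝 0) :=
      tendsto_inv₀_cobounded.comp (tendsto_sub_const_cobounded r)
    exact this.isBigO_one ℂ
  have hQ := QE_inv_O E _ fun e _ => hinv e
  have hth : (fun z => thE E z - z) =O[Bornology.cobounded ℂ] fun _ => (1 : ℂ) := by
    refine hQ.congr' ?_ EventuallyEq.rfl
    filter_upwards [hE] with z hz
    rw [thE_ev hz]; ring
  have hT : Tendsto (fun z => ‖thE E z‖) (Bornology.cobounded ℂ) atTop := by
    obtain ⟨C, hC⟩ := hth.bound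
    refine tendsto_atTop_mono' _ ?_ (tendsto_atTop_add_const_right _ (-C) tendsto_norm_cobounded_atTop)
    filter_upwards [hC] with z hz
    have := norm_sub_norm_le z (thE E z)
    rw [norm_sub_rev] at this
    simp only [norm_one, mul_one] at hz
    linarith
  have h1 : (fun _ => (1 : ℂ)) =O[Bornology.cobounded ℂ] thE E := by
    refine IsBigO.of_bound 1 ?_
    filter_upwards [hT.eventually_ge_atTop 1] with z hz
    simpa using hz
  refine ⟨hev, hT, ?_, fun r => (hinv r).trans h1⟩
  have := (isBigO_refl (thE E) (Bornology.cobounded ℂ)).sub (hth.trans h1)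
  simpa using this

lemma endF_pt {E : Finset ℂ} {e : ℂ} (he : e ∈ E) : EndF E (𝓝[≠] e) := by
  classical
  have hE : ∀ᶠ z in 𝓝[≠] e, z ∉ E := by
    have h1 : ∀ᶠ z in 𝓝 e, z ∉ E.erase e :=
      (Finset.finite_toSet _).isClosed.isOpen_compl.eventually_mem (by simp)
    filter_upwards [nhdsWithin_le_nhds h1, self_mem_nhdsWithin] with z hz hz' hzE
    exact hz (Finset.mem_erase.2 ⟨hz', hzE⟩)
  have hev : ∀ r : ℂ, ∀ᶠ z in 𝓝[≠] e, z ≠ r := by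
    intro r
    by_cases h : r = e
    · subst h; exact self_mem_nhdsWithin
    · exact nhdsWithin_le_nhds (isOpen_ne.eventually_mem (Ne.symm h))
  have hz1 : (fun z : ℂ => z) =O[𝓝[≠] e] fun _ => (1 : ℂ) :=
    (continuousAt_id.tendsto.mono_left nhdsWithin_le_nhds).isBigO_one ℂ
  have hQt : Tendsto (fun z => ‖((QE E).eval z)⁻¹‖) (𝓝[≠] e) atTop := by
    refine tendsto_norm_inv_nhdsNE_zero_atTop.comp (tendsto_nhdsWithin_iff.2 ⟨?_, ?_⟩)
    · have := ((QE E).continuous.tendsto e).mono_left (nhdsWithin_le_nhds (s := {e}ᶜ))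
      rwa [QE_eval_zero he] at this
    · filter_upwards [hE] with z hz using QE_eval_ne hz
  have hT : Tendsto (fun z => ‖thE E z‖) (𝓝[≠] e) atTop := by
    obtain ⟨C, hC⟩ := hz1.bound
    refine tendsto_atTop_mono' _ ?_ (tendsto_atTop_add_const_right _ (-C) hQt)
    filter_upwards [hC, hE] with z hz hzE
    rw [thE_ev hzE]
    have := norm_sub_norm_le (((QE E).eval z)⁻¹) (-z)
    rw [sub_neg_eq_add, norm_neg, add_comm _ z] at this
    simp only [norm_one, mul_one] at hz
    linarith
  have h1 : (fun _ => (1 : ℂ)) =O[𝓝[≠] e] thE E := by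
    refine IsBigO.of_bound 1 ?_
    filter_upwards [hT.eventually_ge_atTop 1] with z hz
    simpa using hz
  refine ⟨hev, hT, hz1.trans h1, fun r => ?_⟩
  by_cases h : r = e
  · subst h
    have hQO : (fun z => ((QE E).eval z)⁻¹) =O[𝓝[≠] r] thE E := by
      refine ((isBigO_refl (thE E) (𝓝[≠] r)).sub (hz1.trans h1)).congr' ?_ EventuallyEq.rfl
      filter_upwards [hE] with z hz
      rw [thE_ev hz]; ring
    have hR : (fun z => ∏ a ∈ E.erase r, (z - a)) =O[𝓝[≠] r] fun _ => (1 : ℂ) := by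
      have : Continuous fun z : ℂ => ∏ a ∈ E.erase r, (z - a) := by fun_prop
      exact ((this.tendsto r).mono_left nhdsWithin_le_nhds).isBigO_one ℂ
    have := hR.mul hQO
    simp only [one_mul] at this
    refine this.congr' ?_ EventuallyEq.rfl
    filter_upwards [hE] with z hz
    have h3 := QE_eval_ne hz
    rw [QE_eval, ← Finset.mul_prod_erase E _ he] at h3 ⊢
    rw [mul_inv, mul_comm (z - r)⁻¹, mul_inv_cancel_left₀ (right_ne_zero_of_mul h3)]
  · refine IsBigO.trans ?_ h1
    have : ContinuousAt (fun z : ℂ => (z - r)⁻¹) e := by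
      refine ContinuousAt.inv₀ (by fun_prop) (sub_ne_zero.2 (Ne.symm h))
    exact (this.tendsto.mono_left nhdsWithin_le_nhds).isBigO_one ℂ

end

section
open Asymptotics

lemma PathData.iso_th {E : Finset ℂ} {W : Set ℂ} {ι : Type} [Fintype ι] (S : PathData E W ι) (A B C : RR E) :
    ∃ u : Polynomial ℂ, u ≠ 0 ∧
    ∀ α, S.Γ α (A * Polynomial.aeval (thE E) u) = 0 ∧ S.Γ α (B * Polynomial.aeval (thE E) u) = 0 ∧
      S.Γ α (C * Polynomial.aeval (thE E) u ^ 2) = 0 := by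
  let T : ι → RR E → Polynomial ℂ →ₗ[ℂ] ℂ := fun α A => S.Γ α ∘ₗ LinearMap.mulLeft ℂ A ∘ₗ
    (Polynomial.aeval (thE E)).toLinearMap
  obtain ⟨u, hu, h1, h2⟩ := lemI (κ := ι) (κ' := ι ⊕ ι) poly_not_fd (fun s => match s with
    | Sum.inl α => T α A
    | Sum.inr α => T α B) (fun α => (LinearMap.mul ℂ (Polynomial ℂ)).compr₂ (T α C)) (by
      intro α u v
      simp [mul_comm u v])
  refine ⟨u, hu, fun α => ⟨h1 (Sum.inl α), h1 (Sum.inr α), ?_⟩⟩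
  have := h2 α
  simpa [T, sq] using this

lemma RR.ev_aeval {E : Finset ℂ} {z : ℂ} (hz : z ∉ E) (θ : RR E) (u : Polynomial ℂ) :
    (Polynomial.aeval θ u : RR E) z = u.eval (θ z) := by
  have := Polynomial.aeval_algHom_apply (RR.evA hz) θ u
  rw [← Polynomial.coe_aeval_eq_eval]
  exact this.symm

namespace Prb
variable {E : Finset ℂ} {W : Set ℂ} {ι : Type} [Fintype ι] {S : PathData E W ι} {n : ℕ} {q Z0 : Polynomial ℂ}
    {P0 : Fin n → Polynomial ℂ} {f : Fin n → ℂ → ℂ} {Xt : Fin n → ℂ → ℝ}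

lemma step3 (p : Prb S q Z0 P0 f Xt) {L : Set ℂ} [CompactSpace L] (hL : RC E L) (hLW : L ⊆ W)
    {F : Fin n → RR E} {γ : Fin n → C(L, ℂ)} (h : Stt L q Z0 P0 f F γ) {η : ℝ} (hγ : ‖γ‖ < η) (N : ℕ) :
    ∃ (F' : Fin n → RR E) (γ' : Fin n → C(L, ℂ)), Stt L q Z0 P0 f F' γ' ∧ ‖γ'‖ < η ∧
      (∀ m α, S.Γ α (F' m) = S.Γ α (F m)) ∧ ∃ l,
      (∀ e ∈ E, Tendsto (fun z => ‖F' l z‖) (𝓝[≠] e) atTop) ∧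
      Tendsto (fun z => ‖F' l z‖ / ‖thE E z‖ ^ N) (Bornology.cobounded ℂ) atTop := by
  classical
  set G : Fin n → RR E := fun m => RR.P Z0 * F m + RR.P (P0 m) with hG
  obtain ⟨x, hx⟩ := Infinite.exists_notMem_finset E
  have hj : 0 < n := by have := p.hn; omega
  obtain ⟨k, hkj, hk⟩ := null_pair p.hn (fun m => G m x) (by
    have := congrArg (RR.evA hx) h.null
    rw [map_sum, map_zero] at this
    simp only [map_pow] at this
    exact this) (h.nv x hx) ⟨0, hj⟩
  obtain ⟨l, hlj, hlk⟩ := exists_third p.hn ⟨0, hj⟩ k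
  let d : Sh n := ⟨⟨0, hj⟩, k, l, I, hkj.symm, hlj.symm, hlk.symm, by simp⟩
  set φ := G d.j + d.ε • G d.k with hφd
  have hφ : φ ≠ 0 := by
    intro h0
    have := congrArg (fun f : RR E => f x) h0
    simp only [hφd, RR.ev_add, RR.ev_smul, RR.ev_zero] at this
    change G ⟨0, hj⟩ x + I * G k x = 0 at this
    apply hk
    linear_combination (G ⟨0, hj⟩ x - I * G k x) * this + G k x ^ 2 * I_mul_I
  have hs : RR.P q * φ ≠ 0 := mul_ne_zero (RR.P_ne p.hq) hφ
  obtain ⟨J0, hJ0⟩ := (endF_infty E).growth (F d.l) _ hs N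
  choose! J1 hJ1 using fun e (he : e ∈ E) => (endF_pt he).growth (F d.l) _ hs 0
  set J := J0 + ∑ e ∈ E, J1 e with hJ
  have hJe : ∀ e ∈ E, J1 e ≤ J := fun e he =>
    (Finset.single_le_sum (f := J1) (fun _ _ => Nat.zero_le _) he).trans (Nat.le_add_left _ _)
  obtain ⟨u, hu, hΓ⟩ := S.iso_th (RR.P q * thE E ^ J * φ) (RR.P q * thE E ^ J * G d.l)
    (RR.P Z0 * (RR.P q * thE E ^ J) ^ 2 * φ)
  set w : RR E := thE E ^ J * Polynomial.aeval (thE E) u with hw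
  obtain ⟨δ, hδ, hsm⟩ := H_small d (rst L (fun z => Z0.eval z) * rst L (fun z => q.eval z)) (GA L q Z0 P0 f γ) (sub_pos.2 hγ)
  set τ : ℝ := δ / 2 / (1 + ‖rst L w‖) with hτ
  have hτ0 : 0 < τ := by positivity
  have hwc : ContinuousOn w L := w.continuousOn hL.2.1
  set ω : RR E := (τ : ℂ) • w with hω
  have hωs : ‖rst L ω‖ < δ := by
    have : rst L ω = (τ : ℂ) • rst L w := by
      rw [← rst_smul _ hwc]
      exact rst_congr fun z _ => by rw [hω, RR.ev_smul]
    rw [this, norm_smul, norm_real, Real.norm_eq_abs, abs_of_pos hτ0, hτ]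
    have h1 : 0 < 1 + ‖rst L w‖ := by positivity
    rw [div_mul_eq_mul_div, div_lt_iff₀ h1]
    have := norm_nonneg (rst L w)
    nlinarith
  have hst := h.step hL.2.1 (fun m => (p.hf m).continuousOn.mono hLW) d ω
  have g1 : ∀ α, S.Γ α (RR.P q * ω * φ) = 0 := fun α => by
    have : RR.P q * ω * φ = (τ : ℂ) • (RR.P q * thE E ^ J * φ * Polynomial.aeval (thE E) u) := by
      rw [hω, hw, mul_smul_comm, smul_mul_assoc]; congr 1; ring
    rw [this, map_smul, (hΓ α).1, smul_zero]
  have g2 : ∀ α, S.Γ α (RR.P q * ω * G d.l) = 0 := fun α => by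
    have : RR.P q * ω * G d.l = (τ : ℂ) • (RR.P q * thE E ^ J * G d.l * Polynomial.aeval (thE E) u) := by
      rw [hω, hw, mul_smul_comm, smul_mul_assoc]; congr 1; ring
    rw [this, map_smul, (hΓ α).2.1, smul_zero]
  have g3 : ∀ α, S.Γ α (RR.P Z0 * (RR.P q * ω) ^ 2 * φ) = 0 := fun α => by
    have : RR.P Z0 * (RR.P q * ω) ^ 2 * φ = (τ ^ 2 : ℂ) • (RR.P Z0 * (RR.P q * thE E ^ J) ^ 2 * φ *
        Polynomial.aeval (thE E) u ^ 2) := by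
      rw [hω, hw, mul_smul_comm, smul_pow, mul_smul_comm, smul_mul_assoc]; congr 1; ring
    rw [this, map_smul, (hΓ α).2.2, smul_zero]
  have hFl : ∀ z ∉ E, (F d.l + RR.P q * d.H (RR.P Z0 * RR.P q) G ω d.l : RR E) z =
      F d.l z - (τ : ℂ) * ((RR.P q * φ : RR E) z * thE E z ^ J * u.eval (thE E z)) := by
    intro z hz
    rw [d.H_l, ← hφd, hω, hw]
    simp only [RR.ev_add, RR.ev_mul, RR.ev_neg, RR.ev_smul, RR.ev_pow _ _ hz, RR.ev_aeval hz]
    ring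
  refine ⟨_, _, hst, ?_, ?_, d.l, ?_, ?_⟩
  · have := hsm (rst L ω) hωs
    calc _ ≤ ‖γ‖ + ‖d.H (rst L (fun z => Z0.eval z) * rst L (fun z => q.eval z)) (GA L q Z0 P0 f γ) (rst L ω)‖ :=
          norm_add_le γ _
      _ < η := by linarith
  · intro m α
    have e1 : RR.P q * (ω * G d.l - (1 / 2 : ℂ) • (RR.P Z0 * RR.P q * ω ^ 2 * φ)) =
      RR.P q * ω * G d.l - (1 / 2 : ℂ) • (RR.P Z0 * (RR.P q * ω) ^ 2 * φ) := by
      rw [mul_sub, mul_smul_comm, show RR.P q * (RR.P Z0 * RR.P q * ω ^ 2 * φ) = RR.P Z0 * (RR.P q * ω) ^ 2 * φ by ring, mul_assoc (RR.P q) ω (G d.l)]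
    rw [map_add]
    by_cases h1 : m = d.l
    · rw [h1, d.H_l, ← hφd, show RR.P q * -(ω * φ) = -(RR.P q * ω * φ) by ring, map_neg, g1]; simp
    by_cases h2 : m = d.j
    · rw [h2, d.H_j, ← hφd, e1, map_sub, map_smul, g2, g3]; simp
    by_cases h3 : m = d.k
    · rw [h3, d.H_k, ← hφd, mul_smul_comm, e1, map_smul, map_sub, map_smul, g2, g3]; simp
    rw [d.H_o _ _ _ h1 h2 h3]; simp
  · intro e he
    have := hJ1 e he J (hJe e he) u hu τ (by exact_mod_cast hτ0.ne')
    simp only [pow_zero, div_one] at this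
    refine this.congr' ?_
    filter_upwards [(endF_pt he).evE] with z hz
    rw [hFl z hz]
  · have := hJ0 J (Nat.le_add_right _ _) u hu τ (by exact_mod_cast hτ0.ne')
    refine this.congr' ?_
    filter_upwards [(endF_infty E).evE] with z hz
    rw [hFl z hz]

/-- the core approximation theorem -/
theorem core (p : Prb S q Z0 P0 f Xt) {L1 : Set ℂ} (hL1 : IsCompact L1) (hL1W : L1 ⊆ W) (hne : L1.Nonempty)
    {η : ℝ} (hη : 0 < η) (N : ℕ) : ∃ F : Fin n → RR E,
      (∑ m, (RR.P Z0 * F m + RR.P (P0 m)) ^ 2 = 0) ∧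
      (∀ z ∉ E, ∃ m, (RR.P Z0 * F m + RR.P (P0 m) : RR E) z ≠ 0) ∧
      (∀ m, ∃ (U : Set ℂ) (h : ℂ → ℂ), IsOpen U ∧ L1 ⊆ U ∧ DifferentiableOn ℂ h U ∧
        (∀ z ∈ U, F m z = f m z + q.eval z * h z) ∧ ∀ z ∈ L1, ‖h z‖ < η) ∧
      (∀ m α, (S.Γ α (F m)).re = Xt m (S.b α) - Xt m (S.a α)) ∧
      ∃ l, (∀ e ∈ E, Tendsto (fun z => ‖F l z‖) (𝓝[≠] e) atTop) ∧
      Tendsto (fun z => ‖F l z‖ / ‖thE E z‖ ^ N) (Bornology.cobounded ℂ) atTop := by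
  obtain ⟨L, hc, F, γ, hL, hLL, hLW, hst, hγ, hbd⟩ := p.step2 hL1 hL1W hne hη
  obtain ⟨F1, γ1, hst1, hγ1, hΓ1⟩ := p.step4 hL hLW hst hγ hbd
  obtain ⟨F2, γ2, hst2, hγ2, hΓ2, hl⟩ := p.step3 hL hLW hst1 hγ1 N
  refine ⟨F2, hst2.null, hst2.nv, ?_, fun m α => by rw [hΓ2, hΓ1], hl⟩
  intro m
  obtain ⟨U, h, hU, hLU, hh, hUh, hhL⟩ := hst2.app m
  refine ⟨U, h, hU, hLL.trans hLU, hh, hUh, fun z hz => ?_⟩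
  rw [← hhL ⟨z, hLL hz⟩]
  exact lt_of_le_of_lt ((γ2 m).norm_coe_le_norm _) (lt_of_le_of_lt (norm_le_pi_norm γ2 m) hγ2)

end Prb

end

lemma Pot.add {U : Set ℂ} {H K : ℂ → ℝ} {f g : ℂ → ℂ} (h : Pot U H f) (k : Pot U K g) :
    Pot U (fun z => H z + K z) (fun z => f z + g z) := fun z hz =>
  ((h z hz).add (k z hz)).congr_fderiv (by ext <;> simp)

lemma Pot.sub {U : Set ℂ} {H K : ℂ → ℝ} {f g : ℂ → ℂ} (h : Pot U H f) (k : Pot U K g) :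
    Pot U (fun z => H z - K z) (fun z => f z - g z) := fun z hz =>
  ((h z hz).sub (k z hz)).congr_fderiv (by ext <;> simp)

lemma Pot.smul {U : Set ℂ} {H : ℂ → ℝ} {f : ℂ → ℂ} (h : Pot U H f) (c : ℝ) :
    Pot U (fun z => c * H z) (fun z => c * f z) := fun z hz =>
  ((h z hz).const_mul c).congr_fderiv (by ext <;> simp <;> ring)

lemma Pot.add_const {U : Set ℂ} {H : ℂ → ℝ} {f : ℂ → ℂ} (h : Pot U H f) (c : ℝ) :
    Pot U (fun z => H z + c) f := fun z hz => (h z hz).add_const c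

lemma Pot.congr {U : Set ℂ} {H : ℂ → ℝ} {f g : ℂ → ℂ} (h : Pot U H f) (hfg : ∀ z ∈ U, f z = g z) :
    Pot U H g := fun z hz => by rw [← hfg z hz]; exact h z hz

lemma Pot.mono {U V : Set ℂ} {H : ℂ → ℝ} {f : ℂ → ℂ} (h : Pot U H f) (hV : V ⊆ U) : Pot V H f :=
  fun z hz => h z (hV hz)

lemma Pot.sum {U : Set ℂ} {κ : Type*} (s : Finset κ) {H : κ → ℂ → ℝ} {f : κ → ℂ → ℂ} (h : ∀ i ∈ s, Pot U (H i) (f i)) :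
    Pot U (fun z => ∑ i ∈ s, H i z) (fun z => ∑ i ∈ s, f i z) := by
  classical
  induction s using Finset.induction_on with
  | empty =>
    intro z hz
    simp only [Finset.sum_empty]
    exact (hasFDerivAt_const (0 : ℝ) z).congr_fderiv (by ext <;> simp)
  | insert a s ha ih =>
    simp only [Finset.sum_insert ha]
    exact (h a (Finset.mem_insert_self _ _)).add (ih fun i hi => h i (Finset.mem_insert_of_mem hi))

lemma Pot.const {U : Set ℂ} (hU : IsOpen U) (hc : IsPreconnected U) {H : ℂ → ℝ} (h : Pot U H (fun _ => 0)) {x y : ℂ}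
    (hx : x ∈ U) (hy : y ∈ U) : H x = H y := by
  refine hU.is_const_of_fderiv_eq_zero (𝕜 := ℝ) hc (fun z hz => (h z hz).differentiableAt.differentiableWithinAt) ?_ hx hy
  intro z hz
  rw [(h z hz).fderiv]
  ext <;> simp

lemma E_conn (E : Finset ℂ) : IsPreconnected ((E : Set ℂ)ᶜ) := by
  refine (Set.Countable.isPathConnected_compl_of_one_lt_rank ?_ E.finite_toSet.countable).isConnected.isPreconnected
  rw [Complex.rank_real_complex]; norm_num

/-- circle integral of a function with potential -/
lemma Pot.circle {U : Set ℂ} {H : ℂ → ℝ} {f : ℂ → ℂ} (h : Pot U H f) (hf : ContinuousOn f U) {e : ℂ} {r : ℝ} (hr : 0 < r)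
    (hs : Metric.sphere e r ⊆ U) : (∮ z in C(e, r), f z).re = 0 := by
  have hm : ∀ t, circleMap e r t ∈ U := fun t => hs (circleMap_mem_sphere e hr.le t)
  have hd : ∀ t, HasDerivAt (fun t => H (circleMap e r t)) ((deriv (circleMap e r) t * f (circleMap e r t)).re) t := by
    intro t
    have := (h _ (hm t)).comp_hasDerivAt t (hasDerivAt_circleMap e r t)
    refine this.congr_deriv ?_
    simp [mul_comm]
  have hc : Continuous fun t => deriv (circleMap e r) t * f (circleMap e r t) := by
    refine Continuous.mul ?_ (hf.comp_continuous (continuous_circleMap e r) hm)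
    have h0 : deriv (circleMap e r) = fun t => circleMap 0 r t * I := funext fun t => deriv_circleMap e r t
    rw [h0]
    exact (continuous_circleMap 0 r).mul continuous_const
  have h1 := intervalIntegral.integral_eq_sub_of_hasDerivAt (a := 0) (b := 2 * Real.pi) (fun t _ => hd t)
    ((Complex.continuous_re.comp hc).intervalIntegrable _ _)
  have h2 : circleMap e r (2 * Real.pi) = circleMap e r 0 := by
    have := periodic_circleMap e r 0
    rwa [zero_add] at this
  rw [h2, sub_self] at h1
  rw [← h1, circleIntegral]
  simp only [smul_eq_mul]
  exact (Complex.reCLM.intervalIntegral_comp_comm (hc.intervalIntegrable _ _)).symm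

lemma RR.D_P {E : Finset ℂ} (p : Polynomial ℂ) : RR.D (RR.P p : RR E) = RR.P p.derivative := RR.ext' fun z hz => by
  rw [RR.ev_P _ hz]
  refine (RR.hasDerivAt _ hz).unique ((p.hasDerivAt z).congr_of_eventuallyEq ?_)
  filter_upwards [E_ev hz] with y hy
  rw [RR.ev_P _ hy]

lemma RR.exP {E : Finset ℂ} (p : Polynomial ℂ) : ∃ F : RR E, RR.D F = RR.P p := by
  induction p using Polynomial.induction_on' with
  | add p r hp hr =>
    obtain ⟨F, hF⟩ := hp
    obtain ⟨G, hG⟩ := hr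
    exact ⟨F + G, by rw [map_add, map_add, hF, hG]⟩
  | monomial k c =>
    refine ⟨RR.P (Polynomial.monomial (k + 1) (c / (k + 1))), ?_⟩
    rw [RR.D_P, Polynomial.derivative_monomial]
    have : (k : ℂ) + 1 ≠ 0 := by exact_mod_cast k.succ_ne_zero
    push_cast
    rw [div_mul_cancel₀ _ this]

/-- partial fractions -/
lemma RR.pf {E : Finset ℂ} (f : RR E) : ∃ (F : RR E) (ρ : E → ℂ), f = RR.D F + ∑ e, ρ e • RR.invS e.2 := by
  classical
  have hP : ∀ p : Polynomial ℂ, ∃ F : RR E, RR.D F = RR.P p := RR.exP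
  have hS : ∀ (e : E) (j : ℕ), ∃ F : RR E, RR.D F = RR.invS e.2 ^ (j + 2) := by
    intro e j
    refine ⟨(-1 / ((j : ℂ) + 1)) • RR.invS e.2 ^ (j + 1), RR.ext' fun z hz => ?_⟩
    have hze : z - e ≠ 0 := sub_ne_zero.2 fun h => hz (h ▸ e.2)
    have h1 : HasDerivAt (fun y : ℂ => (-1 / ((j : ℂ) + 1)) * ((y - e)⁻¹) ^ (j + 1)) (((z - e)⁻¹) ^ (j + 2)) z := by
      have h2 := ((((hasDerivAt_id z).sub_const (e : ℂ)).inv hze).pow (j + 1)).const_mul (-1 / ((j : ℂ) + 1))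
      refine h2.congr_deriv ?_
      have : (j : ℂ) + 1 ≠ 0 := by exact_mod_cast j.succ_ne_zero
      simp
      field_simp
      ring
    have h3 : HasDerivAt ((-1 / ((j : ℂ) + 1)) • RR.invS e.2 ^ (j + 1) : RR E) (((z - e)⁻¹) ^ (j + 2)) z := by
      refine h1.congr_of_eventuallyEq ?_
      filter_upwards [E_ev hz] with y hy
      rw [RR.ev_smul, RR.ev_pow _ _ hy, RR.ev_invS _ hy]
    rw [(RR.hasDerivAt _ hz).unique h3, RR.ev_pow _ _ hz, RR.ev_invS _ hz]
  set gen : Set (RR E) := Set.range (fun p : Polynomial ℂ => (RR.P p : RR E)) ∪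
    Set.range (fun x : E × ℕ => RR.invS x.1.2 ^ (x.2 + 1)) with hgen
  set M := Submodule.span ℂ gen with hM
  have hPM : ∀ p, RR.P p ∈ M := fun p => Submodule.subset_span (Or.inl ⟨p, rfl⟩)
  have hSM : ∀ (e : E) j, RR.invS e.2 ^ (j + 1) ∈ M := fun e j => Submodule.subset_span (Or.inr ⟨(e, j), rfl⟩)
  have hMm : ∀ e : E, ∀ x ∈ M, RR.invS e.2 * x ∈ M := by
    intro e x hx
    induction hx using Submodule.span_induction with
    | zero => rw [mul_zero]; exact M.zero_mem
    | add x y _ _ h1 h2 => rw [mul_add]; exact M.add_mem h1 h2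
    | smul c x _ h1 => rw [mul_smul_comm]; exact M.smul_mem c h1
    | mem x hx =>
      rcases hx with ⟨p, rfl⟩ | ⟨⟨e', j⟩, rfl⟩
      · have h1 := Polynomial.modByMonic_add_div p (Polynomial.X - Polynomial.C (e : ℂ))
        rw [Polynomial.modByMonic_X_sub_C_eq_C_eval] at h1
        have : RR.invS e.2 * RR.P p = p.eval (e : ℂ) • RR.invS e.2 ^ (0 + 1) + RR.P (p /ₘ (Polynomial.X - Polynomial.C (e : ℂ))) := by
          conv_lhs => rw [← h1]
          rw [map_add, map_mul, mul_add, ← mul_assoc, RR.invS_mul, one_mul, zero_add, pow_one]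
          congr 1
          rw [← Polynomial.algebraMap_eq, AlgHom.commutes, mul_comm, ← Algebra.smul_def]
        simp only
        rw [this]
        exact M.add_mem (M.smul_mem _ (hSM e 0)) (hPM _)
      · simp only
        by_cases hee : e = e'
        · subst hee
          rw [← pow_succ']; exact hSM e (j + 1)
        · have hne : (e' : ℂ) - e ≠ 0 := sub_ne_zero.2 fun h => hee (Subtype.ext h.symm)
          have key : RR.invS e.2 * RR.invS e'.2 = ((e' : ℂ) - e)⁻¹ • (RR.invS e'.2 - RR.invS e.2) := by
            refine RR.ext' fun z hz => ?_
            have h1 : z - e ≠ 0 := sub_ne_zero.2 fun h => hz (h ▸ e.2)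
            have h2 : z - e' ≠ 0 := sub_ne_zero.2 fun h => hz (h ▸ e'.2)
            rw [RR.ev_mul, RR.ev_smul, RR.ev_sub, RR.ev_invS _ hz, RR.ev_invS _ hz]
            field_simp
            ring
          induction j with
          | zero =>
            rw [zero_add, pow_one, key]
            refine M.smul_mem _ (M.sub_mem ?_ ?_)
            · simpa using hSM e' 0
            · simpa using hSM e 0
          | succ j ih =>
            rw [pow_succ' _ (j + 1), ← mul_assoc, key, smul_mul_assoc, sub_mul, ← pow_succ']
            exact M.smul_mem _ (M.sub_mem (hSM e' _) ih)
  have hQM : ∀ x ∈ M, RR.invQ * x ∈ M := by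
    have hQ : (RR.invQ : RR E) = ∏ e : E, RR.invS e.2 := by
      refine RR.ext' fun z hz => ?_
      rw [RR.ev_invQ hz, RR.ev_prod _ _ hz, QE_eval, ← Finset.prod_inv_distrib, ← Finset.prod_coe_sort E (fun e => (z - e)⁻¹)]
      exact Finset.prod_congr rfl fun e _ => (RR.ev_invS e.2 hz).symm
    rw [hQ]
    intro x hx
    generalize (Finset.univ : Finset E) = s
    induction s using Finset.induction_on with
    | empty => simpa using hx
    | insert a s ha ih => rw [Finset.prod_insert ha, mul_assoc]; exact hMm a _ ih
  have hfM : f ∈ M := by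
    obtain ⟨p, k, hpk⟩ := RR.exists_poly f
    have : ∀ k : ℕ, RR.invQ ^ k * RR.P p ∈ M := by
      intro k
      induction k with
      | zero => simpa using hPM p
      | succ k ih => rw [pow_succ', mul_assoc]; exact hQM _ ih
    have h1 := this k
    rwa [← hpk, ← mul_assoc, ← mul_pow, RR.invQ_mul, one_pow, one_mul] at h1
  clear_value gen
  induction hfM using Submodule.span_induction with
  | zero => exact ⟨0, 0, by simp⟩
  | add x y _ _ h1 h2 =>
    obtain ⟨F, ρ, hF⟩ := h1
    obtain ⟨G, σ, hG⟩ := h2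
    refine ⟨F + G, ρ + σ, ?_⟩
    simp only [map_add, Pi.add_apply, add_smul, Finset.sum_add_distrib]
    rw [hF, hG]; ring
  | smul c x _ h1 =>
    obtain ⟨F, ρ, hF⟩ := h1
    refine ⟨c • F, c • ρ, ?_⟩
    rw [hF, smul_add, Derivation.map_smul, Finset.smul_sum]
    simp only [Pi.smul_apply, smul_assoc]
  | mem x hx =>
    rw [hgen] at hx
    rcases hx with ⟨p, rfl⟩ | ⟨⟨e, j⟩, rfl⟩
    · obtain ⟨F, hF⟩ := hP p
      exact ⟨F, 0, by simp [hF]⟩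
    · cases j with
      | zero => exact ⟨0, Pi.single e 1, by simp [Pi.single_apply]⟩
      | succ j =>
        obtain ⟨F, hF⟩ := hS e j
        exact ⟨F, 0, by simp [hF]⟩

/-- residues of functions with a potential are real -/
lemma Pot.res {p ρ : ℂ} {R : ℝ} (hR : 0 < R) {H : ℂ → ℝ} {f F F' k : ℂ → ℂ}
    (h : Pot (Metric.ball p R \ {p}) H f)
    (hF : ∀ z ∈ Metric.ball p R \ {p}, HasDerivAt F (F' z) z) (hk : DifferentiableOn ℂ k (Metric.ball p R))
    (hf : ∀ z ∈ Metric.ball p R \ {p}, f z = F' z + ρ * (z - p)⁻¹ + k z) : ρ.im = 0 := by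
  obtain ⟨k1, hk1⟩ := hk.isExactOn_ball
  have h2 : Pot (Metric.ball p R \ {p}) (fun z => H z - (F z + k1 z).re) (fun z => ρ * (z - p)⁻¹) := by
    refine (h.sub (f := f) (K := fun z => (F z + k1 z).re) (g := fun z => F' z + k z) ?_).congr ?_
    · intro z hz
      exact fd_re ((hF z hz).add (hk1 z hz.1))
    · intro z hz
      rw [hf z hz]; ring
  have h3 := h2.circle (e := p) (r := R / 2) ?_ (by positivity) ?_
  · have h4 : (∮ z in C(p, R / 2), ρ * (z - p)⁻¹) = ρ * (2 * Real.pi * I) := by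
      rw [circleIntegral.integral_const_mul, circleIntegral.integral_sub_center_inv _ (by positivity)]
    rw [h4] at h3
    have h5 : ρ.im * (2 * Real.pi) = 0 := by
      simpa using h3
    rcases mul_eq_zero.1 h5 with h6 | h6
    · exact h6
    · exact absurd h6 (by positivity)
  · refine continuousOn_const.mul (ContinuousOn.inv₀ (by fun_prop) fun z hz => sub_ne_zero.2 hz.2)
  · intro z hz
    rw [mem_sphere_iff_norm] at hz
    refine ⟨by rw [mem_ball_iff_norm, hz]; linarith, fun h => ?_⟩
    rw [Set.mem_singleton_iff] at h
    rw [h, sub_self, norm_zero] at hz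
    linarith

lemma punct {E : Finset ℂ} {e : ℂ} {U : Set ℂ} (hU : U ∈ 𝓝 e) : ∃ R > 0, Metric.ball e R ⊆ U ∧ Metric.ball e R \ {e} ⊆ (E : Set ℂ)ᶜ := by
  have : ∀ᶠ z in 𝓝 e, z ∈ U ∧ z ∉ E.erase e := (eventually_mem_set.2 hU).and (E_ev (by simp))
  obtain ⟨R, hR, h⟩ := Metric.eventually_nhds_iff_ball.1 this
  exact ⟨R, hR, fun z hz => (h z hz).1, fun z hz hzE => (h z hz.1).2 (Finset.mem_erase.2 ⟨hz.2, hzE⟩)⟩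

lemma Pot.reRR {E : Finset ℂ} (F : RR E) : Pot (E : Set ℂ)ᶜ (fun z => (F z).re) (RR.D F : RR E) :=
  fun z hz => fd_re (RR.hasDerivAt F (by simpa using hz))

lemma pf_ev {E : Finset ℂ} (F : RR E) (ρ : E → ℂ) {z : ℂ} (hz : z ∉ E) :
    (RR.D F + ∑ e, ρ e • RR.invS e.2 : RR E) z = (RR.D F : RR E) z + ∑ e, ρ e * (z - e)⁻¹ := by
  rw [RR.ev_add, RR.ev_sum]
  congr 1
  exact Finset.sum_congr rfl fun e _ => by rw [RR.ev_smul, RR.ev_invS _ hz]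

/-- realness of residues in partial fractions, potential on a punctured neighbourhood, up to holomorphic terms -/
lemma Pot.resRR {E : Finset ℂ} (F : RR E) (ρ : E → ℂ) (e : E) {H : ℂ → ℝ} {f k : ℂ → ℂ} {U : Set ℂ} (hU : U ∈ 𝓝 (e : ℂ))
    (hH : Pot (U \ E) H f) (hk : DifferentiableOn ℂ k U)
    (hf : ∀ z ∈ U \ (E : Set ℂ), f z = (RR.D F + ∑ e, ρ e • RR.invS e.2 : RR E) z + k z) : (ρ e).im = 0 := by
  classical
  obtain ⟨R, hR, hRU, hRE⟩ := punct (E := E) hU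
  refine Pot.res (p := e) (F := F) (F' := (RR.D F : RR E)) (f := f)
    (k := fun z => ∑ e' ∈ Finset.univ.erase e, ρ e' * (z - e')⁻¹ + k z) hR
    (hH.mono fun z hz => ⟨hRU hz.1, hRE hz⟩) (fun z hz => RR.hasDerivAt F (by simpa using hRE hz)) ?_ ?_
  · refine DifferentiableOn.add (DifferentiableOn.fun_sum fun e' he' => ?_) (hk.mono hRU)
    refine (DifferentiableOn.inv (by fun_prop) fun z hz => sub_ne_zero.2 fun h => ?_).const_mul _
    subst h
    exact hRE ⟨hz, fun h => (Finset.mem_erase.1 he').1 (Subtype.ext h)⟩ e'.2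
  · intro z hz
    rw [hf z ⟨hRU hz.1, hRE hz⟩, pf_ev _ _ (by simpa using hRE hz), ← Finset.add_sum_erase _ _ (Finset.mem_univ e)]
    ring

/-- potential of a partial fraction with real residues -/
def potF {E : Finset ℂ} (F : RR E) (ρ : E → ℂ) (z : ℂ) : ℝ := (F z).re + ∑ e, (ρ e).re * Real.log ‖z - e‖

lemma Pot.potF {E : Finset ℂ} (F : RR E) {ρ : E → ℂ} (hρ : ∀ e, (ρ e).im = 0) :
    Pot (E : Set ℂ)ᶜ (potF F ρ) (RR.D F + ∑ e, ρ e • RR.invS e.2 : RR E) := by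
  have h1 : Pot (E : Set ℂ)ᶜ (fun z => ∑ e, (ρ e).re * Real.log ‖z - e‖) (fun z => ∑ e : E, ((ρ e).re : ℂ) * (z - e)⁻¹) := by
    refine Pot.sum _ fun e _ => Pot.smul (fun z hz => fd_log (sub_ne_zero.2 fun h => ?_)) _
    exact hz (by rw [h]; exact e.2)
  refine ((Pot.reRR F).add h1).congr fun z hz => ?_
  rw [pf_ev _ _ (by simpa using hz)]
  congr 1
  refine Finset.sum_congr rfl fun e _ => ?_
  rw [show ((ρ e).re : ℂ) = ρ e from Complex.ext (by simp) (by simp [hρ e])]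

/-- partial fraction map -/
def Th (E : Finset ℂ) : (RR E × (E → ℂ)) →ₗ[ℂ] RR E :=
  LinearMap.coprod (RR.D : Derivation ℂ (RR E) (RR E)).toLinearMap (Fintype.linearCombination ℂ (fun e : E => RR.invS e.2))

lemma Th_apply {E : Finset ℂ} (F : RR E) (ρ : E → ℂ) : Th E (F, ρ) = RR.D F + ∑ e, ρ e • RR.invS e.2 := by
  simp [Th, Fintype.linearCombination_apply]

lemma Th_surj (E : Finset ℂ) : Function.Surjective (Th E) := fun f => by
  obtain ⟨F, ρ, h⟩ := RR.pf f
  exact ⟨(F, ρ), by rw [Th_apply, h]⟩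

lemma Th_real {E : Finset ℂ} {F : RR E} {ρ : E → ℂ} {H : ℂ → ℝ} (h : Pot (E : Set ℂ)ᶜ H (Th E (F, ρ))) (e : E) :
    (ρ e).im = 0 := by
  refine Pot.resRR F ρ e (U := Set.univ) Filter.univ_mem (k := fun _ => 0) (h.mono fun z hz => hz.2) (by fun_prop) ?_
  intro z _
  rw [Th_apply, add_zero]

lemma Th_ker {E : Finset ℂ} {F : RR E} {ρ : E → ℂ} (h : Th E (F, ρ) = 0) : ρ = 0 ∧ ∃ c : ℂ, F = c • 1 := by
  have h0 : Pot (E : Set ℂ)ᶜ (fun _ => 0) (0 : RR E) := fun z hz => by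
    rw [RR.ev_zero]
    exact (hasFDerivAt_const (0 : ℝ) z).congr_fderiv (by ext <;> simp)
  have h1 : ∀ e, (ρ e).im = 0 := Th_real (F := F) (H := fun _ => 0) (by rw [h]; exact h0)
  have h2 : ∀ e, ((I • ρ) e).im = 0 := Th_real (F := I • F) (H := fun _ => 0) (by
    rw [← Prod.smul_mk, map_smul, h, smul_zero]; exact h0)
  have h3 : ρ = 0 := by
    funext e
    refine Complex.ext ?_ (h1 e)
    simpa using h2 e
  refine ⟨h3, ?_⟩
  subst h3
  rw [Th_apply] at h
  refine RR.wronsk (g := (1 : RR E)) one_ne_zero ?_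
  simp only [Pi.zero_apply, zero_smul, Finset.sum_const_zero, add_zero] at h
  rw [h]; simp

/-- the path functionals on partial fractions -/
def lamF (E : Finset ℂ) (c0 : ℂ) (C : Finset ℂ) : (E ⊕ C) → (RR E × (E → ℂ)) →ₗ[ℂ] ℂ
  | .inl e => (2 * Real.pi * I : ℂ) • (LinearMap.proj e ∘ₗ LinearMap.snd ℂ (RR E) (E → ℂ))
  | .inr c => (RR.evL (c : ℂ) - RR.evL c0) ∘ₗ LinearMap.fst ℂ (RR E) (E → ℂ) +
      ∑ e : E, Complex.log ((c - e) / (c0 - e)) • (LinearMap.proj e ∘ₗ LinearMap.snd ℂ (RR E) (E → ℂ))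

lemma lamF_inl {E C : Finset ℂ} {c0 : ℂ} (e : E) (F : RR E) (ρ : E → ℂ) : lamF E c0 C (.inl e) (F, ρ) = 2 * Real.pi * I * ρ e := by
  simp [lamF]

lemma lamF_inr {E C : Finset ℂ} {c0 : ℂ} (c : C) (F : RR E) (ρ : E → ℂ) : lamF E c0 C (.inr c) (F, ρ) =
    F c - F c0 + ∑ e : E, Complex.log ((c - e) / (c0 - e)) * ρ e := by
  simp [lamF, LinearMap.sum_apply]

lemma exists_Gam (E : Finset ℂ) {c0 : ℂ} (hc0 : c0 ∉ E) (C : Finset ℂ) (hC : ∀ c ∈ C, c ∉ E) :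
    ∃ Γ : (E ⊕ C) → RR E →ₗ[ℂ] ℂ, ∀ α x, Γ α (Th E x) = lamF E c0 C α x := by
  obtain ⟨g, hg⟩ := LinearMap.exists_rightInverse_of_surjective (Th E) (LinearMap.range_eq_top.2 (Th_surj E))
  refine ⟨fun α => lamF E c0 C α ∘ₗ g, fun α x => ?_⟩
  have hker : ∀ x, Th E x = 0 → lamF E c0 C α x = 0 := by
    rintro ⟨F, ρ⟩ h
    obtain ⟨h1, c, h2⟩ := Th_ker h
    subst h1 h2
    rcases α with e | d
    · rw [lamF_inl]; simp
    · rw [lamF_inr, RR.ev_smul, RR.ev_smul, RR.ev_one hc0, RR.ev_one (hC d d.2)]; simp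
  have h1 : Th E (g (Th E x) - x) = 0 := by
    rw [map_sub, ← LinearMap.comp_apply, hg]; simp
  have := hker _ h1
  rw [map_sub, sub_eq_zero] at this
  exact this

lemma dvd_pow_roots {R : Polynomial ℂ} (s : Multiset ℂ) (h : ∀ w ∈ s, R.eval w = 0) :
    (s.map fun w => Polynomial.X - Polynomial.C w).prod ∣ R ^ s.card := by
  induction s using Multiset.induction_on with
  | empty => simp
  | cons a s ih =>
    rw [Multiset.map_cons, Multiset.prod_cons, Multiset.card_cons, pow_succ']
    exact mul_dvd_mul (Polynomial.dvd_iff_isRoot.2 (h a (Multiset.mem_cons_self _ _)))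
      (ih fun w hw => h w (Multiset.mem_cons_of_mem hw))

/-- a polynomial with prescribed values and derivative divisible by `p` -/
lemma bump (p : Polynomial ℂ) (hp : p ≠ 0) (c : ℂ) (T : Finset ℂ) (hT : c ∉ T) : ∃ B s : Polynomial ℂ,
    B.derivative = p * s ∧ B.eval c = 1 ∧ ∀ t ∈ T, B.eval t = 0 := by
  classical
  set S := (p.roots.toFinset ∪ T).erase c
  set κ := ∏ w ∈ S, (c - w)
  have hκ : κ ≠ 0 := Finset.prod_ne_zero_iff.2 fun w hw => sub_ne_zero.2 fun h => by
    subst h; simp [S] at hw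
  set A : Polynomial ℂ := Polynomial.C κ⁻¹ * ∏ w ∈ S, (Polynomial.X - Polynomial.C w) with hA
  have hAc : A.eval c = 1 := by
    simp only [hA, Polynomial.eval_mul, Polynomial.eval_prod, Polynomial.eval_C, Polynomial.eval_sub, Polynomial.eval_X]
    exact inv_mul_cancel₀ hκ
  have hAS : ∀ w ∈ S, A.eval w = 0 := fun w hw => by
    simp only [hA, Polynomial.eval_mul, Polynomial.eval_prod, Polynomial.eval_C, Polynomial.eval_sub, Polynomial.eval_X]
    rw [Finset.prod_eq_zero hw (sub_self w), mul_zero]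
  clear_value A
  set k := p.roots.card
  have h1 : p ∣ (A * (1 - A ^ (k + 1))) ^ k := by
    have h2 := IsAlgClosed.splits p
    have h3 := dvd_pow_roots (R := A * (1 - A ^ (k + 1))) p.roots (by
      intro w hw
      by_cases hwc : w = c
      · subst hwc; simp [hAc]
      · have := hAS w (Finset.mem_erase.2 ⟨hwc, Finset.mem_union_left _ (by simpa using hw)⟩)
        simp [this])
    rw [h2.eq_prod_roots]
    exact (IsUnit.mul_left_dvd ((Polynomial.isUnit_C).2 (by simpa using hp))).2 h3
  obtain ⟨s, hs⟩ := h1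
  refine ⟨1 - (1 - A ^ (k + 1)) ^ (k + 1), (((k + 1 : ℕ) : Polynomial ℂ) * ((k + 1 : ℕ) : Polynomial ℂ) * A.derivative) * s, ?_, ?_, ?_⟩
  · have : p * ((((k + 1 : ℕ) : Polynomial ℂ) * ((k + 1 : ℕ) : Polynomial ℂ) * A.derivative) * s) =
      (((k + 1 : ℕ) : Polynomial ℂ) * ((k + 1 : ℕ) : Polynomial ℂ) * A.derivative) * (A * (1 - A ^ (k + 1))) ^ k := by
        rw [hs]; ring
    rw [this]
    simp only [Polynomial.derivative_sub, Polynomial.derivative_one, Polynomial.derivative_pow, Nat.add_sub_cancel, Polynomial.C_eq_natCast, mul_pow]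
    ring
  · simp [hAc]
  · intro t ht
    have : A.eval t = 0 := hAS t (Finset.mem_erase.2 ⟨fun h => hT (h ▸ ht), Finset.mem_union_right _ ht⟩)
    simp [this]

lemma re_log_div {c c0 e : ℂ} (h : c - e ≠ 0) (h0 : c0 - e ≠ 0) : (Complex.log ((c - e) / (c0 - e))).re = Real.log ‖c - e‖ - Real.log ‖c0 - e‖ := by
  rw [Complex.log_re, norm_div, Real.log_div (by simpa using h) (by simpa using h0)]

/-- existence of the path functionals -/
lemma exists_pathData (E : Finset ℂ) {W : Set ℂ} (hWE : ∀ e ∈ E, e ∉ W) {c0 : ℂ} (hc0W : c0 ∈ W) (C : Finset ℂ)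
    (hCW : ∀ c ∈ C, c ∈ W) (hc0C : c0 ∉ C) : ∃ S : PathData E W (E ⊕ C), (∀ α, S.a α = c0) ∧ (∀ e, S.b (.inl e) = c0) ∧
      (∀ c, S.b (.inr c) = c) ∧ ∀ f, (∀ e, (S.Γ (.inl e) f).re = 0) → ∃ H, Pot (E : Set ℂ)ᶜ H f := by
  classical
  have hc0 : c0 ∉ E := fun h => hWE _ h hc0W
  have hC : ∀ c ∈ C, c ∉ E := fun c hc h => hWE _ h (hCW c hc)
  obtain ⟨Γ, hΓ⟩ := exists_Gam E hc0 C hC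
  have hre : ∀ (F : RR E) (ρ : E → ℂ) (c : C), (∀ e, (ρ e).im = 0) →
      (Γ (.inr c) (Th E (F, ρ))).re = potF F ρ c - potF F ρ c0 := by
    intro F ρ c hρ
    rw [hΓ, lamF_inr, potF, potF, Complex.add_re, Complex.sub_re, Complex.re_sum]
    have : ∀ e : E, (Complex.log ((c - e) / (c0 - e)) * ρ e).re = (ρ e).re * Real.log ‖(c : ℂ) - e‖ - (ρ e).re * Real.log ‖c0 - e‖ := by
      intro e
      rw [Complex.mul_re, hρ e, re_log_div (sub_ne_zero.2 fun h => hC c c.2 (by rw [h]; exact e.2)) (sub_ne_zero.2 fun h => hc0 (by rw [h]; exact e.2))]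
      ring
    rw [Finset.sum_congr rfl fun e _ => this e, Finset.sum_sub_distrib]
    ring
  have hree : ∀ (F : RR E) (ρ : E → ℂ) (e : E), (Γ (.inl e) (Th E (F, ρ))).re = - (2 * Real.pi * (ρ e).im) := by
    intro F ρ e
    rw [hΓ, lamF_inl]
    simp
  have hcirc : ∀ (F : RR E) (ρ : E → ℂ) (e : E), (Γ (.inl e) (Th E (F, ρ))).re = 0 → (ρ e).im = 0 := by
    intro F ρ e h1
    rw [hree] at h1
    have : (2 * Real.pi : ℝ) ≠ 0 := by positivity
    have h2 : 2 * Real.pi * (ρ e).im = 0 := by linarith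
    exact (mul_eq_zero.1 h2).resolve_left this
  have hibpl : ∀ F e, Γ (.inl e) (RR.D F) = 0 := by
    intro F e
    have : RR.D F = Th E (F, 0) := by rw [Th_apply]; simp
    rw [this, hΓ, lamF_inl]; simp
  have hibpr : ∀ F c, Γ (.inr c) (RR.D F) = F c - F c0 := by
    intro F c
    have : RR.D F = Th E (F, 0) := by rw [Th_apply]; simp
    rw [this, hΓ, lamF_inr]; simp
  have hsing : ∀ (e e' : E), Γ (.inl e') (RR.invS e.2) = if e' = e then 2 * Real.pi * I else 0 := by
    intro e e'
    have : RR.invS e.2 = Th E (0, Pi.single e 1) := by rw [Th_apply]; simp [Pi.single_apply]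
    rw [this, hΓ, lamF_inl]; simp [Pi.single_apply]
  refine ⟨{ a := fun _ => c0, b := Sum.elim (fun _ => c0) (fun c => c), haW := fun _ => hc0W, hbW := ?_, Γ := Γ, ibp := ?_, indep := ?_, ftc := ?_, g4 := ?_ },
    fun _ => rfl, fun _ => rfl, fun _ => rfl, ?_⟩
  · rintro (e | c)
    · exact hc0W
    · exact hCW c c.2
  · rintro (e | c) F
    · rw [hibpl]; simp
    · rw [hibpr]; simp
  · intro q hq τ
    obtain ⟨p, k, hpk⟩ := RR.exists_poly q
    have hp : p ≠ 0 := by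
      rintro rfl
      rw [map_zero] at hpk
      rcases mul_eq_zero.1 hpk with h | h
      · exact pow_ne_zero k (RR.P_ne (QE_ne E)) h
      · exact hq h
    have hc : ∀ c : C, ∃ ω : RR E, ∀ α, Γ α (RR.P p * ω) = if α = .inr c then 1 else 0 := by
      intro c
      obtain ⟨B, s, hB, hB1, hB0⟩ := bump p hp c (insert c0 (C.erase c)) (by
        simp only [Finset.mem_insert, Finset.mem_erase, ne_eq, not_true_eq_false, false_and, or_false]
        rintro h
        exact hc0C (h ▸ c.2))
      refine ⟨RR.P s, ?_⟩
      rw [← map_mul, ← hB, ← RR.D_P]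
      rintro (e | c')
      · rw [hibpl]; simp
      · rw [hibpr, RR.ev_P _ hc0, RR.ev_P _ (hC c' c'.2), hB0 c0 (Finset.mem_insert_self _ _)]
        by_cases h : c' = c
        · subst h; simp [hB1]
        · rw [hB0 c' (Finset.mem_insert_of_mem (Finset.mem_erase.2 ⟨fun h' => h (Subtype.ext h'), c'.2⟩))]
          simp [h]
    have he : ∀ e : E, ∃ ω : RR E, ∀ e' : E, Γ (.inl e') (RR.P p * ω) = if e' = e then 1 else 0 := by
      intro e
      obtain ⟨p1, hp1, hp1e⟩ := Polynomial.exists_eq_pow_rootMultiplicity_mul_and_not_dvd p hp (e : ℂ)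
      rw [Polynomial.dvd_iff_isRoot, Polynomial.IsRoot.def] at hp1e
      set m := p.rootMultiplicity (e : ℂ)
      have h1 := Polynomial.modByMonic_add_div p1 (Polynomial.X - Polynomial.C (e : ℂ))
      rw [Polynomial.modByMonic_X_sub_C_eq_C_eval] at h1
      obtain ⟨F2, hF2⟩ := RR.exP (E := E) (p1 /ₘ (Polynomial.X - Polynomial.C (e : ℂ)))
      have h2 : RR.P p * RR.invS e.2 ^ (m + 1) = p1.eval (e : ℂ) • RR.invS e.2 + RR.D F2 := by
        have h3 : RR.invS e.2 * RR.P (Polynomial.X - Polynomial.C (e : ℂ)) = 1 := RR.invS_mul e.2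
        have h4 : RR.P p * RR.invS e.2 ^ (m + 1) = RR.P p1 * RR.invS e.2 * (RR.invS e.2 * RR.P (Polynomial.X - Polynomial.C (e : ℂ))) ^ m := by
          conv_lhs => rw [hp1]
          rw [map_mul, map_pow, mul_pow, pow_succ]; ring
        rw [h4, h3, one_pow, mul_one, hF2]
        conv_lhs => rw [← h1]
        rw [map_add, map_mul, add_mul, mul_right_comm, mul_comm (RR.P (Polynomial.X - Polynomial.C (e : ℂ))), h3, one_mul,
          ← Polynomial.algebraMap_eq, AlgHom.commutes, ← Algebra.smul_def]
      have hpi : (2 * Real.pi * I : ℂ) ≠ 0 := Complex.two_pi_I_ne_zero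
      refine ⟨(p1.eval (e : ℂ) * (2 * Real.pi * I))⁻¹ • RR.invS e.2 ^ (m + 1), fun e' => ?_⟩
      rw [mul_smul_comm, h2, map_smul, map_add, map_smul, hsing, hibpl, smul_eq_mul, smul_eq_mul, add_zero]
      split_ifs
      · exact inv_mul_cancel₀ (mul_ne_zero hp1e hpi)
      · simp
    choose ωc hωc using hc
    choose ωe hωe using he
    obtain ⟨ω1, hω1⟩ : ∃ ω1 : RR E, ω1 = ∑ e, τ (.inl e) • ωe e := ⟨_, rfl⟩
    set ω2 := ω1 + ∑ c, (τ (.inr c) - Γ (.inr c) (RR.P p * ω1)) • ωc c with hω2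
    refine ⟨RR.P (QE E) ^ k * ω2, fun α => ?_⟩
    have : q * (RR.P (QE E) ^ k * ω2) = RR.P p * ω2 := by rw [← hpk]; ring
    rw [this, hω2, mul_add, map_add, Finset.mul_sum, map_sum]
    simp only [mul_smul_comm, map_smul, smul_eq_mul, hωc]
    rcases α with e | c
    · rw [hω1, Finset.mul_sum, map_sum]
      simp only [mul_smul_comm, map_smul, smul_eq_mul, hωe]
      simp
    · simp
  · intro α f H hH
    obtain ⟨⟨F, ρ⟩, rfl⟩ := Th_surj E f
    have hρ : ∀ e, (ρ e).im = 0 := Th_real hH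
    rcases α with e | c
    · rw [hree, hρ e]; simp
    · rw [hre _ _ _ hρ]
      have h1 : Pot (E : Set ℂ)ᶜ (fun z => H z - potF F ρ z) (fun _ => 0) := by
        refine (hH.sub (Pot.potF F hρ)).congr fun z hz => ?_
        rw [Th_apply]; simp
      have := h1.const (E_open E) (E_conn E) (x := c) (y := c0) (by simpa using hC c c.2) (by simpa using hc0)
      simp only [Sum.elim_inr]
      linarith
  · intro f hf
    obtain ⟨⟨F, ρ⟩, rfl⟩ := Th_surj E f
    have hρ : ∀ e, (ρ e).im = 0 := fun e => hcirc F ρ e (hf (.inl e))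
    refine ⟨fun z => potF F ρ z + - potF F ρ c0, ?_, ?_⟩
    · rw [Th_apply]
      exact (Pot.potF F hρ).add_const _
    · rintro (e | c)
      · simp
      · have h1 := hf (.inr c)
        rw [hre _ _ _ hρ] at h1
        simp only [Sum.elim_inr]
        constructor <;> linarith
  · intro f hf
    obtain ⟨⟨F, ρ⟩, rfl⟩ := Th_surj E f
    have hρ : ∀ e, (ρ e).im = 0 := fun e => hcirc F ρ e (hf e)
    exact ⟨potF F ρ, by rw [Th_apply]; exact Pot.potF F hρ⟩

lemma Pot.wirt {U : Set ℂ} {H : ℂ → ℝ} {f : ℂ → ℂ} (h : Pot U H f) {z : ℂ} (hz : z ∈ U) : wirt H z = f z := by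
  rw [_root_.wirt, (h z hz).fderiv]
  apply Complex.ext <;> simp

lemma pot_wirt {U : Set ℂ} (hU : IsOpen U) {H : ℂ → ℝ} (h : DifferentiableOn ℝ H U) : Pot U H (wirt H) := by
  intro z hz
  refine ((h z hz).differentiableAt (hU.mem_nhds hz)).hasFDerivAt.congr_fderiv ?_
  ext v
  have h1 : v = v.re • (1 : ℂ) + v.im • I := by apply Complex.ext <;> simp
  have h2 : (fderiv ℝ H z) v = v.re * (fderiv ℝ H z) 1 + v.im * (fderiv ℝ H z) I := by
    conv_lhs => rw [h1]
    rw [map_add, map_smul, map_smul, smul_eq_mul, smul_eq_mul]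
  rw [h2]
  simp [_root_.wirt]
  ring

lemma punct_conn (p : ℂ) {R : ℝ} (hR : 0 < R) : IsPreconnected (Metric.ball p R \ {p}) := by
  have h1 : Metric.ball p R \ {p} = (fun w : ℂ => p + Complex.exp w) '' {w : ℂ | w.re < Real.log R} := by
    ext z
    simp only [Set.mem_diff, Metric.mem_ball, dist_eq_norm, Set.mem_singleton_iff, Set.mem_image, Set.mem_setOf_eq]
    constructor
    · rintro ⟨h, h'⟩
      refine ⟨Complex.log (z - p), ?_, ?_⟩
      · rw [Complex.log_re]
        exact Real.log_lt_log (by simpa [sub_eq_zero] using h') h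
      · rw [Complex.exp_log (sub_ne_zero.2 h')]; ring
    · rintro ⟨w, hw, rfl⟩
      refine ⟨?_, by simp⟩
      rw [add_sub_cancel_left, Complex.norm_exp, ← Real.exp_log hR]
      exact Real.exp_lt_exp.2 hw
  rw [h1]
  exact (convex_halfSpace_re_lt _).isPreconnected.image _ (by fun_prop)

/-- potentials extend across finite sets -/
lemma Pot.rem {U : Set ℂ} (hU : IsOpen U) (T : Finset ℂ) {H : ℂ → ℝ} {f : ℂ → ℂ} (h : Pot (U \ T) H f)
    (hf : DifferentiableOn ℂ f U) : ∃ H', Pot U H' f ∧ ∀ z ∉ T, H' z = H z := by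
  classical
  have h1 : ∀ p ∈ U, ∃ R > 0, ∃ k : ℂ → ℝ, Metric.ball p R \ {p} ⊆ (T : Set ℂ)ᶜ ∧ Pot (Metric.ball p R) k f ∧
      ∀ z ∈ Metric.ball p R \ {p}, k z = H z := by
    intro p hp
    obtain ⟨R, hR, hRU, hRT⟩ := punct (E := T) (hU.mem_nhds hp)
    obtain ⟨k, hk⟩ := (hf.mono hRU).isExactOn_ball
    have hkp : Pot (Metric.ball p R) (fun z => (k z).re) f := fun z hz => fd_re (hk z hz)
    have hsub : Metric.ball p R \ {p} ⊆ U \ T := fun z hz => ⟨hRU hz.1, hRT hz⟩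
    have h2 : Pot (Metric.ball p R \ {p}) (fun z => H z - (k z).re) (fun _ => 0) :=
      ((h.mono hsub).sub (hkp.mono Set.diff_subset)).congr fun z _ => sub_self _
    have hx : p + (R / 2 : ℝ) ∈ Metric.ball p R \ {p} := by
      refine ⟨?_, ?_⟩
      · rw [mem_ball_iff_norm, add_sub_cancel_left, Complex.norm_real, Real.norm_of_nonneg (by positivity)]
        linarith
      · rw [Set.mem_singleton_iff, add_eq_left, Complex.ofReal_eq_zero]
        positivity
    refine ⟨R, hR, fun z => (k z).re + (H (p + (R / 2 : ℝ)) - (k (p + (R / 2 : ℝ))).re), hRT, hkp.add_const _, fun z hz => ?_⟩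
    have := h2.const (Metric.isOpen_ball.sdiff isClosed_singleton) (punct_conn p hR) hx hz
    simp only at this ⊢
    linarith
  choose! R hR k hkT hk hkH using h1
  refine ⟨fun z => if z ∈ T then k z z else H z, fun z hz => ?_, fun z hz => if_neg hz⟩
  by_cases hzT : z ∈ T
  · refine (hk z hz z (Metric.mem_ball_self (hR z hz))).congr_of_eventuallyEq ?_
    filter_upwards [Metric.ball_mem_nhds z (hR z hz)] with y hy
    by_cases hyz : y = z
    · subst hyz; rw [if_pos hzT]
    · rw [if_neg (by simpa using hkT z hz ⟨hy, hyz⟩), hkH z hz y ⟨hy, hyz⟩]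
  · refine (h z ⟨hz, by simpa using hzT⟩).congr_of_eventuallyEq ?_
    filter_upwards [E_ev hzT] with y hy
    rw [if_neg hy]

lemma Pot.bound {U : Set ℂ} {H : ℂ → ℝ} {f : ℂ → ℂ} (h : Pot U H f) {c z : ℂ} {s M : ℝ} (hs : Metric.closedBall c s ⊆ U)
    (hM : ∀ w ∈ Metric.closedBall c s, ‖f w‖ ≤ M) (hz : z ∈ Metric.closedBall c s) : |H z - H c| ≤ M * ‖z - c‖ := by
  have hs0 : 0 ≤ s := (norm_nonneg _).trans (mem_closedBall_iff_norm.1 hz)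
  refine (convex_closedBall c s).norm_image_sub_le_of_norm_hasFDerivWithin_le
    (fun w hw => (h w (hs hw)).hasFDerivWithinAt) (fun w hw => ?_) (Metric.mem_closedBall_self hs0) hz
  refine ContinuousLinearMap.opNorm_le_bound _ ((norm_nonneg _).trans (hM w hw)) fun v => ?_
  simp only [ContinuousLinearMap.comp_apply, ContinuousLinearMap.mul_apply', Complex.reCLM_apply, Real.norm_eq_abs]
  refine (Complex.abs_re_le_norm _).trans ?_
  rw [norm_mul]
  exact mul_le_mul_of_nonneg_right (hM w hw) (norm_nonneg _)

lemma pole_order {n : ℕ} (f : Fin n → ℂ → ℂ) (p : ℂ) (hm : ∀ j, MeromAt (f j) p) (hp : ∃ j, IsPole (f j) p) :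
    ∃ (m : ℕ) (g : Fin n → ℂ → ℂ), 1 ≤ m ∧ (∀ j, AnalyticAt ℂ (g j) p) ∧ (∀ j, ∀ᶠ z in 𝓝[≠] p, f j z = g j z / (z - p) ^ m) ∧
      ∃ j, g j p ≠ 0 := by
  classical
  have hne : ∀ᶠ z in 𝓝[≠] p, z - p ≠ 0 := by
    filter_upwards [self_mem_nhdsWithin] with z hz using sub_ne_zero.2 hz
  have hex : ∃ m : ℕ, ∀ j, ∃ g : ℂ → ℂ, AnalyticAt ℂ g p ∧ ∀ᶠ z in 𝓝[≠] p, f j z = g z / (z - p) ^ m := by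
    choose m g hg hfg using hm
    refine ⟨∑ j, m j, fun j => ⟨fun z => g j z * (z - p) ^ (∑ i, m i - m j), ?_, ?_⟩⟩
    · have := hg j
      fun_prop
    · filter_upwards [hfg j, hne] with z hz hzp
      have hle : m j ≤ ∑ i, m i := Finset.single_le_sum (fun _ _ => Nat.zero_le _) (Finset.mem_univ j)
      rw [hz, div_eq_div_iff (pow_ne_zero _ hzp) (pow_ne_zero _ hzp), mul_assoc, ← pow_add, Nat.sub_add_cancel hle]
  have hmin := Nat.find_spec hex
  set m := Nat.find hex with hmdef
  have hm1 : 1 ≤ m := by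
    by_contra hlt
    have hm0 : m = 0 := by omega
    obtain ⟨j, k, hk, g, hg, hgp, hfg⟩ := hp
    obtain ⟨g0, hg0, hfg0⟩ := hmin j
    rw [hm0] at hfg0
    have h1 : ∀ᶠ z in 𝓝[≠] p, g z = g0 z * (z - p) ^ k := by
      filter_upwards [hfg, hfg0, hne] with z h1 h2 h3
      rw [h1, pow_zero, div_one] at h2
      rw [← h2, div_mul_cancel₀ _ (pow_ne_zero _ h3)]
    have h2 : Tendsto g (𝓝[≠] p) (𝓝 (g p)) := hg.continuousAt.tendsto.mono_left nhdsWithin_le_nhds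
    have h3 : ContinuousAt (fun z => g0 z * (z - p) ^ k) p := by
      have := hg0.continuousAt
      fun_prop
    have h4 := (h3.tendsto.mono_left nhdsWithin_le_nhds).congr' (f₁ := fun z => g0 z * (z - p) ^ k) (f₂ := g) (l₁ := 𝓝[≠] p)
      (by filter_upwards [h1] with z hz using hz.symm)
    have h5 := tendsto_nhds_unique h2 h4
    rw [sub_self, zero_pow (by omega), mul_zero] at h5
    exact hgp h5
  choose g hg hfg using hmin
  refine ⟨m, g, hm1, hg, hfg, ?_⟩
  by_contra hcon
  push Not at hcon
  have : m - 1 < m := by omega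
  refine Nat.find_min hex (by rw [← hmdef]; exact this) fun j => ⟨dslope (g j) p, ?_, ?_⟩
  · obtain ⟨U, hU, hgU⟩ := (hg j).eventually_analyticAt.exists_mem
    obtain ⟨V, hVU, hV, hpV⟩ := mem_nhds_iff.1 hU
    have hd : DifferentiableOn ℂ (g j) V := fun z hz => (hgU z (hVU hz)).differentiableAt.differentiableWithinAt
    exact (hol_div hV hd hpV).1.analyticAt (hV.mem_nhds hpV)
  · filter_upwards [hfg j, hne] with z hz hzp
    have h1 := sub_smul_dslope (g j) p z
    rw [hcon j, sub_zero, smul_eq_mul] at h1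
    rw [hz, ← h1, div_eq_div_iff (pow_ne_zero _ hzp) (pow_ne_zero _ hzp)]
    obtain ⟨m', hm'⟩ := Nat.exists_eq_add_of_le hm1
    rw [hm', Nat.add_sub_cancel_left]; ring

lemma mero_clear {n : ℕ} {W : Set ℂ} (hW : IsOpen W) {E₀ : Finset ℂ} (f : Fin n → ℂ → ℂ)
    (hf : ∀ j, DifferentiableOn ℂ (f j) (W \ E₀)) (hm : ∀ p ∈ E₀, ∀ j, MeromAt (f j) p) (hp : ∀ p ∈ E₀, ∃ j, IsPole (f j) p) :
    ∃ (Z0 : Polynomial ℂ) (G : Fin n → ℂ → ℂ), Z0 ≠ 0 ∧ (∀ z, Z0.eval z = 0 ↔ z ∈ E₀) ∧ (∀ j, DifferentiableOn ℂ (G j) W) ∧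
      (∀ z ∉ E₀, ∀ j, G j z = Z0.eval z * f j z) ∧ ∀ p ∈ E₀, ∃ j, G j p ≠ 0 := by
  classical
  have h1 : ∀ p ∈ E₀, _ := fun p h => pole_order f p (hm p h) (hp p h)
  choose! m g hm1 hg hfg hgp using h1
  have hZe : ∀ z, (∏ p ∈ E₀, (Polynomial.X - Polynomial.C p) ^ m p).eval z = ∏ p ∈ E₀, (z - p) ^ m p := fun z => by
    simp [Polynomial.eval_prod]
  refine ⟨∏ p ∈ E₀, (Polynomial.X - Polynomial.C p) ^ m p,
    fun j z => if z ∈ E₀ then (∏ p ∈ E₀.erase z, (z - p) ^ m p) * g z j z else (∏ p ∈ E₀, (z - p) ^ m p) * f j z, ?_, ?_, ?_, ?_, ?_⟩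
  · exact Finset.prod_ne_zero_iff.2 fun p _ => pow_ne_zero _ (Polynomial.X_sub_C_ne_zero p)
  · intro z
    rw [hZe, Finset.prod_eq_zero_iff]
    constructor
    · rintro ⟨p, hp, h⟩
      rw [sub_eq_zero.1 (pow_eq_zero_iff (by have := hm1 p hp; omega) |>.1 h)]
      exact hp
    · intro hz
      exact ⟨z, hz, by rw [sub_self, zero_pow (by have := hm1 z hz; omega)]⟩
  · intro j z hz
    refine DifferentiableAt.differentiableWithinAt ?_
    by_cases hzE : z ∈ E₀
    · have h2 : DifferentiableAt ℂ (fun y => (∏ p ∈ E₀.erase z, (y - p) ^ m p) * g z j y) z := by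
        refine DifferentiableAt.mul ?_ (hg z hzE j).differentiableAt
        refine DifferentiableAt.fun_finset_prod fun p _ => by fun_prop
      refine h2.congr_of_eventuallyEq ?_
      have h3 := eventually_nhdsWithin_iff.1 (hfg z hzE j)
      have h4 : ∀ᶠ y in 𝓝 z, y ∉ E₀.erase z := E_ev (by simp)
      filter_upwards [h3, h4] with y hy hyE
      by_cases hyz : y = z
      · subst hyz; rw [if_pos hzE]
      · have hyE0 : y ∉ E₀ := fun h => hyE (Finset.mem_erase.2 ⟨hyz, h⟩)
        rw [if_neg hyE0, hy hyz, ← Finset.mul_prod_erase _ _ hzE]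
        have : (y - z) ^ m z ≠ 0 := pow_ne_zero _ (sub_ne_zero.2 hyz)
        field_simp
    · have hd : DifferentiableAt ℂ (f j) z := (hf j z ⟨hz, by simpa using hzE⟩).differentiableAt
        ((hW.sdiff E₀.finite_toSet.isClosed).mem_nhds ⟨hz, by simpa using hzE⟩)
      have h2 : DifferentiableAt ℂ (fun y => (∏ p ∈ E₀, (y - p) ^ m p) * f j y) z := by
        refine DifferentiableAt.mul ?_ hd
        refine DifferentiableAt.fun_finset_prod fun p _ => by fun_prop
      refine h2.congr_of_eventuallyEq ?_
      filter_upwards [E_ev hzE] with y hy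
      rw [if_neg hy]
  · intro z hz j
    simp only [if_neg hz, hZe]
  · intro p hp
    obtain ⟨j, hj⟩ := hgp p hp
    refine ⟨j, ?_⟩
    simp only [if_pos hp]
    refine mul_ne_zero (Finset.prod_ne_zero_iff.2 fun q hq => pow_ne_zero _ (sub_ne_zero.2 ?_)) hj
    exact (Finset.mem_erase.1 hq).1.symm

/-- reduced fraction and extension of the potential -/
lemma rat_pot (T : Finset ℂ) {H : ℂ → ℝ} {g : ℂ → ℂ} (h : Pot (T : Set ℂ)ᶜ H g) (N D : Polynomial ℂ) (hD : D ≠ 0)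
    (hDT : ∀ z, D.eval z = 0 → z ∈ T) (hg : ∀ z ∉ T, g z = N.eval z / D.eval z) :
    ∃ (P Q : Polynomial ℂ) (H' : ℂ → ℝ), IsCoprime P Q ∧ Q ≠ 0 ∧ (∀ z, Q.eval z = 0 → z ∈ T) ∧
      Pot {z | Q.eval z ≠ 0} H' (fun z => P.eval z / Q.eval z) ∧ (∀ z ∉ T, H' z = H z) ∧ ∀ z ∉ T, g z = P.eval z / Q.eval z := by
  classical
  obtain ⟨P, hP⟩ := EuclideanDomain.gcd_dvd_left N D
  obtain ⟨Q, hQ⟩ := EuclideanDomain.gcd_dvd_right N D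
  set d := EuclideanDomain.gcd N D with hd
  have hd0 : d ≠ 0 := fun h => hD (by rw [hQ, h, zero_mul])
  have hQ0 : Q ≠ 0 := fun h => hD (by rw [hQ, h, mul_zero])
  have hcop : IsCoprime P Q := by
    have h1 := EuclideanDomain.gcd_eq_gcd_ab N D
    refine ⟨EuclideanDomain.gcdA N D, EuclideanDomain.gcdB N D, mul_left_cancel₀ hd0 ?_⟩
    have h2 : d * (EuclideanDomain.gcdA N D * P + EuclideanDomain.gcdB N D * Q) = (d * P) * EuclideanDomain.gcdA N D + (d * Q) * EuclideanDomain.gcdB N D := by ring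
    rw [h2, ← hP, ← hQ, ← h1, mul_one]
  have hQT : ∀ z, Q.eval z = 0 → z ∈ T := fun z hz => hDT z (by rw [hQ, Polynomial.eval_mul, hz, mul_zero])
  have hPQ : ∀ z ∉ T, g z = P.eval z / Q.eval z := fun z hz => by
    have h1 : D.eval z ≠ 0 := fun h => hz (hDT z h)
    rw [hg z hz]
    rw [hQ, Polynomial.eval_mul] at h1
    conv_lhs => rw [hP, hQ]
    rw [Polynomial.eval_mul, Polynomial.eval_mul, mul_div_mul_left _ _ (left_ne_zero_of_mul h1)]
  have hop : IsOpen {z | Q.eval z ≠ 0} := isOpen_ne_fun Q.continuous continuous_const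
  obtain ⟨H', h1, h2⟩ := Pot.rem hop T (H := H) (f := fun z => P.eval z / Q.eval z)
    ((h.mono fun z hz => hz.2).congr fun z hz => hPQ z (by simpa using hz.2))
    (P.differentiable.differentiableOn.div Q.differentiable.differentiableOn fun z hz => hz)
  exact ⟨P, Q, H', hcop, hQ0, hQT, h1, h2, hPQ⟩

/-- splitting off the principal parts -/
lemma decomp {n : ℕ} {W : Set ℂ} (hW : IsOpen W) {E₀ : Finset ℂ} (hEW : ∀ p ∈ E₀, p ∈ W) {X : ℂ → Fin n → ℝ}
    (hX : IsCMI n (W \ ↑E₀) X)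
    (hXm : ∀ p ∈ E₀, ∀ j, MeromAt (fun z => ddata n X z j) p)
    (hXpole : ∀ p ∈ E₀, ∃ j, IsPole (fun z => ddata n X z j) p) :
    ∃ (Z0 : Polynomial ℂ) (P0 : Fin n → Polynomial ℂ) (f : Fin n → ℂ → ℂ) (Xt Pi : Fin n → ℂ → ℝ), Z0 ≠ 0 ∧
      (∀ z, Z0.eval z = 0 ↔ z ∈ E₀) ∧ (∀ m, DifferentiableOn ℂ (f m) W) ∧
      (∀ z ∈ W, ∑ m, (Z0.eval z * f m z + (P0 m).eval z) ^ 2 = 0) ∧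
      (∀ z ∈ W, ∃ m, Z0.eval z * f m z + (P0 m).eval z ≠ 0) ∧ (∀ m, Pot W (Xt m) (f m)) ∧
      (∀ m, Pot (E₀ : Set ℂ)ᶜ (Pi m) (fun z => (P0 m).eval z / Z0.eval z)) ∧
      (∀ m, ∀ z ∈ W \ (E₀ : Set ℂ), X z m = Xt m z + Pi m z) ∧
      (∀ m, ∀ z ∈ W \ (E₀ : Set ℂ), ddata n X z m = f m z + (P0 m).eval z / Z0.eval z) := by
  classical
  obtain ⟨hXc, hXd, hXn, hX0⟩ := hX
  have hWo : IsOpen (W \ (E₀ : Set ℂ)) := hW.sdiff E₀.finite_toSet.isClosed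
  obtain ⟨Z0, G, hZ, hZE, hG, hGf, hGp⟩ := mero_clear hW (fun j z => ddata n X z j) hXd hXm hXpole
  have h1 : ∀ j, ∃ (J : Polynomial ℂ) (h : ℂ → ℂ), DifferentiableOn ℂ h W ∧ ∀ z ∈ W, G j z = J.eval z + Z0.eval z * h z :=
    fun j => HI hW (hG j) Z0 hZ
  choose P0 f hf hGJ using h1
  have hZne : ∀ z ∉ E₀, Z0.eval z ≠ 0 := fun z hz h => hz ((hZE z).1 h)
  have hdd : ∀ m, ∀ z ∈ W \ (E₀ : Set ℂ), ddata n X z m = f m z + (P0 m).eval z / Z0.eval z := by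
    intro m z hz
    have h2 : z ∉ E₀ := by simpa using hz.2
    have h3 := hZne z h2
    have h4 := hGJ m z hz.1
    rw [hGf z h2 m] at h4
    field_simp
    linear_combination h4
  have hXpot : ∀ m, Pot (W \ (E₀ : Set ℂ)) (fun z => X z m) (fun z => ddata n X z m) := fun m =>
    pot_wirt hWo (((contDiffOn_pi.1 hXc) m).differentiableOn (by simp))
  obtain ⟨iz, hiz⟩ := RRdiv (E := E₀) (U := ∅) isOpen_empty Z0 hZ (fun a ha ha' => absurd ((hZE a).1 ha) ha') 1 (fun _ => 0)
    (by fun_prop) (fun z hz => absurd hz (Set.notMem_empty z))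
  have hPi : ∀ m, ∃ Pi : ℂ → ℝ, Pot (E₀ : Set ℂ)ᶜ Pi (fun z => (P0 m).eval z / Z0.eval z) := by
    intro m
    have hev : ∀ z ∉ E₀, (RR.P (P0 m) * iz : RR E₀) z = (P0 m).eval z / Z0.eval z := by
      intro z hz
      have h2 : (1 : RR E₀) z = (RR.P Z0 * iz : RR E₀) z := by rw [hiz]
      rw [RR.ev_one hz, RR.ev_mul, RR.ev_P _ hz] at h2
      rw [RR.ev_mul, RR.ev_P _ hz, eq_div_iff (hZne z hz), mul_assoc, mul_comm _ (Z0.eval z), ← h2, mul_one]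
    obtain ⟨F, ρ, hFρ⟩ := RR.pf (RR.P (P0 m) * iz : RR E₀)
    have hρ : ∀ e, (ρ e).im = 0 := by
      intro e
      refine Pot.resRR F ρ e (U := W) (hW.mem_nhds (hEW e e.2)) (hXpot m) (hf m) ?_
      intro z hz
      rw [← hFρ, hev z (by simpa using hz.2), hdd m z hz, add_comm]
    refine ⟨potF F ρ, (Pot.potF F hρ).congr fun z hz => ?_⟩
    rw [← hFρ, hev z (by simpa using hz)]
  choose Pi hPi using hPi
  have hXt : ∀ m, ∃ Xt, Pot W Xt (f m) ∧ ∀ z ∉ E₀, Xt z = X z m - Pi m z := by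
    intro m
    refine Pot.rem hW E₀ (H := fun z => X z m - Pi m z) ?_ (hf m)
    refine ((hXpot m).sub ((hPi m).mono fun z hz => hz.2)).congr fun z hz => ?_
    rw [hdd m z hz]; ring
  choose Xt hXt hXte using hXt
  have hGe : ∀ z ∈ W, ∀ m, Z0.eval z * f m z + (P0 m).eval z = G m z := fun z hz m => by rw [hGJ m z hz]; ring
  refine ⟨Z0, P0, f, Xt, Pi, hZ, hZE, hf, ?_, ?_, hXt, hPi, ?_, hdd⟩
  · have hoff : ∀ z ∈ W \ (E₀ : Set ℂ), ∑ m, (G m z) ^ 2 = 0 := by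
      intro z hz
      have := hX0 z hz
      simp only [hGf z (by simpa using hz.2), mul_pow, ← Finset.mul_sum, this, mul_zero]
    intro z hz
    simp only [hGe z hz]
    by_cases hzE : z ∈ E₀
    · have hc : ContinuousAt (fun z => ∑ m, (G m z) ^ 2) z := by
        refine tendsto_finsetSum _ fun m _ => ?_
        exact (((hG m).continuousOn.continuousAt (hW.mem_nhds hz)).pow 2).tendsto
      obtain ⟨R, hR, hRW, hRE⟩ := punct (E := E₀) (hW.mem_nhds hz)
      have h2 : ∀ᶠ y in 𝓝[≠] z, (0 : ℂ) = ∑ m, (G m y) ^ 2 := by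
        filter_upwards [self_mem_nhdsWithin, mem_nhdsWithin_of_mem_nhds (Metric.ball_mem_nhds z hR)] with y hy hyb
        exact (hoff y ⟨hRW hyb, hRE ⟨hyb, hy⟩⟩).symm
      exact tendsto_nhds_unique (hc.tendsto.mono_left nhdsWithin_le_nhds) (tendsto_const_nhds.congr' h2)
    · exact hoff z ⟨hz, by simpa using hzE⟩
  · intro z hz
    simp only [hGe z hz]
    by_cases hzE : z ∈ E₀
    · exact hGp z hzE
    · have := hXn z ⟨hz, by simpa using hzE⟩
      obtain ⟨m, hm⟩ := Function.ne_iff.1 this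
      exact ⟨m, by rw [hGf z hzE]; exact mul_ne_zero (hZne z hzE) hm⟩
  · intro m z hz
    rw [hXte m z (by simpa using hz.2)]; ring

/-- approximation with potentials -/
lemma approx {n : ℕ} (hn : 3 ≤ n) {E : Finset ℂ} {W : Set ℂ} (hW : Dom E W) {K : Set ℂ} (hK : IsCompact K) (hKW : K ⊆ W)
    (hKn : K.Nonempty) (C1 : Finset ℂ) (hC1 : ∀ c ∈ C1, c ∈ W) {Z0 : Polynomial ℂ} {P0 : Fin n → Polynomial ℂ} {f : Fin n → ℂ → ℂ}
    {Xt : Fin n → ℂ → ℝ} (hZ : Z0 ≠ 0) (hZW : ∀ a, Z0.eval a = 0 → a ∈ W) (hf : ∀ m, DifferentiableOn ℂ (f m) W)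
    (hnull : ∀ z ∈ W, ∑ m, (Z0.eval z * f m z + (P0 m).eval z) ^ 2 = 0)
    (hnv : ∀ z ∈ W, ∃ m, Z0.eval z * f m z + (P0 m).eval z ≠ 0) (hX : ∀ m, Pot W (Xt m) (f m))
    {ε : ℝ} (hε : 0 < ε) (r N : ℕ) : ∃ (F : Fin n → RR E) (Yt : Fin n → ℂ → ℝ),
      (∑ m, (RR.P Z0 * F m + RR.P (P0 m)) ^ 2 = 0) ∧
      (∀ z ∉ E, ∃ m, (RR.P Z0 * F m + RR.P (P0 m) : RR E) z ≠ 0) ∧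
      (∀ m, Pot (E : Set ℂ)ᶜ (Yt m) (F m)) ∧ (∀ m, ∀ z ∈ K, |Yt m z - Xt m z| < ε) ∧
      (∀ m, ∀ p ∈ C1, Asymptotics.IsBigO (𝓝 p) (fun z => Yt m z - Xt m z) (fun z => (z - p) ^ r)) ∧
      ∃ l, (∀ e ∈ E, Tendsto (fun z => ‖F l z‖) (𝓝[≠] e) atTop) ∧
      Tendsto (fun z => ‖F l z‖ / ‖thE E z‖ ^ N) (Bornology.cobounded ℂ) atTop := by
  classical
  have h1 : ∀ z ∈ W, ∃ R > 0, R ≤ 1 ∧ Metric.closedBall z R ⊆ W := by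
    intro z hz
    obtain ⟨R, hR, h⟩ := Metric.nhds_basis_closedBall.mem_iff.1 (hW.op.mem_nhds hz)
    exact ⟨min R 1, lt_min hR one_pos, min_le_right _ _, (Metric.closedBall_subset_closedBall (min_le_left _ _)).trans h⟩
  choose! R hR hR1 hRW using h1
  obtain ⟨T, hTK, hTc⟩ := hK.elim_nhds_subcover (fun z => Metric.closedBall z (R z)) fun z hz => Metric.closedBall_mem_nhds z (hR z (hKW hz))
  obtain ⟨c0, hc0⟩ := hKn
  set C0 : Finset ℂ := insert c0 (T ∪ C1) with hC0
  have hC0W : ∀ c ∈ C0, c ∈ W := by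
    intro c hc
    simp only [hC0, Finset.mem_insert, Finset.mem_union] at hc
    rcases hc with rfl | h | h
    · exact hKW hc0
    · exact hKW (hTK c h)
    · exact hC1 c h
  have hc0C : c0 ∈ C0 := Finset.mem_insert_self _ _
  have hT0 : ∀ c ∈ T, c ∈ C0 := fun c hc => Finset.mem_insert_of_mem (Finset.mem_union_left _ hc)
  have hC10 : ∀ c ∈ C1, c ∈ C0 := fun c hc => Finset.mem_insert_of_mem (Finset.mem_union_right _ hc)
  clear_value C0
  set L1 : Set ℂ := ⋃ c ∈ C0, Metric.closedBall c (R c) with hL1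
  have hL1c : IsCompact L1 := C0.isCompact_biUnion fun c _ => isCompact_closedBall c (R c)
  have hL1W : L1 ⊆ W := Set.iUnion₂_subset fun c hc => hRW c (hC0W c hc)
  have hbL : ∀ c ∈ C0, Metric.closedBall c (R c) ⊆ L1 := fun c hc => Set.subset_iUnion₂_of_subset c hc subset_rfl
  have hL1n : L1.Nonempty := ⟨c0, hbL c0 hc0C (Metric.mem_closedBall_self (hR c0 (hC0W c0 hc0C)).le)⟩
  obtain ⟨S, hSa, hSl, hSr, hS5⟩ := exists_pathData E hW.dis (hC0W c0 hc0C) (C0.erase c0)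
    (fun c hc => hC0W c (Finset.mem_of_mem_erase hc)) (by simp)
  set q : Polynomial ℂ := ∏ c ∈ C0, (Polynomial.X - Polynomial.C c) ^ (r + 1) with hq
  have hqe : ∀ z, q.eval z = ∏ c ∈ C0, (z - c) ^ (r + 1) := fun z => by simp [hq, Polynomial.eval_prod]
  have hq0 : ∀ c ∈ C0, q.eval c = 0 := fun c hc => by
    rw [hqe, Finset.prod_eq_zero hc]; simp
  have hSb : ∀ α, S.b α ∈ C0 := by
    rintro (e | c)
    · rw [hSl]; exact hc0C
    · rw [hSr]; exact Finset.mem_of_mem_erase c.2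
  have hP : Prb S q Z0 P0 f Xt := by
    refine ⟨hn, hW, ?_, ?_, ?_, hZ, hZW, hf, hnull, hnv, hX⟩
    · exact Finset.prod_ne_zero_iff.2 fun c _ => pow_ne_zero _ (Polynomial.X_sub_C_ne_zero c)
    · exact fun α => ⟨by rw [hSa]; exact hq0 _ hc0C, hq0 _ (hSb α)⟩
    · intro a ha
      rw [hqe, Finset.prod_eq_zero_iff] at ha
      obtain ⟨c, hc, h⟩ := ha
      rw [sub_eq_zero.1 ((pow_eq_zero_iff (by omega)).1 h)]
      exact hC0W c hc
  obtain ⟨M, hM⟩ := hL1c.exists_bound_of_continuousOn q.continuous.continuousOn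
  have hM0 : 0 ≤ M := (norm_nonneg _).trans (hM _ hL1n.choose_spec)
  obtain ⟨F, hFn, hFv, hFh, hFΓ, hFl⟩ := hP.core hL1c hL1W hL1n (η := ε / (2 * (M + 1))) (by positivity) N
  choose U k hU hLU hk hFk hkη using hFh
  have hYt : ∀ m, ∃ Y, Pot (E : Set ℂ)ᶜ Y (F m) ∧ Y c0 = Xt m c0 := by
    intro m
    obtain ⟨H, hH⟩ := hS5 (F m) fun e => by rw [hFΓ, hSa, hSl, sub_self]
    exact ⟨fun z => H z + (Xt m c0 - H c0), hH.add_const _, by simp⟩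
  choose Yt hYt hYc0 using hYt
  have hYC : ∀ m, ∀ c ∈ C0, Yt m c = Xt m c := by
    intro m c hc
    by_cases h : c = c0
    · rw [h, hYc0]
    · have h2 := S.ftc (.inr ⟨c, Finset.mem_erase.2 ⟨h, hc⟩⟩) (F m) (Yt m) (hYt m)
      rw [hFΓ, hSa, hSr, hYc0] at h2
      simp only at h2
      linarith
  have hdis : W ⊆ (E : Set ℂ)ᶜ := fun z hz h => hW.dis z h hz
  have hdiff : ∀ m, Pot L1 (fun z => Yt m z - Xt m z) (fun z => q.eval z * k m z) := by
    intro m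
    refine (((hYt m).mono (hL1W.trans hdis)).sub ((hX m).mono hL1W)).congr fun z hz => ?_
    rw [hFk m z (hLU m hz)]; ring
  refine ⟨F, Yt, hFn, hFv, hYt, ?_, ?_, hFl⟩
  · intro m z hz
    obtain ⟨c, hcT, hzc⟩ := Set.mem_iUnion₂.1 (hTc hz)
    have hcC := hT0 c hcT
    have h2 := (hdiff m).bound (hbL c hcC) (M := ε / 2) (fun w hw => ?_) hzc
    · rw [hYC m c hcC, sub_self, sub_zero] at h2
      have h3 : ‖z - c‖ ≤ 1 := (mem_closedBall_iff_norm.1 hzc).trans (hR1 c (hC0W c hcC))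
      nlinarith
    · rw [norm_mul]
      have hwL := hbL c hcC hw
      calc ‖q.eval w‖ * ‖k m w‖ ≤ M * (ε / (2 * (M + 1))) := mul_le_mul (hM w hwL) (hkη m w hwL).le (norm_nonneg _) hM0
        _ ≤ (M + 1) * (ε / (2 * (M + 1))) := mul_le_mul_of_nonneg_right (by linarith) (by positivity)
        _ = ε / 2 := by field_simp
  · intro m p hp
    have hpC := hC10 p hp
    set q2 : ℂ → ℂ := fun z => ∏ c ∈ C0.erase p, (z - c) ^ (r + 1) with hq2
    have hqq : ∀ z, q.eval z = (z - p) ^ (r + 1) * q2 z := fun z => by rw [hqe, ← Finset.mul_prod_erase _ _ hpC]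
    obtain ⟨M2, hM2⟩ := hL1c.exists_bound_of_continuousOn (f := q2) (by rw [hq2]; fun_prop)
    have hM20 : 0 ≤ M2 := (norm_nonneg _).trans (hM2 _ hL1n.choose_spec)
    set η := ε / (2 * (M + 1))
    have hη : 0 < η := by positivity
    refine Asymptotics.IsBigO.of_bound (M2 * η) ?_
    filter_upwards [Metric.closedBall_mem_nhds p (hR p (hC0W p hpC))] with z hz
    have hz1 := mem_closedBall_iff_norm.1 hz
    have hsub : Metric.closedBall p ‖z - p‖ ⊆ L1 := (Metric.closedBall_subset_closedBall hz1).trans (hbL p hpC)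
    have hzz : ‖z - p‖ ≤ 1 := hz1.trans (hR1 p (hC0W p hpC))
    have h2 := (hdiff m).bound hsub (M := ‖z - p‖ ^ r * (M2 * η)) (fun w hw => ?_) (mem_closedBall_iff_norm.2 le_rfl)
    · rw [hYC m p hpC, sub_self, sub_zero] at h2
      rw [Real.norm_eq_abs, norm_pow]
      refine h2.trans ?_
      have : 0 ≤ ‖z - p‖ ^ r * (M2 * η) := by positivity
      nlinarith
    · have hwL := hsub hw
      have hw1 := mem_closedBall_iff_norm.1 hw
      rw [hqq, norm_mul, norm_mul, norm_pow, mul_assoc]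
      refine mul_le_mul ?_ (mul_le_mul (hM2 w hwL) (hkη m w hwL).le (norm_nonneg _) hM20) (by positivity) (by positivity)
      calc ‖w - p‖ ^ (r + 1) ≤ ‖z - p‖ ^ (r + 1) := pow_le_pow_left₀ (norm_nonneg _) hw1 _
        _ ≤ ‖z - p‖ ^ r := pow_le_pow_of_le_one (norm_nonneg _) hzz (Nat.le_succ r)

lemma deg_inf {P Q : Polynomial ℂ} (hQ : Q ≠ 0)
    (h : Tendsto (fun z => ‖P.eval z / Q.eval z‖) (Bornology.cobounded ℂ) atTop) :
    P ≠ 0 ∧ Q.natDegree ≤ P.natDegree + 1 := by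
  have key : ¬ P.degree < Q.degree := by
    intro hd
    have h1 := (Polynomial.isLittleO_cobounded_of_degree_lt hd).tendsto_div_nhds_zero
    exact not_tendsto_nhds_of_tendsto_atTop h _ h1.norm
  have hP : P ≠ 0 := by
    rintro rfl
    exact key (by simpa [bot_lt_iff_ne_bot] using hQ)
  refine ⟨hP, ?_⟩
  have := Polynomial.natDegree_le_natDegree (not_lt.1 key)
  omega

lemma decay_exp (E : Finset ℂ) (P Z : Polynomial ℂ) (hZ : Z ≠ 0) :
    ∃ a : ℕ, (fun z => P.eval z / Z.eval z) =O[Bornology.cobounded ℂ] (fun z => thE E z ^ a) := by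
  obtain ⟨a, ha⟩ := (endF_infty E).poly P
  obtain ⟨-, b, hb⟩ := (endF_infty E).polyinv Z hZ
  refine ⟨a + b, (ha.mul hb).congr (fun z => ?_) fun z => ?_⟩
  · simp [div_eq_mul_inv]
  · simp [pow_add]

lemma inf_growth (E : Finset ℂ) {F g : ℂ → ℂ} {a N : ℕ} (haN : a ≤ N)
    (h : Tendsto (fun z => ‖F z‖ / ‖thE E z‖ ^ N) (Bornology.cobounded ℂ) atTop)
    (hg : g =O[Bornology.cobounded ℂ] (fun z => thE E z ^ a)) :
    Tendsto (fun z => ‖F z + g z‖) (Bornology.cobounded ℂ) atTop := by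
  obtain ⟨C, hC⟩ := (hg.trans ((endF_infty E).mono haN)).bound
  refine tendsto_atTop_mono' _ ?_ (tendsto_atTop_add_const_right _ (-C) h)
  filter_upwards [hC, h.eventually_ge_atTop C, (endF_infty E).th.eventually_ge_atTop 1] with z h1 h2 h3
  have h4 : 1 ≤ ‖thE E z‖ ^ N := one_le_pow₀ h3
  have h5 : ‖F z‖ ≤ ‖F z + g z‖ + ‖g z‖ := by simpa using norm_sub_le (F z + g z) (g z)
  rw [norm_pow] at h1
  have h6 : (‖F z‖ / ‖thE E z‖ ^ N) * ‖thE E z‖ ^ N = ‖F z‖ := div_mul_cancel₀ _ (by positivity)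
  nlinarith

lemma main0 (n : ℕ) (hn : 3 ≤ n)
    (E : Finset ℂ) (K : Set ℂ) (hKcpt : IsCompact K) (hKE : ∀ e ∈ E, e ∉ K)
    (hRunge : ∀ z ∉ K, Bornology.IsBounded (connectedComponentIn Kᶜ z) →
      ∃ e ∈ E, e ∈ connectedComponentIn Kᶜ z)
    (E₀ Λ : Finset ℂ) (hE₀K : ↑E₀ ⊆ K) (hΛK : ↑Λ ⊆ K)
    (W : Set ℂ) (hW : IsOpen W) (hKW : K ⊆ W)
    (X : ℂ → Fin n → ℝ) (hX : IsCMI n (W \ ↑E₀) X)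
    (hXm : ∀ p ∈ E₀, ∀ j, MeromAt (fun z => ddata n X z j) p)
    (hXpole : ∀ p ∈ E₀, ∃ j, IsPole (fun z => ddata n X z j) p)
    (ε : ℝ) (hε : 0 < ε) (r : ℕ) (hKn : K.Nonempty) :
    ∃ Y : ℂ → Fin n → ℝ,
      IsCMI n ((↑E ∪ ↑E₀ : Set ℂ)ᶜ) Y ∧
      (∃ Pp Qp : Fin n → Polynomial ℂ,
        (∀ j, IsCoprime (Pp j) (Qp j) ∧ Qp j ≠ 0 ∧
          ∀ z : ℂ, (Qp j).eval z ≠ 0 → ddata n Y z j = (Pp j).eval z / (Qp j).eval z) ∧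
        (∀ j, ∀ z : ℂ, (Qp j).eval z = 0 → z ∈ (↑E ∪ ↑E₀ : Set ℂ)) ∧
        (∀ q ∈ (↑E ∪ ↑E₀ : Set ℂ), ∃ j, (Qp j).eval q = 0) ∧
        (∃ j, Pp j ≠ 0 ∧ (Qp j).natDegree ≤ (Pp j).natDegree + 1)) ∧
      (∃ V : Set ℂ, IsOpen V ∧ K ⊆ V ∧ V ⊆ W ∧
        ∃ φ : ℂ → Fin n → ℂ, (∀ j, DifferentiableOn ℂ (fun z => φ z j) V) ∧
          ∀ z ∈ V \ (↑E₀ : Set ℂ), φ z = fun j => ddata n Y z j - ddata n X z j) ∧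
      (∃ h : ℂ → Fin n → ℝ, ContinuousOn h K ∧
        (∀ z ∈ K \ (↑E₀ : Set ℂ), h z = fun j => Y z j - X z j) ∧
        (∀ z ∈ K, ‖h z‖ < ε)) ∧
      (∀ p ∈ (↑E₀ ∪ ↑Λ : Set ℂ), Asymptotics.IsBigO (𝓝[≠] p)
        (fun z => fun j => Y z j - X z j) (fun z => (z - p) ^ r)) := by
  classical
  obtain ⟨W', hWo, hKW', hWW, hWE', hWex⟩ := NBW (E := E) (L := K) ⟨hKcpt, hKE, hRunge⟩ hW hKW
  have hDom : Dom E W' := ⟨hWo, hWE', hWex⟩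
  have hsub : W' \ (E₀ : Set ℂ) ⊆ W \ E₀ := Set.sdiff_subset_sdiff_left hWW
  have hX' : IsCMI n (W' \ ↑E₀) X := ⟨hX.1.mono hsub, fun j => (hX.2.1 j).mono hsub, fun z hz => hX.2.2.1 z (hsub hz),
    fun z hz => hX.2.2.2 z (hsub hz)⟩
  have hE₀W : ∀ p ∈ E₀, p ∈ W' := fun p hp => hKW' (hE₀K hp)
  obtain ⟨Z0, P0, f, Xt, Pi, hZ, hZE, hf, hnull, hnv, hXt, hPi, hXe, hXd⟩ := decomp hWo hE₀W hX' hXm hXpole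
  have hdec : ∀ m, ∃ a : ℕ, (fun z => (P0 m).eval z / Z0.eval z) =O[Bornology.cobounded ℂ] (fun z => thE E z ^ a) :=
    fun m => decay_exp E (P0 m) Z0 hZ
  choose a ha using hdec
  obtain ⟨F, Yt, hF0, hFn, hYt, hYK, hYO, l, hlE, hlinf⟩ := approx hn hDom hKcpt hKW' hKn (E₀ ∪ Λ)
    (fun c hc => by
      rcases Finset.mem_union.1 hc with h | h
      · exact hKW' (hE₀K h)
      · exact hKW' (hΛK h)) hZ (fun z hz => hE₀W z ((hZE z).1 hz)) hf hnull hnv hXt hε r (∑ m, a m)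
  have hT : ((E ∪ E₀ : Finset ℂ) : Set ℂ) = (↑E ∪ ↑E₀ : Set ℂ) := Finset.coe_union E E₀
  have hnE : ∀ {z}, z ∉ E ∪ E₀ → z ∉ E ∧ z ∉ E₀ := fun h => by
    rwa [Finset.mem_union, not_or] at h
  have hZne : ∀ {z}, z ∉ E₀ → Z0.eval z ≠ 0 := fun h h' => h ((hZE _).1 h')
  have hg : ∀ m, Pot ((E ∪ E₀ : Finset ℂ) : Set ℂ)ᶜ (fun z => Yt m z + Pi m z) (fun z => F m z + (P0 m).eval z / Z0.eval z) :=
    fun m => ((hYt m).mono fun z hz => by simp at hz ⊢; tauto).add ((hPi m).mono fun z hz => by simp at hz ⊢; tauto)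
  have hrat : ∀ m, ∃ (P Q : Polynomial ℂ) (H' : ℂ → ℝ), IsCoprime P Q ∧ Q ≠ 0 ∧ (∀ z, Q.eval z = 0 → z ∈ E ∪ E₀) ∧
      Pot {z | Q.eval z ≠ 0} H' (fun z => P.eval z / Q.eval z) ∧ (∀ z ∉ E ∪ E₀, H' z = Yt m z + Pi m z) ∧
      ∀ z ∉ E ∪ E₀, F m z + (P0 m).eval z / Z0.eval z = P.eval z / Q.eval z := by
    intro m
    obtain ⟨p, k, hpk⟩ := RR.exists_poly (F m)
    refine rat_pot (E ∪ E₀) (hg m) (p * Z0 + P0 m * QE E ^ k) (QE E ^ k * Z0) (mul_ne_zero (pow_ne_zero _ (QE_ne E)) hZ) ?_ ?_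
    · intro z hz
      by_contra hzn
      obtain ⟨h1, h2⟩ := hnE hzn
      rw [Polynomial.eval_mul, Polynomial.eval_pow] at hz
      exact mul_ne_zero (pow_ne_zero _ (QE_eval_ne h1)) (hZne h2) hz
    · intro z hz
      obtain ⟨h1, h2⟩ := hnE hz
      have h3 := hZne h2
      have h4 := QE_eval_ne h1
      have h5 : (RR.P (QE E) ^ k * F m : RR E) z = (RR.P p : RR E) z := by rw [hpk]
      rw [RR.ev_mul, RR.ev_pow _ _ h1, RR.ev_P _ h1, RR.ev_P _ h1] at h5
      simp only [Polynomial.eval_mul, Polynomial.eval_add, Polynomial.eval_pow]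
      rw [← h5]
      field_simp
  choose P Q Y hcop hQ0 hQT hYpot hYe hgPQ using hrat
  have hQne : ∀ m, ∀ z ∉ E ∪ E₀, (Q m).eval z ≠ 0 := fun m z hz h => hz (hQT m z h)
  have hdd : ∀ m z, (Q m).eval z ≠ 0 → ddata n (fun z m => Y m z) z m = (P m).eval z / (Q m).eval z := fun m z hz => (hYpot m).wirt hz
  have hQo : ∀ m, IsOpen {z | (Q m).eval z ≠ 0} := fun m => isOpen_ne_fun (Q m).continuous continuous_const
  have hPQd : ∀ m, DifferentiableOn ℂ (fun z => (P m).eval z / (Q m).eval z) {z | (Q m).eval z ≠ 0} := fun m =>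
    (P m).differentiable.differentiableOn.div (Q m).differentiable.differentiableOn fun z hz => hz
  have hclear : ∀ m z, z ∉ E ∪ E₀ → (RR.P Z0 * F m + RR.P (P0 m) : RR E) z = Z0.eval z * ((P m).eval z / (Q m).eval z) := by
    intro m z hz
    obtain ⟨h1, h2⟩ := hnE hz
    have h3 := hZne h2
    rw [RR.ev_add, RR.ev_mul, RR.ev_P _ h1, RR.ev_P _ h1, ← hgPQ m z hz]
    field_simp
  have hmT : ∀ {z : ℂ}, z ∈ (↑E ∪ ↑E₀ : Set ℂ)ᶜ → z ∉ E ∪ E₀ := fun hz h => hz (by rw [← hT]; exact h)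
  have hYX : ∀ m, ∀ z ∈ W' \ (E₀ : Set ℂ), Y m z - X z m = Yt m z - Xt m z := by
    intro m z hz
    have h1 : z ∉ E ∪ E₀ := fun h => (Finset.mem_union.1 h).elim (fun h => hWE' z h hz.1) (fun h => hz.2 h)
    rw [hYe m z h1, hXe m z hz]
    ring
  refine ⟨fun z m => Y m z, ⟨?_, ?_, ?_, ?_⟩, ⟨P, Q, ?_, ?_, ?_, l, ?_⟩, ⟨W', hWo, hKW', hWW, fun z j => F j z - f j z, ?_, ?_⟩,
    ⟨fun z j => Yt j z - Xt j z, ?_, ?_, ?_⟩, ?_⟩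
  · exact contDiffOn_pi.2 fun m => ((hYpot m).contDiffOn (hQo m) (hPQd m)).mono fun z hz => hQne m z (hmT hz)
  · intro m
    exact ((hPQd m).mono fun z hz => hQne m z (hmT hz)).congr fun z hz => hdd m z (hQne m z (hmT hz))
  · intro z hz h
    have hz' := hmT hz
    obtain ⟨m, hm⟩ := hFn z (hnE hz').1
    rw [hclear m z hz', ← hdd m z (hQne m z hz'), h] at hm
    simp at hm
  · intro z hz
    have hz' := hmT hz
    have h1 : (∑ m, (RR.P Z0 * F m + RR.P (P0 m)) ^ 2 : RR E) z = 0 := by rw [hF0]; simp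
    rw [RR.ev_sum] at h1
    have h2 : Z0.eval z ^ 2 * ∑ j, (ddata n (fun z m => Y m z) z j) ^ 2 = 0 := by
      rw [← h1, Finset.mul_sum]
      refine Finset.sum_congr rfl fun m _ => ?_
      rw [RR.ev_pow _ _ (hnE hz').1, hclear m z hz', hdd m z (hQne m z hz')]
      ring
    exact (mul_eq_zero.1 h2).resolve_left (pow_ne_zero _ (hZne (hnE hz').2))
  · exact fun j => ⟨hcop j, hQ0 j, hdd j⟩
  · intro j z hz
    rw [← hT]
    exact hQT j z hz
  · have hev : ∀ q : ℂ, ∀ᶠ z in 𝓝[≠] q, z ∉ E ∪ E₀ := by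
      intro q
      obtain ⟨R, hR, -, h⟩ := punct (E := E ∪ E₀) (e := q) (U := Set.univ) Filter.univ_mem
      filter_upwards [mem_nhdsWithin_of_mem_nhds (Metric.ball_mem_nhds q hR), self_mem_nhdsWithin] with z h1 h2
      exact h ⟨h1, h2⟩
    rintro q (hq | hq)
    · refine ⟨l, ?_⟩
      by_contra hQq
      have hqE0 : q ∉ E₀ := fun h => hKE q hq (hE₀K h)
      have hc : ContinuousAt (fun z => (P l).eval z / (Q l).eval z - (P0 l).eval z / Z0.eval z) q :=
        ((P l).continuous.continuousAt.div (Q l).continuous.continuousAt hQq).sub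
          ((P0 l).continuous.continuousAt.div Z0.continuous.continuousAt (hZne hqE0))
      have h1 : Tendsto (fun z => ‖F l z‖) (𝓝[≠] q) (𝓝 ‖(P l).eval q / (Q l).eval q - (P0 l).eval q / Z0.eval q‖) := by
        refine (hc.tendsto.mono_left nhdsWithin_le_nhds).norm.congr' ?_
        filter_upwards [hev q] with z hz
        rw [← hgPQ l z hz, add_sub_cancel_right]
      exact not_tendsto_nhds_of_tendsto_atTop (hlE q hq) _ h1
    · have hqE : q ∉ E := fun h => hKE q h (hE₀K hq)
      obtain ⟨m, hm⟩ := hFn q hqE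
      refine ⟨m, ?_⟩
      by_contra hQq
      have hc : ContinuousAt (fun z => Z0.eval z * ((P m).eval z / (Q m).eval z)) q :=
        Z0.continuous.continuousAt.mul ((P m).continuous.continuousAt.div (Q m).continuous.continuousAt hQq)
      have hc2 : ContinuousAt (RR.P Z0 * F m + RR.P (P0 m) : RR E) q := (RR.differentiableAt _ hqE).continuousAt
      have h1 := (hc.tendsto.mono_left (nhdsWithin_le_nhds (s := {q}ᶜ))).congr' (f₂ := (RR.P Z0 * F m + RR.P (P0 m) : RR E)) (by
        filter_upwards [hev q] with z hz
        exact (hclear m z hz).symm)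
      have h2 := tendsto_nhds_unique (hc2.tendsto.mono_left (nhdsWithin_le_nhds (s := {q}ᶜ))) h1
      rw [(hZE q).2 hq, zero_mul] at h2
      exact hm h2
  · refine deg_inf (hQ0 l) ((inf_growth E (Finset.single_le_sum (f := a) (fun _ _ => Nat.zero_le _) (Finset.mem_univ l)) hlinf (ha l)).congr' ?_)
    have : ∀ᶠ z in Bornology.cobounded ℂ, z ∉ E ∪ E₀ := (endF_infty (E ∪ E₀)).evE
    filter_upwards [this] with z hz
    rw [hgPQ l z hz]
  · exact fun j => (RR.differentiableOn (F j) hWE').sub (hf j)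
  · intro z hz
    have h1 : z ∉ E ∪ E₀ := fun h => (Finset.mem_union.1 h).elim (fun h => hWE' z h hz.1) (fun h => hz.2 h)
    funext j
    rw [hdd j z (hQne j z h1), ← hgPQ j z h1, hXd j z hz]
    ring
  · refine continuousOn_pi.2 fun j z hz => ContinuousAt.continuousWithinAt ?_
    exact (hYt j z fun h => hKE z h hz).continuousAt.sub (hXt j z (hKW' hz)).continuousAt
  · intro z hz
    funext j
    exact (hYX j z ⟨hKW' hz.1, hz.2⟩).symm
  · intro z hz
    rw [pi_norm_lt_iff hε]
    exact fun j => hYK j z hz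
  · intro p hp
    have hpC : p ∈ E₀ ∪ Λ := by simpa using hp
    have hpW : p ∈ W' := hp.elim (fun h => hKW' (hE₀K h)) fun h => hKW' (hΛK h)
    obtain ⟨R, hR, hRW, hRE⟩ := punct (E := E₀) (hWo.mem_nhds hpW)
    rw [Asymptotics.isBigO_pi]
    intro j
    refine ((hYO j p hpC).mono nhdsWithin_le_nhds).congr' ?_ EventuallyEq.rfl
    filter_upwards [mem_nhdsWithin_of_mem_nhds (Metric.ball_mem_nhds p hR), self_mem_nhdsWithin] with z h1 h2
    exact (hYX j z ⟨hRW h1, hRE ⟨h1, h2⟩⟩).symm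

/-- genus-zero Runge theorem for complete minimal surfaces of finite total curvature -/
theorem statement_7 (n : ℕ) (hn : 3 ≤ n)
    (E : Finset ℂ) (K : Set ℂ) (hKcpt : IsCompact K) (hKE : ∀ e ∈ E, e ∉ K)
    (hRunge : ∀ z ∉ K, Bornology.IsBounded (connectedComponentIn Kᶜ z) →
      ∃ e ∈ E, e ∈ connectedComponentIn Kᶜ z)
    (E₀ Λ : Finset ℂ) (hdis : Disjoint E₀ Λ) (hE₀K : ↑E₀ ⊆ K) (hΛK : ↑Λ ⊆ K)
    (W : Set ℂ) (hW : IsOpen W) (hKW : K ⊆ W) (hWE : ∀ e ∈ E, e ∉ W)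
    (X : ℂ → Fin n → ℝ) (hX : IsCMI n (W \ ↑E₀) X)
    (hXm : ∀ p ∈ E₀, ∀ j, MeromAt (fun z => ddata n X z j) p)
    (hXpole : ∀ p ∈ E₀, ∃ j, IsPole (fun z => ddata n X z j) p)
    (ε : ℝ) (hε : 0 < ε) (r : ℕ) :
    ∃ Y : ℂ → Fin n → ℝ,
      -- (i) conformal minimal immersion on ℂ \ (E ∪ E₀) with rational derivative data
      IsCMI n ((↑E ∪ ↑E₀ : Set ℂ)ᶜ) Y ∧
      (∃ Pp Qp : Fin n → Polynomial ℂ,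
        (∀ j, IsCoprime (Pp j) (Qp j) ∧ Qp j ≠ 0 ∧
          ∀ z : ℂ, (Qp j).eval z ≠ 0 → ddata n Y z j = (Pp j).eval z / (Qp j).eval z) ∧
        (∀ j, ∀ z : ℂ, (Qp j).eval z = 0 → z ∈ (↑E ∪ ↑E₀ : Set ℂ)) ∧
        (∀ q ∈ (↑E ∪ ↑E₀ : Set ℂ), ∃ j, (Qp j).eval q = 0) ∧
        (∃ j, Pp j ≠ 0 ∧ (Qp j).natDegree ≤ (Pp j).natDegree + 1)) ∧
      -- (ii) approximation on K and holomorphic extension of ∂Y − ∂X near K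
      (∃ V : Set ℂ, IsOpen V ∧ K ⊆ V ∧ V ⊆ W ∧
        ∃ φ : ℂ → Fin n → ℂ, (∀ j, DifferentiableOn ℂ (fun z => φ z j) V) ∧
          ∀ z ∈ V \ (↑E₀ : Set ℂ), φ z = fun j => ddata n Y z j - ddata n X z j) ∧
      (∃ h : ℂ → Fin n → ℝ, ContinuousOn h K ∧
        (∀ z ∈ K \ (↑E₀ : Set ℂ), h z = fun j => Y z j - X z j) ∧
        (∀ z ∈ K, ‖h z‖ < ε)) ∧
      -- (iii) interpolation to order r at E₀ ∪ Λ
      (∀ p ∈ (↑E₀ ∪ ↑Λ : Set ℂ), Asymptotics.IsBigO (𝓝[≠] p)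
        (fun z => fun j => Y z j - X z j) (fun z => (z - p) ^ r)) := by
  rcases K.eq_empty_or_nonempty with rfl | hKn
  swap
  · exact main0 n hn E K hKcpt hKE hRunge E₀ Λ hE₀K hΛK W hW hKW X hX hXm hXpole ε hε r hKn
  have hE₀ : E₀ = ∅ := by simpa using hE₀K
  have hΛ : Λ = ∅ := by simpa using hΛK
  subst hE₀ hΛ
  obtain ⟨p, hp⟩ := Infinite.exists_notMem_finset E
  let i0 : Fin n := ⟨0, by omega⟩
  let i1 : Fin n := ⟨1, by omega⟩
  have h01 : i1 ≠ i0 := by simp [i0, i1]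
  let c : Fin n → ℂ := Pi.single i0 1 + Pi.single i1 I
  have hc0 : c i0 = 1 := by simp [c, Pi.single_eq_of_ne h01.symm]
  have hc1 : c i1 = I := by simp [c, Pi.single_eq_of_ne h01]
  have hc2 : ∀ j, j ≠ i0 → j ≠ i1 → c j = 0 := fun j h0 h1 => by simp [c, Pi.single_eq_of_ne h0, Pi.single_eq_of_ne h1]
  have hpot : ∀ j, Pot Set.univ (fun z => (c j * z).re) (fun _ => c j) := fun j z _ =>
    (Complex.reCLM.comp ((ContinuousLinearMap.mul ℝ ℂ) (c j))).hasFDerivAt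
  have hdd : ∀ z j, ddata n (fun z j => (c j * z).re) z j = c j := fun z j => (hpot j).wirt (Set.mem_univ z)
  have hRp : ∀ z ∉ ({p} : Set ℂ), Bornology.IsBounded (connectedComponentIn {p}ᶜ z) →
      ∃ e ∈ E, e ∈ connectedComponentIn {p}ᶜ z := by
    intro z hz hb
    have h1 : IsPreconnected ({p}ᶜ : Set ℂ) :=
      (isConnected_compl_singleton_of_one_lt_rank (by rw [Complex.rank_real_complex]; norm_num) p).isPreconnected
    rw [h1.connectedComponentIn hz] at hb
    have h2 := hb.union (Bornology.isBounded_singleton (x := p))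
    rw [Set.compl_union_self] at h2
    exact absurd h2 (NormedSpace.unbounded_univ ℝ ℂ)
  have hcmi : IsCMI n (Set.univ \ ((∅ : Finset ℂ) : Set ℂ)) (fun z j => (c j * z).re) := by
    refine ⟨?_, ?_, ?_, ?_⟩
    · exact contDiffOn_pi.2 fun j => ((hpot j).contDiffOn isOpen_univ (by fun_prop)).mono (Set.subset_univ _)
    · intro j
      simp only [hdd]
      fun_prop
    · intro z _ h
      have := hdd z i0
      rw [h, hc0] at this
      simp at this
    · intro z _
      simp only [hdd]
      rw [Finset.sum_eq_add_of_mem i0 i1 (Finset.mem_univ _) (Finset.mem_univ _) h01.symm, hc0, hc1]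
      · simp
      · rintro j - ⟨h0, h1⟩
        simp [hc2 j h0 h1]
  obtain ⟨Y, h1, h2, -⟩ := main0 n hn E {p} isCompact_singleton (fun e he h => hp (by rw [← Set.mem_singleton_iff.1 h]; exact he))
    hRp ∅ ∅ (by simp) (by simp) Set.univ isOpen_univ (Set.subset_univ _) (fun z j => (c j * z).re) hcmi (by simp) (by simp)
    1 one_pos 0 (Set.singleton_nonempty p)
  exact ⟨Y, h1, h2, ⟨∅, isOpen_empty, subset_rfl, Set.empty_subset _, fun _ _ => 0, by simp, by simp⟩,
      ⟨fun _ _ => 0, by simp, by simp, by simp⟩, by simp⟩
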